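/- Let n = 4. A glueing datum of dimension n consists of: a finite nonempty index set I (indexing copies Δ_i of the standard n-simplex, realized as {x : {0,…,n} → [0,∞) | Σ_v x_v = 1}, with vertices labeled 0,…,n); a fixed-point-free involution P of the set I × {0,…,n} of codimension-1 faces, where (i,k) denotes the face {x ∈ Δ_i | x_k = 0}; and, for each face (i,k) with P(i,k) = (j,l), a bijection φ_{(i,k)} : {0,…,n}∖{k} → {0,…,n}∖{l}, subject to φ_{(j,l)} = φ_{(i,k)}⁻¹. Let X be the quotient of the disjoint union of the Δ_i by the identifications which, for each (i,k) with P(i,k) = (j,l), identify each point x of the face (i,k) with the point y of the face (j,l) given by y_{φ_{(i,k)}(a)} = x_a for a ≠ k and y_l = 0, with the quotient topology, and let X* be X minus the images of the vertices of all the Δ_i. Define: condition Dir — there exist relations o_i on {0,…,4} such that for all a ≠ b exactly one of o_i(a,b), o_i(b,a) holds, and for every face (i,k) with P(i,k) = (j,l) and all a,b ∈ {0,…,4}∖{k} with a ≠ b one has o_i(a,b) ↔ o_j(φ_{(i,k)}(a), φ_{(i,k)}(b)); condition Cycl — for every cycle around a triangle, i.e., every data of m ≥ 1, indices i_0,…,i_m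 ∈ I, injections t_0,…,t_m : {0,1,2} → {0,…,4}, and choices k_r ∉ image(t_r) for 0 ≤ r < m with P(i_r,k_r) = (i_{r+1}, l_{r+1}), t_{r+1} = φ_{(i_r,k_r)} ∘ t_r, k_r ≠ l_r for all 0 < r < m, i_m = i_0, image(t_m) = image(t_0) and l_m ≠ k_0, one has t_m = t_0; condition Surf — for each i ∈ I and each 2-element subset {a,b} of {0,…,4}, take a copy T_i(a,b) of the standard 2-simplex with its three vertices labeled by the three elements of {0,…,4}∖{a,b}; each face (i,k) with P(i,k) = (j,l) and φ = φ_{(i,k)} induces, for every 2-element subset {a,b} of {0,…,4}∖{k}, the affine identification of the edge of T_i(a,b) with endpoints labeled by the two elements c,d of {0,…,4}∖{k,a,b} with the edge of T_j(φ(a),φ(b)) with endpoints labeled φ(c), φ(d), matching c to φ(c) and d to φ(d); letting Σ be the quotient of the disjoint union of all the T_i(a,b) by these identifications, every connected component of Σ is homeomorphic to the 2-sphere S² (the unit sphere in ℝ³). Then X* is a topological 4-manifold (every point of X* has an open neighborhood homeomorphic to ℝ⁴) if and only if conditions Cycl, Dir and Surf all hold. -/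

import Mathlib

open scoped Classical

noncomputable section

/-- A glueing datum of dimension `n`: a finite nonempty set `I` indexing copies of the
standard `n`-simplex, a fixed-point-free involution `P` of the set `I × Fin (n+1)` of
codimension-1 faces (the face `(i,k)` of the `i`-th simplex being opposite to the vertex
`k`), and for each face `(i,k)` with `P (i,k) = (j,l)` a simplicial identification,
encoded as a permutation `glue (i,k)` of the vertex labels sending `k` to `l` (its
restriction to `{0,…,n} \ {k}` is the bijection `φ_{(i,k)}` onto `{0,…,n} \ {l}`),
subject to `φ_{P f} = (φ f)⁻¹`. -/
structure GlueingDatum (n : ℕ) where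
  I : Type
  fintypeI : Fintype I
  nonemptyI : Nonempty I
  P : I × Fin (n + 1) → I × Fin (n + 1)
  P_involutive : ∀ f, P (P f) = f
  P_fixedPointFree : ∀ f, P f ≠ f
  glue : I × Fin (n + 1) → Equiv.Perm (Fin (n + 1))
  glue_face : ∀ f, glue f f.2 = (P f).2
  glue_symm : ∀ f, glue (P f) = (glue f).symm

/-- The permutation of `Fin n` obtained from a permutation `e` of `Fin (n+1)` by
deleting `k` from the source and `e k` from the target, conjugating by the
order-preserving bijections `{0,…,n} \ {k} ≃ {1,…,n}` and `{0,…,n} \ {e k} ≃ {1,…,n}`. -/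
def restrictPerm {n : ℕ} (e : Equiv.Perm (Fin (n + 1))) (k : Fin (n + 1)) :
    Equiv.Perm (Fin n) :=
  (finSuccAboveEquiv k).trans
    ((e.subtypeEquiv (fun _ => (not_congr e.apply_eq_iff_eq).symm)).trans
      (finSuccAboveEquiv (e k)).symm)

/-- The signature of the face-pairing `e` at the face opposite to `k`. -/
def glueSign {n : ℕ} (e : Equiv.Perm (Fin (n + 1))) (k : Fin (n + 1)) : ℤˣ :=
  Equiv.Perm.sign (restrictPerm e k)

/-- Condition Ori: the simplices can be given signs so that every face-pairing
reverses the induced orientation. -/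
def Ori {n : ℕ} (D : GlueingDatum n) : Prop :=
  ∃ ε : D.I → ℤˣ, ∀ (i : D.I) (k : Fin (n + 1)),
    ε i * (-1) ^ (k : ℕ) * glueSign (D.glue (i, k)) k
      = -(ε (D.P (i, k)).1 * (-1) ^ (((D.P (i, k)).2 : Fin (n + 1)) : ℕ))

/-- Condition Dir: the edges of the simplices can be directed compatibly with all the
face-pairings. -/
def Dir {n : ℕ} (D : GlueingDatum n) : Prop :=
  ∃ o : D.I → Fin (n + 1) → Fin (n + 1) → Prop,
    (∀ i a b, a ≠ b → Xor' (o i a b) (o i b a)) ∧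
    (∀ (i : D.I) (k a b : Fin (n + 1)), a ≠ k → b ≠ k → a ≠ b →
      (o i a b ↔ o (D.P (i, k)).1 (D.glue (i, k) a) (D.glue (i, k) b)))

/-- The standard `n`-simplex, in barycentric coordinates. -/
abbrev Delta (n : ℕ) : Type :=
  {x : Fin (n + 1) → ℝ // (∀ v, 0 ≤ x v) ∧ ∑ v, x v = 1}

/-- The disjoint union of the simplices `Δ_i`, `i ∈ I`. -/
abbrev GlueTotal {n : ℕ} (D : GlueingDatum n) : Type := Σ _ : D.I, Delta n

/-- The identifications: for each face `(i,k)` with `P (i,k) = (j,l)`, every point `x`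
of the face `(i,k)` (i.e. with `x k = 0`) is identified with the point `y = x ∘ φ⁻¹` of
the face `(j,l)`, which satisfies `y (φ a) = x a` for `a ≠ k` and `y l = 0`. -/
def glueRel {n : ℕ} (D : GlueingDatum n) : GlueTotal D → GlueTotal D → Prop :=
  fun p q => ∃ k : Fin (n + 1), p.2.1 k = 0 ∧ (D.P (p.1, k)).1 = q.1 ∧
    (q.2.1 : Fin (n + 1) → ℝ) = p.2.1 ∘ ⇑(D.glue (p.1, k)).symm

/-- The glued space `X = S/P`, with the quotient topology. -/
abbrev GlueSpace {n : ℕ} (D : GlueingDatum n) : Type := Quot (glueRel D)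

/-- The image in `X` of the vertices of the simplices. -/
def vertexImage {n : ℕ} (D : GlueingDatum n) : Set (GlueSpace D) :=
  {z | ∃ p : GlueTotal D, (∃ v, p.2.1 v = 1) ∧ Quot.mk (glueRel D) p = z}

/-- The space `X* = X ∖ {vertices}`, with the subspace topology. -/
abbrev GlueSpaceStar {n : ℕ} (D : GlueingDatum n) : Type := ↥((vertexImage D)ᶜ)

/-- Local euclideanness: every point has an open neighborhood homeomorphic to `ℝⁿ`. -/
def LocEuclidean (n : ℕ) (Z : Type) [TopologicalSpace Z] : Prop :=
  ∀ z : Z, ∃ U : Set Z, IsOpen U ∧ z ∈ U ∧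
    Nonempty (↥U ≃ₜ EuclideanSpace ℝ (Fin n))

/-- The triangle `T_i(a,b)` (for `s = {a,b}`), realized in barycentric coordinates on
`Fin 5` supported on the complement of `s`: its three vertices are labeled by the three
elements of `{0,…,4} \ s`. -/
abbrev LabTri (s : Finset (Fin 5)) : Type :=
  {x : Fin 5 → ℝ // (∀ v, 0 ≤ x v) ∧ (∑ v, x v = 1) ∧ ∀ v ∈ s, x v = 0}

/-- The disjoint union of the triangles `T_i(a,b)` over all `i ∈ I` and all 2-element
subsets `{a,b}` of `{0,…,4}`. -/
abbrev SurfTotal (D : GlueingDatum 4) : Type :=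
  Σ p : D.I × {s : Finset (Fin 5) // s.card = 2}, LabTri p.2.1

/-- The edge identifications induced by the face-pairings: for a face `(i,k)` with
`P (i,k) = (j,l)` and `φ = φ_{(i,k)}`, and a 2-element subset `s ⊆ {0,…,4} \ {k}`, the
edge of `T_i(s)` with endpoints labeled by the two elements of `{0,…,4} \ (s ∪ {k})`
(i.e. the points with `x k = 0`) is identified with the corresponding edge of
`T_j(φ(s))` by `y = x ∘ φ⁻¹`, which matches each endpoint label `c` with `φ(c)`. -/
def surfRel (D : GlueingDatum 4) : SurfTotal D → SurfTotal D → Prop := fun p q =>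
  ∃ k : Fin 5, k ∉ p.1.2.1 ∧ p.2.1 k = 0 ∧
    (D.P (p.1.1, k)).1 = q.1.1 ∧
    q.1.2.1 = p.1.2.1.image (⇑(D.glue (p.1.1, k))) ∧
    (q.2.1 : Fin 5 → ℝ) = p.2.1 ∘ ⇑(D.glue (p.1.1, k)).symm

/-- The closed surface `Σ(S,P)` associated to the glueing datum, with the quotient
topology. -/
abbrev SurfSpace (D : GlueingDatum 4) : Type := Quot (surfRel D)

/-- Condition Surf: every connected component of the surface `Σ(S,P)` is homeomorphic
to the 2-sphere (the unit sphere in ℝ³). -/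
def Surf (D : GlueingDatum 4) : Prop :=
  ∀ z : SurfSpace D,
    Nonempty (↥(connectedComponent z) ≃ₜ
      ↥(Metric.sphere (0 : EuclideanSpace ℝ (Fin 3)) 1))

/-- Condition Cycl: for every cycle around a triangle — data of `m ≥ 1`, 4-simplices
`i 0, …, i m`, triangle labelings `t 0, …, t m : Fin 3 → Fin 5` (injections), and faces
`k r ∉ range (t r)` with `P (i r, k r) = (i (r+1), l (r+1))`, `t (r+1) = φ_{(i r, k r)} ∘ t r`,
`k r ≠ l r` for `0 < r < m`, returning to the start: `i m = i 0`,
`range (t m) = range (t 0)`, `l m ≠ k 0` — the return labeling is the identity: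
`t m = t 0`. -/
def Cycl (D : GlueingDatum 4) : Prop :=
  ∀ m : ℕ, 1 ≤ m → ∀ (i : ℕ → D.I) (t : ℕ → Fin 3 → Fin 5) (k l : ℕ → Fin 5),
    (∀ r, r ≤ m → Function.Injective (t r)) →
    (∀ r, r < m → k r ∉ Set.range (t r)) →
    (∀ r, r < m → D.P (i r, k r) = (i (r + 1), l (r + 1))) →
    (∀ r, r < m → t (r + 1) = ⇑(D.glue (i r, k r)) ∘ t r) →
    (∀ r, 0 < r → r < m → k r ≠ l r) →
    i m = i 0 → Set.range (t m) = Set.range (t 0) → l m ≠ k 0 →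
    t m = t 0


section FileT1
open Finset in
theorem telChi {R : Type*} [CommRing R] (χ a : ℕ → R) (N : ℕ)
    (h : ∀ k < N, (χ k - χ (k+1)) * a (k+1) = 0) :
    ∑ k ∈ range N, χ k * (a (k+1) - a k) = χ N * a N - χ 0 * a 0 := by
  induction N with
  | zero => simp
  | succ N ih =>
    rw [sum_range_succ, ih (fun k hk => h k (by omega))]
    have := h N (by omega)
    linear_combination this

open Finset in
theorem gridComb {R : Type*} [CommRing R] (N M : ℕ) (hM : M ≤ N)
    (ct cr ch χ : ℕ → ℕ → ℕ → R)
    (hrper : ∀ j k, cr N j k = cr 0 j k) (hhper : ∀ j k, ch N j k = ch 0 j k)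
    (hχper : ∀ j k, χ N j k = χ 0 j k)
    (hχ0 : ∀ i k, i ≤ N → χ i 0 k = χ 0 0 k)
    (hχtop : ∀ i j, i ≤ N → j ≤ N → χ i j N = 0)
    (hχbot : ∀ i j, i ≤ N → j ≤ N → χ i j 0 = 1)
    (hχR : ∀ i k, i ≤ N → k ≤ N → χ i N k = if k < M then 1 else 0)
    (Qh : ∀ i j k, i < N → j < N → k < N → (χ i j k - χ i j (k+1)) *
      (ct i j (k+1) + cr (i+1) j (k+1) - ct i (j+1) (k+1) - cr i j (k+1)) = 0)
    (Qr : ∀ i j k, i < N → j < N → k < N → (χ i j k - χ i (j+1) k) *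
      (ct i (j+1) k + ch (i+1) (j+1) k - ct i (j+1) (k+1) - ch i (j+1) k) = 0)
    (Qt : ∀ i j k, i < N → j < N → k < N → (χ i j k - χ (i+1) j k) *
      (cr (i+1) j k + ch (i+1) (j+1) k - cr (i+1) j (k+1) - ch (i+1) j k) = 0)
    (s0 : ∀ k ≤ N, ∑ i ∈ range N, ct i 0 k = 1)
    (s1 : ∑ i ∈ range N, ct i N M = 0) : (1 : R) = 0 := by
  set qh : ℕ → ℕ → ℕ → R := fun i j k => ct i j k + cr (i+1) j k - ct i (j+1) k - cr i j k with hqh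
  set qr : ℕ → ℕ → ℕ → R := fun i j k => ct i j k + ch (i+1) j k - ct i j (k+1) - ch i j k with hqr
  set qt : ℕ → ℕ → ℕ → R := fun i j k => cr i j k + ch i (j+1) k - cr i j (k+1) - ch i j k with hqt
  have e0 : ∑ i ∈ range N, ∑ j ∈ range N, ∑ k ∈ range N,
      (χ i j k * (qh i j (k+1) - qh i j k) - χ i j k * (qr i (j+1) k - qr i j k)
        + χ i j k * (qt (i+1) j k - qt i j k)) = 0 := by
    refine sum_eq_zero fun i _ => sum_eq_zero fun j _ => sum_eq_zero fun k _ => ?_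
    simp only [hqh, hqr, hqt]; ring
  simp only [sum_add_distrib, sum_sub_distrib] at e0
  have eh : ∑ i ∈ range N, ∑ j ∈ range N, ∑ k ∈ range N, χ i j k * (qh i j (k+1) - qh i j k)
      = - ∑ i ∈ range N, (ct i 0 0 - ct i N 0) := by
    have : ∀ i ∈ range N, ∀ j ∈ range N, ∑ k ∈ range N, χ i j k * (qh i j (k+1) - qh i j k)
        = - qh i j 0 := by
      intro i hi j hj
      rw [mem_range] at hi hj
      rw [telChi (fun k => χ i j k) (fun k => qh i j k) N (fun k hk => Qh i j k hi hj hk),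
        hχtop i j hi.le hj.le, hχbot i j hi.le hj.le]; ring
    rw [sum_congr rfl fun i hi => sum_congr rfl fun j hj => this i hi j hj]
    simp only [sum_neg_distrib, neg_inj]
    have h2 : ∀ i, ∑ j ∈ range N, qh i j 0
        = (ct i 0 0 - ct i N 0) + ∑ j ∈ range N, (cr (i+1) j 0 - cr i j 0) := by
      intro i
      rw [← sum_range_sub' (fun j => ct i j 0) N, ← sum_add_distrib]
      exact sum_congr rfl fun j _ => by simp only [hqh]; ring
    simp only [h2]
    rw [sum_add_distrib, sum_comm (s := range N) (t := range N)
      (f := fun i j => cr (i+1) j 0 - cr i j 0)]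
    have : ∀ j ∈ range N, ∑ i ∈ range N, (cr (i+1) j 0 - cr i j 0) = 0 := by
      intro j _
      rw [sum_range_sub (fun i => cr i j 0) N, hrper]; ring
    rw [sum_eq_zero this, add_zero]
  have er : ∑ i ∈ range N, ∑ j ∈ range N, ∑ k ∈ range N, χ i j k * (qr i (j+1) k - qr i j k)
      = ∑ i ∈ range N, (ct i N 0 - ct i N M) := by
    have h1 : ∀ i ∈ range N, ∑ j ∈ range N, ∑ k ∈ range N, χ i j k * (qr i (j+1) k - qr i j k)
        = ∑ k ∈ range N, (χ i N k * qr i N k - χ i 0 k * qr i 0 k) := by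
      intro i hi
      rw [mem_range] at hi
      rw [sum_comm]
      refine sum_congr rfl fun k hk => ?_
      rw [mem_range] at hk
      exact telChi (fun j => χ i j k) (fun j => qr i j k) N (fun j hj => Qr i j k hi hj hk)
    rw [sum_congr rfl h1]
    rw [sum_comm]
    have h2 : ∀ j k, ∑ i ∈ range N, qr i j k = ∑ i ∈ range N, (ct i j k - ct i j (k+1)) := by
      intro j k
      have : ∑ i ∈ range N, (ch (i+1) j k - ch i j k) = 0 := by
        rw [sum_range_sub (fun i => ch i j k) N, hhper]; ring
      rw [← add_zero (∑ i ∈ range N, (ct i j k - ct i j (k+1))), ← this, ← sum_add_distrib]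
      exact sum_congr rfl fun j _ => by simp only [hqr]; ring
    have h3 : ∀ k ∈ range N, ∑ i ∈ range N, (χ i N k * qr i N k - χ i 0 k * qr i 0 k)
        = (if k < M then 1 else 0) * ∑ i ∈ range N, (ct i N k - ct i N (k+1)) := by
      intro k hk
      rw [mem_range] at hk
      have : ∀ i ∈ range N, χ i N k * qr i N k - χ i 0 k * qr i 0 k
        = (if k < M then 1 else 0) * qr i N k - χ 0 0 k * qr i 0 k := by
        intro i hi
        rw [mem_range] at hi
        rw [hχ0 i k hi.le, hχR i k hi.le hk.le]
      rw [sum_congr rfl this, sum_sub_distrib, ← mul_sum, ← mul_sum, h2, h2 0 k]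
      rw [sum_sub_distrib (fun i => ct i 0 k), s0 k hk.le, s0 (k+1) hk]; ring
    rw [sum_congr rfl h3]
    have h4 : ∑ k ∈ range N, (if k < M then (1:R) else 0) * ∑ i ∈ range N, (ct i N k - ct i N (k+1))
       = ∑ k ∈ range M, ∑ i ∈ range N, (ct i N k - ct i N (k+1)) := by
      simp only [ite_mul, one_mul, zero_mul]
      rw [← sum_filter]
      congr 1
      ext k; simp only [mem_filter, mem_range]; omega
    rw [h4, sum_comm]
    exact sum_congr rfl fun i _ => sum_range_sub' (fun k => ct i N k) M
  have et : ∑ i ∈ range N, ∑ j ∈ range N, ∑ k ∈ range N, χ i j k * (qt (i+1) j k - qt i j k) = 0 := by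
    rw [sum_comm]
    refine sum_eq_zero fun j hj => ?_
    rw [sum_comm]
    refine sum_eq_zero fun k hk => ?_
    rw [mem_range] at hj hk
    rw [telChi (fun i => χ i j k) (fun i => qt i j k) N (fun i hi => Qt i j k hi hj hk)]
    simp only [hqt, hχper, hrper, hhper]; ring
  rw [eh, er, et, sum_sub_distrib, sum_sub_distrib, s0 0 (Nat.zero_le _), s1] at e0
  linear_combination -e0
end FileT1

section FileT2
/-- continuity up to multiplication by powers of `ζ` -/
def OrbContAt {A E : Type*} [TopologicalSpace A] [NormedAddCommGroup E] [NormedSpace ℂ E]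
    (ζ : ℂ) (W : A → E) (p : A) : Prop :=
  ∀ ε > 0, ∀ᶠ q in nhds p, ∃ i : ℕ, ‖W q - ζ ^ i • W p‖ < ε

section orb
variable {E : Type*} [NormedAddCommGroup E] [NormedSpace ℂ E] {n : ℕ} {ζ : ℂ}

theorem norm_pow_root (hn : 0 < n) (hζ : IsPrimitiveRoot ζ n) (i : ℕ) : ‖ζ ^ i‖ = 1 := by
  rw [norm_pow, IsPrimitiveRoot.norm'_eq_one hζ hn.ne', one_pow]

theorem orb_symm (hn : 0 < n) (hζ : IsPrimitiveRoot ζ n) (i : ℕ) :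
    ∃ j, ζ ^ j * ζ ^ i = 1 := by
  refine ⟨n * i - i, ?_⟩
  rw [← pow_add, Nat.sub_add_cancel (Nat.le_mul_of_pos_left i hn), pow_mul, hζ.pow_eq_one, one_pow]

theorem orb_flip (hn : 0 < n) (hζ : IsPrimitiveRoot ζ n) {a b : E} {ε : ℝ} {i : ℕ}
    (h : ‖a - ζ ^ i • b‖ < ε) : ∃ j : ℕ, ‖b - ζ ^ j • a‖ < ε := by
  obtain ⟨j, hj⟩ := orb_symm hn hζ i
  refine ⟨j, ?_⟩
  have : b - ζ ^ j • a = - (ζ ^ j • (a - ζ ^ i • b)) := by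
    rw [smul_sub, smul_smul, hj, one_smul]; abel
  rw [this, norm_neg, norm_smul, norm_pow_root hn hζ, one_mul]; exact h

theorem orb_trans (hn : 0 < n) (hζ : IsPrimitiveRoot ζ n) {a b c : E} {ε δ : ℝ} {i j : ℕ}
    (h : ‖a - ζ ^ i • b‖ < ε) (h' : ‖b - ζ ^ j • c‖ < δ) : ‖a - ζ ^ (i+j) • c‖ < ε + δ := by
  have : a - ζ ^ (i+j) • c = (a - ζ ^ i • b) + ζ ^ i • (b - ζ ^ j • c) := by
    rw [smul_sub, smul_smul, pow_add]; abel
  rw [this]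
  refine (norm_add_le _ _).trans_lt ?_
  rw [norm_smul, norm_pow_root hn hζ, one_mul]
  exact add_lt_add h h'

theorem orb_unif (hn : 0 < n) (hζ : IsPrimitiveRoot ζ n) {A : Type*} [PseudoMetricSpace A]
    {W : A → E} {K : Set A} (hK : IsCompact K) (hW : ∀ p ∈ K, OrbContAt ζ W p) {ε : ℝ} (hε : 0 < ε) :
    ∃ δ > 0, ∀ p ∈ K, ∀ q ∈ K, dist q p < δ → ∃ i : ℕ, ‖W q - ζ ^ i • W p‖ < ε := by
  obtain ⟨δ, hδ, h⟩ := lebesgue_number_lemma_of_metric (s := K)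
    (c := fun p : K => interior {q | ∃ i : ℕ, ‖W q - ζ ^ i • W p.1‖ < ε / 2}) hK
    (fun _ => isOpen_interior) (fun p hp => Set.mem_iUnion.2 ⟨⟨p, hp⟩,
      mem_interior_iff_mem_nhds.2 (hW p hp (ε/2) (half_pos hε))⟩)
  refine ⟨δ, hδ, fun p hp q _ hpq => ?_⟩
  obtain ⟨p0, h0⟩ := h p hp
  obtain ⟨i, hi⟩ := interior_subset (h0 (Metric.mem_ball.2 hpq))
  obtain ⟨j, hj⟩ := interior_subset (h0 (Metric.mem_ball_self hδ))
  obtain ⟨j', hj'⟩ := orb_flip hn hζ hj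
  refine ⟨i + j', ?_⟩
  have := orb_trans hn hζ hi hj'
  rwa [add_halves] at this

theorem orb_norm_cont (hn : 0 < n) (hζ : IsPrimitiveRoot ζ n) {A : Type*} [TopologicalSpace A]
    {W : A → E} {p : A} (hW : OrbContAt ζ W p) : ContinuousAt (fun q => ‖W q‖) p := by
  rw [Metric.continuousAt_iff']
  intro ε hε
  filter_upwards [hW ε hε] with q ⟨i, hi⟩
  rw [Real.dist_eq]
  refine lt_of_le_of_lt ?_ hi
  have := abs_norm_sub_norm_le (W q) (ζ ^ i • W p)
  rwa [norm_smul, norm_pow_root hn hζ, one_mul] at this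

/-- separation constant of the roots of unity -/
theorem root_sep (hn : 0 < n) (hζ : IsPrimitiveRoot ζ n) :
    ∃ s > 0, ∀ (a b : ℕ) (z : E), ‖ζ ^ a • z - ζ ^ b • z‖ < s * ‖z‖ → (a : ZMod n) = b := by
  have h1 : ∃ s > 0, ∀ a ∈ Finset.range n, ∀ b ∈ Finset.range n, ‖ζ ^ a - ζ ^ b‖ < s → a = b := by
    by_contra hcon
    push Not at hcon
    have : ∀ᶠ s : ℝ in nhdsWithin 0 (Set.Ioi 0), ∀ a ∈ Finset.range n, ∀ b ∈ Finset.range n,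
        ‖ζ ^ a - ζ ^ b‖ < s → a = b := by
      rw [Filter.eventually_all_finset]
      intro a ha
      rw [Filter.eventually_all_finset]
      intro b hb
      by_cases hab : a = b
      · simp [hab]
      · have : 0 < ‖ζ ^ a - ζ ^ b‖ := by
          rw [norm_pos_iff, sub_ne_zero]
          exact fun h => hab (hζ.pow_inj (Finset.mem_range.1 ha) (Finset.mem_range.1 hb) h)
        filter_upwards [nhdsWithin_le_nhds (Iio_mem_nhds this)] with s hs h
        exact absurd (h.trans hs) (lt_irrefl _)
    obtain ⟨s, hs, hs0⟩ := (this.and self_mem_nhdsWithin).exists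
    obtain ⟨a, ha, b, hb, h, hne⟩ := hcon s hs0
    exact hne (hs a ha b hb h)
  obtain ⟨s, hs, h⟩ := h1
  refine ⟨s, hs, fun a b z hz => ?_⟩
  rw [← sub_smul, norm_smul] at hz
  have h2 : ‖ζ ^ a - ζ ^ b‖ < s := lt_of_mul_lt_mul_right hz (norm_nonneg _)
  rw [ZMod.natCast_eq_natCast_iff]
  have ma : ζ ^ a = ζ ^ (a % n) := pow_eq_pow_mod a hζ.pow_eq_one
  have mb : ζ ^ b = ζ ^ (b % n) := pow_eq_pow_mod b hζ.pow_eq_one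
  rw [ma, mb] at h2
  exact h _ (Finset.mem_range.2 (Nat.mod_lt _ hn)) _ (Finset.mem_range.2 (Nat.mod_lt _ hn)) h2

theorem orb_square (hn : 0 < n) (hζ : IsPrimitiveRoot ζ n) {s ε m : ℝ}
    (hs : ∀ (a b : ℕ) (z : E), ‖ζ ^ a • z - ζ ^ b • z‖ < s * ‖z‖ → (a : ZMod n) = b)
    (hs0 : 0 < s) (hε : 4 * ε ≤ s * m) {z00 z10 z01 z11 : E} (hz : m ≤ ‖z00‖) {a b c d : ℕ}
    (h1 : ‖z10 - ζ ^ a • z00‖ < ε) (h2 : ‖z11 - ζ ^ b • z10‖ < ε)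
    (h3 : ‖z01 - ζ ^ c • z00‖ < ε) (h4 : ‖z11 - ζ ^ d • z01‖ < ε) :
    (a : ZMod n) + b = c + d := by
  have e1 := orb_trans hn hζ h2 h1
  have e2 := orb_trans hn hζ h4 h3
  have : ((b + a : ℕ) : ZMod n) = ((d + c : ℕ) : ZMod n) := by
    apply hs _ _ z00
    calc _ = ‖(z11 - ζ ^ (d+c) • z00) - (z11 - ζ ^ (b+a) • z00)‖ := by congr 1; abel
      _ ≤ _ := norm_sub_le _ _
      _ < 4 * ε := by linarith
      _ ≤ s * m := hε
      _ ≤ _ := by gcongr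
  push_cast at this
  linear_combination this
end orb
end FileT2

section FileT3
theorem gridObstruction {E : Type*} [NormedAddCommGroup E] [NormedSpace ℂ E] {n : ℕ} {ζ : ℂ}
    (hn : 2 ≤ n) (hζ : IsPrimitiveRoot ζ n) (η : ℝ × ℝ × ℝ → ℝ) (hη : Continuous η)
    (W : ℝ × ℝ × ℝ → E) (hW : ∀ p, OrbContAt ζ W p)
    (hWper : ∀ r h, W (1, r, h) = W (0, r, h)) (hηper : ∀ r h, η (1, r, h) = η (0, r, h))
    (hW0 : ∀ t h, W (t, 0, h) = W (0, 0, h)) (hη0 : ∀ t h, η (t, 0, h) = η (0, 0, h))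
    (hη1 : ∀ t, ∀ h ∈ Set.Icc (0:ℝ) 1, (η (t, 1, h) < 0 ↔ h < 1/2))
    (hηhalf : ∀ t, η (t, 1, 1/2) = 0)
    (hηbot : ∀ t r, η (t, r, 0) < 0) (hηtop : ∀ t r, 0 ≤ η (t, r, 1))
    (hz : ∀ p, η p = 0 → W p ≠ 0)
    (w : ℝ → E) (hw : Continuous w) (hwW : ∀ t, ∃ i : ℕ, W (t, 1, 1/2) = ζ ^ i • w t)
    (hw1 : w 1 = ζ • w 0) : False := by
  have hn0 : 0 < n := by omega
  set K : Set (ℝ × ℝ × ℝ) := Set.Icc 0 1 ×ˢ Set.Icc 0 1 ×ˢ Set.Icc 0 1 with hKdef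
  have hK : IsCompact K := isCompact_Icc.prod (isCompact_Icc.prod isCompact_Icc)
  have hKne : K.Nonempty := ⟨(0,0,0), by simp [hKdef]⟩
  have hcontW : Continuous fun p => ‖W p‖ :=
    continuous_iff_continuousAt.2 fun p => orb_norm_cont hn0 hζ (hW p)
  obtain ⟨m, hm, hmK⟩ : ∃ m > 0, ∀ p ∈ K, 2 * m ≤ |η p| + ‖W p‖ := by
    obtain ⟨p, _, hp⟩ := hK.exists_isMinOn hKne (f := fun p => |η p| + ‖W p‖)
      (by fun_prop)
    have hpos : 0 < |η p| + ‖W p‖ := by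
      by_cases h : η p = 0
      · have := norm_pos_iff.2 (hz p h); positivity
      · have := abs_pos.2 h; positivity
    exact ⟨(|η p| + ‖W p‖) / 2, by positivity, fun q hq => by
      have := hp hq; simp only [Set.mem_ofPred_eq] at this; linarith⟩
  obtain ⟨s, hs0, hs⟩ := root_sep (E := E) hn0 hζ
  set ε := s * m / 4 with hε
  have hε0 : 0 < ε := by positivity
  obtain ⟨δ1, hδ1, H1⟩ := orb_unif hn0 hζ hK (fun p _ => hW p) hε0
  obtain ⟨δ2, hδ2, H2⟩ := Metric.uniformContinuousOn_iff.1
    (hK.uniformContinuousOn_of_continuous hη.continuousOn) m hm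
  obtain ⟨δ3, hδ3, H3⟩ := Metric.uniformContinuousOn_iff.1
    (isCompact_Icc.uniformContinuousOn_of_continuous (s := Set.Icc (0:ℝ) 1) hw.continuousOn) ε hε0
  obtain ⟨M, hM⟩ := exists_nat_gt (1 / min δ1 (min δ2 δ3))
  have hM0 : 0 < M := by
    have : (0:ℝ) < 1 / min δ1 (min δ2 δ3) := by positivity
    exact_mod_cast this.trans hM
  set N := 2 * M with hN
  have hNpos : (0:ℝ) < N := by exact_mod_cast (by omega : 0 < N)
  have hMN : ((M : ℕ) : ℝ) / N = 1/2 := by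
    rw [hN]; push_cast; field_simp
  have hNd : (1:ℝ) / N < min δ1 (min δ2 δ3) := by
    have hmin : 0 < min δ1 (min δ2 δ3) := by positivity
    rw [div_lt_iff₀ hmin] at hM
    rw [div_lt_iff₀ hNpos]
    have : (M:ℝ) ≤ N := by exact_mod_cast (by omega : M ≤ N)
    nlinarith
  have hd1 : (1:ℝ) / N < δ1 := hNd.trans_le (min_le_left _ _)
  have hd2 : (1:ℝ) / N < δ2 := hNd.trans_le ((min_le_right _ _).trans (min_le_left _ _))
  have hd3 : (1:ℝ) / N < δ3 := hNd.trans_le ((min_le_right _ _).trans (min_le_right _ _))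
  set pt : ℕ → ℕ → ℕ → ℝ × ℝ × ℝ := fun i j k => (i / N, j / N, k / N) with hpt
  have hI : ∀ i : ℕ, i ≤ N → (i : ℝ) / N ∈ Set.Icc (0:ℝ) 1 := by
    intro i hi
    refine ⟨by positivity, (div_le_one hNpos).2 (by exact_mod_cast hi)⟩
  have hptK : ∀ i j k, i ≤ N → j ≤ N → k ≤ N → pt i j k ∈ K := by
    intro i j k hi hj hk
    exact ⟨hI i hi, hI j hj, hI k hk⟩
  have hdd : ∀ i : ℕ, dist (((i+1 : ℕ) : ℝ) / N) ((i:ℝ) / N) = 1 / N := by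
    intro i
    rw [Real.dist_eq, ← sub_div]; push_cast
    rw [add_sub_cancel_left, abs_of_pos (by positivity)]
  have hp0 : 0 ≤ (1:ℝ) / N := by positivity
  have dt : ∀ i j k, dist (pt (i+1) j k) (pt i j k) = 1 / N := by
    intro i j k
    simp only [hpt, Prod.dist_eq, dist_self, hdd, max_self, max_eq_left hp0]
  have dr : ∀ i j k, dist (pt i (j+1) k) (pt i j k) = 1 / N := by
    intro i j k
    simp only [hpt, Prod.dist_eq, dist_self, hdd, max_eq_left hp0, max_eq_right hp0]
  have dh : ∀ i j k, dist (pt i j (k+1)) (pt i j k) = 1 / N := by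
    intro i j k
    simp only [hpt, Prod.dist_eq, dist_self, hdd, max_eq_right hp0]
  have ptN : ∀ j k, pt N j k = (1, (j:ℝ)/N, (k:ℝ)/N) := by
    intro j k; simp only [hpt]; rw [div_self hNpos.ne']
  have pt0 : ∀ j k, pt 0 j k = (0, (j:ℝ)/N, (k:ℝ)/N) := by
    intro j k; simp [hpt]
  -- lifts
  set z' : ℕ → ℕ → ℕ → E := fun i j k => if j = N ∧ k = M then w (i / N) else W (pt i j k) with hz'
  set z : ℕ → ℕ → ℕ → E := fun i j k => if i = N then ζ • z' 0 j k else z' i j k with hzdef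
  have zorb' : ∀ i j k, ∃ a : ℕ, W (pt i j k) = ζ ^ a • z' i j k := by
    intro i j k
    simp only [hz']
    split_ifs with h
    · have : pt i j k = ((i:ℝ)/N, 1, 1/2) := by
        simp only [hpt, h.1, h.2, hMN, div_self hNpos.ne']
      rw [this]; exact hwW _
    · exact ⟨0, by simp⟩
  have zorb : ∀ i j k, ∃ a : ℕ, W (pt i j k) = ζ ^ a • z i j k := by
    intro i j k
    simp only [hzdef]
    split_ifs with h
    · subst h
      rw [ptN, hWper, ← pt0]
      obtain ⟨a, ha⟩ := zorb' 0 j k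
      refine ⟨a + (n - 1), ?_⟩
      rw [ha, smul_smul, ← pow_succ, add_assoc, Nat.sub_add_cancel (by omega), pow_add,
        hζ.pow_eq_one, mul_one]
    · exact zorb' i j k
  have znorm : ∀ i j k, ‖z i j k‖ = ‖W (pt i j k)‖ := by
    intro i j k
    obtain ⟨a, ha⟩ := zorb i j k
    rw [ha, norm_smul, norm_pow_root hn0 hζ, one_mul]
  have edge : ∀ i j k i' j' k', i ≤ N → j ≤ N → k ≤ N → i' ≤ N → j' ≤ N → k' ≤ N →
      dist (pt i' j' k') (pt i j k) = 1 / N → ∃ c : ℕ, ‖z i' j' k' - ζ ^ c • z i j k‖ < ε := by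
    intro i j k i' j' k' hi hj hk hi' hj' hk' hd
    obtain ⟨c, hc⟩ := H1 _ (hptK i j k hi hj hk) _ (hptK i' j' k' hi' hj' hk') (hd ▸ hd1)
    obtain ⟨a, ha⟩ := zorb i j k
    obtain ⟨b, hb⟩ := zorb i' j' k'
    obtain ⟨b', hb'⟩ := orb_symm hn0 hζ b
    refine ⟨b' + c + a, ?_⟩
    have : z i' j' k' - ζ ^ (b' + c + a) • z i j k
        = ζ ^ b' • (W (pt i' j' k') - ζ ^ c • W (pt i j k)) := by
      rw [ha, hb, smul_sub, smul_smul, hb', one_smul, smul_smul, smul_smul, pow_add, pow_add, mul_assoc]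
    rw [this, norm_smul, norm_pow_root hn0 hζ, one_mul]; exact hc
  have zN : ∀ j k, z N j k = ζ • z 0 j k := by
    intro j k
    have : (0:ℕ) ≠ N := by omega
    simp [hzdef, this]
  have per : ∀ {j k j' k'} {c : ℕ}, ‖z 0 j' k' - ζ ^ c • z 0 j k‖ < ε → ‖z N j' k' - ζ ^ c • z N j k‖ < ε := by
    intro j k j' k' c h
    rw [zN, zN, smul_comm, ← smul_sub, norm_smul, hζ.norm'_eq_one hn0.ne', one_mul]; exact h
  have cr_ex : ∃ cr : ℕ → ℕ → ℕ → ℕ, (∀ j k, cr N j k = cr 0 j k) ∧ ∀ i j k, i ≤ N → j < N → k ≤ N →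
      ‖z i (j+1) k - ζ ^ cr i j k • z i j k‖ < ε := by
    have : ∀ i j k, ∃ c : ℕ, i ≤ N → j < N → k ≤ N → ‖z i (j+1) k - ζ ^ c • z i j k‖ < ε := by
      intro i j k
      by_cases h : i ≤ N ∧ j < N ∧ k ≤ N
      · obtain ⟨c, hc⟩ := edge i j k i (j+1) k h.1 (by omega) h.2.2 h.1 (by omega) h.2.2 (dr i j k)
        exact ⟨c, fun _ _ _ => hc⟩
      · exact ⟨0, fun a b c => absurd ⟨a, b, c⟩ h⟩
    choose c hc using this
    refine ⟨fun i j k => if i = N then c 0 j k else c i j k, fun j k => by simp, ?_⟩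
    intro i j k hi hj hk
    by_cases h : i = N
    · subst h; simp only [if_true]; exact per (hc 0 j k (by omega) hj hk)
    · simp only [h, if_false]; exact hc i j k hi hj hk
  have ch_ex : ∃ ch : ℕ → ℕ → ℕ → ℕ, (∀ j k, ch N j k = ch 0 j k) ∧ ∀ i j k, i ≤ N → j ≤ N → k < N →
      ‖z i j (k+1) - ζ ^ ch i j k • z i j k‖ < ε := by
    have : ∀ i j k, ∃ c : ℕ, i ≤ N → j ≤ N → k < N → ‖z i j (k+1) - ζ ^ c • z i j k‖ < ε := by
      intro i j k
      by_cases h : i ≤ N ∧ j ≤ N ∧ k < N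
      · obtain ⟨c, hc⟩ := edge i j k i j (k+1) h.1 (by omega) (by omega) h.1 (by omega) (by omega) (dh i j k)
        exact ⟨c, fun _ _ _ => hc⟩
      · exact ⟨0, fun a b c => absurd ⟨a, b, c⟩ h⟩
    choose c hc using this
    refine ⟨fun i j k => if i = N then c 0 j k else c i j k, fun j k => by simp, ?_⟩
    intro i j k hi hj hk
    by_cases h : i = N
    · subst h; simp only [if_true]; exact per (hc 0 j k (by omega) hj hk)
    · simp only [h, if_false]; exact hc i j k hi hj hk
  have z00 : ∀ i k, i < N → z i 0 k = z 0 0 k := by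
    intro i k hi
    have h0 : (0:ℕ) ≠ N := by omega
    simp only [hzdef, hi.ne, h0, if_false, hz', false_and]
    simp only [hpt]
    have := hW0 (i / N) (k / N)
    simp only [Nat.cast_zero, zero_div, this]
  have ct_ex : ∃ ct : ℕ → ℕ → ℕ → ℕ, (∀ i k, ct i 0 k = if i + 1 = N then 1 else 0) ∧
      ∀ i j k, i < N → j ≤ N → k ≤ N → ‖z (i+1) j k - ζ ^ ct i j k • z i j k‖ < ε := by
    have : ∀ i j k, ∃ c : ℕ, i < N → j ≤ N → k ≤ N → ‖z (i+1) j k - ζ ^ c • z i j k‖ < ε := by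
      intro i j k
      by_cases h : i < N ∧ j ≤ N ∧ k ≤ N
      · obtain ⟨c, hc⟩ := edge i j k (i+1) j k h.1.le (by omega) (by omega) h.1 (by omega) (by omega) (dt i j k)
        exact ⟨c, fun _ _ _ => hc⟩
      · exact ⟨0, fun a b c => absurd ⟨a, b, c⟩ h⟩
    choose c hc using this
    refine ⟨fun i j k => if j = 0 then (if i + 1 = N then 1 else 0) else c i j k, fun i k => by simp, ?_⟩
    intro i j k hi hj hk
    by_cases h : j = 0
    · subst h; simp only [if_true]
      by_cases h2 : i + 1 = N
      · simp only [h2, if_true, zN, pow_one, z00 i k hi, sub_self, norm_zero]; exact hε0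
      · simp only [h2, if_false, z00 i k hi, z00 (i+1) k (by omega), pow_zero, one_smul, sub_self,
          norm_zero]; exact hε0
    · simp only [h, if_false]; exact hc i j k hi hj hk
  obtain ⟨cr, crN, hcr⟩ := cr_ex
  obtain ⟨ch, chN, hch⟩ := ch_ex
  obtain ⟨ct, ct0, hct⟩ := ct_ex
  set χ : ℕ → ℕ → ℕ → ZMod n := fun i j k => if η (pt i j k) < 0 then 1 else 0 with hχ
  have h4 : 4 * ε ≤ s * m := by rw [hε]; linarith
  have big : ∀ p ∈ K, ∀ q ∈ K, dist q p = 1 / N → (if η p < 0 then (1 : ZMod n) else 0) ≠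
      (if η q < 0 then 1 else 0) → m ≤ ‖W q‖ := by
    intro p hp q hq hd hne
    have h1 := H2 q hq p hp (hd ▸ hd2)
    rw [Real.dist_eq, abs_lt] at h1
    have : |η q| < m := by
      rw [abs_lt]
      by_cases a : η p < 0 <;> by_cases b : η q < 0 <;> simp [a, b] at hne
      · constructor <;> linarith
      · constructor <;> linarith
    linarith [hmK q hq]
  have hfin : (1 : ZMod n) = 0 := by
    refine gridComb N M (by omega) (fun i j k => (ct i j k : ZMod n)) (fun i j k => (cr i j k : ZMod n))
      (fun i j k => (ch i j k : ZMod n)) χ (fun j k => by simp [crN]) (fun j k => by simp [chN])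
      ?_ ?_ ?_ ?_ ?_ ?_ ?_ ?_ ?_ ?_
    · intro j k; simp only [hχ, ptN, pt0, hηper]
    · intro i k _; simp only [hχ, hpt, Nat.cast_zero, zero_div]; rw [hη0]
    · intro i j _ _; simp only [hχ, hpt, div_self hNpos.ne']
      rw [if_neg (not_lt.2 (hηtop _ _))]
    · intro i j _ _; simp only [hχ, hpt, Nat.cast_zero, zero_div]
      rw [if_pos (hηbot _ _)]
    · intro i k _ hk
      simp only [hχ, hpt, div_self hNpos.ne']
      have : η ((i:ℝ)/N, 1, (k:ℝ)/N) < 0 ↔ k < M := by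
        rw [hη1 _ _ (hI k hk), ← hMN, div_lt_div_iff_of_pos_right hNpos, Nat.cast_lt]
      simp only [this]
    · intro i j k hi hj hk
      by_cases hc : χ i j k = χ i j (k+1)
      · rw [hc, sub_self, zero_mul]
      · have hb := big _ (hptK i j k hi.le hj.le hk.le) _ (hptK i j (k+1) hi.le hj.le hk) (dh i j k) hc
        rw [← znorm] at hb
        have := orb_square hn0 hζ hs hs0 h4 hb (hct i j (k+1) hi hj.le hk) (hcr (i+1) j (k+1) hi hj hk)
          (hcr i j (k+1) hi.le hj hk) (hct i (j+1) (k+1) hi hj hk)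
        linear_combination (χ i j k - χ i j (k+1)) * this
    · intro i j k hi hj hk
      by_cases hc : χ i j k = χ i (j+1) k
      · rw [hc, sub_self, zero_mul]
      · have hb := big _ (hptK i j k hi.le hj.le hk.le) _ (hptK i (j+1) k hi.le hj hk.le) (dr i j k) hc
        rw [← znorm] at hb
        have := orb_square hn0 hζ hs hs0 h4 hb (hct i (j+1) k hi hj hk.le) (hch (i+1) (j+1) k hi hj hk)
          (hch i (j+1) k hi.le hj hk) (hct i (j+1) (k+1) hi hj hk)
        linear_combination (χ i j k - χ i (j+1) k) * this
    · intro i j k hi hj hk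
      by_cases hc : χ i j k = χ (i+1) j k
      · rw [hc, sub_self, zero_mul]
      · have hb := big _ (hptK i j k hi.le hj.le hk.le) _ (hptK (i+1) j k hi hj.le hk.le) (dt i j k) hc
        rw [← znorm] at hb
        have := orb_square hn0 hζ hs hs0 h4 hb (hcr (i+1) j k hi hj hk.le) (hch (i+1) (j+1) k hi hj hk)
          (hch (i+1) j k hi hj.le hk) (hcr (i+1) j (k+1) hi hj hk)
        linear_combination (χ i j k - χ (i+1) j k) * this
    · intro k _
      simp only [ct0]
      have : ∀ i ∈ Finset.range N, ((if i + 1 = N then 1 else 0 : ℕ) : ZMod n) = if i = N - 1 then 1 else 0 := by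
        intro i _
        have : i + 1 = N ↔ i = N - 1 := by omega
        simp only [this, Nat.cast_ite, Nat.cast_one, Nat.cast_zero]
      rw [Finset.sum_congr rfl this, Finset.sum_ite_eq']
      rw [if_pos (Finset.mem_range.2 (by omega))]
    · refine Finset.sum_eq_zero fun i hi => ?_
      rw [Finset.mem_range] at hi
      have zw : ∀ i ≤ N, z i N M = w (i / N) := by
        intro i hi
        by_cases h : i = N
        · subst h
          have : (0:ℕ) ≠ N := by omega
          rw [zN]; simp [hzdef, hz', this, div_self hNpos.ne', hw1]
        · simp [hzdef, hz', h]
      have h1 := hct i N M hi le_rfl (by omega)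
      have h2 : ‖z (i+1) N M - ζ ^ 0 • z i N M‖ < ε := by
        rw [zw _ hi, zw _ hi.le, pow_zero, one_smul, ← dist_eq_norm]
        exact H3 _ (hI _ hi) _ (hI _ hi.le) ((hdd i).symm ▸ hd3)
      have hb : m ≤ ‖z i N M‖ := by
        rw [znorm]
        have h3 := hmK _ (hptK i N M hi.le le_rfl (by omega))
        have : η (pt i N M) = 0 := by
          simp only [hpt, div_self hNpos.ne', hMN]; exact hηhalf _
        rw [this, abs_zero, zero_add] at h3; linarith
      have := hs (ct i N M) 0 (z i N M) (by
        calc _ = ‖(z (i+1) N M - ζ ^ 0 • z i N M) - (z (i+1) N M - ζ ^ ct i N M • z i N M)‖ := by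
              congr 1; abel
          _ ≤ _ := norm_sub_le _ _
          _ < 4 * ε := by linarith
          _ ≤ s * m := h4
          _ ≤ _ := by gcongr)
      simpa using this
  have : Fact (1 < n) := ⟨by omega⟩
  exact one_ne_zero hfin
end FileT3

section FileT4
theorem perturb_off_zero (f : ℂ × ℝ → EuclideanSpace ℝ (Fin 4)) (hf : Continuous f) {m : ℝ}
    (hm : 0 < m) : ∃ F : ℂ × ℝ → EuclideanSpace ℝ (Fin 4), Continuous F ∧ (∀ p, F p ≠ 0) ∧
      (∀ p, m ≤ ‖f p‖ → F p = f p) ∧ ∀ p, ‖F p - f p‖ < m := by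
  obtain ⟨G, hG, hGf, -⟩ := hf.exists_contDiff_approx 1 (ε := fun _ => m / 8)
    continuous_const (fun _ => by positivity)
  have hd : Dense (Set.range G)ᶜ := by
    apply ContDiff.dense_compl_range_of_finrank_lt_finrank (hG.of_le (by norm_num))
    rw [Module.finrank_prod, finrank_euclideanSpace]
    simp [Complex.finrank_real_complex]
  obtain ⟨v, hv, hvm⟩ := hd.exists_dist_lt 0 (show 0 < m / 8 by positivity)
  rw [dist_zero_left] at hvm
  set l : ℂ × ℝ → ℝ := fun p => max 0 (min 1 (2 * ‖f p‖ / m - 1)) with hl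
  have hlc : Continuous l := by fun_prop
  have hl1 : ∀ p, l p ≤ 1 := fun p => max_le zero_le_one (min_le_left _ _)
  have hl0 : ∀ p, 0 ≤ l p := fun p => le_max_left _ _
  have hdiff : ∀ p, ‖(G p - v) - f p‖ < m / 4 := by
    intro p
    have h1 : ‖G p - f p‖ < m / 8 := by rw [← dist_eq_norm]; exact hGf p
    calc _ = ‖(G p - f p) - v‖ := by congr 1; abel
      _ ≤ _ := norm_sub_le _ _
      _ < m / 4 := by linarith
  have hF : ∀ p, ‖((1 - l p) • (G p - v) + l p • f p) - f p‖ < m / 4 := by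
    intro p
    have : ((1 - l p) • (G p - v) + l p • f p) - f p = (1 - l p) • ((G p - v) - f p) := by
      module
    rw [this, norm_smul, Real.norm_eq_abs, abs_of_nonneg (by linarith [hl1 p])]
    have h0 := norm_nonneg ((G p - v) - f p)
    nlinarith [hdiff p, hl0 p, hl1 p]
  refine ⟨fun p => (1 - l p) • (G p - v) + l p • f p, ?_, ?_, ?_, fun p => (hF p).trans (by linarith)⟩
  · have := hG.continuous
    fun_prop
  · intro p hp
    by_cases h : 2 * ‖f p‖ / m - 1 ≤ 0
    · have : l p = 0 := by
        simp only [hl]; rw [max_eq_left]; exact (min_le_right _ _).trans h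
      simp only [this, sub_zero, one_smul, zero_smul, add_zero, sub_eq_zero] at hp
      exact hv ⟨p, hp⟩
    · push Not at h
      have h2 := hF p
      simp only at hp
      rw [hp, zero_sub, norm_neg] at h2
      rw [sub_pos, lt_div_iff₀ hm] at h
      linarith
  · intro p hp
    have : l p = 1 := by
      simp only [hl]; rw [min_eq_left, max_eq_right zero_le_one]
      rw [le_sub_iff_add_le, le_div_iff₀ hm]; linarith
    simp [this]
end FileT4

section FileT5
/-- clamp to the unit interval -/
def cl01 (t : ℝ) : ℝ := max 0 (min 1 t)

theorem cl01_mem (t : ℝ) : cl01 t ∈ Set.Icc (0:ℝ) 1 :=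
  ⟨le_max_left _ _, max_le zero_le_one (min_le_left _ _)⟩

theorem cl01_of_mem {t : ℝ} (h : t ∈ Set.Icc (0:ℝ) 1) : cl01 t = t := by
  rw [cl01, min_eq_right h.2, max_eq_right h.1]

theorem cl01_cont : Continuous cl01 := by unfold cl01; fun_prop

/-- the domain `disc × [-1,1]` -/
def cylDom : Set (ℂ × ℝ) := Metric.closedBall 0 1 ×ˢ Set.Icc (-1) 1

/-- retraction onto the cylinder -/
def cylRet (p : ℂ × ℝ) : ℂ × ℝ := ((1 / max 1 ‖p.1‖ : ℝ) • p.1, max (-1) (min 1 p.2))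

theorem cylRet_mem (p : ℂ × ℝ) : cylRet p ∈ cylDom := by
  refine ⟨?_, le_max_left _ _, max_le (by norm_num) (min_le_left _ _)⟩
  have h0 : 0 < max 1 ‖p.1‖ := lt_of_lt_of_le one_pos (le_max_left _ _)
  rw [mem_closedBall_zero_iff]
  simp only [cylRet]
  rw [norm_smul, Real.norm_eq_abs, abs_of_pos (by positivity), one_div,
    inv_mul_le_iff₀ h0, mul_one]
  exact le_max_right _ _

theorem cylRet_of_mem {p : ℂ × ℝ} (h : p ∈ cylDom) : cylRet p = p := by
  have h1 : ‖p.1‖ ≤ 1 := mem_closedBall_zero_iff.1 h.1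
  ext1
  · simp [cylRet, max_eq_left h1]
  · simp only [cylRet]
    rw [min_eq_right h.2.2, max_eq_right h.2.1]

theorem cylRet_cont : Continuous cylRet := by
  have : ∀ p : ℂ × ℝ, max 1 ‖p.1‖ ≠ 0 := fun p =>
    (lt_of_lt_of_le one_pos (le_max_left _ _)).ne'
  unfold cylRet
  refine Continuous.prodMk (Continuous.smul (Continuous.div ?_ ?_ this) continuous_fst) ?_ <;> fun_prop

theorem localObstruction {X E : Type*} [TopologicalSpace X] [NormedAddCommGroup E] [NormedSpace ℂ E]
    {n : ℕ} {ζ : ℂ} (hn : 2 ≤ n) (hζ : IsPrimitiveRoot ζ n) (z0 : X)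
    (V : Set X) (hV : IsOpen V) (hzV : z0 ∈ V) (e : V ≃ₜ EuclideanSpace ℝ (Fin 4))
    (N : Set X) (hN : N ∈ nhds z0) (W : X → E) (hW : ∀ z ∈ N, OrbContAt ζ W z)
    (lam : X → ℝ) (hlam : ∀ z ∈ N, ContinuousAt lam z) (hlam0 : lam z0 = 0)
    (hzero : ∀ z ∈ N, W z = 0 → lam z = 0 → z = z0)
    (hloop : ∀ O ∈ nhds z0, ∃ g : ℂ × ℝ → X, ContinuousOn g cylDom ∧ Set.MapsTo g cylDom O ∧
      (∀ p ∈ cylDom, ‖p.1‖ = 1 → g p ≠ z0) ∧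
      ((∀ p ∈ cylDom, (lam (g p) < 0 ↔ p.2 < 0) ∧ (lam (g p) = 0 ↔ p.2 = 0)) ∨ ∀ z ∈ N, lam z = 0) ∧
      ∃ w : ℝ → E, ContinuousOn w (Set.Icc 0 1) ∧
        (∀ t ∈ Set.Icc (0:ℝ) 1, ∃ i : ℕ,
          W (g (Complex.exp (2 * Real.pi * t * Complex.I), 0)) = ζ ^ i • w t) ∧ w 1 = ζ • w 0) :
    False := by
  have hn0 : 0 < n := by omega
  -- recentred chart
  set ez : V → EuclideanSpace ℝ (Fin 4) := fun v => e v - e ⟨z0, hzV⟩ with hez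
  set inv : EuclideanSpace ℝ (Fin 4) → X := fun y => (e.symm (y + e ⟨z0, hzV⟩)).1 with hinv
  have hinvc : Continuous inv := by
    simp only [hinv]; exact continuous_subtype_val.comp (e.symm.continuous.comp (by fun_prop))
  have hinv0 : inv 0 = z0 := by simp [hinv]
  have hinvz : ∀ y, inv y = z0 → y = 0 := by
    intro y hy
    have : e.symm (y + e ⟨z0, hzV⟩) = ⟨z0, hzV⟩ := Subtype.ext hy
    rw [Homeomorph.symm_apply_eq] at this
    simpa using this
  have hinvez : ∀ v : V, inv (ez v) = v.1 := by intro v; simp [hinv, hez]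
  obtain ⟨r, hr, hrN⟩ : ∃ r > 0, ∀ y : EuclideanSpace ℝ (Fin 4), ‖y‖ < r → inv y ∈ N := by
    have : inv ⁻¹' N ∈ nhds (0 : EuclideanSpace ℝ (Fin 4)) :=
      hinvc.continuousAt.preimage_mem_nhds (by rw [hinv0]; exact hN)
    obtain ⟨r, hr, h⟩ := Metric.mem_nhds_iff.1 this
    exact ⟨r, hr, fun y hy => h (mem_ball_zero_iff.2 hy)⟩
  -- small neighbourhood
  have hO : Subtype.val '' {v : V | ‖ez v‖ < r / 2} ∈ nhds z0 := by
    refine IsOpen.mem_nhds ?_ ⟨⟨z0, hzV⟩, by simp [hez, hr], rfl⟩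
    apply hV.isOpenMap_subtype_val
    exact isOpen_lt (by simp only [hez]; fun_prop) continuous_const
  obtain ⟨g, hg, hgO, hgne, hAB, w, hwc, hwW, hw1⟩ := hloop _ hO
  have hgV : ∀ p, g (cylRet p) ∈ V := by
    intro p
    obtain ⟨v, -, hv⟩ := hgO (cylRet_mem p)
    rw [← hv]; exact v.2
  have hgc : Continuous fun p => g (cylRet p) :=
    hg.comp_continuous cylRet_cont cylRet_mem
  set f : ℂ × ℝ → EuclideanSpace ℝ (Fin 4) := fun p => ez ⟨g (cylRet p), hgV p⟩ with hf
  have hfc : Continuous f := by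
    simp only [hf, hez]
    exact (e.continuous.comp (hgc.subtype_mk hgV)).sub continuous_const
  have hinvf : ∀ p, inv (f p) = g (cylRet p) := fun p => hinvez _
  have hfr : ∀ p, ‖f p‖ < r / 2 := by
    intro p
    obtain ⟨v, hv, hv'⟩ := hgO (cylRet_mem p)
    have : (⟨g (cylRet p), hgV p⟩ : V) = v := Subtype.ext hv'.symm
    simp only [hf, this]; exact hv
  have hf0 : ∀ p, f p = 0 → g (cylRet p) = z0 := fun p hp => by rw [← hinvf, hp, hinv0]
  -- the set where f must not be changed
  set K : Set (ℂ × ℝ) := {p | p ∈ cylDom ∧ (‖p.1‖ = 1 ∨ (¬ (∀ z ∈ N, lam z = 0) ∧ |p.2| = 1))} with hK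
  have hdc : IsCompact cylDom := (isCompact_closedBall _ _).prod isCompact_Icc
  have hKc : IsCompact K := by
    have : K = cylDom ∩ {p | ‖p.1‖ = 1 ∨ (¬ (∀ z ∈ N, lam z = 0) ∧ |p.2| = 1)} := rfl
    rw [this]
    apply hdc.inter_right
    refine IsClosed.union ?_ ?_
    · exact isClosed_eq (by fun_prop) continuous_const
    · by_cases h : ∀ z ∈ N, lam z = 0
      · have : {p : ℂ × ℝ | ¬ (∀ z ∈ N, lam z = 0) ∧ |p.2| = 1} = ∅ :=
          Set.eq_empty_of_forall_notMem fun p hp => hp.1 h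
        change IsClosed {p : ℂ × ℝ | ¬ (∀ z ∈ N, lam z = 0) ∧ |p.2| = 1}
        rw [this]; exact isClosed_empty
      · simp only [h, not_false_eq_true, true_and]
        exact isClosed_eq (by fun_prop) continuous_const
  have hKf : ∀ p ∈ K, f p ≠ 0 := by
    rintro p ⟨hp, h⟩ h0
    have h1 := hf0 p h0
    rw [cylRet_of_mem hp] at h1
    rcases h with h | ⟨h, h'⟩
    · exact hgne p hp h h1
    · rcases hAB with hA | hB
      · have := (hA p hp).2.1 (by rw [h1, hlam0])
        rw [this] at h'; norm_num at h'
      · exact h hB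
  obtain ⟨m, hm, hmr, hmK⟩ : ∃ m > 0, m ≤ r / 2 ∧ ∀ p ∈ K, m ≤ ‖f p‖ := by
    by_cases hne : K.Nonempty
    · obtain ⟨p, hp, hmin⟩ := hKc.exists_isMinOn hne (f := fun p => ‖f p‖) (by fun_prop)
      exact ⟨min (r/2) ‖f p‖, lt_min (by positivity) (norm_pos_iff.2 (hKf p hp)), min_le_left _ _,
        fun q hq => (min_le_right _ _).trans (hmin hq)⟩
    · exact ⟨r/2, by positivity, le_rfl, fun p hp => absurd ⟨p, hp⟩ hne⟩
  obtain ⟨F, hFc, hF0, hFf, hFd⟩ := perturb_off_zero f hfc hm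
  set H : ℂ × ℝ → X := fun p => inv (F p) with hH
  have hHc : Continuous H := hinvc.comp hFc
  have hHN : ∀ p, H p ∈ N := by
    intro p
    apply hrN
    calc ‖F p‖ = ‖(F p - f p) + f p‖ := by rw [sub_add_cancel]
      _ ≤ _ := norm_add_le _ _
      _ < r := by linarith [hFd p, hfr p]
  have hHz : ∀ p, H p ≠ z0 := fun p h => hF0 p (hinvz _ h)
  have hHK : ∀ p ∈ K, H p = g p := by
    intro p hp
    simp only [hH]
    rw [hFf p (hmK p hp), hinvf, cylRet_of_mem hp.1]
  -- polar coordinates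
  set pol : ℝ × ℝ × ℝ → ℂ × ℝ := fun q =>
    (((cl01 q.2.1 : ℝ) : ℂ) * Complex.exp (2 * Real.pi * (cl01 q.1 : ℝ) * Complex.I), 2 * cl01 q.2.2 - 1) with hpol
  have hpolc : Continuous pol := by
    have := cl01_cont
    simp only [hpol]; fun_prop
  have hnexp : ∀ t : ℝ, ‖Complex.exp (2 * Real.pi * t * Complex.I)‖ = 1 := by
    intro t
    have := Complex.norm_exp_ofReal_mul_I (2 * Real.pi * t)
    push_cast at this; exact this
  have hpolD : ∀ q, pol q ∈ cylDom := by
    intro q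
    have h1 := cl01_mem q.2.1
    have h2 := cl01_mem q.2.2
    refine ⟨?_, by simp only [hpol]; linarith [h2.1], by simp only [hpol]; linarith [h2.2]⟩
    rw [mem_closedBall_zero_iff]
    simp only [hpol]
    rw [norm_mul, hnexp, mul_one, Complex.norm_real, Real.norm_eq_abs, abs_of_nonneg h1.1]
    exact h1.2
  have c0 : cl01 0 = 0 := cl01_of_mem (by simp)
  have c1 : cl01 1 = 1 := cl01_of_mem (by simp)
  have ch : cl01 (1/2) = 1/2 := cl01_of_mem (by constructor <;> norm_num)
  have hper : ∀ r h, pol (1, r, h) = pol (0, r, h) := by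
    intro r h
    simp only [hpol, c0, c1]
    simp [Complex.exp_two_pi_mul_I]
  have hz0 : ∀ t h, pol (t, 0, h) = pol (0, 0, h) := by
    intro t h; simp [hpol, c0]
  have hpolR : ∀ t h, ‖(pol (t, 1, h)).1‖ = 1 := by
    intro t h; simp only [hpol, c1, Complex.ofReal_one, one_mul]; exact hnexp _
  have hKR : ∀ t h, pol (t, 1, h) ∈ K := fun t h => ⟨hpolD _, Or.inl (hpolR t h)⟩
  have hWgood : ∀ q, OrbContAt ζ (fun q => W (H (pol q))) q := by
    intro q ε hε
    exact (hHc.comp hpolc).continuousAt.eventually (hW (H (pol q)) (hHN _) ε hε)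
  have hWhalf : ∀ t, ∃ i : ℕ, W (H (pol (t, 1, 1/2))) = ζ ^ i • w (cl01 t) := by
    intro t
    rw [hHK _ (hKR t _)]
    have : pol (t, 1, 1/2) = (Complex.exp (2 * Real.pi * (cl01 t : ℝ) * Complex.I), 0) := by
      simp only [hpol, c1, ch]; norm_num
    rw [this]; exact hwW _ (cl01_mem t)
  have hwc' : Continuous fun t => w (cl01 t) := hwc.comp_continuous cl01_cont cl01_mem
  by_cases hB : ∀ z ∈ N, lam z = 0
  · refine gridObstruction hn hζ (fun q => 2 * cl01 q.2.2 - 1) (by have := cl01_cont; fun_prop)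
      (fun q => W (H (pol q))) hWgood (fun r h => by simp only [hper]) (fun _ _ => rfl)
      (fun t h => by simp only [hz0 t h]) (fun _ _ => rfl) ?_ ?_ ?_ ?_ ?_
      (fun t => w (cl01 t)) hwc' hWhalf (by simp only [c0, c1, hw1])
    · intro t h hh; simp only [cl01_of_mem hh]; constructor <;> intro <;> linarith
    · intro t; simp only [ch]; norm_num
    · intro t r; simp only [c0]; norm_num
    · intro t r; simp only [c1]; norm_num
    · intro q _ h; exact hHz _ (hzero _ (hHN _) h (hB _ (hHN _)))
  · have hA := hAB.resolve_right hB
    have hKh : ∀ t r h, (h = 0 ∨ h = 1) → pol (t, r, h) ∈ K := by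
      rintro t r h (rfl | rfl)
      · exact ⟨hpolD _, Or.inr ⟨hB, by simp [hpol, c0]⟩⟩
      · exact ⟨hpolD _, Or.inr ⟨hB, by simp [hpol, c1]; norm_num⟩⟩
    refine gridObstruction hn hζ (fun q => lam (H (pol q))) ?_
      (fun q => W (H (pol q))) hWgood (fun r h => by simp only [hper]) (fun r h => by simp only [hper])
      (fun t h => by simp only [hz0 t h]) (fun t h => by simp only [hz0 t h]) ?_ ?_ ?_ ?_ ?_
      (fun t => w (cl01 t)) hwc' hWhalf (by simp only [c0, c1, hw1])
    · refine continuous_iff_continuousAt.2 fun q => ?_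
      exact ContinuousAt.comp (f := fun q => H (pol q)) (g := lam) (hlam _ (hHN _))
        (hHc.comp hpolc).continuousAt
    · intro t h hh
      rw [hHK _ (hKR t _), (hA _ (hpolD _)).1]
      simp only [hpol, cl01_of_mem hh]; constructor <;> intro <;> linarith
    · intro t
      rw [hHK _ (hKR t _), (hA _ (hpolD _)).2]
      simp only [hpol, ch]; norm_num
    · intro t r
      rw [hHK _ (hKh t r _ (Or.inl rfl)), (hA _ (hpolD _)).1]
      simp only [hpol, c0]; norm_num
    · intro t r
      rw [hHK _ (hKh t r _ (Or.inr rfl)), ← not_lt, (hA _ (hpolD _)).1]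
      simp only [hpol, c1]; norm_num
    · intro q h1 h; exact hHz _ (hzero _ (hHN _) h h1)
end FileT5

section FileC1
/-! ### States and moves -/

attribute [instance] GlueingDatum.fintypeI GlueingDatum.nonemptyI

section basics
variable {D : GlueingDatum 4}

/-- a simplex together with an ordered `d`-tuple of distinct vertices -/
abbrev St (D : GlueingDatum 4) (d : ℕ) : Type := D.I × (Fin d ↪ Fin 5)

/-- label of the facet on the other side -/
def opf (D : GlueingDatum 4) (i : D.I) (k : Fin 5) : Fin 5 := (D.P (i, k)).2

/-- simplex on the other side -/
def nbr (D : GlueingDatum 4) (i : D.I) (k : Fin 5) : D.I := (D.P (i, k)).1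

theorem P_eq (i : D.I) (k : Fin 5) : D.P (i, k) = (nbr D i k, opf D i k) := rfl

theorem glue_opf (i : D.I) (k : Fin 5) : D.glue (i, k) k = opf D i k := D.glue_face (i, k)

theorem nbr_nbr (i : D.I) (k : Fin 5) : nbr D (nbr D i k) (opf D i k) = i := by
  have := D.P_involutive (i, k)
  rw [P_eq] at this
  exact congrArg Prod.fst this

theorem opf_opf (i : D.I) (k : Fin 5) : opf D (nbr D i k) (opf D i k) = k := by
  have := D.P_involutive (i, k)
  rw [P_eq] at this
  exact congrArg Prod.snd this

theorem glue_back (i : D.I) (k : Fin 5) :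
    D.glue (nbr D i k, opf D i k) = (D.glue (i, k)).symm := D.glue_symm (i, k)

/-- move a state across the facet `k` -/
def St.mv {d : ℕ} (s : St D d) (k : Fin 5) : St D d :=
  (nbr D s.1 k, s.2.trans (D.glue (s.1, k)).toEmbedding)

theorem St.mv_fst {d : ℕ} (s : St D d) (k : Fin 5) : (s.mv k).1 = nbr D s.1 k := rfl

theorem St.mv_snd {d : ℕ} (s : St D d) (k : Fin 5) (a : Fin d) :
    (s.mv k).2 a = D.glue (s.1, k) (s.2 a) := rfl

theorem St.mv_mv {d : ℕ} (s : St D d) (k : Fin 5) : (s.mv k).mv (opf D s.1 k) = s := by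
  refine Prod.ext (nbr_nbr _ _) ?_
  ext1 a
  rw [St.mv_snd, St.mv_snd, St.mv_fst, glue_back, Equiv.symm_apply_apply]

theorem St.op_notMem {d : ℕ} {s : St D d} {k : Fin 5} (h : k ∉ Set.range s.2) :
    opf D s.1 k ∉ Set.range (s.mv k).2 := by
  rintro ⟨a, ha⟩
  rw [St.mv_snd, ← glue_opf] at ha
  exact h ⟨a, (D.glue _).injective ha⟩

/-- point of the total space -/
abbrev Tot (D : GlueingDatum 4) : Type := GlueTotal D

/-- class of a point -/
abbrev mkX (p : GlueTotal D) : GlueSpace D := Quot.mk (glueRel D) p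

/-- move a point across a facet -/
def crossD (i : D.I) (k : Fin 5) (y : Delta 4) : Delta 4 :=
  ⟨y.1 ∘ (D.glue (i, k)).symm, fun v => y.2.1 _, 
    (Equiv.sum_comp (D.glue (i, k)).symm y.1).trans y.2.2⟩

theorem glueRel_iff {p q : GlueTotal D} : glueRel D p q ↔
    ∃ k, p.2.1 k = 0 ∧ q = ⟨nbr D p.1 k, crossD p.1 k p.2⟩ := by
  constructor
  · rintro ⟨k, h0, h1, h2⟩
    refine ⟨k, h0, ?_⟩
    rcases q with ⟨j, y⟩
    change nbr D p.1 k = j at h1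
    subst h1
    congr 1
    exact Subtype.ext h2
  · rintro ⟨k, h0, rfl⟩
    exact ⟨k, h0, rfl, rfl⟩

theorem glueRel_symm {p q : GlueTotal D} (h : glueRel D p q) : glueRel D q p := by
  obtain ⟨k, h0, rfl⟩ := glueRel_iff.1 h
  refine glueRel_iff.2 ⟨opf D p.1 k, ?_, ?_⟩
  · simp only [crossD, Function.comp]
    rw [← glue_opf, Equiv.symm_apply_apply, h0]
  · rcases p with ⟨i, y⟩
    have h1 := nbr_nbr (D := D) i k
    simp only
    refine Sigma.ext h1.symm (heq_of_eq (Subtype.ext ?_))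
    simp only [crossD]
    rw [glue_back]
    ext v; simp

theorem quot_transport {α : Type*} {r : α → α → Prop} (hs : ∀ a b, r a b → r b a) {Q : α → Prop}
    (hQ : ∀ a b, r a b → Q a → Q b) {a b : α} (h : Quot.mk r a = Quot.mk r b) (ha : Q a) : Q b := by
  have h1 := Quot.eqvGen_exact h
  have : ∀ a b, Relation.EqvGen r a b → (Q a ↔ Q b) := by
    intro a b h
    induction h with
    | rel a b h => exact ⟨hQ a b h, hQ b a (hs a b h)⟩
    | refl => exact Iff.rfl
    | symm _ _ _ ih => exact ih.symm
    | trans _ _ _ _ _ ih1 ih2 => exact ih1.trans ih2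
  exact (this a b h1).1 ha

theorem mkX_transport {Q : GlueTotal D → Prop}
    (hQ : ∀ (p : GlueTotal D) (k : Fin 5), p.2.1 k = 0 → Q p → Q ⟨nbr D p.1 k, crossD p.1 k p.2⟩)
    {a b : GlueTotal D} (h : mkX a = mkX b) (ha : Q a) : Q b := by
  refine quot_transport (fun _ _ => glueRel_symm) ?_ h ha
  intro a b h
  obtain ⟨k, h0, rfl⟩ := glueRel_iff.1 h
  exact hQ a k h0

theorem mkX_cross (i : D.I) (y : Delta 4) (k : Fin 5) (h : y.1 k = 0) :
    mkX (⟨nbr D i k, crossD i k y⟩ : GlueTotal D) = mkX ⟨i, y⟩ :=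
  Quot.sound (glueRel_symm (glueRel_iff.2 ⟨k, h, rfl⟩))

theorem mem_vertexImage (p : GlueTotal D) : mkX p ∈ vertexImage D ↔ ∃ v, p.2.1 v = 1 := by
  constructor
  · rintro ⟨q, hq, hqp⟩
    refine mkX_transport (Q := fun p => ∃ v, p.2.1 v = 1) ?_ hqp hq
    rintro p k - ⟨v, hv⟩
    exact ⟨D.glue (p.1, k) v, by simp [crossD, hv]⟩
  · exact fun h => ⟨p, h, rfl⟩

theorem isClosed_vertexImage : IsClosed (vertexImage D) := by
  rw [← isQuotientMap_quot_mk.isClosed_preimage]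
  have : Quot.mk (glueRel D) ⁻¹' vertexImage D = ⋃ v, {p : GlueTotal D | p.2.1 v = 1} := by
    ext p; simp only [Set.mem_preimage, Set.mem_iUnion]; exact mem_vertexImage p
  rw [this]
  refine isClosed_iUnion_of_finite fun v => ?_
  rw [isClosed_sigma_iff]
  intro i
  exact isClosed_eq ((continuous_apply v).comp continuous_subtype_val) continuous_const

theorem chart_of_loc (h : LocEuclidean 4 (GlueSpaceStar D)) (z : GlueSpace D)
    (hz : z ∉ vertexImage D) : ∃ V : Set (GlueSpace D), IsOpen V ∧ z ∈ V ∧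
      Nonempty (V ≃ₜ EuclideanSpace ℝ (Fin 4)) := by
  obtain ⟨U, hU, hzU, ⟨e⟩⟩ := h ⟨z, hz⟩
  have hop : IsOpen (vertexImage D)ᶜ := isClosed_vertexImage.isOpen_compl
  refine ⟨Subtype.val '' U, hop.isOpenMap_subtype_val _ hU, ⟨_, hzU, rfl⟩, ⟨?_⟩⟩
  refine Homeomorph.trans ?_ e
  exact (Topology.IsEmbedding.subtypeVal.homeomorphImage U).symm

/-! ### Extending a function on `Fin d` to the vertices -/

/-- extension by zero along an embedding -/
def extz {d : ℕ} (t : Fin d ↪ Fin 5) (x : Fin d → ℝ) : Fin 5 → ℝ :=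
  fun v => ∑ a, if t a = v then x a else 0

theorem extz_apply {d : ℕ} (t : Fin d ↪ Fin 5) (x : Fin d → ℝ) (a : Fin d) :
    extz t x (t a) = x a := by
  simp [extz, t.injective.eq_iff]

theorem extz_notMem {d : ℕ} (t : Fin d ↪ Fin 5) (x : Fin d → ℝ) {v : Fin 5}
    (h : v ∉ Set.range t) : extz t x v = 0 := by
  refine Finset.sum_eq_zero fun a _ => if_neg fun h' => h ⟨a, h'⟩

theorem extz_sum {d : ℕ} (t : Fin d ↪ Fin 5) (x : Fin d → ℝ) : ∑ v, extz t x v = ∑ a, x a := by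
  simp only [extz]
  rw [Finset.sum_comm]
  simp

theorem extz_nonneg {d : ℕ} (t : Fin d ↪ Fin 5) (x : Fin d → ℝ) (hx : ∀ a, 0 ≤ x a) (v) :
    0 ≤ extz t x v :=
  Finset.sum_nonneg fun a _ => by split_ifs; exacts [hx a, le_rfl]

theorem extz_trans {d : ℕ} (t : Fin d ↪ Fin 5) (x : Fin d → ℝ) (e : Equiv.Perm (Fin 5)) :
    extz (t.trans e.toEmbedding) x = extz t x ∘ e.symm := by
  ext v
  simp only [extz, Function.Embedding.trans_apply, Equiv.coe_toEmbedding, Function.comp,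
    Equiv.eq_symm_apply]

theorem extz_perm {d : ℕ} (t : Fin d ↪ Fin 5) (x : Fin d → ℝ) (σ : Equiv.Perm (Fin d)) :
    extz (σ.toEmbedding.trans t) (x ∘ σ) = extz t x := by
  ext v
  simp only [extz, Function.Embedding.trans_apply, Equiv.coe_toEmbedding, Function.comp]
  exact Equiv.sum_comp σ (fun a => if t a = v then x a else 0)

theorem extz_cont {d : ℕ} (t : Fin d ↪ Fin 5) : Continuous (extz t) := by
  unfold extz
  refine continuous_pi fun v => continuous_finsetSum _ fun a _ => ?_
  split_ifs
  · exact continuous_apply a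
  · exact continuous_const
end basics
end FileC1

section FileC2
/-- An equivariant family of states used as a local coordinate system near a face. -/
structure Enh (D : GlueingDatum 4) (d n : ℕ) where
  S : Type
  fin : Fintype S
  pi : S → St D d
  mv : S → Fin 5 → S
  pi_mv : ∀ s k, k ∉ Set.range (pi s).2 → pi (mv s k) = (pi s).mv k
  mv_mv : ∀ s k, k ∉ Set.range (pi s).2 → mv (mv s k) (opf D (pi s).1 k) = s
  deck : S → S
  σ : Equiv.Perm (Fin d)
  pi_deck : ∀ s, pi (deck s) = ((pi s).1, σ.toEmbedding.trans (pi s).2)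
  deck_mv : ∀ s k, k ∉ Set.range (pi s).2 → deck (mv s k) = mv (deck s) k
  deck_pow : ∀ s, deck^[n] s = s

namespace Enh
variable {D : GlueingDatum 4} {d n : ℕ} (En : Enh D d n)

attribute [instance] Enh.fin

/-- one step of an extended state -/
def estep (a b : En.S × Finset (Fin 5)) : Prop :=
  ∃ k, k ∉ Set.range (En.pi a.1).2 ∧ k ∉ a.2 ∧
    b = (En.mv a.1 k, a.2.map (D.glue ((En.pi a.1).1, k)).toEmbedding)

/-- reachability of extended states -/
def ER : En.S × Finset (Fin 5) → En.S × Finset (Fin 5) → Prop := Relation.ReflTransGen En.estep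

/-- reachability of states -/
def R : En.S → En.S → Prop :=
  Relation.ReflTransGen fun s s' => ∃ k, k ∉ Set.range (En.pi s).2 ∧ s' = En.mv s k

theorem estep_symm {a b} (h : En.estep a b) : En.estep b a := by
  obtain ⟨k, hk, hkA, rfl⟩ := h
  refine ⟨opf D (En.pi a.1).1 k, ?_, ?_, ?_⟩
  · simp only [En.pi_mv _ _ hk]; exact St.op_notMem hk
  · rw [← glue_opf]; simpa using hkA
  · simp only [En.pi_mv _ _ hk, En.mv_mv _ _ hk]
    rw [St.mv_fst, glue_back]
    refine Prod.ext rfl ?_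
    simp only [Finset.map_map]
    ext v; simp

theorem ER_symm {a b} (h : En.ER a b) : En.ER b a := by
  have : Std.Symm En.estep := ⟨fun _ _ => En.estep_symm⟩
  exact Relation.ReflTransGen.stdSymm.symm _ _ h

theorem ER_card {a b} (h : En.ER a b) : b.2.card = a.2.card := by
  induction h with
  | refl => rfl
  | tail _ h ih =>
    obtain ⟨k, -, -, rfl⟩ := h
    simpa using ih

theorem range_deck (s : En.S) : Set.range (En.pi (En.deck s)).2 = Set.range (En.pi s).2 := by
  rw [En.pi_deck]
  ext v; constructor
  · rintro ⟨a, rfl⟩; exact ⟨En.σ a, rfl⟩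
  · rintro ⟨a, rfl⟩; exact ⟨En.σ.symm a, by simp⟩

theorem fst_deck (s : En.S) : (En.pi (En.deck s)).1 = (En.pi s).1 := by rw [En.pi_deck]

theorem estep_deck {a b} (h : En.estep a b) : En.estep (En.deck a.1, a.2) (En.deck b.1, b.2) := by
  obtain ⟨k, hk, hkA, rfl⟩ := h
  refine ⟨k, by rwa [range_deck], hkA, ?_⟩
  simp only [fst_deck, En.deck_mv _ _ hk]

theorem ER_deck {a b} (h : En.ER a b) : En.ER (En.deck a.1, a.2) (En.deck b.1, b.2) := by
  induction h with
  | refl => exact .refl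
  | tail _ h ih => exact ih.tail (En.estep_deck h)

theorem ER_deck_pow {a b} (i : ℕ) (h : En.ER a b) :
    En.ER (En.deck^[i] a.1, a.2) (En.deck^[i] b.1, b.2) := by
  induction i with
  | zero => exact h
  | succ i ih => rw [Function.iterate_succ_apply', Function.iterate_succ_apply']; exact En.ER_deck ih

theorem deck_pow_mul (q : ℕ) (s : En.S) : En.deck^[n * q] s = s := by
  rw [Function.iterate_mul]
  exact Function.iterate_fixed (En.deck_pow s) q

theorem deck_mod (i : ℕ) (s : En.S) : En.deck^[i] s = En.deck^[i % n] s := by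
  conv_lhs => rw [← Nat.mod_add_div i n]
  rw [Function.iterate_add_apply, deck_pow_mul]

/-- coefficient of the monomial of `A` in the component `(s0, A0)` -/
def coef (ζ : ℂ) (s : En.S) (A : Finset (Fin 5)) (q : En.S × Finset (Fin 5)) : ℂ :=
  if A.Nonempty ∧ Disjoint (A : Set (Fin 5)) (Set.range (En.pi s).2) then
    ∑ i ∈ Finset.range n, if En.ER (s, A) (En.deck^[i] q.1, q.2) then ζ ^ i else 0
  else 0

/-- the local invariant -/
def W (ζ : ℂ) (l : (Fin d → ℝ) →ₗ[ℝ] ℂ) (s : En.S) (y : Fin 5 → ℝ) :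
    (En.S × Finset (Fin 5) → ℂ) × ℂ :=
  (fun q => ∑ A : Finset (Fin 5), En.coef ζ s A q * ((∏ k ∈ A, y k : ℝ) : ℂ),
    l (fun a => y ((En.pi s).2 a)))

theorem W_cont (ζ : ℂ) (l : (Fin d → ℝ) →ₗ[ℝ] ℂ) (s : En.S) : Continuous (En.W ζ l s) := by
  unfold W
  refine Continuous.prodMk ?_ ?_
  · refine continuous_pi fun q => continuous_finsetSum _ fun A _ => ?_
    fun_prop
  · exact (LinearMap.continuous_of_finiteDimensional l).comp (by fun_prop)

theorem coef_deck (hn : 0 < n) {ζ : ℂ} (hζ : ζ ^ n = 1) (s : En.S) (A) (q) :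
    En.coef ζ (En.deck s) A q = ζ * En.coef ζ s A q := by
  unfold coef
  rw [range_deck]
  split_ifs with h
  · rw [Finset.mul_sum]
    obtain ⟨m, rfl⟩ : ∃ m, n = m + 1 := ⟨n - 1, by omega⟩
    rw [Finset.sum_range_succ', Finset.sum_range_succ]
    have key : ∀ i, En.ER (En.deck s, A) (En.deck^[i+1] q.1, q.2) ↔ En.ER (s, A) (En.deck^[i] q.1, q.2) := by
      intro i
      constructor
      · intro h
        have := En.ER_deck_pow m h
        simp only [← Function.iterate_add_apply] at this
        rw [show En.deck^[m] (En.deck s) = s from by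
          rw [← Function.iterate_succ_apply]; exact En.deck_pow s,
          show m + (i + 1) = (m+1) + i by ring, Function.iterate_add_apply, En.deck_pow] at this
        exact this
      · intro h
        have := En.ER_deck h
        simpa only [Function.iterate_succ_apply'] using this
    have key0 : En.ER (En.deck s, A) (En.deck^[0] q.1, q.2) ↔ En.ER (s, A) (En.deck^[m] q.1, q.2) := by
      rw [← key m, En.deck_pow]; rfl
    congr 1
    · refine Finset.sum_congr rfl fun i _ => ?_
      simp only [key]; split_ifs
      · rw [pow_succ']
      · simp
    · simp only [key0]; split_ifs
      · rw [← pow_succ', hζ]; rfl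
      · simp
  · simp

theorem W_deck (hn : 0 < n) {ζ : ℂ} (hζ : ζ ^ n = 1) {l : (Fin d → ℝ) →ₗ[ℝ] ℂ}
    (hl : ∀ v, l (v ∘ En.σ) = ζ * l v) (s : En.S) (y) :
    En.W ζ l (En.deck s) y = ζ • En.W ζ l s y := by
  refine Prod.ext ?_ ?_
  · ext q
    simp only [W, En.coef_deck hn hζ, Prod.smul_fst, Pi.smul_apply, smul_eq_mul, Finset.mul_sum, mul_assoc]
  · simp only [W, Prod.smul_snd, smul_eq_mul]
    rw [← hl, En.pi_deck]
    rfl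

theorem W_deck_pow (hn : 0 < n) {ζ : ℂ} (hζ : ζ ^ n = 1) {l : (Fin d → ℝ) →ₗ[ℝ] ℂ}
    (hl : ∀ v, l (v ∘ En.σ) = ζ * l v) (i : ℕ) (s : En.S) (y) :
    En.W ζ l (En.deck^[i] s) y = ζ ^ i • En.W ζ l s y := by
  induction i with
  | zero => simp
  | succ i ih => rw [Function.iterate_succ_apply', En.W_deck hn hζ hl, ih, smul_smul, pow_succ']

theorem W_cross {ζ : ℂ} {l : (Fin d → ℝ) →ₗ[ℝ] ℂ} (s : En.S) (y : Fin 5 → ℝ) (k : Fin 5)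
    (hk : k ∉ Set.range (En.pi s).2) (hy : y k = 0) :
    En.W ζ l (En.mv s k) (y ∘ (D.glue ((En.pi s).1, k)).symm) = En.W ζ l s y := by
  set φ := D.glue ((En.pi s).1, k) with hφ
  refine Prod.ext ?_ ?_
  · ext q
    simp only [W]
    symm
    refine Fintype.sum_equiv φ.finsetCongr _ _ fun A => ?_
    rw [Equiv.finsetCongr_apply]
    have hprod : ∏ k ∈ A.map φ.toEmbedding, (y ∘ φ.symm) k = ∏ k ∈ A, y k := by
      rw [Finset.prod_map]; simp
    rw [hprod]
    by_cases hkA : k ∈ A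
    · rw [Finset.prod_eq_zero hkA hy]; simp
    · congr 1
      have hst : En.estep (s, A) (En.mv s k, A.map φ.toEmbedding) := ⟨k, hk, hkA, rfl⟩
      unfold coef
      have h1 : ∀ b, En.ER (s, A) b ↔ En.ER (En.mv s k, A.map φ.toEmbedding) b := fun b =>
        ⟨fun h => (Relation.ReflTransGen.single (En.estep_symm hst)).trans h,
         fun h => (Relation.ReflTransGen.single hst).trans h⟩
      have h2 : Disjoint (A : Set (Fin 5)) (Set.range (En.pi s).2) ↔
          Disjoint ((A.map φ.toEmbedding : Finset (Fin 5)) : Set (Fin 5)) (Set.range (En.pi (En.mv s k)).2) := by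
        rw [En.pi_mv s k hk]
        have : Set.range ((En.pi s).mv k).2 = φ '' Set.range (En.pi s).2 := by
          ext v; simp [St.mv_snd, ← hφ, Equiv.eq_symm_apply]
        rw [this, Finset.coe_map, Equiv.coe_toEmbedding, Set.disjoint_image_iff φ.injective]
      simp only [h1, h2, Finset.map_nonempty]
  · simp only [W]
    congr 1
    rw [En.pi_mv s k hk]
    ext a
    simp [St.mv_snd, ← hφ]

/-- freeness gives nonvanishing -/
theorem W_ne_zero (hn : 0 < n) {ζ : ℂ} {l : (Fin d → ℝ) →ₗ[ℝ] ℂ} (s : En.S) (y : Fin 5 → ℝ)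
    (hfree : ∀ (A : Finset (Fin 5)) (i : ℕ), A.Nonempty → Disjoint (A : Set (Fin 5)) (Set.range (En.pi s).2) →
      En.ER (s, A) (En.deck^[i] s, A) → n ∣ i)
    (hy : ∃ k, k ∉ Set.range (En.pi s).2 ∧ y k ≠ 0) : En.W ζ l s y ≠ 0 := by
  set Rs : Finset (Fin 5) := Finset.univ.filter fun k => k ∉ Set.range (En.pi s).2 ∧ y k ≠ 0 with hR
  have hRne : Rs.Nonempty := by
    obtain ⟨k, hk⟩ := hy; exact ⟨k, by simp only [hR, Finset.mem_filter, Finset.mem_univ, true_and]; exact hk⟩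
  have hRd : Disjoint (Rs : Set (Fin 5)) (Set.range (En.pi s).2) := by
    rw [Set.disjoint_left]
    intro k hk
    have := Finset.mem_coe.1 hk
    simp only [hR, Finset.mem_filter] at this
    exact this.2.1
  intro h
  have h1 : (En.W ζ l s y).1 (s, Rs) = 0 := by rw [h]; rfl
  simp only [W] at h1
  rw [Finset.sum_eq_single Rs] at h1
  · have hc : En.coef ζ s Rs (s, Rs) = 1 := by
      unfold coef
      rw [if_pos ⟨hRne, hRd⟩, Finset.sum_eq_single 0]
      · rw [if_pos, pow_zero]; exact Relation.ReflTransGen.refl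
      · intro i hi hi0
        rw [if_neg]
        intro hER
        have := Nat.le_of_dvd (by omega) (hfree Rs i hRne hRd hER)
        rw [Finset.mem_range] at hi; omega
      · intro h0; simp [hn] at h0
    rw [hc, one_mul, Complex.ofReal_eq_zero, Finset.prod_eq_zero_iff] at h1
    obtain ⟨k, hk, hk0⟩ := h1
    simp only [hR, Finset.mem_filter] at hk
    exact hk.2.2 hk0
  · intro A _ hA
    by_cases hc : En.coef ζ s A (s, Rs) = 0
    · rw [hc, zero_mul]
    · unfold coef at hc
      split_ifs at hc with hAA
      · obtain ⟨i, -, hi⟩ := Finset.exists_ne_zero_of_sum_ne_zero hc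
        split_ifs at hi with hER
        · have hcard := En.ER_card hER
          simp only at hcard
          have : ¬ A ⊆ Rs := fun hsub => hA (Finset.eq_of_subset_of_card_le hsub hcard.le)
          rw [Finset.not_subset] at this
          obtain ⟨k, hkA, hkR⟩ := this
          have hy0 : y k = 0 := by
            by_contra hne
            apply hkR
            simp only [hR, Finset.mem_filter, Finset.mem_univ, true_and]
            exact ⟨Set.disjoint_left.1 hAA.2 hkA, hne⟩
          rw [Finset.prod_eq_zero hkA hy0]; simp
        · exact absurd rfl hi
      · exact absurd rfl hc
  · intro h; simp at h

theorem R_deck {s s'} (h : En.R s s') : En.R (En.deck s) (En.deck s') := by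
  induction h with
  | refl => exact .refl
  | tail _ h ih =>
    obtain ⟨k, hk, rfl⟩ := h
    exact ih.tail ⟨k, by rwa [range_deck], En.deck_mv _ _ hk⟩

end Enh
end FileC2

section FileC3
namespace Enh
section det
variable {D : GlueingDatum 4} {d n : ℕ} (En : Enh D d n)

/-- admissible states for a point close to the base point -/
def Adm (s0 : En.S) (x : Fin d → ℝ) (ε : ℝ) (p : GlueTotal D) (s : En.S) : Prop :=
  En.R s0 s ∧ (En.pi s).1 = p.1 ∧ ∀ a, |p.2.1 ((En.pi s).2 a) - x a| < ε

variable {En} {s0 : En.S} {x : Fin d → ℝ} {ε : ℝ}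

theorem adm_notMem (hx : ∀ a, ε ≤ x a) {p s} (h : En.Adm s0 x ε p s) {k} (hk : p.2.1 k = 0) :
    k ∉ Set.range (En.pi s).2 := by
  rintro ⟨a, rfl⟩
  have := h.2.2 a
  rw [hk, zero_sub, abs_neg, abs_lt] at this
  linarith [hx a]

theorem adm_cross (hx : ∀ a, ε ≤ x a) {p s} (h : En.Adm s0 x ε p s) {k} (hk : p.2.1 k = 0) :
    En.Adm s0 x ε ⟨nbr D p.1 k, crossD p.1 k p.2⟩ (En.mv s k) := by
  have hk' := adm_notMem hx h hk
  refine ⟨h.1.tail ⟨k, hk', rfl⟩, ?_, fun a => ?_⟩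
  · rw [En.pi_mv _ _ hk', St.mv_fst, h.2.1]
  · rw [En.pi_mv _ _ hk', St.mv_snd, h.2.1]
    simpa [crossD] using h.2.2 a

/-- stabilizer hypothesis -/
def Stab (En : Enh D d n) (s0 : En.S) (x : Fin d → ℝ) : Prop :=
  ∀ s s' (π : Equiv.Perm (Fin d)), En.R s0 s → En.R s0 s' → (En.pi s').1 = (En.pi s).1 →
    (En.pi s').2 = π.toEmbedding.trans (En.pi s).2 → x ∘ π = x → ∃ i : ℕ, s' = En.deck^[i] s

theorem adm_unique (hx : ∀ a, (d + 1) * ε ≤ x a) (hx2 : ∀ a b, x a ≠ x b → 2 * ε ≤ |x a - x b|)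
    (hx1 : ∑ a, x a = 1)
    (hst : Stab En s0 x) {p s s'} (h : En.Adm s0 x ε p s) (h' : En.Adm s0 x ε p s') :
    ∃ i : ℕ, s' = En.deck^[i] s := by
  have hsub : ∀ a, ∃ b, (En.pi s).2 b = (En.pi s').2 a := by
    intro a
    by_contra hc
    have hc' : (En.pi s').2 a ∉ Finset.univ.map (En.pi s).2 := by
      simp only [Finset.mem_map, Finset.mem_univ, true_and]; exact hc
    have h1 : ∑ v ∈ insert ((En.pi s').2 a) (Finset.univ.map (En.pi s).2), p.2.1 v ≤ 1 := by
      refine le_trans ?_ p.2.2.2.le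
      exact Finset.sum_le_sum_of_subset_of_nonneg (Finset.subset_univ _) fun v _ _ => p.2.2.1 v
    rw [Finset.sum_insert hc', Finset.sum_map] at h1
    have h2 : ∑ b, (x b - ε) ≤ ∑ b, p.2.1 ((En.pi s).2 b) :=
      Finset.sum_le_sum fun b _ => by have := abs_lt.1 (h.2.2 b); linarith
    rw [Finset.sum_sub_distrib, hx1, Finset.sum_const, Finset.card_univ, Fintype.card_fin, nsmul_eq_mul] at h2
    have h3 := abs_lt.1 (h'.2.2 a)
    have h4 := hx a
    linarith
  choose π hπ using hsub
  have hinj : Function.Injective π := by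
    intro a b hab
    apply (En.pi s').2.injective
    rw [← hπ, ← hπ, hab]
  have hbij := Finite.injective_iff_bijective.1 hinj
  refine hst s s' (Equiv.ofBijective π hbij) h.1 h'.1 (h'.2.1.trans h.2.1.symm) ?_ ?_
  · ext1 a; exact (hπ a).symm
  · ext a
    by_contra hne
    have h1 := hx2 _ _ hne
    simp only [Equiv.ofBijective_apply, Function.comp] at h1
    have h2 := h.2.2 (π a)
    have h3 := h'.2.2 a
    rw [hπ a] at h2
    rw [abs_lt] at h2 h3
    rcases abs_cases (x (π a) - x a) with h4 | h4 <;> linarith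

theorem adm_open (hx : ∀ a, ε ≤ x a) (Q : En.S → (Fin 5 → ℝ) → Prop)
    (hQo : ∀ s, IsOpen {y | Q s y})
    (hQ : ∀ s y k, k ∉ Set.range (En.pi s).2 → y k = 0 → Q s y →
      Q (En.mv s k) (y ∘ (D.glue ((En.pi s).1, k)).symm)) :
    IsOpen {z : GlueSpace D | ∃ p s, mkX p = z ∧ En.Adm s0 x ε p s ∧ Q s p.2.1} := by
  rw [← isQuotientMap_quot_mk.isOpen_preimage]
  have : Quot.mk (glueRel D) ⁻¹' {z : GlueSpace D | ∃ p s, mkX p = z ∧ En.Adm s0 x ε p s ∧ Q s p.2.1}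
      = {p | ∃ s, En.Adm s0 x ε p s ∧ Q s p.2.1} := by
    ext p
    constructor
    · rintro ⟨q, s, h, hq⟩
      refine mkX_transport (Q := fun p => ∃ s, En.Adm s0 x ε p s ∧ Q s p.2.1) ?_ h ⟨s, hq⟩
      rintro p k hk ⟨s, h1, h2⟩
      have h3 := hQ s _ k (adm_notMem hx h1 hk) hk h2
      rw [h1.2.1] at h3
      exact ⟨En.mv s k, adm_cross hx h1 hk, h3⟩
    · rintro ⟨s, h⟩
      exact ⟨p, s, rfl, h⟩
  rw [this, isOpen_sigma_iff]
  intro i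
  have : Sigma.mk i ⁻¹' {p : GlueTotal D | ∃ s, En.Adm s0 x ε p s ∧ Q s p.2.1} =
      ⋃ s, ⋃ (_ : En.R s0 s), ⋃ (_ : (En.pi s).1 = i), ({y : Delta 4 | Q s y.1} ∩
        ⋂ a, {y : Delta 4 | |y.1 ((En.pi s).2 a) - x a| < ε}) := by
    ext y
    simp only [Set.mem_preimage, Set.mem_ofPred_eq, Adm, Set.mem_iUnion, Set.mem_inter_iff,
      Set.mem_iInter]
    constructor
    · rintro ⟨s, ⟨h1, h2, h3⟩, h4⟩; exact ⟨s, h1, h2, h4, h3⟩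
    · rintro ⟨s, h1, h2, h4, h3⟩; exact ⟨s, ⟨h1, h2, h3⟩, h4⟩
  rw [this]
  refine isOpen_iUnion fun s => isOpen_iUnion fun _ => isOpen_iUnion fun _ => IsOpen.inter ?_ ?_
  · exact (hQo s).preimage continuous_subtype_val
  · refine isOpen_iInter_of_finite fun a => ?_
    refine isOpen_lt ?_ continuous_const
    exact (((continuous_apply _).comp continuous_subtype_val).sub continuous_const).abs

/-- values of a state invariant at two representatives -/
theorem adm_key (hx0 : ∀ a, ε ≤ x a) (hx : ∀ a, (d + 1) * ε ≤ x a) (hx2 : ∀ a b, x a ≠ x b → 2 * ε ≤ |x a - x b|)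
    (hx1 : ∑ a, x a = 1) (hst : Stab En s0 x) {B : Type*} (f : En.S → (Fin 5 → ℝ) → B)
    (hf : ∀ s y k, k ∉ Set.range (En.pi s).2 → y k = 0 → 
      f (En.mv s k) (y ∘ (D.glue ((En.pi s).1, k)).symm) = f s y)
    {p p' s s'} (hp : mkX p = mkX p') (h : En.Adm s0 x ε p s) (h' : En.Adm s0 x ε p' s') :
    ∃ i : ℕ, f s p.2.1 = f (En.deck^[i] s') p'.2.1 := by
  obtain ⟨s2, h2, h3⟩ : ∃ s2, En.Adm s0 x ε p' s2 ∧ f s2 p'.2.1 = f s p.2.1 := by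
    refine mkX_transport (Q := fun q => ∃ s2, En.Adm s0 x ε q s2 ∧ f s2 q.2.1 = f s p.2.1) ?_ hp ⟨s, h, rfl⟩
    rintro q k hk ⟨s1, h1, h2⟩
    refine ⟨En.mv s1 k, adm_cross hx0 h1 hk, ?_⟩
    have := hf s1 _ k (adm_notMem hx0 h1 hk) hk
    rw [h1.2.1] at this
    exact this.trans h2
  obtain ⟨i, rfl⟩ := adm_unique hx hx2 hx1 hst h' h2
  exact ⟨i, h3.symm⟩

theorem lin_deck {μ : (Fin d → ℝ) →ₗ[ℝ] ℝ} (hμ : ∀ v, μ (v ∘ En.σ) = μ v) (i : ℕ) (s : En.S) (y : Fin 5 → ℝ) :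
    μ (y ∘ (En.pi (En.deck^[i] s)).2) = μ (y ∘ (En.pi s).2) := by
  induction i with
  | zero => rfl
  | succ i ih =>
    rw [Function.iterate_succ_apply', En.pi_deck, ← ih, ← hμ (y ∘ (En.pi (En.deck^[i] s)).2)]
    rfl

theorem lin_cross (s : En.S) (y : Fin 5 → ℝ) (k : Fin 5) (hk : k ∉ Set.range (En.pi s).2) :
    (y ∘ (D.glue ((En.pi s).1, k)).symm) ∘ (En.pi (En.mv s k)).2 = y ∘ (En.pi s).2 := by
  rw [En.pi_mv _ _ hk]
  ext a
  simp [St.mv_snd]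

/-- the base points are identified -/
theorem base_eq {s} (h : En.R s0 s) (v : Fin d → ℝ) (hv : (∀ a, 0 ≤ v a) ∧ ∑ a, v a = 1) :
    mkX (⟨(En.pi s).1, ⟨extz (En.pi s).2 v, extz_nonneg _ _ hv.1, (extz_sum _ _).trans hv.2⟩⟩ : GlueTotal D) =
    mkX ⟨(En.pi s0).1, ⟨extz (En.pi s0).2 v, extz_nonneg _ _ hv.1, (extz_sum _ _).trans hv.2⟩⟩ := by
  induction h with
  | refl => rfl
  | tail _ h ih =>
    obtain ⟨k, hk, rfl⟩ := h
    rw [← ih]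
    rename_i b _
    refine Eq.trans ?_ (mkX_cross _ _ k (extz_notMem _ _ hk))
    congr 1
    refine Sigma.ext ?_ (heq_of_eq (Subtype.ext ?_))
    · simp only [En.pi_mv _ _ hk]; rfl
    · simp only [En.pi_mv _ _ hk, crossD]
      exact extz_trans _ _ _

end det
end Enh
end FileC3

section FileC4
namespace Enh
section loopsec
variable {D : GlueingDatum 4} {d n : ℕ} (En : Enh D d n)

/-- link directions -/
def Vs (s : En.S) : Set (Fin 5 → ℝ) := {r | (∀ v, 0 ≤ r v) ∧ ∑ v, r v = 1 ∧ ∀ a, r ((En.pi s).2 a) = 0}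

/-- parameters of the loop -/
structure LPar (En : Enh D d n) where
  x : Fin d → ℝ
  v0 : Fin d → ℝ
  κ : ℝ
  hx1 : ∑ a, x a = 1
  hv0 : ∑ a, v0 a = 0
  hκ0 : 0 < κ
  hκ1 : κ < 1
  hpos : ∀ a, κ * |v0 a| ≤ x a
  hxσ : x ∘ En.σ = x
  hvσ : v0 ∘ En.σ = v0

/-- the compact parameter space -/
abbrev Kc : Type := unitInterval × Set.Icc (-1 : ℝ) 1

variable {En} (L : LPar En)

/-- moving base point -/
def LPar.xh (h : ℝ) : Fin d → ℝ := fun a => L.x a + h * L.κ * L.v0 a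

theorem LPar.xh_ok {h : ℝ} (hh : h ∈ Set.Icc (-1 : ℝ) 1) : (∀ a, 0 ≤ L.xh h a) ∧ ∑ a, L.xh h a = 1 := by
  constructor
  · intro a
    have h1 := L.hpos a
    have h2 : |h * L.κ * L.v0 a| ≤ L.κ * |L.v0 a| := by
      rw [abs_mul, abs_mul, abs_of_pos L.hκ0]
      have : |h| ≤ 1 := abs_le.2 hh
      nlinarith [mul_nonneg L.hκ0.le (abs_nonneg (L.v0 a))]
    have := neg_abs_le (h * L.κ * L.v0 a)
    simp only [LPar.xh]; linarith
  · simp only [LPar.xh, Finset.sum_add_distrib, ← Finset.mul_sum, L.hx1, L.hv0]; simp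

/-- points of the loop -/
def LPar.ptv (s : En.S) (r : Fin 5 → ℝ) (ρ h : ℝ) : Fin 5 → ℝ :=
  fun v => (1 - ρ * L.κ) * extz (En.pi s).2 (L.xh h) v + ρ * L.κ * r v

theorem LPar.ptv_ok (s : En.S) {r} (hr : r ∈ En.Vs s) (c : Kc) :
    (∀ v, 0 ≤ L.ptv s r c.1 c.2 v) ∧ ∑ v, L.ptv s r c.1 c.2 v = 1 := by
  have h1 := L.xh_ok c.2.2
  have hc := c.1.2
  have hk0 := L.hκ0
  have hk1 := L.hκ1
  have h2 : (c.1 : ℝ) * L.κ ≤ 1 := by nlinarith [hc.1, hc.2]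
  have h3 : 0 ≤ (c.1 : ℝ) * L.κ := mul_nonneg hc.1 hk0.le
  constructor
  · intro v
    have := extz_nonneg (En.pi s).2 _ h1.1 v
    have := hr.1 v
    simp only [LPar.ptv]
    have : 0 ≤ 1 - (c.1 : ℝ) * L.κ := by linarith
    positivity
  · simp only [LPar.ptv, Finset.sum_add_distrib, ← Finset.mul_sum, extz_sum, h1.2, hr.2.1]
    ring

/-- points of the loop in the total space -/
def LPar.ptT (s : En.S) (r : En.Vs s) (c : Kc) : GlueTotal D :=
  ⟨(En.pi s).1, ⟨L.ptv s r.1 c.1 c.2, L.ptv_ok s r.2 c⟩⟩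

theorem LPar.ptT_cont (s : En.S) : Continuous fun q : En.Vs s × Kc => L.ptT s q.1 q.2 := by
  unfold LPar.ptT
  refine continuous_sigmaMk.comp (Continuous.subtype_mk ?_ _)
  unfold LPar.ptv LPar.xh
  refine continuous_pi fun v => ?_
  have : Continuous fun q : En.Vs s × Kc => extz (En.pi s).2 (fun a => L.x a + (q.2.2 : ℝ) * L.κ * L.v0 a) v :=
    (continuous_apply v).comp ((extz_cont _).comp (by fun_prop))
  have h2 : Continuous fun q : En.Vs s × Kc => (q.1 : Fin 5 → ℝ) v :=
    (continuous_apply v).comp (continuous_subtype_val.comp continuous_fst)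
  fun_prop

/-- loop data at a state -/
def LPar.PT (ζ : ℂ) (l : (Fin d → ℝ) →ₗ[ℝ] ℂ) (s : En.S) (r : En.Vs s) :
    C(Kc, GlueSpace D) × ((En.S × Finset (Fin 5) → ℂ) × ℂ) :=
  (⟨fun c => mkX (L.ptT s r c), continuous_quot_mk.comp
    (show Continuous (fun c => L.ptT s r c) from
      (L.ptT_cont s).comp (g := fun q : En.Vs s × Kc => L.ptT s q.1 q.2) (f := fun c : Kc => (r, c)) (by fun_prop))⟩,
    En.W ζ l s (L.ptv s r.1 1 0))

theorem LPar.PT_cont (ζ : ℂ) (l : (Fin d → ℝ) →ₗ[ℝ] ℂ) (s : En.S) : Continuous (L.PT ζ l s) := by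
  refine Continuous.prodMk ?_ ?_
  · exact (ContinuousMap.curry ⟨fun q : En.Vs s × Kc => mkX (L.ptT s q.1 q.2),
      continuous_quot_mk.comp (L.ptT_cont s)⟩).continuous
  · refine (En.W_cont ζ l s).comp ?_
    unfold LPar.ptv
    refine continuous_pi fun v => ?_
    have h2 : Continuous fun q : En.Vs s => (q : Fin 5 → ℝ) v :=
      (continuous_apply v).comp continuous_subtype_val
    exact continuous_const.add (continuous_const.mul h2)

theorem Vs_cross {s : En.S} {k} (hk : k ∉ Set.range (En.pi s).2) {r} (hr : r ∈ En.Vs s) :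
    r ∘ (D.glue ((En.pi s).1, k)).symm ∈ En.Vs (En.mv s k) := by
  refine ⟨fun v => hr.1 _, (Equiv.sum_comp (D.glue _).symm r).trans hr.2.1, fun a => ?_⟩
  rw [En.pi_mv _ _ hk, St.mv_snd]
  simpa using hr.2.2 a

theorem LPar.ptv_cross {s : En.S} {k} (hk : k ∉ Set.range (En.pi s).2) (r ρ h) :
    L.ptv (En.mv s k) (r ∘ (D.glue ((En.pi s).1, k)).symm) ρ h =
      L.ptv s r ρ h ∘ (D.glue ((En.pi s).1, k)).symm := by
  unfold LPar.ptv
  rw [En.pi_mv _ _ hk]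
  have := extz_trans (En.pi s).2 (L.xh h) (D.glue ((En.pi s).1, k))
  ext v
  have h2 := congrFun this v
  simp only [Function.comp] at h2 ⊢
  rw [← h2]
  rfl

theorem LPar.PT_cross (ζ : ℂ) (l : (Fin d → ℝ) →ₗ[ℝ] ℂ) {s : En.S} {k} (hk : k ∉ Set.range (En.pi s).2)
    (r : En.Vs s) (hr : r.1 k = 0) :
    L.PT ζ l (En.mv s k) ⟨_, Vs_cross hk r.2⟩ = L.PT ζ l s r := by
  have h0 : ∀ ρ h, L.ptv s r.1 ρ h k = 0 := by
    intro ρ h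
    simp only [LPar.ptv, hr, extz_notMem _ _ hk]; simp
  refine Prod.ext ?_ ?_
  · ext c
    refine Eq.trans ?_ (mkX_cross _ _ k (h0 c.1 c.2))
    simp only [LPar.PT, ContinuousMap.coe_mk]
    congr 1
    refine Sigma.ext ?_ (heq_of_eq (Subtype.ext ?_))
    · simp only [LPar.ptT, En.pi_mv _ _ hk]; rfl
    · exact L.ptv_cross hk _ _ _
  · simp only [LPar.PT]
    rw [L.ptv_cross hk, En.W_cross s _ k hk (h0 _ _)]

theorem Vs_convex (s : En.S) : Convex ℝ (En.Vs s) := by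
  intro r hr r' hr' a b ha hb hab
  refine ⟨fun v => ?_, ?_, fun c => ?_⟩
  · have := hr.1 v; have := hr'.1 v
    simp only [Pi.add_apply, Pi.smul_apply, smul_eq_mul]; positivity
  · simp only [Pi.add_apply, Pi.smul_apply, smul_eq_mul, Finset.sum_add_distrib, ← Finset.mul_sum, hr.2.1, hr'.2.1]
    linarith
  · simp [hr.2.2 c, hr'.2.2 c]

theorem Vs_single {s : En.S} {v} (hv : v ∉ Set.range (En.pi s).2) : (Pi.single v 1 : Fin 5 → ℝ) ∈ En.Vs s := by
  refine ⟨fun w => ?_, by simp, fun a => ?_⟩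
  · by_cases h : w = v
    · subst h; simp
    · simp [h]
  · exact Pi.single_eq_of_ne (fun h => hv ⟨a, h⟩) _

theorem exists_off (hd : d ≤ 3) (t : Fin d ↪ Fin 5) (k : Fin 5) : ∃ v, v ∉ Set.range t ∧ v ≠ k := by
  by_contra hc
  push Not at hc
  have : (Finset.univ : Finset (Fin 5)) ⊆ insert k (Finset.univ.map t) := by
    intro v _
    by_cases h : v ∈ Set.range t
    · obtain ⟨a, rfl⟩ := h; simp
    · rw [hc v h]; simp
  have h1 := Finset.card_le_card this
  have h2 := Finset.card_insert_le k (Finset.univ.map t)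
  simp at h1 h2
  omega

/-- the set of loop data of reachable states -/
def LPar.F (ζ : ℂ) (l : (Fin d → ℝ) →ₗ[ℝ] ℂ) (s0 : En.S) :
    Set (C(Kc, GlueSpace D) × ((En.S × Finset (Fin 5) → ℂ) × ℂ)) :=
  {q | ∃ s r, En.R s0 s ∧ q = L.PT ζ l s r}

theorem LPar.joined_same (ζ : ℂ) (l : (Fin d → ℝ) →ₗ[ℝ] ℂ) (s0 : En.S) {s} (hs : En.R s0 s) (r r' : En.Vs s) :
    JoinedIn (L.F ζ l s0) (L.PT ζ l s r) (L.PT ζ l s r') := by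
  have hp : IsPathConnected (En.Vs s) := (Vs_convex s).isPathConnected ⟨r.1, r.2⟩
  have := isPathConnected_iff_pathConnectedSpace.1 hp
  obtain ⟨γ⟩ := PathConnectedSpace.joined r r'
  exact ⟨γ.map (L.PT_cont ζ l s), fun t => ⟨s, γ t, hs, rfl⟩⟩

theorem LPar.joined (hd : d ≤ 3) (ζ : ℂ) (l : (Fin d → ℝ) →ₗ[ℝ] ℂ) (s0 : En.S) {s} (hs : En.R s0 s)
    (r0 : En.Vs s0) (r : En.Vs s) :
    JoinedIn (L.F ζ l s0) (L.PT ζ l s0 r0) (L.PT ζ l s r) := by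
  induction hs with
  | refl => exact L.joined_same ζ l s0 .refl _ _
  | @tail b c hb h ih =>
    have hc := hb.tail h
    obtain ⟨k, hk, rfl⟩ := h
    obtain ⟨v, hv, hvk⟩ := exists_off hd (En.pi b).2 k
    have h1 := ih ⟨_, Vs_single hv⟩
    rw [← L.PT_cross ζ l hk ⟨_, Vs_single hv⟩ (Pi.single_eq_of_ne hvk.symm _)] at h1
    exact h1.trans (L.joined_same ζ l s0 hc _ _)

theorem Vs_deck {s : En.S} {r} (hr : r ∈ En.Vs s) : r ∈ En.Vs (En.deck s) := by
  refine ⟨hr.1, hr.2.1, fun a => ?_⟩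
  rw [En.pi_deck]; exact hr.2.2 _

theorem LPar.ptv_deck (s : En.S) (r ρ h) : L.ptv (En.deck s) r ρ h = L.ptv s r ρ h := by
  unfold LPar.ptv
  rw [En.pi_deck]
  have h1 : L.xh h ∘ En.σ = L.xh h := by
    ext a
    have := congrFun L.hxσ a
    have := congrFun L.hvσ a
    simp only [Function.comp, LPar.xh] at *
    simp only [*]
  have := extz_perm (En.pi s).2 (L.xh h) En.σ
  rw [h1] at this
  rw [this]

/-- the polar quotient map -/
def polM : unitInterval × Kc → cylDom := fun q =>
  ⟨((q.2.1 : ℝ) * Complex.exp (2 * Real.pi * (q.1 : ℝ) * Complex.I), q.2.2), by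
    refine ⟨?_, q.2.2.2⟩
    rw [mem_closedBall_zero_iff, norm_mul]
    have : ‖Complex.exp (2 * Real.pi * (q.1 : ℝ) * Complex.I)‖ = 1 := by
      have := Complex.norm_exp_ofReal_mul_I (2 * Real.pi * (q.1 : ℝ))
      push_cast at this; exact this
    rw [this, mul_one, Complex.norm_real, Real.norm_of_nonneg q.2.1.2.1]
    exact q.2.1.2.2⟩

theorem polM_cont : Continuous polM := by
  unfold polM
  refine Continuous.subtype_mk ?_ _
  fun_prop

theorem polM_norm (q : unitInterval × Kc) : ‖(polM q).1.1‖ = q.2.1 := by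
  have : ‖Complex.exp (2 * Real.pi * (q.1 : ℝ) * Complex.I)‖ = 1 := by
    have := Complex.norm_exp_ofReal_mul_I (2 * Real.pi * (q.1 : ℝ))
    push_cast at this; exact this
  simp only [polM]
  rw [norm_mul, this, mul_one, Complex.norm_real, Real.norm_of_nonneg q.2.1.2.1]

theorem polM_surj : Function.Surjective polM := by
  rintro ⟨⟨z, h⟩, hz, hh⟩
  simp only [mem_closedBall_zero_iff] at hz
  have hpi := Real.two_pi_pos
  obtain ⟨θ, hθ, hz2⟩ : ∃ θ ∈ Set.Icc (0:ℝ) 1, z = ‖z‖ * Complex.exp (2 * Real.pi * θ * Complex.I) := by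
    have h1 := Complex.norm_mul_exp_arg_mul_I z
    have h2 := Complex.neg_pi_lt_arg z
    have h3 := Complex.arg_le_pi z
    by_cases h0 : 0 ≤ z.arg
    · refine ⟨z.arg / (2 * Real.pi), ⟨by positivity, by rw [div_le_one hpi]; linarith⟩, ?_⟩
      conv_lhs => rw [← h1]
      congr 3
      push_cast
      field_simp
    · refine ⟨z.arg / (2 * Real.pi) + 1, ⟨?_, ?_⟩, ?_⟩
      · have : -1 ≤ z.arg / (2 * Real.pi) := by rw [le_div_iff₀ hpi]; linarith
        linarith
      · have : z.arg / (2 * Real.pi) ≤ 0 := by rw [div_le_iff₀ hpi]; linarith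
        linarith
      · conv_lhs => rw [← h1]
        congr 1
        rw [Complex.exp_eq_exp_iff_exists_int]
        refine ⟨-1, ?_⟩
        push_cast
        field_simp
        ring
  refine ⟨(⟨θ, hθ⟩, ⟨⟨‖z‖, norm_nonneg _, hz⟩, ⟨h, hh⟩⟩), ?_⟩
  refine Subtype.ext (Prod.ext hz2.symm rfl)

theorem polM_fib {q q' : unitInterval × Kc} (h : polM q = polM q') :
    q.2 = q'.2 ∧ (q.1 = q'.1 ∨ (q.2.1 : ℝ) = 0 ∨ (q.1 = 0 ∧ q'.1 = 1) ∨ (q.1 = 1 ∧ q'.1 = 0)) := by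
  have hn : (q.2.1 : ℝ) = q'.2.1 := by rw [← polM_norm, ← polM_norm, h]
  have hh : (q.2.2 : ℝ) = q'.2.2 := congrArg (fun z => z.1.2) h
  refine ⟨Prod.ext (Subtype.ext hn) (Subtype.ext hh), ?_⟩
  by_cases h0 : (q.2.1 : ℝ) = 0
  · exact Or.inr (Or.inl h0)
  have h1 : ((q.2.1 : ℝ) : ℂ) * Complex.exp (2 * Real.pi * (q.1 : ℝ) * Complex.I) = ((q'.2.1 : ℝ) : ℂ) * Complex.exp (2 * Real.pi * (q'.1 : ℝ) * Complex.I) :=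
    congrArg (fun z => z.1.1) h
  rw [← hn] at h1
  have h2 := mul_left_cancel₀ (by exact_mod_cast h0) h1
  rw [Complex.exp_eq_exp_iff_exists_int] at h2
  obtain ⟨m, hm⟩ := h2
  have hI := Complex.I_ne_zero
  have hpi : (Real.pi : ℂ) ≠ 0 := by exact_mod_cast Real.pi_ne_zero
  have h3 : ((q.1 : ℝ) : ℂ) = (q'.1 : ℝ) + m := by
    have : (2 * Real.pi * Complex.I) * ((q.1 : ℝ) : ℂ) = (2 * Real.pi * Complex.I) * ((q'.1 : ℝ) + m) := by
      linear_combination hm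
    exact mul_left_cancel₀ (by simp [hpi]) this
  have h4 : (q.1 : ℝ) = q'.1 + m := by exact_mod_cast h3
  have ha := q.1.2; have hb := q'.1.2
  have hm1 : m ≤ 1 := by
    by_contra hc
    have : (2:ℝ) ≤ m := by exact_mod_cast (by omega : (2:ℤ) ≤ m)
    linarith [ha.2, hb.1]
  have hm2 : -1 ≤ m := by
    by_contra hc
    have : (m:ℝ) ≤ -2 := by exact_mod_cast (by omega : m ≤ (-2:ℤ))
    linarith [ha.1, hb.2]
  have : m = -1 ∨ m = 0 ∨ m = 1 := by omega
  rcases this with rfl | rfl | rfl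
  · right; right; left
    push_cast at h4
    exact ⟨Subtype.ext (show (q.1 : ℝ) = 0 by linarith [ha.1, hb.2]), Subtype.ext (show (q'.1 : ℝ) = 1 by linarith [ha.1, hb.2])⟩
  · left; exact Subtype.ext (by simpa using h4)
  · right; right; right
    push_cast at h4
    exact ⟨Subtype.ext (show (q.1 : ℝ) = 1 by linarith [ha.2, hb.1]), Subtype.ext (show (q'.1 : ℝ) = 0 by linarith [ha.2, hb.1])⟩

end loopsec
end Enh
end FileC4

section FileC5
namespace Enh
section loop2
variable {D : GlueingDatum 4} {d n : ℕ} {En : Enh D d n} (L : LPar En)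

theorem LPar.loop (hd : d ≤ 3) (hn : 0 < n) {ζ : ℂ} (hζ : ζ ^ n = 1) {l : (Fin d → ℝ) →ₗ[ℝ] ℂ}
    (hl : ∀ v, l (v ∘ En.σ) = ζ * l v) {s0 : En.S} (hR : En.R s0 (En.deck s0)) :
    ∃ g : ℂ × ℝ → GlueSpace D, ContinuousOn g cylDom ∧
      (∀ p ∈ cylDom, ∃ s r, ∃ c : Kc, En.R s0 s ∧ (c.1 : ℝ) = ‖p.1‖ ∧ (c.2 : ℝ) = p.2 ∧ g p = mkX (L.ptT s r c)) ∧
      ∃ w : ℝ → ((En.S × Finset (Fin 5) → ℂ) × ℂ), ContinuousOn w (Set.Icc 0 1) ∧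
        (∀ t ∈ Set.Icc (0:ℝ) 1, ∃ s r, ∃ c : Kc, En.R s0 s ∧ (c.1 : ℝ) = 1 ∧ (c.2 : ℝ) = 0 ∧
          g (Complex.exp (2 * Real.pi * t * Complex.I), 0) = mkX (L.ptT s r c) ∧
          w t = En.W ζ l s (L.ptv s r.1 1 0)) ∧ w 1 = ζ • w 0 := by
  obtain ⟨v, hv, -⟩ := exists_off hd (En.pi s0).2 0
  set r0 : En.Vs s0 := ⟨_, Vs_single hv⟩ with hr0
  set r1 : En.Vs (En.deck s0) := ⟨_, Vs_deck (Vs_single hv)⟩ with hr1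
  obtain ⟨γ, hγ⟩ := L.joined hd ζ l s0 hR r0 r1
  have hG : Continuous fun q : unitInterval × Kc => (γ q.1).1 q.2 :=
    ContinuousMap.continuous_uncurry_of_continuous ⟨fun t => (γ t).1, by fun_prop⟩
  set G : unitInterval × Kc → GlueSpace D := fun q => (γ q.1).1 q.2 with hGd
  have hG01 : (γ 0).1 = (γ 1).1 := by
    rw [γ.source, γ.target]
    ext c
    simp only [LPar.PT, ContinuousMap.coe_mk]
    congr 1
    refine Sigma.ext ?_ (heq_of_eq (Subtype.ext ?_))
    · simp only [LPar.ptT, En.fst_deck]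
    · exact (L.ptv_deck _ _ _ _).symm
  have hG0 : ∀ t (c : Kc), (c.1 : ℝ) = 0 → G (t, c) = mkX ⟨(En.pi s0).1, ⟨extz (En.pi s0).2 (L.xh c.2),
      extz_nonneg _ _ (L.xh_ok c.2.2).1, (extz_sum _ _).trans (L.xh_ok c.2.2).2⟩⟩ := by
    intro t c hc
    obtain ⟨s, r, hs, hq⟩ := hγ t
    simp only [hGd, hq]
    rw [← base_eq hs _ (L.xh_ok c.2.2)]
    simp only [LPar.PT, ContinuousMap.coe_mk]
    congr 1
    refine Sigma.ext rfl (heq_of_eq (Subtype.ext ?_))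
    ext v
    simp only [LPar.ptT, LPar.ptv, hc]
    ring
  have hker : ∀ q q', polM q = polM q' → G q = G q' := by
    rintro ⟨t, c⟩ ⟨t', c'⟩ h
    obtain ⟨h1, h2⟩ := polM_fib h
    simp only at h1 h2
    subst h1
    rcases h2 with rfl | h2 | ⟨rfl, rfl⟩ | ⟨rfl, rfl⟩
    · rfl
    · rw [hG0 _ _ h2, hG0 _ _ h2]
    · simp only [hGd, hG01]
    · simp only [hGd, hG01]
  have hqm : Topology.IsQuotientMap polM :=
    (polM_cont.isClosedMap).isQuotientMap polM_cont polM_surj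
  set g0 : cylDom → GlueSpace D := fun p => G (Function.surjInv polM_surj p) with hg0
  have hg0G : ∀ q, g0 (polM q) = G q := fun q => hker _ _ (Function.surjInv_eq polM_surj _)
  have hg0c : Continuous g0 := by
    rw [hqm.continuous_iff]
    have : g0 ∘ polM = G := funext hg0G
    rw [this]; exact hG
  refine ⟨fun p => if h : p ∈ cylDom then g0 ⟨p, h⟩ else mkX (L.ptT s0 r0 (1, ⟨0, by norm_num⟩)), ?_, ?_, ?_⟩
  · rw [continuousOn_iff_continuous_domRestrict]
    convert hg0c using 1
    ext p
    simp [Set.domRestrict]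
  · intro p hp
    obtain ⟨q, hq⟩ := polM_surj ⟨p, hp⟩
    obtain ⟨s, r, hs, hqr⟩ := hγ q.1
    refine ⟨s, r, q.2, hs, ?_, ?_, ?_⟩
    · rw [← polM_norm, hq]
    · have := congrArg (fun z => z.1.2) hq
      exact this
    · simp only [dif_pos hp]
      rw [← hq, hg0G]
      simp only [hGd, hqr]; rfl
  · refine ⟨fun t => (γ (Set.projIcc 0 1 zero_le_one t)).2, ?_, ?_, ?_⟩
    · refine Continuous.continuousOn ?_
      exact (continuous_snd.comp γ.continuous).comp continuous_projIcc
    · intro t ht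
      obtain ⟨s, r, hs, hqr⟩ := hγ ⟨t, ht⟩
      refine ⟨s, r, (1, ⟨0, by norm_num⟩), hs, rfl, rfl, ?_, ?_⟩
      · have : (⟨(Complex.exp (2 * Real.pi * t * Complex.I), 0), (polM (⟨t, ht⟩, ((1 : unitInterval), ⟨0, by norm_num⟩))).2 |> fun h => by
            simpa [polM] using h⟩ : cylDom) = polM (⟨t, ht⟩, ((1 : unitInterval), ⟨0, by norm_num⟩)) := by
          refine Subtype.ext ?_
          simp [polM]
        have hm : (Complex.exp (2 * Real.pi * t * Complex.I), (0:ℝ)) ∈ cylDom := by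
          have := (polM (⟨t, ht⟩, ((1 : unitInterval), ⟨0, by norm_num⟩))).2
          simpa [polM] using this
        simp only [dif_pos hm]
        rw [this, hg0G]
        simp only [hGd, hqr]; rfl
      · simp only [Set.projIcc_of_mem _ ht, hqr]; rfl
    · have h1 : Set.projIcc (0:ℝ) 1 zero_le_one 1 = 1 := Set.projIcc_right _
      have h0 : Set.projIcc (0:ℝ) 1 zero_le_one 0 = 0 := Set.projIcc_left _
      have h2 : (L.PT ζ l (En.deck s0) r1).2 = ζ • (L.PT ζ l s0 r0).2 := by
        simp only [LPar.PT]
        rw [L.ptv_deck, En.W_deck hn hζ hl]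
      have h3 := congrArg Prod.snd γ.source
      have h4 := congrArg Prod.snd γ.target
      simp only [h1, h0]
      exact h4.trans (h2.trans (congrArg (fun u => ζ • u) h3.symm))

end loop2

theorem det {D : GlueingDatum 4} {d n : ℕ} (En : Enh D d n) (hloc : LocEuclidean 4 (GlueSpaceStar D))
    (hn : 2 ≤ n) {ζ : ℂ} (hζ : IsPrimitiveRoot ζ n) (hd2 : 2 ≤ d) (hd : d ≤ 3)
    (x : Fin d → ℝ) (hx0 : ∀ a, 0 < x a) (hx1 : ∑ a, x a = 1) (hxσ : x ∘ En.σ = x) (s0 : En.S)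
    (hfree : ∀ s, En.R s0 s → ∀ (A : Finset (Fin 5)) (i : ℕ), A.Nonempty →
      Disjoint (A : Set (Fin 5)) (Set.range (En.pi s).2) → En.ER (s, A) (En.deck^[i] s, A) → n ∣ i)
    (hst : Stab En s0 x)
    (l : (Fin d → ℝ) →ₗ[ℝ] ℂ) (hl : ∀ v, l (v ∘ En.σ) = ζ * l v)
    (lam : (Fin d → ℝ) →ₗ[ℝ] ℝ) (hlam : ∀ v, lam (v ∘ En.σ) = lam v) (hlamx : lam x = 0)
    (hzero : ∀ v, ∑ a, v a = 1 → l v = 0 → lam v = 0 → v = x)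
    (v0 : Fin d → ℝ) (hv0 : ∑ a, v0 a = 0) (hvσ : v0 ∘ En.σ = v0) (hlv : 0 < lam v0 ∨ lam = 0) :
    ¬ En.R s0 (En.deck s0) := by
  intro hR
  have hn0 : 0 < n := by omega
  have hζn := hζ.pow_eq_one
  have hζ0 : ζ ≠ 0 := hζ.ne_zero hn0.ne'
  -- the tolerance
  obtain ⟨ε, hε, hεx, hεx2⟩ : ∃ ε > 0, (∀ a, (d + 1) * ε ≤ x a) ∧ ∀ a b, x a ≠ x b → 2 * ε ≤ |x a - x b| := by
    have h1 : ∀ a, ∀ᶠ ε in nhdsWithin (0:ℝ) (Set.Ioi 0), (d + 1) * ε ≤ x a := by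
      intro a
      refine nhdsWithin_le_nhds ?_
      have : Filter.Tendsto (fun ε : ℝ => (d + 1) * ε) (nhds 0) (nhds ((d+1)*0)) := by
        apply Continuous.tendsto; fun_prop
      rw [mul_zero] at this
      exact (this.eventually (gt_mem_nhds (hx0 a))).mono fun _ h => le_of_lt h
    have h2 : ∀ a b, ∀ᶠ ε in nhdsWithin (0:ℝ) (Set.Ioi 0), x a ≠ x b → 2 * ε ≤ |x a - x b| := by
      intro a b
      by_cases hab : x a = x b
      · exact Filter.Eventually.of_forall fun _ h => absurd hab h
      refine nhdsWithin_le_nhds ?_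
      have : Filter.Tendsto (fun ε : ℝ => 2 * ε) (nhds 0) (nhds (2*0)) := by
        apply Continuous.tendsto; fun_prop
      rw [mul_zero] at this
      exact (this.eventually (gt_mem_nhds (abs_pos.2 (sub_ne_zero.2 hab)))).mono fun _ h _ => le_of_lt h
    obtain ⟨ε, ⟨h3, h4⟩, h5⟩ := (((Filter.eventually_all.2 h1).and (Filter.eventually_all.2 fun a =>
      Filter.eventually_all.2 (h2 a))).and self_mem_nhdsWithin).exists
    exact ⟨ε, h5, h3, h4⟩
  have hεx' : ∀ a, ε ≤ x a := fun a => le_trans (by nlinarith [(Nat.cast_nonneg d : (0:ℝ) ≤ d)]) (hεx a)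
  have hxok : (∀ a, 0 ≤ x a) ∧ ∑ a, x a = 1 := ⟨fun a => (hx0 a).le, hx1⟩
  set bp : En.S → GlueTotal D := fun s =>
    ⟨(En.pi s).1, ⟨extz (En.pi s).2 x, extz_nonneg _ _ hxok.1, (extz_sum _ _).trans hxok.2⟩⟩ with hbp
  set z0 : GlueSpace D := mkX (bp s0) with hz0
  have hbase : ∀ s, En.R s0 s → mkX (bp s) = z0 := fun s hs => base_eq hs x hxok
  have hbpA : ∀ s, En.R s0 s → En.Adm s0 x ε (bp s) s := by
    intro s hs
    refine ⟨hs, rfl, fun a => ?_⟩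
    simp only [hbp, extz_apply, sub_self, abs_zero]; exact hε
  have hz0v : z0 ∉ vertexImage D := by
    rw [hz0, mem_vertexImage]
    rintro ⟨v, hv⟩
    simp only [hbp] at hv
    have hcase : ∀ a : Fin d, x a < 1 := by
      intro a
      obtain ⟨b, hb⟩ : ∃ b : Fin d, b ≠ a := by
        have : Nontrivial (Fin d) := Fin.nontrivial_iff_two_le.2 hd2
        exact exists_ne a
      rw [← hx1]
      have : ∑ c ∈ {a, b}, x c ≤ ∑ c, x c :=
        Finset.sum_le_sum_of_subset_of_nonneg (Finset.subset_univ _) fun c _ _ => (hx0 c).le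
      rw [Finset.sum_pair hb.symm] at this
      linarith [hx0 b]
    by_cases h : v ∈ Set.range (En.pi s0).2
    · obtain ⟨a, rfl⟩ := h
      rw [extz_apply] at hv
      exact (hcase a).ne hv
    · rw [extz_notMem _ _ h] at hv; norm_num at hv
  obtain ⟨V, hV, hzV, ⟨e⟩⟩ := chart_of_loc hloc z0 hz0v
  -- the functions on the quotient
  set N : Set (GlueSpace D) := {z | ∃ p s, mkX p = z ∧ En.Adm s0 x ε p s ∧ True} with hN
  have hNo : IsOpen N := adm_open hεx' (fun _ _ => True) (fun _ => by simp) (by simp)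
  have hz0N : z0 ∈ N := ⟨bp s0, s0, rfl, hbpA s0 .refl, trivial⟩
  set WX : GlueSpace D → (En.S × Finset (Fin 5) → ℂ) × ℂ := fun z =>
    if h : ∃ q : GlueTotal D × En.S, mkX q.1 = z ∧ En.Adm s0 x ε q.1 q.2 then
      En.W ζ l h.choose.2 h.choose.1.2.1 else 0 with hWX
  set LX : GlueSpace D → ℝ := fun z =>
    if h : ∃ q : GlueTotal D × En.S, mkX q.1 = z ∧ En.Adm s0 x ε q.1 q.2 then
      lam (h.choose.1.2.1 ∘ (En.pi h.choose.2).2) else 0 with hLX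
  have hWkey : ∀ p s, En.Adm s0 x ε p s → ∃ i : ℕ, WX (mkX p) = ζ ^ i • En.W ζ l s p.2.1 := by
    intro p s hs
    have h : ∃ q : GlueTotal D × En.S, mkX q.1 = mkX p ∧ En.Adm s0 x ε q.1 q.2 := ⟨(p, s), rfl, hs⟩
    obtain ⟨i, hi⟩ := adm_key hεx' hεx hεx2 hx1 hst (En.W ζ l) (fun s y k hk hy => En.W_cross s y k hk hy)
      h.choose_spec.1 h.choose_spec.2 hs
    refine ⟨i, ?_⟩
    simp only [hWX, dif_pos h]
    rw [hi, En.W_deck_pow hn0 hζn hl]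
  have hmu : ∀ (μ : (Fin d → ℝ) →ₗ[ℝ] ℝ), (∀ v, μ (v ∘ En.σ) = μ v) → ∀ p p' s s', mkX p = mkX p' →
      En.Adm s0 x ε p s → En.Adm s0 x ε p' s' → μ (p.2.1 ∘ (En.pi s).2) = μ (p'.2.1 ∘ (En.pi s').2) := by
    intro μ hμ p p' s s' hp h h'
    obtain ⟨i, hi⟩ := adm_key hεx' hεx hεx2 hx1 hst (fun s y => μ (y ∘ (En.pi s).2))
      (fun s y k hk hy => by simp only [lin_cross s y k hk]) hp h h'
    rw [hi, lin_deck hμ]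
  have hLkey : ∀ p s, En.Adm s0 x ε p s → LX (mkX p) = lam (p.2.1 ∘ (En.pi s).2) := by
    intro p s hs
    have h : ∃ q : GlueTotal D × En.S, mkX q.1 = mkX p ∧ En.Adm s0 x ε q.1 q.2 := ⟨(p, s), rfl, hs⟩
    simp only [hLX, dif_pos h]
    exact hmu lam hlam _ _ _ _ h.choose_spec.1 h.choose_spec.2 hs
  have hlc := LinearMap.continuous_of_finiteDimensional lam
  -- apply the local obstruction
  refine localObstruction hn hζ z0 V hV hzV e N (hNo.mem_nhds hz0N) WX ?_ LX ?_ ?_ ?_ ?_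
  · rintro z ⟨p, s, rfl, hs, -⟩ η hη
    have ho := adm_open (s0 := s0) (x := x) (ε := ε) hεx'
      (fun s y => ∃ i : ℕ, ‖En.W ζ l s y - ζ ^ i • WX (mkX p)‖ < η) (fun s => by
        have : {y | ∃ i : ℕ, ‖En.W ζ l s y - ζ ^ i • WX (mkX p)‖ < η} =
          ⋃ i : ℕ, {y | ‖En.W ζ l s y - ζ ^ i • WX (mkX p)‖ < η} := by ext; simp
        rw [this]
        exact isOpen_iUnion fun i => isOpen_lt (((En.W_cont ζ l s).sub continuous_const).norm) continuous_const)
      (by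
        rintro s y k hk hy ⟨i, hi⟩
        exact ⟨i, by rwa [En.W_cross s y k hk hy]⟩)
    have hmem : ∀ i : ℕ, ∃ j : ℕ, ζ ^ j * ζ ^ i = 1 := by
      intro i
      refine ⟨(n - 1) * i, ?_⟩
      rw [← pow_add, show (n-1)*i + i = n * i by rw [Nat.sub_one_mul]; have := Nat.le_mul_of_pos_left i hn0; omega,
        pow_mul, hζn, one_pow]
    refine Filter.mem_of_superset (ho.mem_nhds ?_) ?_
    · obtain ⟨i, hi⟩ := hWkey p s hs
      obtain ⟨j, hj⟩ := hmem i
      refine ⟨p, s, rfl, hs, j, ?_⟩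
      rw [hi, smul_smul, hj, one_smul, sub_self, norm_zero]; exact hη
    · rintro _ ⟨q, s', rfl, hs', i, hi⟩
      obtain ⟨j, hj⟩ := hWkey q s' hs'
      refine ⟨j + i, ?_⟩
      rw [hj, pow_add, mul_smul, ← smul_sub, norm_smul, norm_pow, hζ.norm'_eq_one hn0.ne', one_pow, one_mul]
      exact hi
  · rintro z ⟨p, s, rfl, hs, -⟩
    rw [Metric.continuousAt_iff']
    intro η hη
    have ho := adm_open (s0 := s0) (x := x) (ε := ε) hεx'
      (fun s y => dist (lam (y ∘ (En.pi s).2)) (LX (mkX p)) < η) (fun s => by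
        refine isOpen_lt (Continuous.dist (hlc.comp ?_) continuous_const) continuous_const
        fun_prop)
      (by
        rintro s y k hk hy hi
        rwa [lin_cross s y k hk])
    refine Filter.mem_of_superset (ho.mem_nhds ?_) ?_
    · refine ⟨p, s, rfl, hs, ?_⟩
      rw [hLkey p s hs, dist_self]; exact hη
    · rintro _ ⟨q, s', rfl, hs', hi⟩
      simp only [Set.mem_ofPred_eq]
      rw [hLkey q s' hs']; exact hi
  · rw [hz0, hLkey _ _ (hbpA s0 .refl)]
    have : (bp s0).2.1 ∘ (En.pi s0).2 = x := by ext a; exact extz_apply _ _ _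
    rw [this, hlamx]
  · rintro z ⟨p, s, rfl, hs, -⟩ hW0 hL0
    obtain ⟨i, hi⟩ := hWkey p s hs
    rw [hLkey p s hs] at hL0
    rw [hi, smul_eq_zero] at hW0
    have hW1 := hW0.resolve_left (pow_ne_zero _ hζ0)
    have hrest : ∀ k, k ∉ Set.range (En.pi s).2 → p.2.1 k = 0 := by
      by_contra hc
      push Not at hc
      exact En.W_ne_zero hn0 s _ (hfree s hs.1) hc hW1
    have hl0 : l (p.2.1 ∘ (En.pi s).2) = 0 := congrArg Prod.snd hW1
    have hyx : p.2.1 = extz (En.pi s).2 (p.2.1 ∘ (En.pi s).2) := by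
      ext v
      by_cases h : v ∈ Set.range (En.pi s).2
      · obtain ⟨a, rfl⟩ := h
        rw [extz_apply]; rfl
      · rw [extz_notMem _ _ h, hrest v h]
    have hsum : ∑ a, (p.2.1 ∘ (En.pi s).2) a = 1 := by
      rw [← extz_sum, ← hyx]; exact p.2.2.2
    have := hzero _ hsum hl0 hL0
    rw [← hbase s hs.1]
    congr 1
    refine Sigma.ext hs.2.1.symm (heq_of_eq (Subtype.ext ?_))
    rw [hyx, this]
  · intro O hO
    -- choose κ
    obtain ⟨M, hM0, hM⟩ : ∃ M : ℝ, 0 ≤ M ∧ ∀ a, |v0 a| ≤ M :=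
      ⟨∑ a, |v0 a|, Finset.sum_nonneg fun _ _ => abs_nonneg _, fun a =>
        Finset.single_le_sum (f := fun a => |v0 a|) (fun _ _ => abs_nonneg _) (Finset.mem_univ a)⟩
    have hδ : ∀ s, ∀ᶠ δ in nhdsWithin (0:ℝ) (Set.Ioi 0), En.R s0 s → ∀ y : Delta 4,
        (∀ v, |y.1 v - extz (En.pi s).2 x v| < δ) → mkX ⟨(En.pi s).1, y⟩ ∈ O := by
      intro s
      by_cases hs : En.R s0 s
      swap
      · exact Filter.Eventually.of_forall fun _ h => absurd h hs
      have hc : Continuous fun y : Delta 4 => (mkX ⟨(En.pi s).1, y⟩ : GlueSpace D) :=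
        continuous_quot_mk.comp continuous_sigmaMk
      have h1 : (fun y : Delta 4 => (mkX ⟨(En.pi s).1, y⟩ : GlueSpace D)) ⁻¹' O ∈ nhds (bp s).2 := by
        refine hc.continuousAt ?_
        have := hbase s hs
        simp only [hbp] at this ⊢
        rw [this]; exact hO
      obtain ⟨δ, hδ0, hδ⟩ := Metric.mem_nhds_iff.1 h1
      have h2 : Set.Ioo 0 δ ∈ nhdsWithin (0:ℝ) (Set.Ioi 0) := Ioo_mem_nhdsGT hδ0
      filter_upwards [h2] with δ' hδ' _ y hy
      apply hδ
      rw [Metric.mem_ball, Subtype.dist_eq, dist_pi_lt_iff hδ0]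
      intro v
      rw [Real.dist_eq]
      exact (hy v).trans hδ'.2
    obtain ⟨δ, hδ0, hδε, hδO⟩ : ∃ δ > 0, δ ≤ ε ∧ ∀ s, En.R s0 s → ∀ y : Delta 4,
        (∀ v, |y.1 v - extz (En.pi s).2 x v| < δ) → mkX ⟨(En.pi s).1, y⟩ ∈ O := by
      obtain ⟨δ, ⟨h1, h2⟩, h3⟩ := (((Filter.eventually_all.2 hδ).and
        (Ioo_mem_nhdsGT hε)).and self_mem_nhdsWithin).exists
      exact ⟨δ, h3, h2.2.le, h1⟩
    obtain ⟨κ, hκ0, hκ1, hκδ⟩ : ∃ κ : ℝ, 0 < κ ∧ κ < 1 ∧ κ * (M + 1) < δ := by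
      have hp : (0:ℝ) < M + 1 := by linarith
      refine ⟨min (1/2) (δ / (2 * (M + 1))), by positivity, lt_of_le_of_lt (min_le_left _ _) (by norm_num), ?_⟩
      calc _ ≤ δ / (2 * (M + 1)) * (M + 1) := by gcongr; exact min_le_right _ _
        _ = δ / 2 := by field_simp
        _ < δ := by linarith
    let L : LPar En :=
      { x := x, v0 := v0, κ := κ, hx1 := hx1, hv0 := hv0, hκ0 := hκ0, hκ1 := hκ1
        hpos := fun a => by
          have := hM a; have := hεx' a
          nlinarith
        hxσ := hxσ, hvσ := hvσ }
    have hcl : ∀ s (r : En.Vs s) (c : Kc) v, |L.ptv s r.1 c.1 c.2 v - extz (En.pi s).2 x v| < δ := by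
      intro s r c v
      refine lt_of_le_of_lt ?_ hκδ
      have hr0 := r.2.1 v
      have hr1 : r.1 v ≤ 1 := by
        rw [← r.2.2.1]; exact Finset.single_le_sum (f := r.1) (fun w _ => r.2.1 w) (Finset.mem_univ v)
      obtain ⟨c, h⟩ := c
      have hc := c.2
      have hh := h.2
      have hE : ∃ X0 V0 : ℝ, extz (En.pi s).2 x v = X0 ∧ extz (En.pi s).2 (L.xh h) v = X0 + h * κ * V0 ∧
          0 ≤ X0 ∧ X0 ≤ 1 ∧ |V0| ≤ M := by
        by_cases hv : v ∈ Set.range (En.pi s).2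
        · obtain ⟨a, rfl⟩ := hv
          refine ⟨x a, v0 a, extz_apply _ _ _, extz_apply _ _ _, (hx0 a).le, ?_, hM a⟩
          rw [← hx1]
          exact Finset.single_le_sum (f := x) (fun w _ => (hx0 w).le) (Finset.mem_univ a)
        · exact ⟨0, 0, extz_notMem _ _ hv, by rw [extz_notMem _ _ hv]; simp, le_rfl, zero_le_one, by simpa using hM0⟩
      obtain ⟨X0, V0, e1, e2, hX0, hX1, hV⟩ := hE
      simp only [LPar.ptv]
      rw [e1, e2]
      have hκL : L.κ = κ := rfl
      rw [hκL]
      have h3 : (1 - (c:ℝ) * κ) * (X0 + h * κ * V0) + c * κ * r.1 v - X0 =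
          κ * ((1 - c * κ) * (h * V0) + c * (r.1 v - X0)) := by ring
      rw [h3, abs_mul, abs_of_pos hκ0]
      refine mul_le_mul_of_nonneg_left ?_ hκ0.le
      refine (abs_add_le _ _).trans (add_le_add ?_ ?_)
      · rw [abs_mul, abs_mul]
        have a1 : |1 - (c:ℝ) * κ| ≤ 1 := by rw [abs_le]; constructor <;> nlinarith [hc.1, hc.2]
        have a2 : |(h:ℝ)| ≤ 1 := abs_le.2 hh
        have a3 : |(h:ℝ)| * |V0| ≤ 1 * M := mul_le_mul a2 hV (abs_nonneg _) zero_le_one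
        calc _ ≤ 1 * (1 * M) := mul_le_mul a1 a3 (by positivity) zero_le_one
          _ = M := by ring
      · rw [abs_mul]
        have a1 : |(c:ℝ)| ≤ 1 := by rw [abs_le]; constructor <;> linarith [hc.1, hc.2]
        have a2 : |r.1 v - X0| ≤ 1 := by rw [abs_le]; constructor <;> linarith
        calc _ ≤ 1 * 1 := mul_le_mul a1 a2 (abs_nonneg _) zero_le_one
          _ = (1:ℝ) := one_mul 1
    have hadm : ∀ s (r : En.Vs s) (c : Kc), En.R s0 s → En.Adm s0 x ε (L.ptT s r c) s := by
      intro s r c hs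
      refine ⟨hs, rfl, fun a => ?_⟩
      have := hcl s r c ((En.pi s).2 a)
      rw [extz_apply] at this
      exact this.trans_le hδε
    have hval : ∀ s (r : En.Vs s) (c : Kc), (L.ptT s r c).2.1 ∘ (En.pi s).2 =
        (1 - (c.1:ℝ) * κ) • (x + ((c.2:ℝ) * κ) • v0) := by
      intro s r c
      ext a
      simp only [LPar.ptT, LPar.ptv, Function.comp, extz_apply, r.2.2.2 a, Pi.smul_apply, Pi.add_apply, smul_eq_mul,
        LPar.xh, mul_zero, add_zero]
      rfl
    obtain ⟨g, hgc, hg, w, hwc, hw, hw1⟩ := L.loop hd hn0 hζn hl hR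
    refine ⟨g, hgc, ?_, ?_, ?_, w, hwc, ?_, hw1⟩
    · intro p hp
      obtain ⟨s, r, c, hs, -, -, he⟩ := hg p hp
      rw [he]
      exact hδO s hs _ (hcl s r c)
    · intro p hp hp1 hz
      obtain ⟨s, r, c, hs, hc1, -, he⟩ := hg p hp
      rw [he] at hz
      have h1 := hmu (∑ a, LinearMap.proj a) (fun v => by
        simp only [LinearMap.sum_apply, LinearMap.proj_apply, Function.comp]
        exact Equiv.sum_comp En.σ v) _ _ s s0 hz (hadm s r c hs) (hbpA s0 .refl)
      rw [hval] at h1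
      have h2 : (bp s0).2.1 ∘ (En.pi s0).2 = x := by ext a; exact extz_apply _ _ _
      rw [h2, hc1, hp1] at h1
      simp only [LinearMap.sum_apply, LinearMap.proj_apply, Pi.smul_apply, Pi.add_apply, smul_eq_mul,
        ← Finset.mul_sum, Finset.sum_add_distrib, hx1, hv0] at h1
      linarith
    · rcases hlv with hlv | hlv
      · left
        intro p hp
        obtain ⟨s, r, c, hs, hc1, hc2, he⟩ := hg p hp
        have h1 : LX (g p) = (1 - (c.1:ℝ) * κ) * κ * lam v0 * p.2 := by
          rw [he, hLkey _ _ (hadm s r c hs), hval, map_smul, map_add, hlamx, map_smul, hc2]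
          simp only [smul_eq_mul]; ring
        have h2 : 0 < (1 - (c.1:ℝ) * κ) * κ * lam v0 := by
          have : (c.1:ℝ) * κ < 1 := by nlinarith [c.1.2.1, c.1.2.2]
          have : 0 < 1 - (c.1:ℝ) * κ := by linarith
          positivity
        rw [h1]
        refine ⟨⟨fun h => ?_, fun h => mul_neg_of_pos_of_neg h2 h⟩, ?_⟩
        · by_contra hc; push Not at hc
          exact absurd (mul_nonneg h2.le hc) (not_le.2 h)
        · rw [mul_eq_zero]; exact or_iff_right h2.ne'
      · right
        rintro z ⟨p, s, rfl, hs, -⟩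
        rw [hLkey p s hs, hlv]; rfl
    · intro t ht
      obtain ⟨s, r, c, hs, hc1, hc2, he, hwt⟩ := hw t ht
      obtain ⟨i, hi⟩ := hWkey _ _ (hadm s r c hs)
      refine ⟨i, ?_⟩
      rw [he, hi, hwt]
      simp only [LPar.ptT, hc1, hc2]

end Enh
end FileC5

section FileC6
section apps
variable {D : GlueingDatum 4}

/-- coordinate functional -/
abbrev lproj {d : ℕ} (a : Fin d) : (Fin d → ℝ) →ₗ[ℝ] ℝ := LinearMap.proj a

/-- relabelling a state -/
def St.pre {d : ℕ} (s : St D d) (π : Equiv.Perm (Fin d)) : St D d := (s.1, π.toEmbedding.trans s.2)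

theorem St.range_pre {d : ℕ} (s : St D d) (π : Equiv.Perm (Fin d)) :
    Set.range (s.pre π).2 = Set.range s.2 := by
  ext v; constructor
  · rintro ⟨a, rfl⟩; exact ⟨π a, rfl⟩
  · rintro ⟨a, rfl⟩; exact ⟨π.symm a, by simp [St.pre]⟩

theorem St.mv_pre {d : ℕ} (s : St D d) (π : Equiv.Perm (Fin d)) (k) : (s.pre π).mv k = (s.mv k).pre π := rfl

theorem St.pre_pre {d : ℕ} (s : St D d) (π τ : Equiv.Perm (Fin d)) : (s.pre π).pre τ = s.pre (π * τ) := rfl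

theorem St.pre_one {d : ℕ} (s : St D d) : s.pre 1 = s := rfl

theorem St.pre_inj {d : ℕ} {s : St D d} {π τ : Equiv.Perm (Fin d)} (h : s.pre π = s.pre τ) : π = τ := by
  ext a
  have := congrArg (fun q : St D d => q.2 a) h
  exact congrArg _ (s.2.injective this)

/-- reachability of states -/
def SR {d : ℕ} : St D d → St D d → Prop :=
  Relation.ReflTransGen fun s s' => ∃ k, k ∉ Set.range s.2 ∧ s' = s.mv k

theorem SR.symm {d : ℕ} {s s' : St D d} (h : SR s s') : SR s' s := by
  have : Std.Symm (fun s s' : St D d => ∃ k, k ∉ Set.range s.2 ∧ s' = s.mv k) := ⟨by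
    rintro s _ ⟨k, hk, rfl⟩
    exact ⟨opf D s.1 k, St.op_notMem hk, (St.mv_mv _ _).symm⟩⟩
  exact Relation.ReflTransGen.stdSymm.symm _ _ h

theorem SR.trans {d : ℕ} {s s' s'' : St D d} (h : SR s s') (h' : SR s' s'') : SR s s'' :=
  Relation.ReflTransGen.trans h h'

theorem SR.pre {d : ℕ} {s s' : St D d} (h : SR s s') (π : Equiv.Perm (Fin d)) : SR (s.pre π) (s'.pre π) := by
  induction h with
  | refl => exact .refl
  | tail _ h ih =>
    obtain ⟨k, hk, rfl⟩ := h
    exact ih.tail ⟨k, by rwa [St.range_pre], rfl⟩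

/-- the basic family -/
def stEnh (D : GlueingDatum 4) (d n : ℕ) (σ : Equiv.Perm (Fin d)) (hσ : σ ^ n = 1) : Enh D d n where
  S := St D d
  fin := inferInstance
  pi := id
  mv := St.mv
  pi_mv _ _ _ := rfl
  mv_mv s k _ := St.mv_mv s k
  deck s := s.pre σ
  σ := σ
  pi_deck _ := rfl
  deck_mv _ _ _ := rfl
  deck_pow s := by
    have : ∀ i : ℕ, (fun s : St D d => s.pre σ)^[i] s = s.pre (σ ^ i) := by
      intro i
      induction i with
      | zero => rfl
      | succ i ih => rw [Function.iterate_succ_apply', ih, St.pre_pre, pow_succ]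
    rw [this, hσ]; rfl

theorem stEnh_deck (d n : ℕ) (σ : Equiv.Perm (Fin d)) (hσ : σ ^ n = 1) (i : ℕ) (s : St D d) :
    (stEnh D d n σ hσ).deck^[i] s = s.pre (σ ^ i) := by
  show (fun s : St D d => s.pre σ)^[i] s = s.pre (σ ^ i)
  induction i with
  | zero => rfl
  | succ i ih => rw [Function.iterate_succ_apply', ih, St.pre_pre, pow_succ]

namespace Enh
variable {d n : ℕ} (En : Enh D d n)

theorem range_deck_pow (i : ℕ) (s : En.S) : Set.range (En.pi (En.deck^[i] s)).2 = Set.range (En.pi s).2 := by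
  induction i with
  | zero => rfl
  | succ i ih => rw [Function.iterate_succ_apply', range_deck, ih]

theorem fst_deck_pow (i : ℕ) (s : En.S) : (En.pi (En.deck^[i] s)).1 = (En.pi s).1 := by
  induction i with
  | zero => rfl
  | succ i ih => rw [Function.iterate_succ_apply', fst_deck, ih]

/-- the vertices used by an extended state -/
def used (a : En.S × Finset (Fin 5)) : Finset (Fin 5) := Finset.univ.map (En.pi a.1).2 ∪ a.2

theorem notMem_used {a : En.S × Finset (Fin 5)} {k} : k ∉ En.used a ↔ k ∉ Set.range (En.pi a.1).2 ∧ k ∉ a.2 := by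
  simp [used]

theorem used_step {a : En.S × Finset (Fin 5)} {k} (hk : k ∉ Set.range (En.pi a.1).2) :
    En.used (En.mv a.1 k, a.2.map (D.glue ((En.pi a.1).1, k)).toEmbedding) =
      (En.used a).map (D.glue ((En.pi a.1).1, k)).toEmbedding := by
  simp only [used, Finset.map_union, En.pi_mv _ _ hk, Finset.map_map]
  rfl

theorem ER_full {a b : En.S × Finset (Fin 5)} (h : En.ER a b) (ha : En.used a = Finset.univ) : b = a := by
  induction h using Relation.ReflTransGen.head_induction_on with
  | refl => rfl
  | head h _ _ =>
    obtain ⟨k, h1, h2, -⟩ := h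
    exact absurd (by rw [ha]; simp) (En.notMem_used.2 ⟨h1, h2⟩)

theorem ER_facet {a b : En.S × Finset (Fin 5)} (h : En.ER a b) {k : Fin 5} (ha : En.used a = Finset.univ.erase k) :
    b = a ∨ b = (En.mv a.1 k, a.2.map (D.glue ((En.pi a.1).1, k)).toEmbedding) := by
  have hk := En.notMem_used (a := a) (k := k)
  rw [ha] at hk
  replace hk := hk.1 (by simp)
  induction h with
  | refl => exact Or.inl rfl
  | @tail b c _ h ih =>
    rcases ih with rfl | rfl
    · obtain ⟨k', h1, h2, rfl⟩ := h
      have := En.notMem_used.2 ⟨h1, h2⟩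
      rw [ha] at this
      have : k' = k := by simpa using this
      subst this
      right; rfl
    · obtain ⟨k', h1, h2, rfl⟩ := h
      have h3 := En.notMem_used.2 ⟨h1, h2⟩
      rw [used_step _ hk.1, ha] at h3
      have h4 : k' = opf D (En.pi a.1).1 k := by
        rw [← glue_opf]
        simp only [Finset.mem_map, Finset.mem_erase, Finset.mem_univ, and_true, not_exists, not_and,
          Equiv.coe_toEmbedding] at h3
        by_contra hne
        exact h3 ((D.glue ((En.pi a.1).1, k)).symm k') (by rwa [Ne, Equiv.symm_apply_eq]) (by simp)
      subst h4
      left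
      simp only [En.pi_mv _ _ hk.1, En.mv_mv _ _ hk.1]
      rw [St.mv_fst, glue_back]
      refine Prod.ext rfl ?_
      simp only [Finset.map_map]
      ext v; simp

theorem free_of (hd2 : 2 ≤ d) (s0 : En.S) (hdeck : ∀ s i, En.deck^[i] s = s → n ∣ i)
    (h3 : d = 2 → ∀ s κ i, En.R s0 s → κ ∉ Set.range (En.pi s).2 →
      En.ER (s, {κ}) (En.deck^[i] s, {κ}) → n ∣ i) :
    ∀ s, En.R s0 s → ∀ (A : Finset (Fin 5)) (i : ℕ), A.Nonempty →
      Disjoint (A : Set (Fin 5)) (Set.range (En.pi s).2) → En.ER (s, A) (En.deck^[i] s, A) → n ∣ i := by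
  intro s hs A i hA hdis hER
  have hcard : (En.used (s, A)).card = d + A.card := by
    unfold used
    rw [Finset.card_union_of_disjoint, Finset.card_map]
    · simp
    · rw [Finset.disjoint_left]
      intro v hv hv2
      refine Set.disjoint_left.1 hdis hv2 ?_
      simpa using hv
  have h5 : (En.used (s, A)).card ≤ 5 := (Finset.card_le_univ _).trans (by simp)
  have hA1 : 1 ≤ A.card := hA.card_pos
  have hcases : (En.used (s, A)).card = 5 ∨ (En.used (s, A)).card = 4 ∨ (d = 2 ∧ A.card = 1) := by omega
  rcases hcases with hc | hc | ⟨hd, hc⟩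
  · have := En.ER_full hER (by rw [← Finset.card_eq_iff_eq_univ, hc]; rfl)
    exact hdeck s i (congrArg Prod.fst this)
  · obtain ⟨k, hk⟩ : ∃ k, En.used (s, A) = Finset.univ.erase k := by
      have : (En.used (s, A))ᶜ.card = 1 := by rw [Finset.card_compl, hc]; rfl
      obtain ⟨k, hk⟩ := Finset.card_eq_one.1 this
      refine ⟨k, ?_⟩
      rw [← compl_compl (En.used (s, A)), hk]
      ext v; simp
    rcases En.ER_facet hER hk with h | h
    · exact hdeck s i (congrArg Prod.fst h)
    · exfalso
      have hk' := En.notMem_used (a := (s, A)) (k := k)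
      rw [hk] at hk'
      replace hk' := hk'.1 (by simp)
      have h1 : nbr D (En.pi s).1 k = (En.pi s).1 := by
        have := congrArg (fun q => (En.pi q.1).1) h
        simp only [fst_deck_pow, En.pi_mv _ _ hk'.1] at this
        exact this.symm
      have h2 : En.used (En.deck^[i] s, A) = En.used (s, A) := by
        simp only [used]
        congr 1
        ext v
        have := Set.ext_iff.1 (En.range_deck_pow i s) v
        simpa using this
      rw [h, En.used_step hk'.1, hk] at h2
      have h3 : opf D (En.pi s).1 k = k := by
        by_contra hne
        have : opf D (En.pi s).1 k ∈ Finset.univ.erase k := by simp [hne]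
        rw [← h2, ← glue_opf] at this
        simp at this
      apply D.P_fixedPointFree ((En.pi s).1, k)
      rw [P_eq, h1, h3]
  · obtain ⟨κ, rfl⟩ := Finset.card_eq_one.1 hc
    exact h3 hd s κ i hs (fun h => Set.disjoint_left.1 hdis (by simp) h) hER

end Enh

theorem stEnh_R {d n : ℕ} {σ : Equiv.Perm (Fin d)} {hσ : σ ^ n = 1} {s s' : St D d} :
    (stEnh D d n σ hσ).R s s' ↔ SR s s' := Iff.rfl

/-- no reflection of a triangle -/
theorem tri_noflip (hloc : LocEuclidean 4 (GlueSpaceStar D)) (s : St D 3) :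
    ¬ SR s (s.pre (Equiv.swap 0 1)) := by
  have hσ : (Equiv.swap (0 : Fin 3) 1) ^ 2 = 1 := by decide
  refine (stEnh D 3 2 (Equiv.swap 0 1) hσ).det hloc le_rfl (ζ := -1) (IsPrimitiveRoot.neg_one 0 (by norm_num)) (by norm_num) le_rfl
    ![1/4, 1/4, 1/2] ?_ ?_ ?_ s ?_ ?_
    (Complex.ofRealCLM.toLinearMap ∘ₗ (lproj 0 - lproj 1 : (Fin 3 → ℝ) →ₗ[ℝ] ℝ)) ?_
    (lproj 2 - lproj 0 - lproj 1 : (Fin 3 → ℝ) →ₗ[ℝ] ℝ) ?_ ?_ ?_ ![-1, -1, 2] ?_ ?_ ?_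
  · intro a; fin_cases a <;> norm_num
  · simp [Fin.sum_univ_three]; norm_num
  · ext a; fin_cases a <;> simp [stEnh]
    rw [Equiv.swap_apply_of_ne_of_ne (by decide) (by decide)]; simp
  · refine (stEnh D 3 2 (Equiv.swap 0 1) hσ).free_of (by norm_num) s ?_ (by norm_num)
    intro s i h
    have := St.pre_inj (((stEnh_deck _ _ _ hσ i s).symm.trans h).trans (St.pre_one s).symm)
    have h2 := orderOf_dvd_of_pow_eq_one this
    rwa [orderOf_eq_prime hσ (by decide)] at h2
  · intro t t' π _ _ h1 h2 hx
    have hπ : π = 1 ∨ π = Equiv.swap 0 1 := by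
      have h3 : π 2 = 2 := by
        have := congrFun hx 2
        simp only [Function.comp] at this
        generalize π 2 = b at this ⊢
        fin_cases b <;> simp at this ⊢ <;> norm_num at this
      revert h3; clear hx h2; revert π; decide
    have h4 : t' = St.pre t π := Prod.ext h1 h2
    rcases hπ with rfl | rfl
    · exact ⟨0, h4⟩
    · exact ⟨1, h4⟩
  · intro v; simp [stEnh]
  · intro v; simp [stEnh]
    rw [Equiv.swap_apply_of_ne_of_ne (by decide) (by decide)]; ring
  · simp; norm_num
  · intro v h1 h2 h3
    simp at h2 h3
    have h2' : v 0 = v 1 := by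
      have : ((v 0 - v 1 : ℝ) : ℂ) = 0 := by push_cast; exact h2
      have := Complex.ofReal_eq_zero.1 this
      linarith
    rw [Fin.sum_univ_three] at h1
    ext a; fin_cases a <;> simp <;> linarith
  · simp [Fin.sum_univ_three]; norm_num
  · ext a; fin_cases a <;> simp [stEnh]
    rw [Equiv.swap_apply_of_ne_of_ne (by decide) (by decide)]; simp
  · left; simp; norm_num

theorem tri_noodd (hloc : LocEuclidean 4 (GlueSpaceStar D)) (s : St D 3) (π τ : Equiv.Perm (Fin 3))
    (hπ : π * τ = τ * Equiv.swap 0 1) : ¬ SR s (s.pre π) := by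
  intro h
  have := h.pre τ
  rw [St.pre_pre, hπ, ← St.pre_pre] at this
  exact tri_noflip hloc _ this

/-- no rotation of a triangle -/
theorem tri_norot (hloc : LocEuclidean 4 (GlueSpaceStar D)) (s : St D 3) :
    ¬ SR s (s.pre (finRotate 3)) := by
  have hσ : (finRotate 3) ^ 3 = 1 := by decide
  have hζ := Complex.isPrimitiveRoot_exp 3 (by norm_num)
  set ζ := Complex.exp (2 * Real.pi * Complex.I / ((3:ℕ):ℂ)) with hζd
  have h30 : ζ ^ 3 = 1 := hζ.pow_eq_one
  have h31 : ζ ≠ 1 := hζ.ne_one (by norm_num)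
  have h32 : 1 + ζ + ζ ^ 2 = 0 := by
    have : (ζ - 1) * (1 + ζ + ζ ^ 2) = 0 := by linear_combination h30
    exact (mul_eq_zero.1 this).resolve_left (sub_ne_zero.2 h31)
  have him : ζ.im ≠ 0 := by
    intro h
    have h1 : ζ = (ζ.re : ℂ) := Complex.ext rfl (by simpa using h)
    rw [h1] at h32
    have h2 : 1 + ζ.re + ζ.re ^ 2 = 0 := by exact_mod_cast h32
    nlinarith [sq_nonneg (ζ.re + 1/2)]
  have key : ∀ π : Equiv.Perm (Fin 3), (∃ i : ℕ, π = finRotate 3 ^ i) ∨ ∃ τ, π * τ = τ * Equiv.swap 0 1 := by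
    intro π
    have : (π = finRotate 3 ^ 0 ∨ π = finRotate 3 ^ 1 ∨ π = finRotate 3 ^ 2) ∨ ∃ τ, π * τ = τ * Equiv.swap 0 1 := by
      revert π; decide
    rcases this with (h | h | h) | h
    exacts [Or.inl ⟨_, h⟩, Or.inl ⟨_, h⟩, Or.inl ⟨_, h⟩, Or.inr h]
  refine (stEnh D 3 3 (finRotate 3) hσ).det hloc (by norm_num) hζ (by norm_num) le_rfl
    ![1/3, 1/3, 1/3] ?_ ?_ ?_ s ?_ ?_
    (Complex.ofRealCLM.toLinearMap ∘ₗ (lproj 0 : (Fin 3 → ℝ) →ₗ[ℝ] ℝ) + (ζ ^ 2) • (Complex.ofRealCLM.toLinearMap ∘ₗ (lproj 1 : (Fin 3 → ℝ) →ₗ[ℝ] ℝ))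
      + ζ • (Complex.ofRealCLM.toLinearMap ∘ₗ (lproj 2 : (Fin 3 → ℝ) →ₗ[ℝ] ℝ))) ?_
    0 ?_ ?_ ?_ 0 ?_ ?_ ?_
  · intro a; fin_cases a <;> norm_num
  · simp [Fin.sum_univ_three]; norm_num
  · ext a; 
    have : ∀ a : Fin 3, (![1/3, 1/3, 1/3] : Fin 3 → ℝ) a = 1/3 := by intro a; fin_cases a <;> simp
    simp only [Function.comp, this]
  · refine (stEnh D 3 3 (finRotate 3) hσ).free_of (by norm_num) s ?_ (by norm_num)
    intro s i h
    have := St.pre_inj (((stEnh_deck _ _ _ hσ i s).symm.trans h).trans (St.pre_one s).symm)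
    have h2 := orderOf_dvd_of_pow_eq_one this
    have h3 : orderOf (finRotate 3) = 3 := orderOf_eq_prime hσ (by decide)
    rwa [h3] at h2
  · intro t t' π ht ht' h1 h2 hx
    have h4 : t' = St.pre t π := Prod.ext h1 h2
    rcases key π with ⟨i, rfl⟩ | ⟨τ, hτ⟩
    · exact ⟨i, h4.trans (stEnh_deck 3 3 _ hσ i t).symm⟩
    · exfalso
      have h5 : SR (D := D) t t' := (SR.symm ht).trans ht'
      rw [h4] at h5
      exact tri_noodd hloc t π τ hτ h5
  · intro v
    have e0 : finRotate 3 0 = 1 := by decide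
    have e1 : finRotate 3 1 = 2 := by decide
    have e2 : finRotate 3 2 = 0 := by decide
    simp [stEnh, e0, e1, e2]
    linear_combination (- (v 1 : ℂ)) * h30
  · intro v; simp
  · simp
  · intro v h1 h2 h3
    simp at h2
    have h4 : ((v 0 - v 1 : ℝ) : ℂ) + ζ * ((v 2 - v 1 : ℝ) : ℂ) = 0 := by
      push_cast; linear_combination h2 - (v 1 : ℂ) * h32
    have h5 := congrArg Complex.im h4
    simp only [Complex.add_im, Complex.ofReal_im, Complex.mul_im, Complex.ofReal_re, Complex.zero_im] at h5
    have h6 : v 2 = v 1 := by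
      have : ζ.im * (v 2 - v 1) = 0 := by linarith
      have := (mul_eq_zero.1 this).resolve_left him
      linarith
    have h7 := congrArg Complex.re h4
    simp [h6] at h7
    have h8 : v 0 = v 1 := by linarith
    rw [Fin.sum_univ_three] at h1
    ext a; fin_cases a <;> simp <;> linarith
  · simp
  · rfl
  · right; rfl

theorem tri_trivial (hloc : LocEuclidean 4 (GlueSpaceStar D)) (s : St D 3) (π : Equiv.Perm (Fin 3))
    (h : SR s (s.pre π)) : π = 1 := by
  have key : ∀ π : Equiv.Perm (Fin 3), π = 1 ∨ π = finRotate 3 ∨ π * π = finRotate 3 ∨ ∃ τ, π * τ = τ * Equiv.swap 0 1 := by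
    decide
  rcases key π with h1 | rfl | h1 | ⟨τ, hτ⟩
  · exact h1
  · exact absurd h (tri_norot hloc s)
  · refine absurd ?_ (tri_norot hloc s)
    rw [← h1, ← St.pre_pre]
    exact h.trans (h.pre π)
  · exact absurd h (tri_noodd hloc s π τ hτ)

/-- condition Cycl follows -/
theorem cycl_of_tri (h : ∀ (s : St D 3) (π : Equiv.Perm (Fin 3)), SR s (s.pre π) → π = 1) : Cycl D := by
  intro m hm i t k l hinj hk hP ht _ hi hr _
  have hS : ∀ r (hr : r ≤ m), SR (D := D) (i 0, ⟨t 0, hinj 0 (Nat.zero_le _)⟩) (i r, ⟨t r, hinj r hr⟩) := by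
    intro r
    induction r with
    | zero => intro _; exact .refl
    | succ r ih =>
      intro hr
      refine (ih (by omega)).tail ⟨k r, hk r (by omega), ?_⟩
      refine Prod.ext ?_ ?_
      · exact (congrArg Prod.fst (hP r (by omega))).symm
      · ext1 a
        exact congrFun (ht r (by omega)) a
  have h1 := hS m le_rfl
  have hsub : ∀ a, ∃ b, t 0 b = t m a := fun a => by
    have : t m a ∈ Set.range (t 0) := hr ▸ ⟨a, rfl⟩
    exact this
  choose π hπ using hsub
  have hπi : Function.Injective π := fun a b hab => hinj m le_rfl (by rw [← hπ, ← hπ, hab])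
  have hb := Finite.injective_iff_bijective.1 hπi
  have h2 := h (i 0, ⟨t 0, hinj 0 (Nat.zero_le _)⟩) (Equiv.ofBijective π hb) (by
    convert h1 using 1
    refine Prod.ext hi.symm ?_
    ext1 a
    exact hπ a)
  ext1 a
  rw [← hπ a]
  have := congrArg (fun e : Equiv.Perm (Fin 3) => e a) h2
  simp at this
  rw [this]

/-- adding a vertex to an edge -/
def St.addv (s : St D 2) (κ : Fin 5) (h : κ ∉ Set.range s.2) : St D 3 :=
  (s.1, ⟨![s.2 0, s.2 1, κ], by
    have h0 : s.2 0 ≠ κ := fun e => h ⟨0, e⟩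
    have h1 : s.2 1 ≠ κ := fun e => h ⟨1, e⟩
    have h01 : s.2 0 ≠ s.2 1 := fun e => by have := s.2.injective e; simp at this
    intro a b hab
    fin_cases a <;> fin_cases b <;> simp_all [eq_comm]⟩)

theorem St.add_range (s : St D 2) (κ : Fin 5) (h : κ ∉ Set.range s.2) (v) :
    v ∈ Set.range (s.addv κ h).2 ↔ v ∈ Set.range s.2 ∨ v = κ := by
  constructor
  · rintro ⟨a, rfl⟩
    fin_cases a
    · exact Or.inl ⟨0, rfl⟩
    · exact Or.inl ⟨1, rfl⟩
    · exact Or.inr rfl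
  · rintro (⟨a, rfl⟩ | rfl)
    · fin_cases a
      · exact ⟨0, rfl⟩
      · exact ⟨1, rfl⟩
    · exact ⟨2, rfl⟩

theorem St.mv_notMem {d : ℕ} {s : St D d} {k κ : Fin 5} (h : κ ∉ Set.range s.2) :
    D.glue (s.1, k) κ ∉ Set.range (s.mv k).2 := by
  rintro ⟨a, ha⟩
  rw [St.mv_snd] at ha
  exact h ⟨a, (D.glue _).injective ha⟩

theorem St.addv_mv (s : St D 2) (κ : Fin 5) (h : κ ∉ Set.range s.2) (k) :
    (s.addv κ h).mv k = (s.mv k).addv (D.glue (s.1, k) κ) (St.mv_notMem h) := by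
  refine Prod.ext rfl ?_
  ext1 a
  rw [St.mv_snd]
  fin_cases a <;> rfl

theorem ER_tri {n : ℕ} {En : Enh D 2 n} {s : En.S} {κ} (hκ : κ ∉ Set.range (En.pi s).2) {b}
    (h : En.ER (s, {κ}) b) : ∃ (κ' : Fin 5) (h' : κ' ∉ Set.range (En.pi b.1).2), b.2 = {κ'} ∧
      SR ((En.pi s).addv κ hκ) ((En.pi b.1).addv κ' h') := by
  induction h with
  | refl => exact ⟨κ, hκ, rfl, .refl⟩
  | @tail b c _ h ih =>
    obtain ⟨κ', h', hb, hS⟩ := ih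
    obtain ⟨k, h1, h2, rfl⟩ := h
    have h3 : D.glue ((En.pi b.1).1, k) κ' ∉ Set.range (En.pi (En.mv b.1 k)).2 := by
      rw [En.pi_mv _ _ h1]; exact St.mv_notMem h'
    refine ⟨D.glue ((En.pi b.1).1, k) κ', h3, ?_, ?_⟩
    · simp [hb]
    · refine hS.tail ⟨k, ?_, ?_⟩
      · rw [St.add_range]
        rintro (h4 | h4)
        · exact h1 h4
        · exact h2 (by rw [hb, h4]; simp)
      · rw [St.addv_mv]
        simp only [En.pi_mv _ _ h1]

/-- no flip of an edge -/
theorem edge_noflip (hloc : LocEuclidean 4 (GlueSpaceStar D)) (s : St D 2) :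
    ¬ SR s (s.pre (Equiv.swap 0 1)) := by
  have hσ : (Equiv.swap (0 : Fin 2) 1) ^ 2 = 1 := by decide
  have hdk : ∀ (s : St D 2) i, (stEnh D 2 2 (Equiv.swap 0 1) hσ).deck^[i] s = s → 2 ∣ i := by
    intro s i h
    have := St.pre_inj (((stEnh_deck _ _ _ hσ i s).symm.trans h).trans (St.pre_one s).symm)
    have h2 := orderOf_dvd_of_pow_eq_one this
    rwa [orderOf_eq_prime hσ (by decide)] at h2
  refine (stEnh D 2 2 (Equiv.swap 0 1) hσ).det hloc le_rfl (ζ := -1) (IsPrimitiveRoot.neg_one 0 (by norm_num)) (by norm_num) (by norm_num)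
    ![1/2, 1/2] ?_ ?_ ?_ s ?_ ?_
    (Complex.ofRealCLM.toLinearMap ∘ₗ (lproj 0 - lproj 1 : (Fin 2 → ℝ) →ₗ[ℝ] ℝ)) ?_
    0 ?_ ?_ ?_ 0 ?_ ?_ ?_
  · intro a; fin_cases a <;> norm_num
  · simp [Fin.sum_univ_two]; norm_num
  · ext a; fin_cases a <;> simp [stEnh]
  · refine (stEnh D 2 2 (Equiv.swap 0 1) hσ).free_of (by norm_num) s hdk ?_
    intro _ s κ i _ hκ hER
    obtain ⟨κ', h', h1, h2⟩ := ER_tri hκ hER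
    have h1 : κ' = κ := by simpa using h1.symm
    subst h1
    by_contra hi
    have hodd : (Equiv.swap (0:Fin 2) 1) ^ i = Equiv.swap 0 1 := by
      obtain ⟨j, rfl⟩ : ∃ j, i = 2 * j + 1 := ⟨i / 2, by omega⟩
      rw [pow_succ, pow_mul, hσ, one_pow, one_mul]
    have h3 := stEnh_deck 2 2 _ hσ i s
    rw [hodd] at h3
    have h4 : ∀ (s t : St D 2), t = s.pre (Equiv.swap 0 1) → ∀ hκ h', SR (s.addv κ' hκ) (t.addv κ' h') → False := by
      rintro s t rfl hκ h' h2
      apply tri_noflip hloc (St.addv s κ' hκ)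
      convert h2 using 1
      refine Prod.ext rfl ?_
      ext1 a
      fin_cases a <;> rfl
    exact h4 _ _ h3 _ _ h2
  · intro t t' π _ _ h1 h2 hx
    have hπ : π = 1 ∨ π = Equiv.swap 0 1 := by
      clear hx h2; revert π; decide
    have h4 : t' = St.pre t π := Prod.ext h1 h2
    rcases hπ with rfl | rfl
    · exact ⟨0, h4⟩
    · exact ⟨1, h4⟩
  · intro v; simp [stEnh]
  · intro v; simp
  · simp
  · intro v h1 h2 h3
    simp at h2
    have h2' : v 0 = v 1 := by
      have : ((v 0 - v 1 : ℝ) : ℂ) = 0 := by push_cast; exact h2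
      have := Complex.ofReal_eq_zero.1 this
      linarith
    rw [Fin.sum_univ_two] at h1
    ext a; fin_cases a <;> simp <;> linarith
  · simp
  · rfl
  · right; rfl

/-- an edge state from two vertices -/
def St.mk2 (i : D.I) (a b : Fin 5) (h : a ≠ b) : St D 2 := (i, ⟨![a, b], by
    intro c d hcd
    fin_cases c <;> fin_cases d <;> simp_all [eq_comm]⟩)

theorem St.mk2_swap (i : D.I) (a b : Fin 5) (h : a ≠ b) : (St.mk2 i a b h).pre (Equiv.swap 0 1) = St.mk2 i b a h.symm := by
  refine Prod.ext rfl ?_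
  ext1 c
  fin_cases c <;> rfl

theorem St.mk2_range (i : D.I) (a b : Fin 5) (h : a ≠ b) (v) : v ∈ Set.range (St.mk2 i a b h).2 ↔ v = a ∨ v = b := by
  constructor
  · rintro ⟨c, rfl⟩
    fin_cases c
    · exact Or.inl rfl
    · exact Or.inr rfl
  · rintro (rfl | rfl)
    · exact ⟨0, rfl⟩
    · exact ⟨1, rfl⟩

/-- condition Dir follows -/
theorem dir_of_edge (h : ∀ (s : St D 2), ¬ SR s (s.pre (Equiv.swap 0 1))) : Dir D := by
  -- representatives of classes of unordered edges
  let st : Setoid (St D 2) :=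
    { r := fun s s' => SR s s' ∨ SR s (s'.pre (Equiv.swap 0 1))
      iseqv := by
        have hsw : ∀ s : St D 2, (s.pre (Equiv.swap 0 1)).pre (Equiv.swap 0 1) = s := by
          intro s; rw [St.pre_pre]; simp [St.pre_one]
        refine ⟨fun s => Or.inl .refl, ?_, ?_⟩
        · rintro s s' (h | h)
          · exact Or.inl h.symm
          · right
            have := h.symm.pre (Equiv.swap 0 1)
            rwa [hsw] at this
        · rintro s s' s'' (h | h) (h' | h')
          · exact Or.inl (h.trans h')
          · exact Or.inr (h.trans h')
          · exact Or.inr (h.trans (h'.pre _))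
          · left
            have := h'.pre (Equiv.swap 0 1)
            rw [hsw] at this
            exact h.trans this }
  refine ⟨fun i a b => ∃ hab : a ≠ b, SR (Quotient.out (s := st) (Quotient.mk st (St.mk2 i a b hab))) (St.mk2 i a b hab), ?_, ?_⟩
  · intro i a b hab
    have hq : Quotient.mk st (St.mk2 i b a hab.symm) = Quotient.mk st (St.mk2 i a b hab) := by
      apply Quotient.sound
      right
      rw [St.mk2_swap]; exact .refl
    have hout : SR (Quotient.out (s := st) (Quotient.mk st (St.mk2 i a b hab))) (St.mk2 i a b hab) ∨
        SR (Quotient.out (s := st) (Quotient.mk st (St.mk2 i a b hab))) ((St.mk2 i a b hab).pre (Equiv.swap 0 1)) :=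
      Quotient.mk_out (s := st) (St.mk2 i a b hab)
    rw [St.mk2_swap] at hout
    refine (?_ : ∀ a b : Prop, (a ∨ b) ∧ ¬ (a ∧ b) → Xor' a b) _ _ ?_
    · intro a b h; unfold Xor'; tauto
    constructor
    · rcases hout with h1 | h1
      · exact Or.inl ⟨hab, h1⟩
      · exact Or.inr ⟨hab.symm, by rw [hq]; exact h1⟩
    · rintro ⟨⟨_, h1⟩, ⟨_, h2⟩⟩
      rw [hq] at h2
      have := h1.symm.trans h2
      rw [← St.mk2_swap i a b hab] at this
      exact h _ this
  · intro i k a b hak hbk hab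
    have hab' : D.glue (i, k) a ≠ D.glue (i, k) b := fun e => hab ((D.glue _).injective e)
    have hm : St.mk2 (D.P (i, k)).1 _ _ hab' = (St.mk2 i a b hab).mv k := by
      refine Prod.ext rfl ?_
      ext1 c; fin_cases c <;> rfl
    have hS : SR (St.mk2 i a b hab) (St.mk2 (D.P (i, k)).1 _ _ hab') := by
      rw [hm]
      refine Relation.ReflTransGen.single ⟨k, ?_, rfl⟩
      rw [St.mk2_range]; rintro (rfl | rfl) <;> contradiction
    have hq : Quotient.mk st (St.mk2 i a b hab) = Quotient.mk st (St.mk2 (D.P (i, k)).1 _ _ hab') :=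
      Quotient.sound (Or.inl hS)
    constructor
    · rintro ⟨_, h1⟩
      exact ⟨hab', by rw [← hq]; exact h1.trans hS⟩
    · rintro ⟨_, h1⟩
      exact ⟨hab, by rw [hq]; exact h1.trans hS.symm⟩

end apps
end FileC6

section FileC7
section h1
variable {D : GlueingDatum 4}

/-- the double cover of the reachable states given by a cocycle -/
def cocEnh (s0 : St D 2) (c : St D 2 → Fin 5 → ZMod 2)
    (hsym : ∀ s k, SR s0 s → k ∉ Set.range s.2 → c (s.mv k) (opf D s.1 k) = c s k) : Enh D 2 2 where
  S := {s : St D 2 // SR s0 s} × ZMod 2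
  fin := inferInstance
  pi s := s.1.1
  mv s k := if h : k ∉ Set.range s.1.1.2 then (⟨s.1.1.mv k, s.1.2.tail ⟨k, h, rfl⟩⟩, s.2 + c s.1.1 k) else s
  pi_mv s k h := by rw [dif_pos h]
  mv_mv s k h := by
    rw [dif_pos h, dif_pos (St.op_notMem h)]
    refine Prod.ext (Subtype.ext (St.mv_mv _ _)) ?_
    show s.2 + c s.1.1 k + c (s.1.1.mv k) (opf D s.1.1.1 k) = s.2
    rw [hsym _ _ s.1.2 h, add_assoc, CharTwo.add_self_eq_zero, add_zero]
  deck s := (s.1, s.2 + 1)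
  σ := 1
  pi_deck _ := rfl
  deck_mv s k h := by
    rw [dif_pos h, dif_pos h]
    refine Prod.ext rfl ?_
    show s.2 + c s.1.1 k + 1 = s.2 + 1 + c s.1.1 k
    ring
  deck_pow s := by
    refine Prod.ext rfl ?_
    show s.2 + 1 + 1 = s.2
    rw [add_assoc, CharTwo.add_self_eq_zero, add_zero]

theorem cocEnh_deck (s0 : St D 2) (c hsym) (i : ℕ) (s : {s : St D 2 // SR s0 s}) (a : ZMod 2) :
    (cocEnh s0 c hsym).deck^[i] (s, a) = (s, a + i) := by
  show (fun q : {s : St D 2 // SR s0 s} × ZMod 2 => (q.1, q.2 + 1))^[i] (s, a) = (s, a + i)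
  induction i with
  | zero => simp
  | succ i ih => rw [Function.iterate_succ_apply', ih]; push_cast; rw [add_assoc]

/-- simple connectivity of the link of an edge, in combinatorial form -/
theorem h1_vanish (hloc : LocEuclidean 4 (GlueSpaceStar D)) (s0 : St D 2) (c : St D 2 → Fin 5 → ZMod 2)
    (g : St D 3 → ZMod 2)
    (hc : ∀ s k κ (hκ : κ ∉ Set.range s.2), SR s0 s → k ∉ Set.range s.2 → κ ≠ k →
      c s k = g (s.addv κ hκ) + g ((s.addv κ hκ).mv k)) :
    ∃ h : St D 2 → ZMod 2, ∀ s k, SR s0 s → k ∉ Set.range s.2 → c s k = h s + h (s.mv k) := by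
  have hsym : ∀ s k, SR s0 s → k ∉ Set.range s.2 → c (s.mv k) (opf D s.1 k) = c s k := by
    intro s k hs hk
    obtain ⟨κ, hκ, hne⟩ := Enh.exists_off (d := 2) (by norm_num) s.2 k
    rw [hc s k κ hκ hs hk hne, hc (s.mv k) (opf D s.1 k) (D.glue (s.1, k) κ) (St.mv_notMem hκ) (hs.tail ⟨k, hk, rfl⟩)
      (St.op_notMem hk) (by rw [← glue_opf]; exact fun e => hne ((D.glue _).injective e))]
    rw [← St.addv_mv s κ hκ k, show ((s.addv κ hκ).mv k).mv (opf D s.1 k) = _ from St.mv_mv (s.addv κ hκ) k, add_comm]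
  set En := cocEnh s0 c hsym with hEn
  have hmvE : ∀ (s : {s : St D 2 // SR s0 s}) (a : ZMod 2) k (h : k ∉ Set.range s.1.2),
      En.mv (s, a) k = (⟨s.1.mv k, s.2.tail ⟨k, h, rfl⟩⟩, a + c s.1 k) := fun s a k h => dif_pos h
  have hdet : ∀ q : En.S, ¬ En.R q (En.deck q) := by
    intro q
    refine En.det hloc le_rfl (ζ := -1) (IsPrimitiveRoot.neg_one 0 (by norm_num)) le_rfl (by norm_num)
      ![1/3, 2/3] ?_ ?_ rfl q ?_ ?_ 0 ?_
      ((2:ℝ) • lproj 0 - lproj 1) ?_ ?_ ?_ ![1, -1] ?_ rfl ?_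
    · intro a; fin_cases a <;> norm_num
    · simp [Fin.sum_univ_two]; norm_num
    · refine En.free_of le_rfl q ?_ ?_
      · rintro ⟨s, a⟩ i h
        have := congrArg Prod.snd ((cocEnh_deck s0 c hsym i s a).symm.trans h)
        have h2 : (i : ZMod 2) = 0 := by simpa using this
        exact (ZMod.natCast_eq_zero_iff i 2).1 h2
      · rintro - ⟨s, a⟩ κ i - hκ hER
        have key : ∀ b, En.ER ((s, a), {κ}) b → ∃ (κ' : Fin 5) (h' : κ' ∉ Set.range (En.pi b.1).2), b.2 = {κ'} ∧
            b.1.2 + g ((En.pi b.1).addv κ' h') = a + g (s.1.addv κ hκ) := by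
          intro b hb
          induction hb with
          | refl => exact ⟨κ, hκ, rfl, rfl⟩
          | @tail b b' _ h ih =>
            obtain ⟨κ', h', hb, hS⟩ := ih
            obtain ⟨k, h1, h2, rfl⟩ := h
            obtain ⟨⟨t, a'⟩, A⟩ := b
            have h3 : κ' ≠ k := by rintro rfl; exact h2 (by rw [hb]; simp)
            have hm := hmvE t a' k h1
            refine ⟨D.glue (t.1.1, k) κ', ?_, ?_, ?_⟩
            · rw [En.pi_mv _ _ h1]; exact St.mv_notMem h'
            · simp only at hb; simp [hb]; rfl
            · rw [← hS]
              have h4 := hc t.1 k κ' h' t.2 h1 h3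
              rw [St.addv_mv t.1 κ' h' k] at h4
              simp only [hm]
              show a' + c t.1 k + g ((t.1.mv k).addv _ _) = a' + g (t.1.addv κ' h')
              have alg : ∀ x y z w : ZMod 2, x = y + z → w + x + z = w + y := by decide
              exact alg _ _ _ _ h4
        obtain ⟨κ', h', h1, h2⟩ := key _ hER
        have h1 : κ' = κ := by simpa using h1.symm
        subst h1
        have hdk := cocEnh_deck s0 c hsym i s a
        have gen : ∀ (b : En.S), b = (s, a + i) → ∀ h', b.2 + g ((En.pi b).addv κ' h') = a + g (s.1.addv κ' hκ) → (i : ZMod 2) = 0 := by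
          rintro b rfl h' h2
          have h3 : a + i + g (s.1.addv κ' hκ) = a + g (s.1.addv κ' hκ) := h2
          have := add_right_cancel h3
          simpa using this
        exact (ZMod.natCast_eq_zero_iff i 2).1 (gen _ hdk _ h2)
    · rintro ⟨t, a⟩ ⟨t', a'⟩ π _ _ h1 h2 hx
      have hπ : π = 1 := by
        have h3 : π 0 = 0 := by
          have := congrFun hx 0
          simp only [Function.comp] at this
          generalize π 0 = b at this ⊢
          fin_cases b <;> simp at this ⊢
          norm_num at this
        revert h3; clear hx h2; revert π; decide
      subst hπ
      have h4 : t' = t := Subtype.ext (Prod.ext h1 h2)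
      refine ⟨(a' - a).val, ?_⟩
      rw [show En.deck^[(a' - a).val] (t, a) = _ from cocEnh_deck s0 c hsym _ t a, h4]
      simp; rfl
    · intro v; simp
    · intro v; rfl
    · simp; norm_num
    · intro v h1 _ h3
      simp at h3
      rw [Fin.sum_univ_two] at h1
      ext a; fin_cases a <;> simp <;> linarith
    · simp [Fin.sum_univ_two]
    · left; simp; norm_num
  have hRs : ∀ q q', En.R q q' → En.R q' q := by
    have : Std.Symm (fun s s' : En.S => ∃ k, k ∉ Set.range (En.pi s).2 ∧ s' = En.mv s k) := ⟨by
      rintro s _ ⟨k, hk, rfl⟩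
      refine ⟨opf D (En.pi s).1 k, ?_, (En.mv_mv _ _ hk).symm⟩
      rw [En.pi_mv _ _ hk]; exact St.op_notMem hk⟩
    intro q q' h
    exact Relation.ReflTransGen.stdSymm.symm _ _ h
  -- the primitive
  have hex : ∀ s, SR s0 s → ∃ hs : SR s0 s, ∃ a, En.R (⟨s0, .refl⟩, 0) (⟨s, hs⟩, a) := by
    intro s hs
    induction hs with
    | refl => exact ⟨.refl, 0, .refl⟩
    | @tail s s' _ h ih =>
      obtain ⟨hs, a, ha⟩ := ih
      obtain ⟨k, hk, rfl⟩ := h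
      exact ⟨hs.tail ⟨k, hk, rfl⟩, a + c s k, ha.tail ⟨k, hk, (hmvE ⟨s, hs⟩ a k hk).symm⟩⟩
  have huniq : ∀ s (hs : SR s0 s) a b, En.R (⟨s0, .refl⟩, 0) (⟨s, hs⟩, a) → En.R (⟨s0, .refl⟩, 0) (⟨s, hs⟩, b) → b = a := by
    intro s hs a b ha hb
    by_contra hne
    have h1 : b = a + 1 := by
      clear ha hb; revert hne; revert a b; decide
    subst h1
    exact hdet (⟨s, hs⟩, a) ((hRs _ _ ha).trans hb)
  refine ⟨fun s => if hs : SR s0 s then (hex s hs).choose_spec.choose else 0, ?_⟩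
  intro s k hs hk
  have hs' : SR s0 (s.mv k) := hs.tail ⟨k, hk, rfl⟩
  simp only [dif_pos hs, dif_pos hs']
  have h1 := (hex s hs).choose_spec.choose_spec
  have h2 := (hex _ hs').choose_spec.choose_spec
  have h3 := huniq _ hs' _ _ (h1.tail ⟨k, hk, (hmvE ⟨s, hs⟩ _ k hk).symm⟩) h2
  rw [h3, ← add_assoc, CharTwo.add_self_eq_zero, zero_add]

end h1
end FileC7

section FileG1
section geom
open Complex Set

/-- the closed unit disc -/
def DD : Set ℂ := Metric.closedBall 0 1

theorem mem_DD {z : ℂ} : z ∈ DD ↔ ‖z‖ ≤ 1 := by simp [DD]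

/-- boundary parametrisation of the disc by a loop of length `N` -/
def bd (N x : ℝ) : ℂ := Complex.exp ((2 * Real.pi * (x / N) : ℝ) * I)

theorem norm_bd (N x : ℝ) : ‖bd N x‖ = 1 := Complex.norm_exp_ofReal_mul_I _

theorem bd_mem (N x : ℝ) : bd N x ∈ DD := mem_DD.2 (norm_bd N x).le

theorem bd_add (N x y : ℝ) : bd N (x + y) = bd N x * bd N y := by
  unfold bd
  rw [← Complex.exp_add]
  congr 1
  push_cast
  ring

theorem bd_zero (N : ℝ) : bd N 0 = 1 := by simp [bd]

theorem bd_self {N : ℝ} (hN : N ≠ 0) : bd N N = 1 := by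
  unfold bd
  rw [div_self hN]
  simp [Complex.exp_two_pi_mul_I]

theorem bd_ne (N x : ℝ) : bd N x ≠ 0 := by
  intro h; have := norm_bd N x; rw [h] at this; simp at this

theorem bd_neg (N x : ℝ) : bd N (-x) * bd N x = 1 := by rw [← bd_add]; simp [bd_zero]

theorem bd_circle (N x : ℝ) : bd N x = ((AddCircle.toCircle (x : AddCircle N) : Circle) : ℂ) := by
  rw [AddCircle.toCircle_apply_mk, Circle.coe_exp]
  unfold bd
  congr 2
  push_cast
  ring

theorem continuous_bd (N : ℝ) : Continuous (bd N) := by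
  unfold bd; fun_prop

theorem bd_inj {N x y : ℝ} (hN : 0 < N) (h : bd N x = bd N y) : ∃ n : ℤ, x = y + n * N := by
  rw [bd_circle, bd_circle] at h
  have h1 := AddCircle.injective_toCircle hN.ne' (Subtype.ext h)
  have h2 : ((x - y : ℝ) : AddCircle N) = 0 := by rw [AddCircle.coe_sub, h1, sub_self]
  obtain ⟨n, hn⟩ := (AddCircle.coe_eq_zero_iff N).1 h2
  exact ⟨n, by rw [zsmul_eq_mul] at hn; linarith⟩

theorem bd_inj' {N x y : ℝ} (hN : 0 < N) (hx : x ∈ Ico 0 N) (hy : y ∈ Ico 0 N) (h : bd N x = bd N y) : x = y := by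
  obtain ⟨n, hn⟩ := bd_inj hN h
  have h1 : (n : ℝ) < 1 := by
    by_contra hh
    push Not at hh
    nlinarith [hx.2, hy.1]
  have h2 : (-1 : ℝ) < n := by
    by_contra hh
    push Not at hh
    nlinarith [hx.1, hy.2]
  have h3 : n = 0 := by
    have : n < 1 := by exact_mod_cast h1
    have : -1 < n := by exact_mod_cast h2
    omega
  rw [h3] at hn
  simpa using hn

theorem bd_surj {N : ℝ} (hN : 0 < N) {z : ℂ} (hz : ‖z‖ = 1) : ∃ x ∈ Ico 0 N, bd N x = z := by
  have : Fact (0 < N) := ⟨hN⟩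
  have h1 := (AddCircle.homeomorphCircle hN.ne').surjective ⟨z, by simpa [Submonoid.unitSphere] using hz⟩
  obtain ⟨a, ha⟩ := h1
  obtain ⟨x, hx, rfl⟩ := (AddCircle.coe_image_Ico_eq N 0).symm ▸ (mem_univ a)
  refine ⟨x, by simpa using hx, ?_⟩
  rw [bd_circle]
  rw [AddCircle.homeomorphCircle_apply] at ha
  rw [ha]

theorem inv_cont {A B : Type*} [Nonempty A] [TopologicalSpace A] [TopologicalSpace B] [T2Space B] {K : Set A} (hK : IsCompact K) {G : A → B}
    (hG : ContinuousOn G K) (hinj : InjOn G K) : ContinuousOn (Function.invFunOn G K) (G '' K) := by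
  rw [continuousOn_iff_continuous_domRestrict]
  have : CompactSpace K := isCompact_iff_compactSpace.1 hK
  let e : K ≃ (G '' K) := Equiv.Set.imageOfInjOn G K hinj
  have he : Continuous e := by
    refine Continuous.subtype_mk ?_ _
    exact continuousOn_iff_continuous_domRestrict.1 hG
  have h2 := (Continuous.homeoOfEquivCompactToT2 he).symm.continuous
  have h3 := continuous_subtype_val.comp h2
  convert h3 using 1
  ext ⟨_, z, hz, rfl⟩
  have h4 : e.symm ⟨G z, z, hz, rfl⟩ = ⟨z, hz⟩ := by
    rw [Equiv.symm_apply_eq]; rfl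
  show Function.invFunOn G K (G z) = (e.symm ⟨G z, z, hz, rfl⟩ : A)
  rw [h4]
  exact hinj.leftInvOn_invFunOn hz


/-- radial homeomorphism from the disc to a convex body with prescribed boundary values -/
theorem cone {φ : ℂ → ℝ} (hφ : Continuous φ)
    (hcv : ∀ z w : ℂ, ∀ r ∈ Icc (0:ℝ) 1, (1 - r) * φ z + r * φ w ≤ φ (z + r * (w - z)))
    {c : ℂ} (hc : 0 < φ c) {M : ℝ} (hb : ∀ z, 0 ≤ φ z → ‖z‖ ≤ M) {N : ℝ} (hN : 0 < N) {l : ℝ → ℂ}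
    (hl : ContinuousOn l (Icc 0 N)) (h0 : l 0 = l N) (hinj : InjOn l (Ico 0 N))
    (hφl : ∀ x ∈ Icc 0 N, φ (l x) = 0) (hsurj : ∀ z, φ z = 0 → ∃ x ∈ Icc 0 N, l x = z) :
    ∃ G G' : ℂ → ℂ, ContinuousOn G DD ∧ ContinuousOn G' {z | 0 ≤ φ z} ∧ (∀ z ∈ DD, 0 ≤ φ (G z)) ∧
      (∀ w, 0 ≤ φ w → G' w ∈ DD) ∧ (∀ z ∈ DD, G' (G z) = z) ∧ (∀ w, 0 ≤ φ w → G (G' w) = w) ∧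
      ∀ x ∈ Icc 0 N, G (bd N x) = l x := by
  have : Fact (0 < N) := ⟨hN⟩
  let L0 : AddCircle N → ℂ := AddCircle.liftIco N 0 l
  have hL0 : Continuous L0 := AddCircle.liftIco_continuous (by simpa using h0) (by simpa using hl)
  have hL0x : ∀ x ∈ Icc 0 N, L0 (x : AddCircle N) = l x := by
    intro x hx
    rcases hx.2.lt_or_eq with h | h
    · exact AddCircle.liftIco_coe_apply (by simpa using ⟨hx.1, h⟩)
    · subst h
      have : ((x : ℝ) : AddCircle x) = ((0 : ℝ) : AddCircle x) := by simp
      rw [this, ← h0]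
      exact AddCircle.liftIco_coe_apply (by simpa using hN)
  let e := AddCircle.homeomorphCircle hN.ne'
  let L : Circle → ℂ := fun q => L0 (e.symm q)
  have hL : Continuous L := hL0.comp e.symm.continuous
  have hLx : ∀ q : Circle, ∀ x ∈ Icc 0 N, bd N x = q → L q = l x := by
    intro q x hx hq
    have : e.symm q = (x : AddCircle N) := by
      rw [Homeomorph.symm_apply_eq]
      apply Subtype.ext
      show (q : ℂ) = (e (x : AddCircle N) : Circle)
      rw [← hq, bd_circle, ← AddCircle.homeomorphCircle_apply hN.ne']
    show L0 (e.symm q) = l x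
    rw [this, hL0x x hx]
  have hLe : ∀ q : Circle, ∃ x ∈ Ico 0 N, bd N x = q := fun q => bd_surj hN (Circle.norm_coe q)
  have hφL : ∀ q, φ (L q) = 0 := by
    intro q
    obtain ⟨x, hx, hq⟩ := hLe q
    rw [hLx q x (Ico_subset_Icc_self hx) hq]
    exact hφl x (Ico_subset_Icc_self hx)
  have hLinj : Function.Injective L := by
    intro q q' h
    obtain ⟨x, hx, hq⟩ := hLe q
    obtain ⟨x', hx', hq'⟩ := hLe q'
    rw [hLx q x (Ico_subset_Icc_self hx) hq, hLx q' x' (Ico_subset_Icc_self hx') hq'] at h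
    have := hinj hx hx' h
    apply Subtype.ext
    rw [← hq, ← hq', this]
  have hLsurj : ∀ z, φ z = 0 → ∃ q, L q = z := by
    intro z hz
    obtain ⟨x, hx, rfl⟩ := hsurj z hz
    exact ⟨_, hLx _ x hx (bd_circle N x)⟩
  -- the radial map
  let u : ℂ → Circle := fun z => Circle.exp (Complex.arg z)
  have huz : ∀ z : ℂ, (‖z‖ : ℂ) * (u z : ℂ) = z := by
    intro z
    show (‖z‖ : ℂ) * (Circle.exp (Complex.arg z) : ℂ) = z
    rw [Circle.coe_exp]
    exact Complex.norm_mul_exp_arg_mul_I z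
  have huc : ∀ z : ℂ, z ≠ 0 → ContinuousAt u z := by
    intro z hz
    have hind : Topology.IsInducing (fun q : Circle => (q : ℂ)) := ⟨rfl⟩
    rw [hind.continuousAt_iff]
    have h1 : ContinuousAt (fun w : ℂ => w / (‖w‖ : ℂ)) z := by
      apply ContinuousAt.div continuousAt_id
      · fun_prop
      · simpa using hz
    refine h1.congr ?_
    filter_upwards [isOpen_ne.mem_nhds hz] with w hw
    have : (‖w‖ : ℂ) ≠ 0 := by simpa using hw
    show w / (‖w‖ : ℂ) = (u w : ℂ)
    rw [div_eq_iff this, mul_comm]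
    exact (huz w).symm
  have huq : ∀ (q : Circle) (r : ℝ), 0 < r → u (r * q) = q := by
    intro q r hr
    have h1 := huz (r * q)
    apply Subtype.ext
    have h2 : ‖(r * q : ℂ)‖ = r := by rw [norm_mul, Circle.norm_coe]; simp [abs_of_pos hr]
    rw [h2] at h1
    have : (r : ℂ) ≠ 0 := by exact_mod_cast hr.ne'
    exact mul_left_cancel₀ this h1
  let G : ℂ → ℂ := fun z => c + ‖z‖ * (L (u z) - c)
  have hGc : Continuous G := by
    rw [continuous_iff_continuousAt]
    intro z
    by_cases hz : z = 0
    · subst hz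
      have hM : ∀ z, ‖G z - c‖ ≤ ‖z‖ * (M + ‖c‖) := by
        intro z
        have : G z - c = ‖z‖ * (L (u z) - c) := by simp [G]
        rw [this, norm_mul]
        simp only [Complex.norm_real, norm_norm]
        refine mul_le_mul_of_nonneg_left ?_ (norm_nonneg _)
        refine (norm_sub_le _ _).trans ?_
        have := hb _ (hφL (u z)).ge
        linarith
      have hG0 : G 0 = c := by simp [G]
      rw [ContinuousAt, hG0, tendsto_iff_norm_sub_tendsto_zero]
      refine squeeze_zero (fun _ => norm_nonneg _) hM ?_
      have : Continuous fun z : ℂ => ‖z‖ * (M + ‖c‖) := by fun_prop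
      simpa using this.tendsto 0
    · have h1 : ContinuousAt (fun z => L (u z)) z := hL.continuousAt.comp (huc z hz)
      have h2 : ContinuousAt (fun z : ℂ => (‖z‖ : ℂ)) z := by fun_prop
      exact continuousAt_const.add (h2.mul (h1.sub continuousAt_const))
  have hstar : ∀ (b : ℂ) (r : ℝ), φ b = 0 → 0 ≤ r → r < 1 → 0 < φ (c + r * (b - c)) := by
    intro b r hb h1 h2
    have := hcv c b r ⟨h1, h2.le⟩
    rw [hb] at this
    nlinarith
  have hGK : ∀ z ∈ DD, 0 ≤ φ (G z) := by
    intro z hz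
    have := hcv c (L (u z)) ‖z‖ ⟨norm_nonneg _, mem_DD.1 hz⟩
    rw [hφL] at this
    have h2 := mem_DD.1 hz
    have : (1 - ‖z‖) * φ c ≤ φ (G z) := by simpa using this
    nlinarith
  have hne : ∀ b, φ b = 0 → b - c ≠ 0 := by
    intro b hb h
    rw [sub_eq_zero] at h
    rw [h] at hb; linarith
  have hlt : ∀ z z' : ℂ, G z = G z' → ¬ ‖z‖ < ‖z'‖ := by
    intro z z' h hlt
    have hz' : 0 < ‖z'‖ := (norm_nonneg _).trans_lt hlt
    have h1 : (‖z‖ : ℂ) * (L (u z) - c) = ‖z'‖ * (L (u z') - c) := add_left_cancel h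
    have hz'c : (‖z'‖ : ℂ) ≠ 0 := by exact_mod_cast hz'.ne'
    have h2 : L (u z') = c + ((‖z‖ / ‖z'‖ : ℝ) : ℂ) * (L (u z) - c) := by
      push_cast
      field_simp
      linear_combination -h1
    have h3 := hstar (L (u z)) (‖z‖ / ‖z'‖) (hφL _) (by positivity) (by rwa [div_lt_one hz'])
    rw [← h2, hφL] at h3
    exact lt_irrefl _ h3
  have hGinj : InjOn G DD := by
    intro z _ z' _ h
    have hn : ‖z‖ = ‖z'‖ := le_antisymm (not_lt.1 (hlt _ _ h.symm)) (not_lt.1 (hlt _ _ h))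
    by_cases hz : ‖z‖ = 0
    · exact (norm_eq_zero.1 hz).trans (norm_eq_zero.1 (hn ▸ hz)).symm
    · have h1 : (‖z‖ : ℂ) * (L (u z) - c) = ‖z'‖ * (L (u z') - c) := add_left_cancel h
      rw [← hn] at h1
      have h2 : (‖z‖ : ℂ) ≠ 0 := by exact_mod_cast hz
      have h3 := hLinj (sub_left_inj.1 (mul_left_cancel₀ h2 h1))
      rw [← huz z, ← huz z', hn, h3]
  have hGsurj : G '' DD = {z | 0 ≤ φ z} := by
    apply Subset.antisymm
    · rintro _ ⟨z, hz, rfl⟩; exact hGK z hz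
    · intro k hk
      have hk : 0 ≤ φ k := hk
      by_cases hkc : k = c
      · exact ⟨0, by simp [mem_DD], by simp [G, hkc]⟩
      have hkc' : 0 < ‖k - c‖ := norm_pos_iff.2 (sub_ne_zero.2 hkc)
      let ψ : ℝ → ℝ := fun t => φ (c + t * (k - c))
      have hψ : Continuous ψ := by fun_prop
      obtain ⟨T, hT1, hT⟩ : ∃ T : ℝ, 1 ≤ T ∧ ψ T < 0 := by
        refine ⟨max 1 ((|M| + ‖c‖ + 1) / ‖k - c‖), le_max_left _ _, ?_⟩
        set T := max 1 ((|M| + ‖c‖ + 1) / ‖k - c‖) with hTd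
        by_contra hh
        push Not at hh
        have h1 := hb _ hh
        have h2 : (|M| + ‖c‖ + 1) / ‖k - c‖ ≤ T := le_max_right _ _
        rw [div_le_iff₀ hkc'] at h2
        have h3 : 0 ≤ T := le_trans zero_le_one (le_max_left _ _)
        have h4 : ‖(T : ℂ) * (k - c)‖ = T * ‖k - c‖ := by rw [norm_mul]; simp [abs_of_nonneg h3]
        have h5 : ‖(T : ℂ) * (k - c)‖ ≤ ‖c + (T : ℂ) * (k - c)‖ + ‖c‖ := by
          have := norm_sub_le (c + (T : ℂ) * (k - c)) c
          simpa using this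
        have := le_abs_self M
        linarith
      have hψ1 : 0 ≤ ψ 1 := by simpa [ψ] using hk
      obtain ⟨t, ht, ht0⟩ : (0:ℝ) ∈ ψ '' Icc 1 T :=
        intermediate_value_Icc' hT1 hψ.continuousOn ⟨hT.le, hψ1⟩
      have htp : 0 < t := lt_of_lt_of_le one_pos ht.1
      obtain ⟨q, hq⟩ := hLsurj _ ht0
      refine ⟨((1 / t : ℝ) : ℂ) * q, ?_, ?_⟩
      · rw [mem_DD]
        have : (1 : ℝ) / t ≤ 1 := by rw [div_le_one htp]; exact ht.1
        rw [norm_mul, Complex.norm_real, Circle.norm_coe, mul_one, Real.norm_eq_abs, abs_of_pos (by positivity)]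
        exact this
      · have h1 : ‖((1 / t : ℝ) : ℂ) * q‖ = 1 / t := by
          rw [norm_mul, Complex.norm_real, Circle.norm_coe, mul_one, Real.norm_eq_abs, abs_of_pos (by positivity)]
        show c + (‖((1 / t : ℝ) : ℂ) * q‖ : ℂ) * (L (u (((1 / t : ℝ) : ℂ) * q)) - c) = k
        rw [h1, huq q _ (by positivity), hq]
        have : (t : ℂ) ≠ 0 := by exact_mod_cast htp.ne'
        push_cast
        field_simp
        ring
  refine ⟨G, Function.invFunOn G DD, hGc.continuousOn, ?_, hGK, ?_, ?_, ?_, ?_⟩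
  · rw [← hGsurj]
    exact inv_cont (isCompact_closedBall _ _) hGc.continuousOn hGinj
  · intro w hw
    have : w ∈ G '' DD := by rw [hGsurj]; exact hw
    exact Function.invFunOn_mem this
  · intro z hz; exact hGinj.leftInvOn_invFunOn hz
  · intro w hw
    have : w ∈ G '' DD := by rw [hGsurj]; exact hw
    exact Function.invFunOn_eq this
  · intro x hx
    show c + (‖bd N x‖ : ℂ) * (L (u (bd N x)) - c) = l x
    have : u (bd N x) = AddCircle.toCircle (x : AddCircle N) := by
      have := huq (AddCircle.toCircle (x : AddCircle N)) 1 one_pos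
      rw [← bd_circle] at this
      simpa using this
    rw [this, hLx _ x hx (bd_circle N x), norm_bd]
    simp

end geom
end FileG1

section FileG2
section geom
open Complex Set

/-- the region between the graphs of `1-|x|` and `-e(1-|x|)` -/
def phiB (e : ℝ) (z : ℂ) : ℝ := min (1 - |z.re| - z.im) (z.im + e * (1 - |z.re|))

theorem phiB_nonneg {e : ℝ} {z : ℂ} : 0 ≤ phiB e z ↔ z.im ≤ 1 - |z.re| ∧ -(e * (1 - |z.re|)) ≤ z.im := by
  unfold phiB
  rw [le_min_iff]
  constructor
  · rintro ⟨h1, h2⟩; constructor <;> linarith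
  · rintro ⟨h1, h2⟩; constructor <;> linarith

theorem phiB_re {e : ℝ} (he : 0 ≤ e) {z : ℂ} (h : 0 ≤ phiB e z) : |z.re| ≤ 1 := by
  obtain ⟨h1, h2⟩ := phiB_nonneg.1 h
  nlinarith

/-- bottom side of the boundary -/
def lowB (e u : ℝ) : ℂ := ⟨u, -(e * (1 - |u|))⟩
/-- top side of the boundary -/
def topB (u : ℝ) : ℂ := ⟨u, 1 - |u|⟩

theorem body {e a N : ℝ} (he : 0 ≤ e) (ha : 0 < a) (haN : a < N) :
    ∃ G G' : ℂ → ℂ, ContinuousOn G DD ∧ ContinuousOn G' {z | 0 ≤ phiB e z} ∧ (∀ z ∈ DD, 0 ≤ phiB e (G z)) ∧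
      (∀ w, 0 ≤ phiB e w → G' w ∈ DD) ∧ (∀ z ∈ DD, G' (G z) = z) ∧ (∀ w, 0 ≤ phiB e w → G (G' w) = w) ∧
      (∀ x ∈ Icc 0 a, G (bd N x) = lowB e (2 * x / a - 1)) ∧
      (∀ x ∈ Icc a N, G (bd N x) = topB (1 - 2 * (x - a) / (N - a))) := by
  have hNa : 0 < N - a := by linarith
  have hN : 0 < N := by linarith
  let l : ℝ → ℂ := fun x => if x ≤ a then lowB e (2 * x / a - 1) else topB (1 - 2 * (x - a) / (N - a))
  have hl1 : ∀ x, x ≤ a → l x = lowB e (2 * x / a - 1) := fun x hx => if_pos hx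
  have hl2 : ∀ x, a ≤ x → l x = topB (1 - 2 * (x - a) / (N - a)) := by
    intro x hx
    rcases hx.lt_or_eq with h | h
    · exact if_neg (not_le.2 h)
    · subst h
      rw [hl1 a le_rfl]
      have : 2 * a / a - 1 = 1 := by field_simp; norm_num
      rw [this]
      simp [lowB, topB]
  have hclow : Continuous (lowB e) := by
    have : lowB e = fun u : ℝ => (u : ℂ) + ((-(e * (1 - |u|)) : ℝ) : ℂ) * I := by
      ext u; simp [lowB, Complex.mk_eq_add_mul_I]
    rw [this]; fun_prop
  have hctop : Continuous topB := by
    have : topB = fun u : ℝ => (u : ℂ) + (((1 - |u|) : ℝ) : ℂ) * I := by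
      ext u; simp [topB, Complex.mk_eq_add_mul_I]
    rw [this]; fun_prop
  have hφc : Continuous (phiB e) := by
    unfold phiB
    fun_prop
  have hlc : Continuous l := by
    apply Continuous.if_le
    · exact hclow.comp (by fun_prop)
    · exact hctop.comp (by fun_prop)
    · fun_prop
    · fun_prop
    · intro x hx
      rw [← hl1 x hx.le, ← hl2 x hx.ge]
  have hr1 : ∀ x ∈ Icc 0 a, |2 * x / a - 1| ≤ 1 := by
    intro x hx
    rw [abs_le]
    have : 2 * x / a ≤ 2 := by rw [div_le_iff₀ ha]; linarith [hx.2]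
    have : 0 ≤ 2 * x / a := by have := hx.1; positivity
    constructor <;> linarith
  have hr2 : ∀ x ∈ Icc a N, |1 - 2 * (x - a) / (N - a)| ≤ 1 := by
    intro x hx
    rw [abs_le]
    have : 2 * (x - a) / (N - a) ≤ 2 := by rw [div_le_iff₀ hNa]; linarith [hx.2]
    have : 0 ≤ 2 * (x - a) / (N - a) := div_nonneg (by linarith [hx.1]) hNa.le
    constructor <;> linarith
  refine Exists.elim (cone (φ := phiB e) (c := ⟨0, 1/2⟩) (M := 2 + e) (N := N) (l := l) hφc ?_ ?_ ?_ hN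
    hlc.continuousOn ?_ ?_ ?_ ?_) ?_
  · intro z w r hr
    have hr0 := hr.1
    have hr1 : 0 ≤ 1 - r := by linarith [hr.2]
    have habs : |z.re + r * (w.re - z.re)| ≤ (1 - r) * |z.re| + r * |w.re| := by
      have : z.re + r * (w.re - z.re) = (1 - r) * z.re + r * w.re := by ring
      rw [this]
      refine (abs_add_le _ _).trans ?_
      rw [abs_mul, abs_mul, abs_of_nonneg hr0, abs_of_nonneg hr1]
    have hre : (z + r * (w - z)).re = z.re + r * (w.re - z.re) := by simp
    have him : (z + r * (w - z)).im = z.im + r * (w.im - z.im) := by simp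
    unfold phiB
    rw [hre, him]
    apply le_min
    · have e1 := mul_le_mul_of_nonneg_left (min_le_left (1 - |z.re| - z.im) (z.im + e * (1 - |z.re|))) hr1
      have e2 := mul_le_mul_of_nonneg_left (min_le_left (1 - |w.re| - w.im) (w.im + e * (1 - |w.re|))) hr0
      linarith
    · have e1 := mul_le_mul_of_nonneg_left (min_le_right (1 - |z.re| - z.im) (z.im + e * (1 - |z.re|))) hr1
      have e2 := mul_le_mul_of_nonneg_left (min_le_right (1 - |w.re| - w.im) (w.im + e * (1 - |w.re|))) hr0
      have e3 := mul_le_mul_of_nonneg_left habs he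
      nlinarith
  · simp only [phiB]
    rw [lt_min_iff]; constructor <;> norm_num
    linarith
  · intro z hz
    have h1 := phiB_re he hz
    obtain ⟨h2, h3⟩ := phiB_nonneg.1 hz
    refine (Complex.norm_le_abs_re_add_abs_im z).trans ?_
    have : |z.im| ≤ 1 + e := by
      rw [abs_le]
      have := abs_nonneg z.re
      constructor <;> nlinarith
    linarith
  · rw [hl1 0 ha.le, hl2 N haN.le]
    have : 2 * (N - a) / (N - a) = 2 := by field_simp
    rw [this]
    norm_num [lowB, topB]
  · intro x hx y hy hxy
    have key : ∀ x y, 0 ≤ x → x ≤ a → a < y → y < N → l x ≠ l y := by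
      intro x y hx0 hx hy hyN h
      rw [hl1 x hx, hl2 y hy.le] at h
      have hre := congrArg Complex.re h
      have him := congrArg Complex.im h
      simp only [lowB, topB] at hre him
      rw [hre] at him
      have hq := hr2 y ⟨hy.le, hyN.le⟩
      have h0 : 0 < 2 * (y - a) / (N - a) := div_pos (by linarith) hNa
      have h2 : 2 * (y - a) / (N - a) < 2 := by rw [div_lt_iff₀ hNa]; linarith
      have : |1 - 2 * (y - a) / (N - a)| < 1 := by rw [abs_lt]; constructor <;> linarith
      nlinarith
    rcases le_or_gt x a with h1 | h1 <;> rcases le_or_gt y a with h2 | h2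
    · rw [hl1 x h1, hl1 y h2] at hxy
      have := congrArg Complex.re hxy
      simp only [lowB] at this
      field_simp at this
      linarith
    · exact absurd hxy (key x y hx.1 h1 h2 hy.2)
    · exact absurd hxy.symm (key y x hy.1 h2 h1 hx.2)
    · rw [hl2 x h1.le, hl2 y h2.le] at hxy
      have := congrArg Complex.re hxy
      simp only [topB] at this
      field_simp at this
      linarith
  · intro x hx
    rcases le_total x a with h1 | h1
    · rw [hl1 x h1]
      have := hr1 x ⟨hx.1, h1⟩
      simp only [phiB, lowB]
      rw [min_eq_right] <;> nlinarith
    · rw [hl2 x h1]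
      have := hr2 x ⟨h1, hx.2⟩
      simp only [phiB, topB]
      rw [min_eq_left] <;> nlinarith
  · intro z hz
    have h1 := phiB_re he hz.ge
    rw [abs_le] at h1
    unfold phiB at hz
    rcases min_choice (1 - |z.re| - z.im) (z.im + e * (1 - |z.re|)) with h | h
    · rw [h] at hz
      refine ⟨a + (N - a) * ((1 - z.re) / 2), ⟨?_, ?_⟩, ?_⟩
      · nlinarith
      · nlinarith
      · rw [hl2 _ (by nlinarith)]
        apply Complex.ext
        · simp only [topB]; field_simp; ring
        · have : 1 - 2 * (a + (N - a) * ((1 - z.re) / 2) - a) / (N - a) = z.re := by field_simp; ring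
          simp only [topB, this]; linarith
    · rw [h] at hz
      have hle : a * ((1 + z.re) / 2) ≤ a := by nlinarith
      refine ⟨a * ((1 + z.re) / 2), ⟨?_, ?_⟩, ?_⟩
      · nlinarith
      · nlinarith
      · rw [hl1 _ hle]
        have : 2 * (a * ((1 + z.re) / 2)) / a - 1 = z.re := by field_simp; ring
        rw [this]
        apply Complex.ext
        · simp only [lowB]
        · simp only [lowB]; linarith
  · rintro G ⟨G', h1, h2, h3, h4, h5, h6, h7⟩
    refine ⟨G, G', h1, h2, h3, h4, h5, h6, ?_, ?_⟩
    · intro x hx; rw [h7 x ⟨hx.1, by linarith [hx.2]⟩, hl1 x hx.2]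
    · intro x hx; rw [h7 x ⟨by linarith [hx.1], hx.2⟩, hl2 x hx.1]

end geom
end FileG2

section FileG3
section geom
open Complex Set

/-- the standard triangle in barycentric coordinates -/
def TT : Set (ℝ × ℝ × ℝ) := {p | 0 ≤ p.1 ∧ 0 ≤ p.2.1 ∧ 0 ≤ p.2.2 ∧ p.1 + p.2.1 + p.2.2 = 1}

theorem merge0 {N : ℝ} (hN : 2 ≤ N) : ∃ (f : ℂ → ℂ) (f' : ℝ × ℝ × ℝ → ℂ),
    ContinuousOn f DD ∧ ContinuousOn f' TT ∧ (∀ z ∈ DD, f z ∈ DD) ∧ (∀ y ∈ TT, f' y ∈ DD) ∧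
    InjOn f DD ∧ InjOn f' TT ∧ (∀ w ∈ DD, (∃ z ∈ DD, f z = w) ∨ ∃ y ∈ TT, f' y = w) ∧
    (∀ x ∈ Icc 1 N, f (bd N x) = bd (N + 1) (x + 1)) ∧
    (∀ t ∈ Icc (0:ℝ) 1, f' (1 - t, 0, t) = bd (N + 1) t) ∧
    (∀ t ∈ Icc (0:ℝ) 1, f' (0, t, 1 - t) = bd (N + 1) (1 + t)) ∧
    (∀ t ∈ Icc (0:ℝ) 1, f (bd N t) = f' (1 - t, t, 0)) ∧
    (∀ z ∈ DD, ∀ y ∈ TT, f z = f' y → ∃ t ∈ Icc (0:ℝ) 1, z = bd N t ∧ y = (1 - t, t, 0)) := by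
  obtain ⟨G, G', cG, cG', mG, mG', GG', G'G, Gl, Gt⟩ := body (e := 0) (a := 1) (N := N) le_rfl one_pos (by linarith)
  obtain ⟨H, H', cH, cH', mH, mH', HH', H'H, Hl, Ht⟩ := body (e := 1) (a := 2) (N := N + 1) zero_le_one two_pos (by linarith)
  have sub : ∀ w, 0 ≤ phiB 0 w → 0 ≤ phiB 1 w := by
    intro w hw
    have h1 := phiB_re le_rfl hw
    have h2 := phiB_nonneg.1 hw
    exact phiB_nonneg.2 ⟨h2.1, by linarith [h2.2]⟩
  have im0 : ∀ w, 0 ≤ phiB 0 w → 0 ≤ w.im := by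
    intro w hw
    have h2 := (phiB_nonneg.1 hw).2
    linarith
  let L : ℝ × ℝ × ℝ → ℂ := fun y => ⟨y.2.1 - y.1, -y.2.2⟩
  have hLc : Continuous L := by
    have : L = fun y => ((y.2.1 - y.1 : ℝ) : ℂ) + ((-y.2.2 : ℝ) : ℂ) * I := by
      ext y; simp [L, Complex.mk_eq_add_mul_I]
    rw [this]; fun_prop
  have hL : ∀ y ∈ TT, 0 ≤ phiB 1 (L y) := by
    rintro ⟨a, b, c⟩ ⟨h1, h2, h3, h4⟩
    simp only at h1 h2 h3 h4
    have : |b - a| ≤ a + b := by rw [abs_le]; constructor <;> linarith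
    refine phiB_nonneg.2 ⟨?_, ?_⟩ <;> simp only [L] <;> linarith
  have injH' : ∀ w w', 0 ≤ phiB 1 w → 0 ≤ phiB 1 w' → H' w = H' w' → w = w' := by
    intro w w' hw hw' h
    rw [← H'H w hw, ← H'H w' hw', h]
  have injG : InjOn G DD := by
    intro z hz z' hz' h
    rw [← GG' z hz, ← GG' z' hz', h]
  have Gt0 : ∀ t ∈ Icc (0:ℝ) 1, G (bd N t) = ⟨2 * t - 1, 0⟩ := by
    intro t ht
    rw [Gl t ht]
    simp [lowB]
  refine ⟨fun z => H' (G z), fun y => H' (L y), ?_, ?_, ?_, ?_, ?_, ?_, ?_, ?_, ?_, ?_, ?_, ?_⟩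
  · exact cH'.comp cG (fun z hz => sub _ (mG z hz))
  · exact cH'.comp hLc.continuousOn hL
  · exact fun z hz => mH' _ (sub _ (mG z hz))
  · exact fun y hy => mH' _ (hL y hy)
  · intro z hz z' hz' h
    exact injG hz hz' (injH' _ _ (sub _ (mG z hz)) (sub _ (mG z' hz')) h)
  · intro y hy y' hy' h
    have h := injH' _ _ (hL y hy) (hL y' hy') h
    have hre := congrArg Complex.re h
    have him := congrArg Complex.im h
    simp only [L] at hre him
    have e1 := hy.2.2.2
    have e2 := hy'.2.2.2
    refine Prod.ext ?_ (Prod.ext ?_ ?_) <;> linarith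
  · intro w hw
    have hb := mH w hw
    by_cases hi : 0 ≤ (H w).im
    · left
      have h0 : 0 ≤ phiB 0 (H w) := phiB_nonneg.2 ⟨(phiB_nonneg.1 hb).1, by simpa using hi⟩
      refine ⟨G' (H w), mG' _ h0, ?_⟩
      show H' (G (G' (H w))) = w
      rw [G'G _ h0, HH' w hw]
    · right
      push Not at hi
      have h2 := (phiB_nonneg.1 hb).2
      have h3 : |(H w).re| ≤ 1 + (H w).im := by linarith
      rw [abs_le] at h3
      refine ⟨((1 + (H w).im - (H w).re) / 2, (1 + (H w).im + (H w).re) / 2, -(H w).im), ⟨?_, ?_, ?_, ?_⟩, ?_⟩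
      · show 0 ≤ (1 + (H w).im - (H w).re) / 2
        linarith
      · show 0 ≤ (1 + (H w).im + (H w).re) / 2
        linarith
      · show 0 ≤ -(H w).im
        linarith
      · show (1 + (H w).im - (H w).re) / 2 + (1 + (H w).im + (H w).re) / 2 + -(H w).im = 1
        ring
      · have : L ((1 + (H w).im - (H w).re) / 2, (1 + (H w).im + (H w).re) / 2, -(H w).im) = H w := by
          apply Complex.ext <;> simp only [L] <;> ring
        show H' (L _) = w
        rw [this, HH' w hw]
  · intro x hx
    show H' (G (bd N x)) = _
    rw [Gt x hx]
    have := Ht (x + 1) ⟨by linarith [hx.1], by linarith [hx.2]⟩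
    have e : (1 - 2 * (x + 1 - 2) / (N + 1 - 2) : ℝ) = 1 - 2 * (x - 1) / (N - 1) := by
      congr 2 <;> ring
    rw [e] at this
    rw [← this, HH' _ (bd_mem _ _)]
  · intro t ht
    have := Hl t ⟨ht.1, by linarith [ht.2]⟩
    show H' (L _) = _
    have e : L (1 - t, 0, t) = lowB 1 (2 * t / 2 - 1) := by
      have : |2 * t / 2 - 1| = 1 - t := by
        rw [abs_of_nonpos] <;> linarith [ht.2]
      apply Complex.ext
      · simp [L, lowB]
      · simp [L, lowB, this]
        rw [abs_of_nonpos (by linarith [ht.2])]; ring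
    rw [e, ← this, HH' _ (bd_mem _ _)]
  · intro t ht
    have := Hl (1 + t) ⟨by linarith [ht.1], by linarith [ht.2]⟩
    show H' (L _) = _
    have e : L (0, t, 1 - t) = lowB 1 (2 * (1 + t) / 2 - 1) := by
      have : 2 * (1 + t) / 2 - 1 = t := by ring
      rw [this]
      apply Complex.ext
      · simp [L, lowB]
      · simp [L, lowB, abs_of_nonneg ht.1]
    rw [e, ← this, HH' _ (bd_mem _ _)]
  · intro t ht
    show H' (G (bd N t)) = H' (L _)
    rw [Gt0 t ht]
    congr 1
    apply Complex.ext
    · simp only [L]; ring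
    · simp [L]
  · intro z hz y hy h
    have h := injH' _ _ (sub _ (mG z hz)) (hL y hy) h
    have hi := im0 _ (mG z hz)
    have e := hy.2.2.2
    have h3 := hy.2.2.1
    have him : (G z).im = -y.2.2 := congrArg Complex.im h
    have hc : y.2.2 = 0 := by linarith
    refine ⟨y.2.1, ⟨hy.2.1, by linarith [hy.1]⟩, ?_, ?_⟩
    · have ht : y.2.1 ∈ Icc (0:ℝ) 1 := ⟨hy.2.1, by linarith [hy.1]⟩
      apply injG hz (bd_mem _ _)
      rw [Gt0 _ ht, h]
      apply Complex.ext
      · simp only [L]; linarith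
      · simp [L, hc]
    · refine Prod.ext ?_ (Prod.ext rfl hc)
      show y.1 = 1 - y.2.1
      linarith

theorem merge {N i : ℝ} (hN : 2 ≤ N) (hi0 : 0 ≤ i) (hi : i + 1 ≤ N) : ∃ (f : ℂ → ℂ) (f' : ℝ × ℝ × ℝ → ℂ),
    ContinuousOn f DD ∧ ContinuousOn f' TT ∧ (∀ z ∈ DD, f z ∈ DD) ∧ (∀ y ∈ TT, f' y ∈ DD) ∧
    InjOn f DD ∧ InjOn f' TT ∧ (∀ w ∈ DD, (∃ z ∈ DD, f z = w) ∨ ∃ y ∈ TT, f' y = w) ∧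
    (∀ x ∈ Icc 0 i, f (bd N x) = bd (N + 1) x) ∧
    (∀ x ∈ Icc (i + 1) N, f (bd N x) = bd (N + 1) (x + 1)) ∧
    (∀ t ∈ Icc (0:ℝ) 1, f' (1 - t, 0, t) = bd (N + 1) (i + t)) ∧
    (∀ t ∈ Icc (0:ℝ) 1, f' (0, t, 1 - t) = bd (N + 1) (i + 1 + t)) ∧
    (∀ t ∈ Icc (0:ℝ) 1, f (bd N (i + t)) = f' (1 - t, t, 0)) ∧
    (∀ z ∈ DD, ∀ y ∈ TT, f z = f' y → ∃ t ∈ Icc (0:ℝ) 1, z = bd N (i + t) ∧ y = (1 - t, t, 0)) := by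
  obtain ⟨f, f', h1, h2, h3, h4, h5, h6, h7, h8, h9, h10, h11, h12⟩ := merge0 hN
  have mulD : ∀ M x, ∀ z ∈ DD, bd M x * z ∈ DD := by
    intro M x z hz
    rw [mem_DD] at *
    rwa [norm_mul, norm_bd, one_mul]
  have rot : ∀ x, bd N (-i) * bd N x = bd N (x - i) := by
    intro x; rw [← bd_add]; congr 1; ring
  have N0 : N ≠ 0 := by linarith
  have N1 : N + 1 ≠ 0 := by linarith
  refine ⟨fun z => bd (N + 1) i * f (bd N (-i) * z), fun y => bd (N + 1) i * f' y, ?_, ?_, ?_, ?_, ?_, ?_, ?_, ?_, ?_, ?_, ?_, ?_, ?_⟩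
  · exact continuousOn_const.mul (h1.comp (by fun_prop) (fun z hz => mulD _ _ z hz))
  · exact continuousOn_const.mul h2
  · exact fun z hz => mulD _ _ _ (h3 _ (mulD _ _ _ hz))
  · exact fun y hy => mulD _ _ _ (h4 _ hy)
  · intro z hz z' hz' h
    have := h5 (mulD _ _ _ hz) (mulD _ _ _ hz') (mul_left_cancel₀ (bd_ne _ _) h)
    exact mul_left_cancel₀ (bd_ne _ _) this
  · intro y hy y' hy' h
    exact h6 hy hy' (mul_left_cancel₀ (bd_ne _ _) h)
  · intro w hw
    have e : bd (N + 1) i * (bd (N + 1) (-i) * w) = w := by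
      rw [← mul_assoc, mul_comm (bd (N+1) i), bd_neg, one_mul]
    rcases h7 _ (mulD (N + 1) (-i) w hw) with ⟨z, hz, hh⟩ | ⟨y, hy, hh⟩
    · left
      refine ⟨bd N i * z, mulD _ _ _ hz, ?_⟩
      show bd (N + 1) i * f (bd N (-i) * (bd N i * z)) = w
      rw [← mul_assoc, bd_neg, one_mul, hh, e]
    · right
      refine ⟨y, hy, ?_⟩
      show bd (N + 1) i * f' y = w
      rw [hh, e]
  · intro x hx
    show bd (N + 1) i * f (bd N (-i) * bd N x) = _
    rw [rot]
    have e : bd N (x - i) = bd N (x - i + N) := by rw [bd_add N _ N, bd_self N0, mul_one]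
    rw [e, h8 _ ⟨by linarith [hx.1], by linarith [hx.2]⟩, ← bd_add]
    have : i + (x - i + N + 1) = x + (N + 1) := by ring
    rw [this, bd_add, bd_self N1, mul_one]
  · intro x hx
    show bd (N + 1) i * f (bd N (-i) * bd N x) = _
    rw [rot, h8 _ ⟨by linarith [hx.1], by linarith [hx.2]⟩, ← bd_add]
    congr 1; ring
  · intro t ht
    show bd (N + 1) i * f' _ = _
    rw [h9 t ht, ← bd_add]
  · intro t ht
    show bd (N + 1) i * f' _ = _
    rw [h10 t ht, ← bd_add]
    congr 1; ring
  · intro t ht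
    show bd (N + 1) i * f (bd N (-i) * bd N (i + t)) = bd (N + 1) i * f' _
    rw [rot, add_sub_cancel_left, h11 t ht]
  · intro z hz y hy h
    obtain ⟨t, ht, h1, h2⟩ := h12 _ (mulD _ _ _ hz) y hy (mul_left_cancel₀ (bd_ne _ _) h)
    refine ⟨t, ht, ?_, h2⟩
    apply mul_left_cancel₀ (bd_ne N (-i))
    rw [h1, rot]
    congr 1; ring

/-- the triangle as a disc -/
theorem baseTri : ∃ f : ℝ × ℝ × ℝ → ℂ, ContinuousOn f TT ∧ (∀ y ∈ TT, f y ∈ DD) ∧ InjOn f TT ∧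
    (∀ w ∈ DD, ∃ y ∈ TT, f y = w) ∧
    (∀ t ∈ Icc (0:ℝ) 1, f (1 - t, t, 0) = bd 3 t) ∧
    (∀ t ∈ Icc (0:ℝ) 1, f (0, 1 - t, t) = bd 3 (1 + t)) ∧
    (∀ t ∈ Icc (0:ℝ) 1, f (t, 0, 1 - t) = bd 3 (2 + t)) := by
  obtain ⟨H, H', cH, cH', mH, mH', HH', H'H, Hl, Ht⟩ := body (e := 0) (a := 1) (N := 3) le_rfl one_pos (by norm_num)
  let L : ℝ × ℝ × ℝ → ℂ := fun y => ⟨y.2.1 - y.1, y.2.2⟩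
  have hLc : Continuous L := by
    have : L = fun y => ((y.2.1 - y.1 : ℝ) : ℂ) + ((y.2.2 : ℝ) : ℂ) * I := by
      ext y; simp [L, Complex.mk_eq_add_mul_I]
    rw [this]; fun_prop
  have hL : ∀ y ∈ TT, 0 ≤ phiB 0 (L y) := by
    rintro ⟨a, b, c⟩ ⟨h1, h2, h3, h4⟩
    simp only at h1 h2 h3 h4
    have : |b - a| ≤ a + b := by rw [abs_le]; constructor <;> linarith
    refine phiB_nonneg.2 ⟨?_, ?_⟩ <;> simp only [L] <;> linarith
  have injH' : ∀ w w', 0 ≤ phiB 0 w → 0 ≤ phiB 0 w' → H' w = H' w' → w = w' := by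
    intro w w' hw hw' h
    rw [← H'H w hw, ← H'H w' hw', h]
  refine ⟨fun y => H' (L y), cH'.comp hLc.continuousOn hL, fun y hy => mH' _ (hL y hy), ?_, ?_, ?_, ?_, ?_⟩
  · intro y hy y' hy' h
    have h := injH' _ _ (hL y hy) (hL y' hy') h
    have hre := congrArg Complex.re h
    have him := congrArg Complex.im h
    simp only [L] at hre him
    have e1 := hy.2.2.2
    have e2 := hy'.2.2.2
    refine Prod.ext ?_ (Prod.ext ?_ ?_) <;> linarith
  · intro w hw
    have hb := mH w hw
    have h2 := phiB_nonneg.1 hb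
    have h3 : |(H w).re| ≤ 1 - (H w).im := by linarith [h2.1]
    rw [abs_le] at h3
    refine ⟨((1 - (H w).im - (H w).re) / 2, (1 - (H w).im + (H w).re) / 2, (H w).im), ⟨?_, ?_, ?_, ?_⟩, ?_⟩
    · show 0 ≤ (1 - (H w).im - (H w).re) / 2
      linarith
    · show 0 ≤ (1 - (H w).im + (H w).re) / 2
      linarith
    · show 0 ≤ (H w).im
      linarith [h2.2]
    · show (1 - (H w).im - (H w).re) / 2 + (1 - (H w).im + (H w).re) / 2 + (H w).im = 1
      ring
    · have : L ((1 - (H w).im - (H w).re) / 2, (1 - (H w).im + (H w).re) / 2, (H w).im) = H w := by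
        apply Complex.ext
        · simp only [L]; ring
        · simp only [L]
      show H' (L _) = w
      rw [this, HH' w hw]
  · intro t ht
    show H' (L _) = _
    have e : L (1 - t, t, 0) = lowB 0 (2 * t / 1 - 1) := by
      apply Complex.ext
      · simp only [L, lowB]; ring
      · simp [L, lowB]
    rw [e, ← Hl t ht, HH' _ (bd_mem _ _)]
  · intro t ht
    show H' (L _) = _
    have e : L (0, 1 - t, t) = topB (1 - 2 * (1 + t - 1) / (3 - 1)) := by
      have : (1 - 2 * (1 + t - 1) / (3 - 1) : ℝ) = 1 - t := by ring
      rw [this]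
      apply Complex.ext
      · simp [L, topB]
      · simp only [L, topB]; rw [abs_of_nonneg (by linarith [ht.2])]; ring
    rw [e, ← Ht (1 + t) ⟨by linarith [ht.1], by linarith [ht.2]⟩, HH' _ (bd_mem _ _)]
  · intro t ht
    show H' (L _) = _
    have e : L (t, 0, 1 - t) = topB (1 - 2 * (2 + t - 1) / (3 - 1)) := by
      have : (1 - 2 * (2 + t - 1) / (3 - 1) : ℝ) = - t := by ring
      rw [this]
      apply Complex.ext
      · simp [L, topB]
      · simp only [L, topB]; rw [abs_neg, abs_of_nonneg ht.1]
    rw [e, ← Ht (2 + t) ⟨by linarith [ht.1], by linarith [ht.2]⟩, HH' _ (bd_mem _ _)]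

end geom
end FileG3

section FileG4
section geom
open Complex Set

theorem continuous_polar {A : Type*} [TopologicalSpace A] {p s : A → ℝ} (hp : Continuous p) (hs : Continuous s) :
    Continuous fun z => (p z : ℂ) * bd 2 (s z / p z) := by
  rw [continuous_iff_continuousAt]
  intro z
  by_cases hz : p z = 0
  · rw [ContinuousAt, hz, tendsto_iff_norm_sub_tendsto_zero]
    simp only [Complex.ofReal_zero, zero_mul, sub_zero, norm_mul, norm_bd, mul_one]
    have : Continuous fun z => ‖(p z : ℂ)‖ := by fun_prop
    have := this.tendsto z
    simpa [hz] using this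
  · apply ContinuousAt.mul
    · fun_prop
    · apply (continuous_bd 2).continuousAt.comp
      exact hs.continuousAt.div hp.continuousAt hz

theorem polar_norm {p s : ℝ} (hp : 0 ≤ p) : ‖(p : ℂ) * bd 2 (s / p)‖ = p := by
  rw [norm_mul, norm_bd, mul_one, Complex.norm_real, Real.norm_eq_abs, abs_of_nonneg hp]

theorem polar_eq {p s s' : ℝ} (hp : 0 < p) (h : (p : ℂ) * bd 2 (s / p) = (p : ℂ) * bd 2 (s' / p)) :
    ∃ n : ℤ, s = s' + 2 * n * p := by
  have hp' : (p : ℂ) ≠ 0 := by exact_mod_cast hp.ne'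
  obtain ⟨n, hn⟩ := bd_inj two_pos (mul_left_cancel₀ hp' h)
  refine ⟨n, ?_⟩
  field_simp at hn
  linarith

theorem polar_surj (w : ℂ) (hw : w ≠ 0) (c : ℝ) : ∃ s ∈ Ico c (c + 2 * ‖w‖), (‖w‖ : ℂ) * bd 2 (s / ‖w‖) = w := by
  have hw0 : 0 < ‖w‖ := norm_pos_iff.2 hw
  have hwc : (‖w‖ : ℂ) ≠ 0 := by exact_mod_cast hw0.ne'
  obtain ⟨x, hx, hh⟩ := bd_surj (N := 2) two_pos (z := w / ‖w‖ * bd 2 (-(c / ‖w‖))) (by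
    rw [norm_mul, norm_bd, norm_div]; simp [hw])
  refine ⟨c + x * ‖w‖, ⟨by nlinarith [hx.1], by nlinarith [hx.2]⟩, ?_⟩
  have : (c + x * ‖w‖) / ‖w‖ = x + c / ‖w‖ := by field_simp; ring
  rw [this, bd_add, hh, mul_assoc, bd_neg]
  field_simp

theorem int_case {n : ℤ} (h1 : (-1:ℝ) ≤ n) (h2 : (n:ℝ) ≤ 1) : n = -1 ∨ n = 0 ∨ n = 1 := by
  have a : -1 ≤ n := by exact_mod_cast h1
  have b : n ≤ 1 := by exact_mod_cast h2
  omega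

theorem fold0 {N : ℝ} (hN : 2 < N) : ∃ f : ℂ → ℂ, ContinuousOn f DD ∧ (∀ z ∈ DD, f z ∈ DD) ∧
    (∀ w ∈ DD, ∃ z ∈ DD, f z = w) ∧
    (∀ x ∈ Icc 2 N, f (bd N x) = bd (N - 2) (x - 2)) ∧
    (∀ t ∈ Icc (0:ℝ) 1, f (bd N (1 - t)) = f (bd N (1 + t))) ∧
    (∀ z ∈ DD, ∀ z' ∈ DD, f z = f z' → z = z' ∨ ∃ t ∈ Icc (0:ℝ) 1,
      (z = bd N (1 - t) ∧ z' = bd N (1 + t)) ∨ (z' = bd N (1 - t) ∧ z = bd N (1 + t))) := by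
  obtain ⟨G, G', cG, cG', mG, mG', GG', G'G, Gl, Gt⟩ := body (e := 0) (a := 2) (N := N) le_rfl two_pos hN
  let p : ℂ → ℝ := fun z => |z.re| + z.im
  let q : ℂ → ℂ := fun z => (p z : ℂ) * bd 2 ((p z - z.re) / p z)
  have hpc : Continuous p := by
    show Continuous fun z : ℂ => |z.re| + z.im
    fun_prop
  have hqc : Continuous q := by
    apply continuous_polar hpc
    fun_prop
  have im0 : ∀ w, 0 ≤ phiB 0 w → 0 ≤ w.im := by
    intro w hw
    have h2 := (phiB_nonneg.1 hw).2
    linarith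
  have hp0 : ∀ w, 0 ≤ phiB 0 w → 0 ≤ p w := fun w hw => add_nonneg (abs_nonneg _) (im0 w hw)
  have hp1 : ∀ w, 0 ≤ phiB 0 w → p w ≤ 1 := by
    intro w hw
    have h2 := (phiB_nonneg.1 hw).1
    show |w.re| + w.im ≤ 1
    linarith
  have injG : InjOn G DD := by
    intro z hz z' hz' h
    rw [← GG' z hz, ← GG' z' hz', h]
  have Gm : ∀ t ∈ Icc (0:ℝ) 1, G (bd N (1 - t)) = ⟨-t, 0⟩ := by
    intro t ht
    rw [Gl _ ⟨by linarith [ht.2], by linarith [ht.1]⟩]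
    apply Complex.ext <;> simp [lowB]
  have Gp : ∀ t ∈ Icc (0:ℝ) 1, G (bd N (1 + t)) = ⟨t, 0⟩ := by
    intro t ht
    rw [Gl _ ⟨by linarith [ht.1], by linarith [ht.2]⟩]
    apply Complex.ext <;> simp [lowB]
  refine ⟨fun z => q (G z), hqc.comp_continuousOn cG, ?_, ?_, ?_, ?_, ?_⟩
  · intro z hz
    rw [mem_DD]
    show ‖(p (G z) : ℂ) * bd 2 _‖ ≤ 1
    rw [polar_norm (hp0 _ (mG z hz))]
    exact hp1 _ (mG z hz)
  · intro w hw
    obtain ⟨k, hk, hqk⟩ : ∃ k, 0 ≤ phiB 0 k ∧ q k = w := by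
      by_cases hw0 : w = 0
      · refine ⟨0, phiB_nonneg.2 (by simp), ?_⟩
        simp [q, p, hw0]
      · obtain ⟨s, hs, hh⟩ := polar_surj w hw0 0
        have hwp : 0 < ‖w‖ := norm_pos_iff.2 hw0
        have hw1 := mem_DD.1 hw
        have hre : |‖w‖ - s| ≤ ‖w‖ := by rw [abs_le]; constructor <;> linarith [hs.1, hs.2]
        have hpk : p ⟨‖w‖ - s, ‖w‖ - |‖w‖ - s|⟩ = ‖w‖ := by simp [p]
        refine ⟨⟨‖w‖ - s, ‖w‖ - |‖w‖ - s|⟩, phiB_nonneg.2 ⟨?_, ?_⟩, ?_⟩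
        · simp only; linarith
        · simp only; linarith
        · show (p _ : ℂ) * bd 2 ((p _ - (‖w‖ - s)) / p _) = w
          rw [hpk, sub_sub_cancel, hh]
    refine ⟨G' k, mG' k hk, ?_⟩
    show q (G (G' k)) = w
    rw [G'G k hk, hqk]
  · intro x hx
    show q (G (bd N x)) = _
    rw [Gt x hx]
    have : p (topB (1 - 2 * (x - 2) / (N - 2))) = 1 := by simp [p, topB]
    show (p _ : ℂ) * bd 2 ((p _ - (topB (1 - 2 * (x - 2) / (N - 2))).re) / p _) = _
    rw [this]
    simp only [topB, bd]
    rw [Complex.ofReal_one, one_mul]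
    congr 3
    have : N - 2 ≠ 0 := by linarith
    field_simp
    ring
  · intro t ht
    show q (G (bd N (1 - t))) = q (G (bd N (1 + t)))
    rw [Gm t ht, Gp t ht]
    by_cases h0 : t = 0
    · subst h0; simp
    · have e1 : p ⟨-t, 0⟩ = t := by simp [p, abs_of_nonneg ht.1]
      have e2 : p ⟨t, 0⟩ = t := by simp [p, abs_of_nonneg ht.1]
      show (p _ : ℂ) * bd 2 ((p _ - -t) / p _) = (p _ : ℂ) * bd 2 ((p _ - t) / p _)
      rw [e1, e2]
      have : (t - -t) / t = 2 := by field_simp; ring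
      rw [this, bd_self two_ne_zero, sub_self, zero_div, bd_zero]
  · intro z hz z' hz' h
    have k1 := mG z hz
    have k2 := mG z' hz'
    have h : (p (G z) : ℂ) * bd 2 ((p (G z) - (G z).re) / p (G z)) = (p (G z') : ℂ) * bd 2 ((p (G z') - (G z').re) / p (G z')) := h
    have hn := congrArg norm h
    rw [polar_norm (hp0 _ k1), polar_norm (hp0 _ k2)] at hn
    rw [← hn] at h
    have i1 := im0 _ k1
    have i2 := im0 _ k2
    have d1 : p (G z) = |(G z).re| + (G z).im := rfl
    have d2 : p (G z') = |(G z').re| + (G z').im := rfl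
    have a1 := abs_le.1 (show |(G z).re| ≤ p (G z) by linarith)
    have a2 := abs_le.1 (show |(G z').re| ≤ p (G z) by linarith)
    have b1 := hp1 _ k1
    rcases (hp0 _ k1).eq_or_lt with h0 | h0
    · left
      apply injG hz hz'
      have r1 : (G z).re = 0 := by linarith
      have r2 : (G z').re = 0 := by linarith
      rw [r1, abs_zero] at d1
      rw [r2, abs_zero] at d2
      apply Complex.ext <;> linarith
    · obtain ⟨n, hnn⟩ := polar_eq h0 h
      have n1 : (-1 : ℝ) ≤ n := by
        by_contra hh; push Not at hh; nlinarith
      have n2 : (n:ℝ) ≤ 1 := by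
        by_contra hh; push Not at hh; nlinarith
      have ht : p (G z) ∈ Icc (0:ℝ) 1 := ⟨h0.le, b1⟩
      rcases int_case n1 n2 with rfl | rfl | rfl
      · right
        refine ⟨p (G z), ht, Or.inr ⟨?_, ?_⟩⟩
        · apply injG hz' (bd_mem _ _)
          push_cast at hnn
          have r2 : (G z').re = -p (G z) := by linarith
          rw [Gm _ ht]
          rw [r2, abs_neg, abs_of_pos h0] at d2
          apply Complex.ext
          · exact r2
          · show (G z').im = 0
            linarith
        · apply injG hz (bd_mem _ _)
          push_cast at hnn
          have r2 : (G z).re = p (G z) := by linarith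
          have r3 : |(G z).re| = p (G z) := by rw [r2, abs_of_pos h0]
          rw [Gp _ ht]
          apply Complex.ext
          · exact r2
          · show (G z).im = 0
            linarith
      · left
        apply injG hz hz'
        have r : (G z).re = (G z').re := by push_cast at hnn; linarith
        rw [← r] at d2
        apply Complex.ext
        · exact r
        · linarith
      · right
        refine ⟨p (G z), ht, Or.inl ⟨?_, ?_⟩⟩
        · apply injG hz (bd_mem _ _)
          push_cast at hnn
          have r2 : (G z).re = -p (G z) := by linarith
          have r3 : |(G z).re| = p (G z) := by rw [r2, abs_neg, abs_of_pos h0]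
          rw [Gm _ ht]
          apply Complex.ext
          · exact r2
          · show (G z).im = 0
            linarith
        · apply injG hz' (bd_mem _ _)
          push_cast at hnn
          have r2 : (G z').re = p (G z) := by linarith
          have r3 : |(G z').re| = p (G z) := by rw [r2, abs_of_pos h0]
          rw [Gp _ ht]
          apply Complex.ext
          · exact r2
          · show (G z').im = 0
            linarith

theorem fold {N i : ℝ} (hN : 2 < N) (hi0 : 0 ≤ i) (hi : i + 2 ≤ N) : ∃ f : ℂ → ℂ, ContinuousOn f DD ∧ (∀ z ∈ DD, f z ∈ DD) ∧
    (∀ w ∈ DD, ∃ z ∈ DD, f z = w) ∧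
    (∀ x ∈ Icc 0 i, f (bd N x) = bd (N - 2) x) ∧
    (∀ x ∈ Icc (i + 2) N, f (bd N x) = bd (N - 2) (x - 2)) ∧
    (∀ t ∈ Icc (0:ℝ) 1, f (bd N (i + 1 - t)) = f (bd N (i + 1 + t))) ∧
    (∀ z ∈ DD, ∀ z' ∈ DD, f z = f z' → z = z' ∨ ∃ t ∈ Icc (0:ℝ) 1,
      (z = bd N (i + 1 - t) ∧ z' = bd N (i + 1 + t)) ∨ (z' = bd N (i + 1 - t) ∧ z = bd N (i + 1 + t))) := by
  obtain ⟨f, h1, h2, h3, h4, h5, h6⟩ := fold0 hN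
  have mulD : ∀ M x, ∀ z ∈ DD, bd M x * z ∈ DD := by
    intro M x z hz
    rw [mem_DD] at *
    rwa [norm_mul, norm_bd, one_mul]
  have rot : ∀ x, bd N (-i) * bd N x = bd N (x - i) := by
    intro x; rw [← bd_add]; congr 1; ring
  have N0 : N ≠ 0 := by linarith
  have N1 : N - 2 ≠ 0 := by linarith
  refine ⟨fun z => bd (N - 2) i * f (bd N (-i) * z), ?_, ?_, ?_, ?_, ?_, ?_, ?_⟩
  · exact continuousOn_const.mul (h1.comp (by fun_prop) (fun z hz => mulD _ _ z hz))
  · exact fun z hz => mulD _ _ _ (h2 _ (mulD _ _ _ hz))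
  · intro w hw
    have e : bd (N - 2) i * (bd (N - 2) (-i) * w) = w := by
      rw [← mul_assoc, mul_comm (bd (N-2) i), bd_neg, one_mul]
    obtain ⟨z, hz, hh⟩ := h3 _ (mulD (N - 2) (-i) w hw)
    refine ⟨bd N i * z, mulD _ _ _ hz, ?_⟩
    show bd (N - 2) i * f (bd N (-i) * (bd N i * z)) = w
    rw [← mul_assoc, bd_neg, one_mul, hh, e]
  · intro x hx
    show bd (N - 2) i * f (bd N (-i) * bd N x) = _
    rw [rot]
    have e : bd N (x - i) = bd N (x - i + N) := by rw [bd_add N _ N, bd_self N0, mul_one]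
    rw [e, h4 _ ⟨by linarith [hx.1], by linarith [hx.2]⟩, ← bd_add]
    have : i + (x - i + N - 2) = x + (N - 2) := by ring
    rw [this, bd_add, bd_self N1, mul_one]
  · intro x hx
    show bd (N - 2) i * f (bd N (-i) * bd N x) = _
    rw [rot, h4 _ ⟨by linarith [hx.1], by linarith [hx.2]⟩, ← bd_add]
    congr 1; ring
  · intro t ht
    show bd (N - 2) i * f (bd N (-i) * bd N _) = bd (N - 2) i * f (bd N (-i) * bd N _)
    rw [rot, rot]
    have := h5 t ht
    have e1 : i + 1 - t - i = 1 - t := by ring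
    have e2 : i + 1 + t - i = 1 + t := by ring
    rw [e1, e2, this]
  · intro z hz z' hz' h
    have key : ∀ z s, bd N (-i) * z = bd N (1 + s) → z = bd N (i + 1 + s) := by
      intro z s h
      apply mul_left_cancel₀ (bd_ne N (-i))
      rw [h, rot]
      congr 1; ring
    rcases h6 _ (mulD _ _ _ hz) _ (mulD _ _ _ hz') (mul_left_cancel₀ (bd_ne _ _) h) with h | ⟨t, ht, ⟨a, b⟩ | ⟨a, b⟩⟩
    · left; exact mul_left_cancel₀ (bd_ne _ _) h
    · right; exact ⟨t, ht, Or.inl ⟨key _ (-t) a, key _ _ b⟩⟩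
    · right; exact ⟨t, ht, Or.inr ⟨key _ (-t) a, key _ _ b⟩⟩

/-- euclidean three-space -/
abbrev E3 := EuclideanSpace ℝ (Fin 3)

theorem base2 : ∃ f : ℂ → E3, Continuous f ∧ (∀ z ∈ DD, ‖f z‖ = 1) ∧
    (∀ w, ‖w‖ = 1 → ∃ z ∈ DD, f z = w) ∧
    (∀ t : ℝ, f (bd 2 t) = f (bd 2 (2 - t))) ∧
    (∀ z ∈ DD, ∀ z' ∈ DD, f z = f z' → z = z' ∨ ∃ t ∈ Icc (0:ℝ) 1,
      (z = bd 2 t ∧ z' = bd 2 (2 - t)) ∨ (z' = bd 2 t ∧ z = bd 2 (2 - t))) := by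
  let r : ℂ → ℝ := fun z => Real.sqrt (1 - z.re ^ 2)
  let g : ℂ → ℂ := fun z => (r z : ℂ) * bd 2 (z.im / r z)
  have hrc : Continuous r := by
    show Continuous fun z : ℂ => Real.sqrt (1 - z.re ^ 2)
    fun_prop
  have hgc : Continuous g := continuous_polar hrc Complex.continuous_im
  let f : ℂ → E3 := fun z => !₂[z.re, (g z).re, (g z).im]
  have hsq : ∀ z : ℂ, ‖z‖ ^ 2 = z.re ^ 2 + z.im ^ 2 := by
    intro z; rw [Complex.sq_norm, Complex.normSq_apply]; ring
  have hDD : ∀ z ∈ DD, z.re ^ 2 + z.im ^ 2 ≤ 1 := by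
    intro z hz
    have := mem_DD.1 hz
    rw [← hsq]
    nlinarith [norm_nonneg z]
  have hr2 : ∀ z ∈ DD, r z ^ 2 = 1 - z.re ^ 2 := by
    intro z hz
    exact Real.sq_sqrt (by nlinarith [hDD z hz])
  have hrn : ∀ z, 0 ≤ r z := fun z => Real.sqrt_nonneg _
  have hf0 : ∀ z, f z 0 = z.re := fun z => rfl
  have hf1 : ∀ z, f z 1 = (g z).re := fun z => rfl
  have hf2 : ∀ z, f z 2 = (g z).im := fun z => rfl
  have hgn : ∀ z, ‖g z‖ = r z := fun z => polar_norm (hrn z)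
  have hconj : ∀ t, bd 2 (2 - t) = (starRingEnd ℂ) (bd 2 t) := by
    intro t
    have : bd 2 (2 - t) = bd 2 (-t) := by
      have : (2 - t) = (-t) + 2 := by ring
      rw [this, bd_add, bd_self two_ne_zero, mul_one]
    rw [this]
    unfold bd
    rw [← Complex.exp_conj]
    congr 1
    rw [map_mul, Complex.conj_ofReal, Complex.conj_I]
    push_cast
    ring
  refine ⟨f, ?_, ?_, ?_, ?_, ?_⟩
  · apply (PiLp.continuous_toLp 2 _).comp
    apply continuous_pi
    intro j
    fin_cases j
    · exact Complex.continuous_re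
    · exact Complex.continuous_re.comp hgc
    · exact Complex.continuous_im.comp hgc
  · intro z hz
    rw [EuclideanSpace.norm_eq, Fin.sum_univ_three, hf0, hf1, hf2]
    have := hsq (g z)
    rw [hgn, hr2 z hz] at this
    rw [Real.sqrt_eq_one]
    simp only [Real.norm_eq_abs, sq_abs]
    linarith
  · intro w hw
    have hw2 : w 0 ^ 2 + w 1 ^ 2 + w 2 ^ 2 = 1 := by
      rw [EuclideanSpace.norm_eq, Fin.sum_univ_three, Real.sqrt_eq_one] at hw
      simpa [Real.norm_eq_abs, sq_abs] using hw
    have hcn : ‖(⟨w 1, w 2⟩ : ℂ)‖ = Real.sqrt (1 - w 0 ^ 2) := by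
      have : ‖(⟨w 1, w 2⟩ : ℂ)‖ ^ 2 = 1 - w 0 ^ 2 := by rw [hsq]; simp only; linarith
      rw [← this, Real.sqrt_sq (norm_nonneg _)]
    obtain ⟨s, hs, hh⟩ : ∃ s : ℝ, |s| ≤ Real.sqrt (1 - w 0 ^ 2) ∧
        (Real.sqrt (1 - w 0 ^ 2) : ℂ) * bd 2 (s / Real.sqrt (1 - w 0 ^ 2)) = ⟨w 1, w 2⟩ := by
      rw [← hcn]
      by_cases h0 : (⟨w 1, w 2⟩ : ℂ) = 0
      · exact ⟨0, by simp, by rw [h0]; simp⟩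
      · obtain ⟨s, hs, hh⟩ := polar_surj _ h0 (-‖(⟨w 1, w 2⟩ : ℂ)‖)
        exact ⟨s, by rw [abs_le]; constructor <;> linarith [hs.1, hs.2], hh⟩
    refine ⟨⟨w 0, s⟩, ?_, ?_⟩
    · rw [mem_DD]
      have h1 := hsq ⟨w 0, s⟩
      simp only at h1
      have h2 : s ^ 2 ≤ 1 - w 0 ^ 2 := by
        have h3 : 0 ≤ 1 - w 0 ^ 2 := by nlinarith
        rw [← Real.sq_sqrt h3, ← sq_abs s]
        exact pow_le_pow_left₀ (abs_nonneg _) hs 2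
      have : ‖(⟨w 0, s⟩ : ℂ)‖ ^ 2 ≤ 1 := by rw [h1]; linarith
      nlinarith [norm_nonneg (⟨w 0, s⟩ : ℂ)]
    · have hg : g ⟨w 0, s⟩ = ⟨w 1, w 2⟩ := hh
      ext j
      fin_cases j
      · rfl
      · show (g ⟨w 0, s⟩).re = w 1
        rw [hg]
      · show (g ⟨w 0, s⟩).im = w 2
        rw [hg]
  · intro t
    rw [hconj]
    have hrr : r ((starRingEnd ℂ) (bd 2 t)) = r (bd 2 t) := by simp [r]
    have hgg : g ((starRingEnd ℂ) (bd 2 t)) = g (bd 2 t) := by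
      show (r _ : ℂ) * bd 2 (_ / r _) = (r _ : ℂ) * bd 2 (_ / r _)
      rw [hrr]
      by_cases h0 : r (bd 2 t) = 0
      · rw [h0]; simp
      · congr 1
        have h1 := hr2 _ (bd_mem 2 t)
        have h2 := hsq (bd 2 t)
        rw [norm_bd] at h2
        have h3 : (bd 2 t).im ^ 2 = r (bd 2 t) ^ 2 := by rw [h1]; linarith
        rw [Complex.conj_im]
        have key : bd 2 (-1) = bd 2 1 := by
          have h5 := bd_add 2 (-1) 2
          rw [bd_self two_ne_zero, mul_one] at h5
          rw [← h5]
          norm_num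
        rcases sq_eq_sq_iff_eq_or_eq_neg.1 h3 with h4 | h4
        · rw [h4, neg_div, div_self h0, key]
        · rw [h4, neg_neg, neg_div, div_self h0, key]
    ext j
    fin_cases j
    · show (bd 2 t).re = ((starRingEnd ℂ) (bd 2 t)).re
      simp
    · show (g _).re = (g _).re
      rw [hgg]
    · show (g _).im = (g _).im
      rw [hgg]
  · intro z hz z' hz' h
    have e0 : z.re = z'.re := by rw [← hf0 z, h, hf0]
    have eg : g z = g z' := by
      apply Complex.ext
      · rw [← hf1 z, h, hf1]
      · rw [← hf2 z, h, hf2]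
    have er : r z = r z' := by simp only [r, e0]
    have b1 : |z.im| ≤ r z := by
      apply Real.abs_le_sqrt; linarith [hDD z hz]
    have b2 : |z'.im| ≤ r z := by
      rw [er]
      apply Real.abs_le_sqrt; linarith [hDD z' hz']
    rcases (hrn z).eq_or_lt with h0 | h0
    · left
      rw [← h0, abs_nonpos_iff] at b1 b2
      exact Complex.ext e0 (by rw [b1, b2])
    · have eg : (r z : ℂ) * bd 2 (z.im / r z) = (r z' : ℂ) * bd 2 (z'.im / r z') := eg
      rw [← er] at eg
      obtain ⟨n, hn⟩ := polar_eq h0 eg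
      have a1 := abs_le.1 b1
      have a2 := abs_le.1 b2
      have n1 : (-1 : ℝ) ≤ n := by
        by_contra hh; push Not at hh; nlinarith
      have n2 : (n:ℝ) ≤ 1 := by
        by_contra hh; push Not at hh; nlinarith
      have fin : z.im ^ 2 = r z ^ 2 → z' = (starRingEnd ℂ) z → z = z' ∨ ∃ t ∈ Icc (0:ℝ) 1,
          (z = bd 2 t ∧ z' = bd 2 (2 - t)) ∨ (z' = bd 2 t ∧ z = bd 2 (2 - t)) := by
        intro h1 h2
        right
        have hnz : ‖z‖ = 1 := by
          have := hsq z
          rw [h1, hr2 z hz] at this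
          have h3 : ‖z‖ ^ 2 = 1 := by linarith
          nlinarith [norm_nonneg z]
        obtain ⟨x, hx, hxz⟩ := bd_surj two_pos hnz
        rw [← hxz, ← hconj] at h2
        rcases le_total x 1 with h4 | h4
        · exact ⟨x, ⟨hx.1, h4⟩, Or.inl ⟨hxz.symm, h2⟩⟩
        · exact ⟨2 - x, ⟨by linarith [hx.2], by linarith⟩, Or.inr ⟨h2, by rw [sub_sub_cancel, hxz]⟩⟩
      rcases int_case n1 n2 with rfl | rfl | rfl
      · push_cast at hn
        have r1 : z.im = -r z := by linarith
        have r2 : z'.im = r z := by linarith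
        exact fin (by rw [r1]; ring) (Complex.ext (by simp [e0]) (by simp [r1, r2]))
      · left
        push_cast at hn
        exact Complex.ext e0 (by linarith)
      · push_cast at hn
        have r1 : z.im = r z := by linarith
        have r2 : z'.im = -r z := by linarith
        exact fin (by rw [r1]) (Complex.ext (by simp [e0]) (by simp [r1, r2]))

end geom
end FileG4

section FileG5
section geom
open Complex Set

/-- the pairing relation on the boundary of a polygon -/
def PR (N : ℕ) (al : ℕ → ℕ) (z z' : ℂ) : Prop :=
  ∃ m < N, ∃ t ∈ Icc (0:ℝ) 1, z = bd N (m + t) ∧ z' = bd N (al m + 1 - t)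

theorem PR_mem {N : ℕ} {al : ℕ → ℕ} {z z' : ℂ} (h : PR N al z z') : z ∈ DD ∧ z' ∈ DD := by
  obtain ⟨m, _, t, _, rfl, rfl⟩ := h
  exact ⟨bd_mem _ _, bd_mem _ _⟩

theorem EqvPR_mem {N : ℕ} {al : ℕ → ℕ} {z z' : ℂ} (h : Relation.EqvGen (PR N al) z z') : z ∈ DD ↔ z' ∈ DD := by
  induction h with
  | rel a b h => have := PR_mem h; exact ⟨fun _ => this.2, fun _ => this.1⟩
  | refl a => exact Iff.rfl
  | symm a b _ ih => exact ih.symm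
  | trans a b c _ _ ih1 ih2 => exact ih1.trans ih2

theorem exists_adj {N : ℕ} {al : ℕ → ℕ} (hN : 2 ≤ N) (h1 : ∀ m < N, al m < N) (h3 : ∀ m < N, al m ≠ m)
    (h4 : ∀ i m, i < N → m < N → i < m → m < al i → i < al m ∧ al m < al i) : ∃ i, i + 1 < N ∧ al i = i + 1 := by
  have hex : ∃ d, ∃ i < N, i < al i ∧ al i = i + d := by
    have := h3 0 (by omega)
    exact ⟨al 0 - 0, 0, by omega, by omega, by omega⟩
  obtain ⟨i, hi, hlt, hd⟩ := Nat.find_spec hex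
  have hmin := fun d hd => Nat.find_min hex (m := d) hd
  by_cases h : al i = i + 1
  · exact ⟨i, by have := h1 i hi; omega, h⟩
  · exfalso
    have hi1 : i + 1 < N := by have := h1 i hi; omega
    have := h4 i (i + 1) hi hi1 (by omega) (by omega)
    have h5 := h3 (i + 1) hi1
    exact hmin (al (i + 1) - (i + 1)) (by omega) ⟨i + 1, hi1, by omega, by omega⟩

theorem phase2 (N : ℕ) : ∀ al : ℕ → ℕ, 2 ≤ N → (∀ m < N, al m < N) → (∀ m < N, al (al m) = m) → (∀ m < N, al m ≠ m) →
    (∀ i m, i < N → m < N → i < m → m < al i → i < al m ∧ al m < al i) →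
    ∃ Ps : ℂ → E3, ContinuousOn Ps DD ∧ (∀ z ∈ DD, ‖Ps z‖ = 1) ∧ (∀ w, ‖w‖ = 1 → ∃ z ∈ DD, Ps z = w) ∧
      ∀ z ∈ DD, ∀ z' ∈ DD, (Ps z = Ps z' ↔ Relation.EqvGen (PR N al) z z') := by
  induction N using Nat.strong_induction_on with
  | _ N ih =>
  intro al hN h1 h2 h3 h4
  obtain ⟨i, hi, hai⟩ := exists_adj hN h1 h3 h4
  have hai' : al (i + 1) = i := by rw [← hai, h2 i (by omega)]
  by_cases hN2 : N = 2
  · subst hN2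
    have hi0 : i = 0 := by omega
    subst hi0
    obtain ⟨f, c1, c2, c3, c4, c5⟩ := base2
    have hPR : ∀ z z', PR 2 al z z' → f z = f z' := by
      rintro z z' ⟨m, hm, t, ht, rfl, rfl⟩
      rcases (show m = 0 ∨ m = 1 by omega) with rfl | rfl
      · rw [hai]
        have := c4 t
        simp only [Nat.cast_zero, zero_add, Nat.cast_one, Nat.cast_ofNat]
        rw [this]
        congr 2; ring
      · rw [show al 1 = 0 from hai']
        have := c4 (1 - t)
        simp only [Nat.cast_zero, zero_add, Nat.cast_one, Nat.cast_ofNat]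
        rw [this]
        congr 2; ring
    refine ⟨f, c1.continuousOn, c2, c3, ?_⟩
    intro z hz z' hz'
    constructor
    · intro h
      have key : ∀ t ∈ Icc (0:ℝ) 1, Relation.EqvGen (PR 2 al) (bd 2 t) (bd 2 (2 - t)) := by
        intro t ht
        apply Relation.EqvGen.rel
        refine ⟨0, by omega, t, ht, ?_, ?_⟩
        · simp
        · rw [hai]; simp; congr 1; ring
      rcases c5 z hz z' hz' h with rfl | ⟨t, ht, ⟨rfl, rfl⟩ | ⟨rfl, rfl⟩⟩
      · exact Relation.EqvGen.refl _
      · exact key t ht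
      · exact (key t ht).symm
    · intro h
      clear hz hz'
      induction h with
      | rel a b h => exact hPR _ _ h
      | refl a => rfl
      | symm a b _ ih => exact ih.symm
      | trans a b c _ _ ih1 ih2 => exact ih1.trans ih2
  · have hinj : ∀ m < N, ∀ m' < N, al m = al m' → m = m' := by
      intro m hm m' hm' h
      rw [← h2 m hm, ← h2 m' hm', h]
    have hne : ∀ m < N, m ≠ i → m ≠ i + 1 → al m ≠ i ∧ al m ≠ i + 1 := by
      intro m hm e1 e2
      constructor
      · intro h; exact e2 (hinj m hm (i + 1) hi (by rw [h, hai']))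
      · intro h; exact e1 (hinj m hm i (by omega) (by rw [h, hai]))
    have hN4 : 4 ≤ N := by
      by_contra hlt
      have : N = 3 := by omega
      subst this
      obtain ⟨m, hm, e1, e2⟩ : ∃ m < 3, m ≠ i ∧ m ≠ i + 1 := by
        by_cases h : i = 0
        · exact ⟨2, by omega, by omega, by omega⟩
        · exact ⟨0, by omega, by omega, by omega⟩
      have := hne m hm e1 e2
      have := h1 m hm
      have := h3 m hm
      omega
    obtain ⟨M, rfl⟩ : ∃ M, N = M + 2 := ⟨N - 2, by omega⟩
    let de : ℕ → ℕ := fun m => if m < i then m else m + 2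
    let de' : ℕ → ℕ := fun m => if m < i then m else m - 2
    have hde : ∀ m, (m < i ∧ de m = m) ∨ (i ≤ m ∧ de m = m + 2) := by
      intro m
      by_cases h : m < i
      · exact Or.inl ⟨h, if_pos h⟩
      · exact Or.inr ⟨by omega, if_neg h⟩
    have hde' : ∀ m, (m < i ∧ de' m = m) ∨ (i ≤ m ∧ de' m = m - 2) := by
      intro m
      by_cases h : m < i
      · exact Or.inl ⟨h, if_pos h⟩
      · exact Or.inr ⟨by omega, if_neg h⟩
    have dd' : ∀ m, m ≠ i → m ≠ i + 1 → de (de' m) = m := by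
      intro m e1 e2
      have := hde' m
      have := hde (de' m)
      omega
    have d'd : ∀ m, de' (de m) = m := by
      intro m
      have := hde' (de m)
      have := hde m
      omega
    let al' : ℕ → ℕ := fun m => de' (al (de m))
    have hdlt : ∀ m < M, de m < M + 2 ∧ de m ≠ i ∧ de m ≠ i + 1 := by
      intro m hm
      have := hde m
      omega
    have hdal : ∀ m < M, de (al' m) = al (de m) := by
      intro m hm
      obtain ⟨a, b, c⟩ := hdlt m hm
      exact dd' _ (hne _ a b c).1 (hne _ a b c).2
    have hmono : ∀ m m', m < m' ↔ de m < de m' := by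
      intro m m'
      have := hde m
      have := hde m'
      omega
    obtain ⟨Ps, p1, p2, p3, p4⟩ := ih M (by omega) al' (by omega)
      (by
        intro m hm
        obtain ⟨a, b, c⟩ := hdlt m hm
        have := h1 _ a
        have h6 := hne _ a b c
        have := hde' (al (de m))
        show de' (al (de m)) < M
        omega)
      (by
        intro m hm
        obtain ⟨a, b, c⟩ := hdlt m hm
        show de' (al (de (al' m))) = m
        rw [hdal m hm, h2 _ a, d'd])
      (by
        intro m hm h
        obtain ⟨a, b, c⟩ := hdlt m hm
        apply h3 _ a
        rw [← hdal m hm, h])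
      (by
        intro a b ha hb hab hba
        rw [hmono, hdal a ha] at hba
        rw [hmono] at hab
        have := h4 (de a) (de b) (hdlt a ha).1 (hdlt b hb).1 hab hba
        rw [hmono a, hmono (al' b), hdal a ha, hdal b hb]
        exact this)
    have hMr : (2:ℝ) ≤ M := by exact_mod_cast (show 2 ≤ M by omega)
    have hir : (i : ℝ) ≤ M := by exact_mod_cast (show i ≤ M by omega)
    obtain ⟨f, f1, f2, f3, f4, f5, f6, f7⟩ := fold (N := ((M + 2 : ℕ) : ℝ)) (i := i) (by push_cast; linarith) (Nat.cast_nonneg i)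
      (by push_cast; linarith)
    have hM : ((M + 2 : ℕ) : ℝ) - 2 = M := by push_cast; ring
    rw [hM] at f4 f5
    have hfd : ∀ m < M, ∀ t ∈ Icc (0:ℝ) 1, f (bd ((M + 2 : ℕ) : ℝ) (de m + t)) = bd M (m + t) := by
      intro m hm t ht
      have hm0 : (0:ℝ) ≤ m := Nat.cast_nonneg m
      rcases hde m with ⟨h, e⟩ | ⟨h, e⟩
      · rw [e]
        apply f4
        have : (m:ℝ) + 1 ≤ i := by exact_mod_cast h
        exact ⟨by linarith [ht.1], by linarith [ht.2]⟩
      · rw [e, f5]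
        · congr 1; push_cast; ring
        · have h7 : (i:ℝ) ≤ m := by exact_mod_cast h
          have h8 : (m:ℝ) + 1 ≤ M := by exact_mod_cast hm
          push_cast
          exact ⟨by linarith [ht.1], by linarith [ht.2]⟩
    have hal' : ∀ m < M, al' m < M := by
      intro m hm
      obtain ⟨a, b, c⟩ := hdlt m hm
      have := h1 _ a
      have h6 := hne _ a b c
      have := hde' (al (de m))
      show de' (al (de m)) < M
      omega
    have hfPR : ∀ z z', PR (M + 2) al z z' → Relation.EqvGen (PR M al') (f z) (f z') := by
      rintro z z' ⟨m, hm, t, ht, rfl, rfl⟩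
      by_cases e1 : m = i
      · subst e1
        rw [hai]
        have h8 := f6 (1 - t) ⟨by linarith [ht.2], by linarith [ht.1]⟩
        have e3 : (m:ℝ) + 1 - (1 - t) = m + t := by ring
        have e4 : (m:ℝ) + 1 + (1 - t) = ((m + 1 : ℕ) : ℝ) + 1 - t := by push_cast; ring
        rw [e3, e4] at h8
        rw [h8]
        exact Relation.EqvGen.refl _
      by_cases e2 : m = i + 1
      · subst e2
        rw [hai']
        have h8 := f6 t ht
        have e4 : (i:ℝ) + 1 + t = ((i + 1 : ℕ) : ℝ) + t := by push_cast; ring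
        rw [e4] at h8
        rw [h8]
        exact Relation.EqvGen.refl _
      · apply Relation.EqvGen.rel
        have hm' : de' m < M := by have := hde' m; omega
        refine ⟨de' m, hm', t, ht, ?_, ?_⟩
        · rw [← hfd _ hm' t ht, dd' m e1 e2]
        · have h9 := hfd (al' (de' m)) (hal' _ hm') (1 - t) ⟨by linarith [ht.2], by linarith [ht.1]⟩
          rw [hdal _ hm', dd' m e1 e2] at h9
          rw [add_sub_assoc, h9, add_sub_assoc]
    have hker : ∀ z ∈ DD, ∀ z' ∈ DD, f z = f z' → Relation.EqvGen (PR (M + 2) al) z z' := by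
      intro z hz z' hz' h
      have key : ∀ t ∈ Icc (0:ℝ) 1, Relation.EqvGen (PR (M + 2) al) (bd ((M + 2 : ℕ) : ℝ) (i + 1 - t)) (bd ((M + 2 : ℕ) : ℝ) (i + 1 + t)) := by
        intro t ht
        apply Relation.EqvGen.rel
        refine ⟨i, by omega, 1 - t, ⟨by linarith [ht.2], by linarith [ht.1]⟩, ?_, ?_⟩
        · congr 1; ring
        · rw [hai]; congr 1; push_cast; ring
      rcases f7 z hz z' hz' h with rfl | ⟨t, ht, ⟨rfl, rfl⟩ | ⟨rfl, rfl⟩⟩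
      · exact Relation.EqvGen.refl _
      · exact key t ht
      · exact (key t ht).symm
    refine ⟨fun z => Ps (f z), p1.comp f1 f2, fun z hz => p2 _ (f2 z hz), ?_, ?_⟩
    · intro w hw
      obtain ⟨z, hz, rfl⟩ := p3 w hw
      obtain ⟨z', hz', rfl⟩ := f3 z hz
      exact ⟨z', hz', rfl⟩
    · intro z hz z' hz'
      rw [p4 _ (f2 z hz) _ (f2 z' hz')]
      constructor
      · intro h
        have gen : ∀ w w', Relation.EqvGen (PR M al') w w' → ∀ z ∈ DD, ∀ z' ∈ DD, f z = w → f z' = w' →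
            Relation.EqvGen (PR (M + 2) al) z z' := by
          intro w w' h
          induction h with
          | rel a b h =>
            rintro z hz z' hz' rfl rfl
            obtain ⟨m, hm, t, ht, ea, eb⟩ := h
            rw [← hfd m hm t ht] at ea
            have h9 := hfd (al' m) (hal' _ hm) (1 - t) ⟨by linarith [ht.2], by linarith [ht.1]⟩
            rw [hdal _ hm] at h9
            rw [add_sub_assoc, ← h9] at eb
            refine (hker z hz _ (bd_mem _ _) ea).trans _ _ _ (Relation.EqvGen.trans _ _ _ ?_ (hker z' hz' _ (bd_mem _ _) eb).symm)
            apply Relation.EqvGen.rel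
            exact ⟨de m, (hdlt m hm).1, t, ht, rfl, by rw [add_sub_assoc]⟩
          | refl a =>
            rintro z hz z' hz' rfl h
            exact hker z hz z' hz' h.symm
          | symm a b _ ih => exact fun z hz z' hz' e1 e2 => (ih z' hz' z hz e2 e1).symm
          | trans a b c hab _ ih1 ih2 =>
            intro z hz z' hz' e1 e2
            have hb : b ∈ DD := (EqvPR_mem hab).1 (e1 ▸ f2 z hz)
            obtain ⟨y, hy, hyb⟩ := f3 b hb
            exact (ih1 z hz y hy e1 hyb).trans _ _ _ (ih2 y hy z' hz' hyb e2)
        exact gen _ _ h z hz z' hz' rfl rfl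
      · intro h
        clear hz hz'
        induction h with
        | rel a b h => exact hfPR _ _ h
        | refl a => exact Relation.EqvGen.refl _
        | symm a b _ ih => exact ih.symm
        | trans a b c _ _ ih1 ih2 => exact ih1.trans _ _ _ ih2

end geom
end FileG5

section FileS1
section flags
variable {D : GlueingDatum 4}
open Set

/-- the edge of a flag -/
def base (fl : St D 5) : St D 2 := (fl.1, (Fin.castLEEmb (by decide : 2 ≤ 5)).trans fl.2)
/-- crossing the last facet of a flag -/
def Gf (fl : St D 5) : St D 5 := fl.mv (fl.2 4)
/-- reversing the side of a flag -/
def flp (fl : St D 5) : St D 5 := fl.pre (Equiv.swap 2 3)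
/-- point on the side of a flag -/
def pt (fl : St D 5) (t : ℝ) : Fin 5 → ℝ := extz fl.2 ![0, 0, 1 - t, t, 0]
/-- triangle coordinates with respect to a flag -/
def crd (fl : St D 5) (y : Fin 5 → ℝ) : ℝ × ℝ × ℝ := (y (fl.2 2), y (fl.2 3), y (fl.2 4))
/-- the triangle opposite to an edge -/
def tri (s : St D 2) : Set (Fin 5 → ℝ) := {y | (∀ v, 0 ≤ y v) ∧ ∑ v, y v = 1 ∧ ∀ a, y (s.2 a) = 0}
/-- the relation on triangle points generated by side crossings -/
def TR : St D 2 × (Fin 5 → ℝ) → St D 2 × (Fin 5 → ℝ) → Prop :=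
  Relation.ReflTransGen fun p q => ∃ k, k ∉ range p.1.2 ∧ p.2 k = 0 ∧ q = (p.1.mv k, p.2 ∘ (D.glue (p.1.1, k)).symm)

theorem St.ext' {d : ℕ} {s s' : St D d} (h1 : s.1 = s'.1) (h2 : ∀ a, s.2 a = s'.2 a) : s = s' :=
  Prod.ext h1 (DFunLike.ext _ _ h2)

theorem TR.symm {p q : St D 2 × (Fin 5 → ℝ)} (h : TR p q) : TR q p := by
  have : Std.Symm (fun p q : St D 2 × (Fin 5 → ℝ) => ∃ k, k ∉ range p.1.2 ∧ p.2 k = 0 ∧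
      q = (p.1.mv k, p.2 ∘ (D.glue (p.1.1, k)).symm)) := ⟨by
    rintro ⟨s, y⟩ _ ⟨k, hk, h0, rfl⟩
    refine ⟨opf D s.1 k, St.op_notMem hk, ?_, ?_⟩
    · show y ((D.glue (s.1, k)).symm _) = 0
      rw [← glue_opf, Equiv.symm_apply_apply]; exact h0
    · refine Prod.ext (St.mv_mv _ _).symm ?_
      show y = (y ∘ (D.glue (s.1, k)).symm) ∘ (D.glue (nbr D s.1 k, opf D s.1 k)).symm
      rw [glue_back]; ext v; simp⟩
  exact Relation.ReflTransGen.stdSymm.symm _ _ h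

theorem TR.trans {p q r : St D 2 × (Fin 5 → ℝ)} (h : TR p q) (h' : TR q r) : TR p r :=
  Relation.ReflTransGen.trans h h'

theorem TR.toSR {p q : St D 2 × (Fin 5 → ℝ)} (h : TR p q) : SR p.1 q.1 := by
  induction h with
  | refl => exact .refl
  | tail _ h ih => obtain ⟨k, hk, _, rfl⟩ := h; exact ih.tail ⟨k, hk, rfl⟩

theorem tri_step {s : St D 2} {y : Fin 5 → ℝ} (hy : y ∈ tri s) (k : Fin 5) :
    y ∘ (D.glue (s.1, k)).symm ∈ tri (s.mv k) := by
  refine ⟨fun v => hy.1 _, ?_, fun a => ?_⟩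
  · rw [← hy.2.1]; exact Equiv.sum_comp (D.glue (s.1, k)).symm y
  · rw [St.mv_snd]; simpa using hy.2.2 a

theorem TR.tri {p q : St D 2 × (Fin 5 → ℝ)} (h : TR p q) (hp : p.2 ∈ tri p.1) : q.2 ∈ tri q.1 := by
  induction h with
  | refl => exact hp
  | tail _ h ih => obtain ⟨k, hk, _, rfl⟩ := h; exact tri_step ih k

theorem base_mv (fl : St D 5) (k) : base (fl.mv k) = (base fl).mv k := rfl
theorem base_fst (fl : St D 5) : (base fl).1 = fl.1 := rfl
theorem base_0 (fl : St D 5) : (base fl).2 0 = fl.2 0 := rfl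
theorem base_1 (fl : St D 5) : (base fl).2 1 = fl.2 1 := rfl

theorem base_pre (fl : St D 5) (π : Equiv.Perm (Fin 5)) (h0 : π 0 = 0) (h1 : π 1 = 1) : base (fl.pre π) = base fl := by
  refine St.ext' rfl fun a => ?_
  fin_cases a
  · exact congrArg fl.2 h0
  · exact congrArg fl.2 h1

theorem base_flp (fl : St D 5) : base (flp fl) = base fl := base_pre _ _ (by decide) (by decide)

theorem mem_base (fl : St D 5) (a : Fin 5) : fl.2 a ∈ range (base fl).2 ↔ a = 0 ∨ a = 1 := by
  constructor
  · rintro ⟨b, hb⟩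
    have : Fin.castLEEmb (by decide : 2 ≤ 5) b = a := fl.2.injective hb
    subst this
    fin_cases b
    · left; rfl
    · right; rfl
  · rintro (rfl | rfl)
    · exact ⟨0, rfl⟩
    · exact ⟨1, rfl⟩

theorem cK_notMem (fl : St D 5) : fl.2 4 ∉ range (base fl).2 := by
  rw [mem_base]; decide

theorem Gf_Gf (fl : St D 5) : Gf (Gf fl) = fl := by
  have : (Gf fl).2 4 = opf D fl.1 (fl.2 4) := glue_opf _ _
  rw [Gf, this]; exact St.mv_mv _ _

theorem flp_flp (fl : St D 5) : flp (flp fl) = fl := by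
  rw [flp, flp, St.pre_pre, Equiv.swap_mul_self]; rfl

theorem flp_4 (fl : St D 5) : (flp fl).2 4 = fl.2 4 := congrArg fl.2 (by decide)
theorem flp_2 (fl : St D 5) : (flp fl).2 2 = fl.2 3 := congrArg fl.2 (by decide)
theorem flp_3 (fl : St D 5) : (flp fl).2 3 = fl.2 2 := congrArg fl.2 (by decide)

theorem Gf_flp (fl : St D 5) : Gf (flp fl) = flp (Gf fl) := by
  rw [Gf, flp_4]; rfl

theorem flp_ne (fl : St D 5) : flp fl ≠ fl := by
  intro h
  have := flp_2 fl
  rw [h] at this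
  exact absurd (fl.2.injective this) (by decide)

theorem base_Gf (fl : St D 5) : base (Gf fl) = (base fl).mv (fl.2 4) := rfl

theorem Gf_ne (fl : St D 5) : Gf fl ≠ fl := by
  intro h
  have h1 : nbr D fl.1 (fl.2 4) = fl.1 := congrArg Prod.fst h
  have h2 : opf D fl.1 (fl.2 4) = fl.2 4 := by
    rw [← glue_opf]; exact congrArg (fun q : St D 5 => q.2 4) h
  exact D.P_fixedPointFree (fl.1, fl.2 4) (by rw [P_eq, h1, h2])

theorem Gf_ne_flp (fl : St D 5) : Gf fl ≠ flp fl := by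
  intro h
  have h1 : nbr D fl.1 (fl.2 4) = fl.1 := congrArg Prod.fst h
  have h2 : opf D fl.1 (fl.2 4) = fl.2 4 := by
    rw [← glue_opf, ← flp_4 fl]; exact congrArg (fun q : St D 5 => q.2 4) h
  exact D.P_fixedPointFree (fl.1, fl.2 4) (by rw [P_eq, h1, h2])

theorem pt_a (fl : St D 5) (t : ℝ) (a : Fin 5) : pt fl t (fl.2 a) = (![0, 0, 1 - t, t, 0] : Fin 5 → ℝ) a := extz_apply _ _ _

theorem flag_surj (fl : St D 5) (v : Fin 5) : ∃ a, fl.2 a = v :=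
  (Finite.injective_iff_surjective.1 fl.2.injective) v

theorem funext_flag (fl : St D 5) {y y' : Fin 5 → ℝ} (h : ∀ a, y (fl.2 a) = y' (fl.2 a)) : y = y' := by
  ext v; obtain ⟨a, rfl⟩ := flag_surj fl v; exact h a

theorem sum_flag (fl : St D 5) (y : Fin 5 → ℝ) : ∑ v, y v = y (fl.2 0) + y (fl.2 1) + y (fl.2 2) + y (fl.2 3) + y (fl.2 4) := by
  have := Equiv.sum_comp (Equiv.ofBijective fl.2 ⟨fl.2.injective, flag_surj fl⟩) y
  rw [← this, Fin.sum_univ_five]; rfl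

theorem tri_iff (fl : St D 5) (y : Fin 5 → ℝ) : y ∈ tri (base fl) ↔
    y (fl.2 0) = 0 ∧ y (fl.2 1) = 0 ∧ crd fl y ∈ TT := by
  constructor
  · rintro ⟨h1, h2, h3⟩
    have a0 : y (fl.2 0) = 0 := h3 0
    have a1 : y (fl.2 1) = 0 := h3 1
    rw [sum_flag fl, a0, a1] at h2
    exact ⟨a0, a1, h1 _, h1 _, h1 _, by simp only [crd]; linarith⟩
  · rintro ⟨a0, a1, h2, h3, h4, h5⟩
    simp only [crd] at h2 h3 h4 h5
    refine ⟨fun v => ?_, by rw [sum_flag fl, a0, a1]; linarith, fun a => ?_⟩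
    · obtain ⟨a, rfl⟩ := flag_surj fl v
      fin_cases a
      · exact a0.ge
      · exact a1.ge
      · exact h2
      · exact h3
      · exact h4
    · fin_cases a
      · exact a0
      · exact a1

theorem crd_inj (fl : St D 5) {y y' : Fin 5 → ℝ} (hy : y ∈ tri (base fl)) (hy' : y' ∈ tri (base fl))
    (h : crd fl y = crd fl y') : y = y' := by
  rw [tri_iff] at hy hy'
  simp only [crd, Prod.mk.injEq] at h
  refine funext_flag fl fun a => ?_
  fin_cases a
  · exact hy.1.trans hy'.1.symm
  · exact hy.2.1.trans hy'.2.1.symm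
  · exact h.1
  · exact h.2.1
  · exact h.2.2

theorem crd_surj (fl : St D 5) {w : ℝ × ℝ × ℝ} (hw : w ∈ TT) : ∃ y ∈ tri (base fl), crd fl y = w := by
  have h : crd fl (extz fl.2 ![0, 0, w.1, w.2.1, w.2.2]) = w := by
    simp only [crd, extz_apply]; rfl
  exact ⟨extz fl.2 ![0, 0, w.1, w.2.1, w.2.2], (tri_iff _ _).2 ⟨extz_apply _ _ 0, extz_apply _ _ 1, by rw [h]; exact hw⟩, h⟩

theorem crd_pt (fl : St D 5) (t : ℝ) : crd fl (pt fl t) = (1 - t, t, 0) := by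
  simp only [crd, pt_a]; rfl

theorem pt_mem (fl : St D 5) {t : ℝ} (ht : t ∈ Icc (0:ℝ) 1) : pt fl t ∈ tri (base fl) := by
  rw [tri_iff, crd_pt]
  exact ⟨pt_a _ _ 0, pt_a _ _ 1, by linarith [ht.2], ht.1, le_rfl, by simp⟩

theorem pt_K (fl : St D 5) (t : ℝ) : pt fl t (fl.2 4) = 0 := pt_a fl t 4

theorem eq_pt (fl : St D 5) {y : Fin 5 → ℝ} (hy : y ∈ tri (base fl)) (h : y (fl.2 4) = 0) :
    y (fl.2 3) ∈ Icc (0:ℝ) 1 ∧ y = pt fl (y (fl.2 3)) := by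
  have hy2 := ((tri_iff _ _).1 hy).2.2
  obtain ⟨h1, h2, h3, h4⟩ := hy2
  simp only [crd] at h1 h2 h3 h4
  rw [h] at h4
  have ht : y (fl.2 3) ∈ Icc (0:ℝ) 1 := ⟨h2, by linarith⟩
  refine ⟨ht, crd_inj fl hy (pt_mem fl ht) ?_⟩
  rw [crd_pt, crd, h]
  congr 1; linarith

theorem pt_Gf (fl : St D 5) (t : ℝ) : pt (Gf fl) t = pt fl t ∘ (D.glue (fl.1, fl.2 4)).symm := extz_trans _ _ _

theorem TR_Gf (fl : St D 5) (t : ℝ) : TR (base fl, pt fl t) (base (Gf fl), pt (Gf fl) t) :=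
  .single ⟨fl.2 4, cK_notMem fl, pt_K _ _, by rw [pt_Gf]; rfl⟩

theorem pt_flp (fl : St D 5) (t : ℝ) : pt (flp fl) t = pt fl (1 - t) := by
  refine funext_flag fl fun a => ?_
  rw [pt_a]
  fin_cases a
  · exact pt_a (flp fl) t 0
  · exact pt_a (flp fl) t 1
  · have := pt_a (flp fl) t 3
    rw [flp_3] at this
    exact this.trans (by simp)
  · have := pt_a (flp fl) t 2
    rw [flp_2] at this
    exact this.trans (by simp)
  · exact pt_a (flp fl) t 4

theorem pt_zero (fl : St D 5) : pt fl 0 = Pi.single (fl.2 2) 1 := by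
  refine funext_flag fl fun a => ?_
  rw [pt_a, Pi.single_apply]
  fin_cases a <;> simp [fl.2.injective.eq_iff]

theorem exists_flag (s : St D 2) {A k : Fin 5} (hk : k ∉ range s.2) (hA : A ∉ range s.2) (h : A ≠ k) :
    ∃ fl, base fl = s ∧ fl.2 2 = A ∧ fl.2 4 = k := by
  have h01 : s.2 0 ≠ s.2 1 := fun h => absurd (s.2.injective h) (by decide)
  have hk0 : s.2 0 ≠ k := fun h => hk ⟨0, h⟩
  have hk1 : s.2 1 ≠ k := fun h => hk ⟨1, h⟩
  have hA0 : s.2 0 ≠ A := fun h => hA ⟨0, h⟩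
  have hA1 : s.2 1 ≠ A := fun h => hA ⟨1, h⟩
  have key : ∀ a b c d : Fin 5, ∃ e, e ≠ a ∧ e ≠ b ∧ e ≠ c ∧ e ≠ d := by decide
  obtain ⟨B, b0, b1, b2, b3⟩ := key (s.2 0) (s.2 1) A k
  have hinj : Function.Injective (![s.2 0, s.2 1, A, B, k] : Fin 5 → Fin 5) := by
    intro x y hxy
    fin_cases x <;> fin_cases y <;> first
      | rfl
      | exact absurd hxy h01
      | exact absurd hxy.symm h01
      | exact absurd hxy hk0
      | exact absurd hxy.symm hk0
      | exact absurd hxy hk1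
      | exact absurd hxy.symm hk1
      | exact absurd hxy hA0
      | exact absurd hxy.symm hA0
      | exact absurd hxy hA1
      | exact absurd hxy.symm hA1
      | exact absurd hxy b0
      | exact absurd hxy.symm b0
      | exact absurd hxy b1
      | exact absurd hxy.symm b1
      | exact absurd hxy b2
      | exact absurd hxy.symm b2
      | exact absurd hxy b3
      | exact absurd hxy.symm b3
      | exact absurd hxy h
      | exact absurd hxy.symm h
  refine ⟨(s.1, ⟨_, hinj⟩), St.ext' rfl fun a => ?_, rfl, rfl⟩
  fin_cases a <;> rfl

theorem exists_flag' (s : St D 2) {k : Fin 5} (hk : k ∉ range s.2) : ∃ fl, base fl = s ∧ fl.2 4 = k := by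
  obtain ⟨A, hA, hne⟩ := Enh.exists_off (d := 2) (by decide) s.2 k
  obtain ⟨fl, h1, _, h3⟩ := exists_flag s hk hA hne
  exact ⟨fl, h1, h3⟩

theorem exists_flag'' (s : St D 2) : ∃ fl, base fl = s := by
  obtain ⟨A, hA, hne⟩ := Enh.exists_off (d := 2) (by decide) s.2 0
  obtain ⟨fl, h1, h3⟩ := exists_flag' s hA
  exact ⟨fl, h1⟩

theorem flag_cK {fl b : St D 5} (h : base fl = base b) (a : Fin 5) (ha : a ≠ 0) (ha1 : a ≠ 1) :
    fl.2 a = b.2 2 ∨ fl.2 a = b.2 3 ∨ fl.2 a = b.2 4 := by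
  have hk : fl.2 a ∉ range (base fl).2 := by rw [mem_base]; tauto
  rw [h] at hk
  obtain ⟨c, hc⟩ := flag_surj b (fl.2 a)
  rw [← hc, mem_base] at hk
  rw [← hc]
  fin_cases c
  · simp at hk
  · simp at hk
  · left; rfl
  · right; left; rfl
  · right; right; rfl

theorem flag_cases {fl b : St D 5} (h : base fl = base b) (h4 : fl.2 4 = b.2 4) : fl = b ∨ fl = flp b := by
  have e0 : fl.2 0 = b.2 0 := congrArg (fun q : St D 2 => q.2 0) h
  have e1 : fl.2 1 = b.2 1 := congrArg (fun q : St D 2 => q.2 1) h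
  have ei : fl.1 = b.1 := congrArg (fun q : St D 2 => q.1) h
  have n2 : fl.2 2 ≠ b.2 4 := by rw [← h4]; intro h; exact absurd (fl.2.injective h) (by decide)
  have n3 : fl.2 3 ≠ b.2 4 := by rw [← h4]; intro h; exact absurd (fl.2.injective h) (by decide)
  have n23 : fl.2 2 ≠ fl.2 3 := by intro h; exact absurd (fl.2.injective h) (by decide)
  have c2 := flag_cK h 2 (by decide) (by decide)
  have c3 := flag_cK h 3 (by decide) (by decide)
  by_cases hh : fl.2 2 = b.2 2
  · left
    have h3 : fl.2 3 = b.2 3 := by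
      rcases c3 with c | c | c
      · exact absurd (hh.trans c.symm) n23
      · exact c
      · exact absurd c n3
    refine St.ext' ei fun a => ?_
    fin_cases a
    exacts [e0, e1, hh, h3, h4]
  · right
    have h2 : fl.2 2 = b.2 3 := by tauto
    have h3 : fl.2 3 = b.2 2 := by
      rcases c3 with c | c | c
      · exact c
      · exact absurd (h2.trans c.symm) n23
      · exact absurd c n3
    refine St.ext' ei fun a => ?_
    fin_cases a
    exacts [e0, e1, h2.trans (flp_2 b).symm, h3.trans (flp_3 b).symm, h4.trans (flp_4 b).symm]

/-- the two other sides -/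
def sA (b : St D 5) : St D 5 := b.pre (Equiv.swap 3 4)
def sB (b : St D 5) : St D 5 := b.pre (Equiv.swap 2 4)

theorem base_sA (b : St D 5) : base (sA b) = base b := base_pre _ _ (by decide) (by decide)
theorem base_sB (b : St D 5) : base (sB b) = base b := base_pre _ _ (by decide) (by decide)
theorem sA_2 (b : St D 5) : (sA b).2 2 = b.2 2 := congrArg b.2 (by decide)
theorem sA_3 (b : St D 5) : (sA b).2 3 = b.2 4 := congrArg b.2 (by decide)
theorem sA_4 (b : St D 5) : (sA b).2 4 = b.2 3 := congrArg b.2 (by decide)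
theorem sB_2 (b : St D 5) : (sB b).2 2 = b.2 4 := congrArg b.2 (by decide)
theorem sB_3 (b : St D 5) : (sB b).2 3 = b.2 3 := congrArg b.2 (by decide)
theorem sB_4 (b : St D 5) : (sB b).2 4 = b.2 2 := congrArg b.2 (by decide)

theorem crd_sA (b : St D 5) (t : ℝ) : crd b (pt (sA b) t) = (1 - t, 0, t) := by
  rw [crd, ← sA_2 b, ← sA_3 b, ← sA_4 b, pt_a, pt_a, pt_a]; rfl
theorem crd_sB (b : St D 5) (t : ℝ) : crd b (pt (sB b) t) = (0, t, 1 - t) := by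
  rw [crd, ← sB_2 b, ← sB_3 b, ← sB_4 b, pt_a, pt_a, pt_a]; rfl

theorem flag_all {fl b : St D 5} (h : base fl = base b) : fl = b ∨ fl = flp b ∨ fl = sA b ∨ fl = flp (sA b) ∨ fl = sB b ∨ fl = flp (sB b) := by
  rcases flag_cK h 4 (by decide) (by decide) with c | c | c
  · have := flag_cases (h.trans (base_sB b).symm) (c.trans (sB_4 b).symm); tauto
  · have := flag_cases (h.trans (base_sA b).symm) (c.trans (sA_4 b).symm); tauto
  · have := flag_cases h c; tauto

theorem crd_cont (fl : St D 5) : Continuous (crd fl) := by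
  unfold crd; fun_prop

end flags
end FileS1

section FileS2
section grow
variable {D : GlueingDatum 4}
open Set

/-- being a boundary side of the polygon -/
def isSide (N : ℕ) (d : ℕ → St D 5) (fl : St D 5) : Prop := ∃ m < N, fl = d m ∨ fl = flp (d m)

/-- a partial development of the link surface as a polygon -/
structure Grown (s0 : St D 2) (N : ℕ) (P : Set (St D 2)) (p : St D 2 → (Fin 5 → ℝ) → ℂ) (d : ℕ → St D 5) : Prop where
  hN : 3 ≤ N
  reach : ∀ s ∈ P, SR s0 s
  start : s0 ∈ P
  cont : ∀ s ∈ P, ContinuousOn (p s) (tri s)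
  maps : ∀ s ∈ P, ∀ y ∈ tri s, p s y ∈ DD
  surj : ∀ z ∈ DD, ∃ s ∈ P, ∃ y ∈ tri s, p s y = z
  ker : ∀ s ∈ P, ∀ s' ∈ P, ∀ y ∈ tri s, ∀ y' ∈ tri s', p s y = p s' y' → TR (s, y) (s', y')
  side : ∀ m < N, base (d m) ∈ P ∧ ∀ t ∈ Icc (0:ℝ) 1, p (base (d m)) (pt (d m) t) = bd N (m + t)
  glued : ∀ fl, base fl ∈ P → ¬ isSide N d fl → base (Gf fl) ∈ P ∧ ¬ isSide N d (Gf fl) ∧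
    ∀ t ∈ Icc (0:ℝ) 1, p (base fl) (pt fl t) = p (base (Gf fl)) (pt (Gf fl) t)
  corner : ∀ fl, base fl ∈ P → ∃ m ≤ N, p (base fl) (pt fl 0) = bd N m
  conn : ∀ h : St D 2 → ZMod 2, (∀ fl, base fl ∈ P → ¬ isSide N d fl → h (base fl) = h (base (Gf fl))) →
    ∀ s ∈ P, h s = h s0

theorem isSide_flp {N : ℕ} {d : ℕ → St D 5} {fl : St D 5} : isSide N d (flp fl) ↔ isSide N d fl := by
  constructor
  · rintro ⟨m, hm, h | h⟩
    · exact ⟨m, hm, .inr (by rw [← h, flp_flp])⟩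
    · exact ⟨m, hm, .inl (by rw [← flp_flp fl, h, flp_flp])⟩
  · rintro ⟨m, hm, rfl | rfl⟩
    · exact ⟨m, hm, .inr rfl⟩
    · exact ⟨m, hm, .inl (flp_flp _)⟩

theorem Grown.inj {s0 : St D 2} {N : ℕ} {P : Set (St D 2)} {p : St D 2 → (Fin 5 → ℝ) → ℂ} {d : ℕ → St D 5}
    (G : Grown s0 N P p d) {m m' : ℕ} (hm : m < N) (hm' : m' < N) (h : d m = d m' ∨ d m = flp (d m')) : m = m' := by
  have hmr : (m : ℝ) + 1 ≤ N := by exact_mod_cast hm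
  have hmr' : (m' : ℝ) + 1 ≤ N := by exact_mod_cast hm'
  have hm0 : (0:ℝ) ≤ m := by positivity
  have hm0' : (0:ℝ) ≤ m' := by positivity
  have h1 := (G.side m hm).2 (1/4) (by constructor <;> norm_num)
  have hN : (0:ℝ) < N := by linarith
  rcases h with h | h
  · have h2 := (G.side m' hm').2 (1/4) (by constructor <;> norm_num)
    rw [h, h2] at h1
    have := bd_inj' hN (by constructor <;> linarith) (by constructor <;> linarith) h1
    have : (m : ℝ) = m' := by linarith
    exact_mod_cast this
  · have h2 := (G.side m' hm').2 (3/4) (by constructor <;> norm_num)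
    rw [h, pt_flp, base_flp, show (1 - 1/4 : ℝ) = 3/4 by norm_num, h2] at h1
    have := bd_inj' hN (by constructor <;> linarith) (by constructor <;> linarith) h1
    exfalso
    have e : (2 * m' + 1 : ℝ) = 2 * m := by linarith
    have : 2 * m' + 1 = 2 * m := by exact_mod_cast e
    omega

theorem Grown.initial (s0 : St D 2) : ∃ N P p d, Grown s0 N P p d := by
  obtain ⟨b, rfl⟩ := exists_flag'' s0
  obtain ⟨f, h1, h2, h3, h4, h5, h6, h7⟩ := baseTri
  have e0 : ∀ t ∈ Icc (0:ℝ) 1, f (crd b (pt b t)) = bd 3 t := fun t ht => by rw [crd_pt, h5 t ht]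
  have e1 : ∀ t ∈ Icc (0:ℝ) 1, f (crd b (pt (flp (sB b)) t)) = bd 3 (1 + t) := fun t ht => by
    rw [pt_flp, crd_sB, ← h6 t ht]; norm_num
  have e2 : ∀ t ∈ Icc (0:ℝ) 1, f (crd b (pt (flp (sA b)) t)) = bd 3 (2 + t) := fun t ht => by
    rw [pt_flp, crd_sA, ← h7 t ht]; norm_num
  have hall : ∀ fl : St D 5, base fl = base b → isSide 3 (fun m => if m = 0 then b else if m = 1 then flp (sB b) else flp (sA b)) fl := by
    intro fl hfl
    rcases flag_all hfl with h | h | h | h | h | h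
    · exact ⟨0, by norm_num, by simp [h]⟩
    · exact ⟨0, by norm_num, by simp [h]⟩
    · exact ⟨2, by norm_num, by simp [h, flp_flp]⟩
    · exact ⟨2, by norm_num, by simp [h]⟩
    · exact ⟨1, by norm_num, by simp [h, flp_flp]⟩
    · exact ⟨1, by norm_num, by simp [h]⟩
  have hm : ∀ y ∈ tri (base b), crd b y ∈ TT := fun y hy => ((tri_iff _ _).1 hy).2.2
  refine ⟨3, {base b}, fun _ y => f (crd b y), fun m => if m = 0 then b else if m = 1 then flp (sB b) else flp (sA b),
    ?_, ?_, ?_, ?_, ?_, ?_, ?_, ?_, ?_, ?_, ?_⟩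
  · exact le_rfl
  · rintro s rfl; exact .refl
  · rfl
  · rintro s rfl; exact h1.comp (crd_cont b).continuousOn hm
  · rintro s rfl y hy; exact h2 _ (hm y hy)
  · intro z hz
    obtain ⟨w, hw, rfl⟩ := h4 z hz
    obtain ⟨y, hy, rfl⟩ := crd_surj b hw
    exact ⟨_, rfl, y, hy, rfl⟩
  · rintro s rfl s' rfl y hy y' hy' h
    rw [crd_inj b hy hy' (h3 (hm y hy) (hm y' hy') h)]
    exact .refl
  · intro m hm
    interval_cases m
    · exact ⟨rfl, fun t ht => by simpa using e0 t ht⟩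
    · exact ⟨by simp [base_flp, base_sB], fun t ht => by simpa using e1 t ht⟩
    · exact ⟨by simp [base_flp, base_sA], fun t ht => by simpa using e2 t ht⟩
  · intro fl hfl hn
    exact absurd (hall fl hfl) hn
  · intro fl hfl
    have h0 : (0:ℝ) ∈ Icc (0:ℝ) 1 := by simp
    have h1 : (1:ℝ) ∈ Icc (0:ℝ) 1 := by simp
    rw [pt_zero]
    rcases flag_cK hfl 2 (by decide) (by decide) with h | h | h
    · refine ⟨0, by norm_num, ?_⟩
      rw [h, ← pt_zero]; simpa using e0 0 h0
    · refine ⟨1, by norm_num, ?_⟩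
      have := e1 0 h0
      rw [pt_zero, flp_2, sB_3] at this
      rw [h, this]; simp
    · refine ⟨2, by norm_num, ?_⟩
      have := e2 0 h0
      rw [pt_zero, flp_2, sA_3] at this
      rw [h, this]; simp
  · rintro h _ s rfl; rfl

theorem Grown.step {s0 : St D 2} {N : ℕ} {P : Set (St D 2)} {p : St D 2 → (Fin 5 → ℝ) → ℂ} {d : ℕ → St D 5}
    (G : Grown s0 N P p d) {i : ℕ} (hi : i < N) (hu : base (Gf (d i)) ∉ P) :
    ∃ p' d', Grown s0 (N + 1) (insert (base (Gf (d i))) P) p' d' := by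
  have hir : (i : ℝ) + 1 ≤ N := by exact_mod_cast hi
  have hN2 : (2:ℝ) ≤ N := by have := G.hN; exact_mod_cast (by omega : 2 ≤ N)
  obtain ⟨f, f', c1, c2, c3, c4, c5, c6, c7, c8, c9, c10, c11, c12, c13⟩ := merge hN2 (Nat.cast_nonneg i) hir
  obtain ⟨b, hb⟩ : ∃ b, b = Gf (d i) := ⟨_, rfl⟩
  rw [← hb] at hu ⊢
  have hbi : Gf b = d i := by rw [hb, Gf_Gf]
  have hm : ∀ y ∈ tri (base b), crd b y ∈ TT := fun y hy => ((tri_iff _ _).1 hy).2.2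
  obtain ⟨p', hp'⟩ : ∃ p' : St D 2 → (Fin 5 → ℝ) → ℂ, p' = fun s y => if s = base b then f' (crd b y) else f (p s y) := ⟨_, rfl⟩
  have pP : ∀ s ∈ P, p' s = fun y => f (p s y) := by
    intro s hs
    have : s ≠ base b := fun h => hu (h ▸ hs)
    simp [hp', this]
  have pb : p' (base b) = fun y => f' (crd b y) := by simp [hp']
  obtain ⟨d', hd'⟩ : ∃ d' : ℕ → St D 5, d' = fun m => if m < i then d m else if m = i then sA b else if m = i + 1 then sB b else d (m - 1) := ⟨_, rfl⟩
  have d1 : ∀ m < i, d' m = d m := by intro m hm; simp [hd', hm]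
  have d2 : d' i = sA b := by simp [hd']
  have d3 : d' (i + 1) = sB b := by simp [hd']
  have d4 : ∀ m, i < m → d' (m + 1) = d m := by
    intro m hm
    have h1 : ¬ (m + 1 < i) := by omega
    have h2 : ¬ (m + 1 = i) := by omega
    have h3 : ¬ (m = i) := by omega
    simp [hd', h1, h2, h3]
  have old : ∀ m < N, m ≠ i → ∃ m' < N + 1, d' m' = d m := by
    intro m hm hne
    rcases lt_or_gt_of_ne hne with h | h
    · exact ⟨m, by omega, d1 m h⟩
    · exact ⟨m + 1, by omega, d4 m h⟩
  have side' : ∀ fl, isSide (N + 1) d' fl ↔ (∃ m < N, m ≠ i ∧ (fl = d m ∨ fl = flp (d m))) ∨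
      (fl = sA b ∨ fl = flp (sA b)) ∨ (fl = sB b ∨ fl = flp (sB b)) := by
    intro fl
    constructor
    · rintro ⟨m, hm, h⟩
      rcases lt_or_ge m i with h1 | h1
      · rw [d1 m h1] at h; exact .inl ⟨m, by omega, by omega, h⟩
      · rcases eq_or_lt_of_le h1 with rfl | h1
        · rw [d2] at h; tauto
        · rcases eq_or_lt_of_le (Nat.succ_le_of_lt h1) with h2 | h2
          · have : m = i + 1 := h2.symm
            rw [this, d3] at h; tauto
          · obtain ⟨q, rfl⟩ : ∃ q, m = q + 1 := ⟨m - 1, by omega⟩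
            rw [d4 q (by omega)] at h
            exact .inl ⟨q, by omega, by omega, h⟩
    · rintro (⟨m, hm, hne, h⟩ | h | h)
      · obtain ⟨m', hm', e⟩ := old m hm hne
        exact ⟨m', hm', by rwa [e]⟩
      · exact ⟨i, by omega, by rwa [d2]⟩
      · exact ⟨i + 1, by omega, by rwa [d3]⟩
  have sideP : ∀ fl, base fl ∈ P → (isSide (N + 1) d' fl ↔ ∃ m < N, m ≠ i ∧ (fl = d m ∨ fl = flp (d m))) := by
    intro fl hfl
    rw [side']
    constructor
    · rintro (h | (rfl | rfl) | (rfl | rfl))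
      · exact h
      · rw [base_sA] at hfl; exact absurd hfl hu
      · rw [base_flp, base_sA] at hfl; exact absurd hfl hu
      · rw [base_sB] at hfl; exact absurd hfl hu
      · rw [base_flp, base_sB] at hfl; exact absurd hfl hu
    · exact .inl
  have sideb : ¬ isSide (N + 1) d' b := by
    rw [side']
    have n1 : ∀ {x y : Fin 5}, x ≠ y → b.2 x ≠ b.2 y := fun h h' => h (b.2.injective h')
    rintro (⟨m, hm, _, h | h⟩ | (h | h) | (h | h))
    · apply hu; rw [h]; exact (G.side m hm).1
    · apply hu; rw [h, base_flp]; exact (G.side m hm).1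
    all_goals
      have h := congrArg (fun q : St D 5 => q.2 4) h
      simp only [flp_4, sA_4, sB_4] at h
      exact n1 (by decide) h
  have sidea : ¬ isSide (N + 1) d' (d i) := by
    rw [sideP _ (G.side i hi).1]
    rintro ⟨m, hm, hne, h⟩
    exact hne (G.inj hi hm h).symm
  have glue0 : ∀ t ∈ Icc (0:ℝ) 1, p' (base (d i)) (pt (d i) t) = p' (base b) (pt b t) := by
    intro t ht
    rw [pP _ (G.side i hi).1, pb]
    simp only
    rw [(G.side i hi).2 t ht, crd_pt, c12 t ht]
  have flpIcc : ∀ {t : ℝ}, t ∈ Icc (0:ℝ) 1 → 1 - t ∈ Icc (0:ℝ) 1 := fun ht => ⟨by linarith [ht.2], by linarith [ht.1]⟩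
  have glueb : ∀ fl, fl = b ∨ fl = flp b → base (Gf fl) ∈ insert (base b) P ∧ ¬ isSide (N + 1) d' (Gf fl) ∧
      ∀ t ∈ Icc (0:ℝ) 1, p' (base fl) (pt fl t) = p' (base (Gf fl)) (pt (Gf fl) t) := by
    rintro fl (rfl | rfl)
    · rw [hbi]; exact ⟨.inr (G.side i hi).1, sidea, fun t ht => (glue0 t ht).symm⟩
    · rw [Gf_flp, hbi, isSide_flp, base_flp, base_flp]
      refine ⟨.inr (G.side i hi).1, sidea, fun t ht => ?_⟩
      rw [pt_flp, pt_flp]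
      exact (glue0 _ (flpIcc ht)).symm
  have gluea : ∀ fl, fl = d i ∨ fl = flp (d i) → base (Gf fl) ∈ insert (base b) P ∧ ¬ isSide (N + 1) d' (Gf fl) ∧
      ∀ t ∈ Icc (0:ℝ) 1, p' (base fl) (pt fl t) = p' (base (Gf fl)) (pt (Gf fl) t) := by
    rintro fl (rfl | rfl)
    · rw [← hb]; exact ⟨.inl rfl, sideb, fun t ht => glue0 t ht⟩
    · rw [Gf_flp, ← hb, isSide_flp, base_flp, base_flp]
      refine ⟨.inl rfl, sideb, fun t ht => ?_⟩
      rw [pt_flp, pt_flp]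
      exact glue0 _ (flpIcc ht)
  have ptTR : ∀ s ∈ P, ∀ y ∈ tri s, ∀ y' ∈ tri (base b), f (p s y) = f' (crd b y') → TR (s, y) (base b, y') := by
    intro s hs y hy y' hy' h
    obtain ⟨t, ht, e1, e2⟩ := c13 _ (G.maps s hs y hy) _ (hm y' hy') h
    rw [← (G.side i hi).2 t ht] at e1
    have h1 := G.ker s hs _ (G.side i hi).1 y hy _ (pt_mem _ ht) e1
    have h2 : y' = pt b t := crd_inj b hy' (pt_mem b ht) (by rw [e2, crd_pt])
    rw [h2, hb]
    exact h1.trans (TR_Gf _ _)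
  have hNc : ((N + 1 : ℕ) : ℝ) = N + 1 := by push_cast; ring
  refine ⟨p', d', ?_, ?_, ?_, ?_, ?_, ?_, ?_, ?_, ?_, ?_, ?_⟩
  · have := G.hN; omega
  · rintro s (rfl | hs)
    · refine (G.reach _ (G.side i hi).1).trans (.single ⟨(d i).2 4, cK_notMem _, ?_⟩)
      rw [hb]; rfl
    · exact G.reach s hs
  · exact .inr G.start
  · rintro s (rfl | hs)
    · rw [pb]; exact c2.comp (crd_cont b).continuousOn hm
    · rw [pP s hs]; exact c1.comp (G.cont s hs) (G.maps s hs)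
  · rintro s (rfl | hs) y hy
    · rw [pb]; exact c4 _ (hm y hy)
    · rw [pP s hs]; exact c3 _ (G.maps s hs y hy)
  · intro w hw
    rcases c7 w hw with ⟨z, hz, rfl⟩ | ⟨w', hw', rfl⟩
    · obtain ⟨s, hs, y, hy, rfl⟩ := G.surj z hz
      exact ⟨s, .inr hs, y, hy, by rw [pP s hs]⟩
    · obtain ⟨y, hy, rfl⟩ := crd_surj b hw'
      exact ⟨_, .inl rfl, y, hy, by rw [pb]⟩
  · rintro s (rfl | hs) s' (rfl | hs') y hy y' hy' h
    · rw [pb] at h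
      rw [crd_inj b hy hy' (c6 (hm y hy) (hm y' hy') h)]
      exact .refl
    · rw [pb, pP s' hs'] at h
      exact (ptTR s' hs' y' hy' y hy h.symm).symm
    · rw [pb, pP s hs] at h
      exact ptTR s hs y hy y' hy' h
    · rw [pP s hs, pP s' hs'] at h
      exact G.ker s hs s' hs' y hy y' hy' (c5 (G.maps s hs y hy) (G.maps s' hs' y' hy') h)
  · intro m hmN
    rw [hNc]
    rcases lt_or_ge m i with h1 | h1
    · have hmi : (m : ℝ) + 1 ≤ i := by exact_mod_cast h1
      rw [d1 m h1]
      have hs := G.side m (by omega)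
      refine ⟨.inr hs.1, fun t ht => ?_⟩
      rw [pP _ hs.1]; simp only
      rw [hs.2 t ht, c8]
      constructor
      · have := ht.1; positivity
      · linarith [ht.2]
    · rcases eq_or_lt_of_le h1 with rfl | h1
      · rw [d2, base_sA, pb]
        refine ⟨.inl rfl, fun t ht => ?_⟩
        simp only
        rw [crd_sA, c10 t ht]
      · rcases eq_or_lt_of_le (Nat.succ_le_of_lt h1) with h2 | h2
        · have : m = i + 1 := h2.symm
          rw [this, d3, base_sB, pb]
          refine ⟨.inl rfl, fun t ht => ?_⟩
          simp only
          rw [crd_sB, c11 t ht]; push_cast; rfl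
        · obtain ⟨q, rfl⟩ : ∃ q, m = q + 1 := ⟨m - 1, by omega⟩
          rw [d4 q (by omega)]
          have hs := G.side q (by omega)
          have hq1 : (i : ℝ) + 1 ≤ q := by exact_mod_cast (by omega : i + 1 ≤ q)
          have hq2 : (q : ℝ) + 1 ≤ N := by exact_mod_cast (by omega : q + 1 ≤ N)
          refine ⟨.inr hs.1, fun t ht => ?_⟩
          rw [pP _ hs.1]; simp only
          rw [hs.2 t ht, c9]
          · push_cast; congr 1; ring
          · exact ⟨by linarith [ht.1], by linarith [ht.2]⟩
  · rintro fl (hfl | hfl) hns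
    · rcases flag_all hfl with h | h | h
      · exact glueb fl (.inl h)
      · exact glueb fl (.inr h)
      · exact absurd ((side' fl).2 (by tauto)) hns
    · by_cases ho : isSide N d fl
      · obtain ⟨m, hmN, h⟩ := ho
        by_cases hmi : m = i
        · subst hmi; exact gluea fl h
        · exact absurd ((side' fl).2 (.inl ⟨m, hmN, hmi, h⟩)) hns
      · obtain ⟨g1, g2, g3⟩ := G.glued fl hfl ho
        refine ⟨.inr g1, ?_, fun t ht => ?_⟩
        · rw [sideP _ g1]
          rintro ⟨m, hmN, _, h⟩
          exact g2 ⟨m, hmN, h⟩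
        · rw [pP _ hfl, pP _ g1]; simp only; rw [g3 t ht]
  · rintro fl (hfl | hfl)
    · have h0 : (0:ℝ) ∈ Icc (0:ℝ) 1 := by simp
      have h1 : (1:ℝ) ∈ Icc (0:ℝ) 1 := by simp
      have k0 := c10 0 h0
      have k1 := c11 0 h0
      have k2 := c11 1 h1
      rw [← crd_sA b, pt_zero, sA_2] at k0
      rw [← crd_sB b, pt_zero, sB_2] at k1
      rw [← crd_sB b, show (1:ℝ) = 1 - 0 by simp, ← pt_flp, pt_zero, flp_2, sB_3] at k2
      rw [hfl, pb, pt_zero, hNc]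
      rcases flag_cK hfl 2 (by decide) (by decide) with h | h | h
      · exact ⟨i, by omega, by simp only [h, k0]; simp⟩
      · exact ⟨i + 2, by omega, by simp only [h]; rw [sub_zero] at k2; rw [k2]; push_cast; congr 1; ring⟩
      · exact ⟨i + 1, by omega, by simp only [h, k1]; push_cast; simp⟩
    · obtain ⟨m, hmN, h⟩ := G.corner fl hfl
      rw [pP _ hfl, hNc]; simp only [h]
      rcases le_or_gt m i with h1 | h1
      · exact ⟨m, by omega, c8 _ ⟨by positivity, by exact_mod_cast h1⟩⟩
      · refine ⟨m + 1, by omega, ?_⟩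
        rw [c9 _ ⟨by exact_mod_cast h1, by exact_mod_cast hmN⟩]
        push_cast; rfl
  · intro h hh
    have hP : ∀ s ∈ P, h s = h s0 := by
      refine G.conn h fun fl hfl hns => hh fl (.inr hfl) ?_
      rw [sideP _ hfl]
      rintro ⟨m, hmN, _, h⟩
      exact hns ⟨m, hmN, h⟩
    rintro s (rfl | hs)
    · have := hh (d i) (.inr (G.side i hi).1) sidea
      rw [← hb] at this
      rw [← this, hP _ (G.side i hi).1]
    · exact hP s hs

theorem Grown.full (s0 : St D 2) : ∃ N P p d, Grown s0 N P p d ∧ (∀ m < N, base (Gf (d m)) ∈ P) ∧ ∀ s, SR s0 s → s ∈ P := by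
  have hfin : Finite (St D 2) := by
    have := D.fintypeI
    unfold St; infer_instance
  have key : ∃ N P p d, Grown s0 N P p d ∧ (∀ m < N, base (Gf (d m)) ∈ P) := by
    by_contra hcon
    have : ∀ n : ℕ, ∃ N P p d, Grown s0 N P p d ∧ n ≤ P.ncard := by
      intro n
      induction n with
      | zero =>
        obtain ⟨N, P, p, d, h⟩ := Grown.initial s0
        exact ⟨N, P, p, d, h, by omega⟩
      | succ n ih =>
        obtain ⟨N, P, p, d, h, hn⟩ := ih
        have : ¬ ∀ m < N, base (Gf (d m)) ∈ P := fun h' => hcon ⟨N, P, p, d, h, h'⟩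
        push Not at this
        obtain ⟨i, hi, hu⟩ := this
        obtain ⟨p', d', h'⟩ := h.step hi hu
        refine ⟨_, _, p', d', h', ?_⟩
        rw [ncard_insert_of_notMem hu (toFinite _)]; omega
    obtain ⟨N, P, p, d, h, hn⟩ := this (Nat.card (St D 2) + 1)
    have := ncard_le_card P
    omega
  obtain ⟨N, P, p, d, G, hs⟩ := key
  refine ⟨N, P, p, d, G, hs, fun s h => ?_⟩
  induction h with
  | refl => exact G.start
  | tail _ h ih =>
    obtain ⟨k, hk, rfl⟩ := h
    obtain ⟨fl, rfl, rfl⟩ := exists_flag' _ hk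
    rw [← base_Gf]
    by_cases hsd : isSide N d fl
    · obtain ⟨m, hm, rfl | rfl⟩ := hsd
      · exact hs m hm
      · rw [Gf_flp, base_flp]; exact hs m hm
    · exact (G.glued fl ih hsd).1

end grow
end FileS2

section FileS3
section surfc
variable {D : GlueingDatum 4}
open Set

/-- the link surface of an edge is parametrised by the sphere -/
def SurfC (s0 : St D 2) : Prop := ∃ Φ : St D 2 → (Fin 5 → ℝ) → E3,
  (∀ s, SR s0 s → ContinuousOn (Φ s) (tri s)) ∧ (∀ s, SR s0 s → ∀ y ∈ tri s, ‖Φ s y‖ = 1) ∧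
  (∀ w, ‖w‖ = 1 → ∃ s, SR s0 s ∧ ∃ y ∈ tri s, Φ s y = w) ∧
  (∀ s s', SR s0 s → SR s0 s' → ∀ y ∈ tri s, ∀ y' ∈ tri s', Φ s y = Φ s' y' ↔ TR (s, y) (s', y'))

theorem Grown.pair {s0 : St D 2} {N : ℕ} {P : Set (St D 2)} {p : St D 2 → (Fin 5 → ℝ) → ℂ} {d : ℕ → St D 5}
    (G : Grown s0 N P p d) (hs : ∀ m < N, base (Gf (d m)) ∈ P) : ∃ al : ℕ → ℕ, (∀ m < N, al m < N) ∧
      (∀ m < N, al (al m) = m) ∧ (∀ m < N, al m ≠ m) ∧ ∀ m < N, Gf (d m) = d (al m) ∨ Gf (d m) = flp (d (al m)) := by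
  have h1 : ∀ m, ∃ m', m < N → m' < N ∧ (Gf (d m) = d m' ∨ Gf (d m) = flp (d m')) := by
    intro m
    by_cases hm : m < N
    · have : isSide N d (Gf (d m)) := by
        by_contra hc
        have := (G.glued _ (hs m hm) hc).2.1
        rw [Gf_Gf] at this
        exact this ⟨m, hm, .inl rfl⟩
      obtain ⟨m', hm', h⟩ := this
      exact ⟨m', fun _ => ⟨hm', h⟩⟩
    · exact ⟨0, fun h => absurd h hm⟩
  choose al hal using h1
  have back : ∀ m < N, Gf (d (al m)) = d m ∨ Gf (d (al m)) = flp (d m) := by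
    intro m hm
    rcases (hal m hm).2 with h | h
    · left; rw [← h, Gf_Gf]
    · right; rw [← Gf_Gf (d m), h, Gf_flp, flp_flp]
  refine ⟨al, fun m hm => (hal m hm).1, fun m hm => ?_, fun m hm he => ?_, fun m hm => (hal m hm).2⟩
  · have h1 := back m hm
    have h2 := hal (al m) (hal m hm).1
    refine G.inj h2.1 hm ?_
    rcases h1 with h1 | h1 <;> rcases h2.2 with h3 | h3
    · left; rw [← h1, h3]
    · right; rw [← h1, h3, flp_flp]
    · right; rw [← h1, h3]
    · left
      rw [h1] at h3
      rw [← flp_flp (d m), h3, flp_flp]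
  · have := (hal m hm).2
    rw [he] at this
    rcases this with h | h
    · exact Gf_ne _ h
    · exact Gf_ne_flp _ h

theorem ite_iff_zmod {A B : Prop} [Decidable A] [Decidable B]
    (h : (if A then (1 : ZMod 2) else 0) = (if B then 1 else 0)) : A ↔ B := by
  by_cases hA : A
  · by_cases hB : B
    · exact iff_of_true hA hB
    · rw [if_pos hA, if_neg hB] at h; exact absurd h (by decide)
  · by_cases hB : B
    · rw [if_neg hA, if_pos hB] at h; exact absurd h (by decide)
    · exact iff_of_false hA hB

set_option maxHeartbeats 1000000 in
theorem Grown.coh {s0 : St D 2} {N : ℕ} {P : Set (St D 2)} {p : St D 2 → (Fin 5 → ℝ) → ℂ} {d : ℕ → St D 5}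
    (hloc : LocEuclidean 4 (GlueSpaceStar D))
    (G : Grown s0 N P p d) (hfull : ∀ s, SR s0 s → s ∈ P) {al : ℕ → ℕ} (a1 : ∀ m < N, al m < N)
    (a2 : ∀ m < N, al (al m) = m) (a4 : ∀ m < N, Gf (d m) = d (al m) ∨ Gf (d m) = flp (d (al m)))
    {i : ℕ} (hi : i < N) (hlt : i < al i) (m : ℕ) (hm : m < N) :
    (Gf (d m) = d (al m) → ((i + 1 ≤ m ∧ m ≤ al i) ↔ (i + 1 ≤ al m ∧ al m ≤ al i))) ∧
    (Gf (d m) = flp (d (al m)) → ((i + 1 ≤ m ∧ m ≤ al i) ↔ (i + 1 ≤ al m + 1 ∧ al m + 1 ≤ al i))) := by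
  have hN0 : (0:ℝ) < N := by exact_mod_cast (by omega : 0 < N)
  obtain ⟨χ, hχ⟩ : ∃ χ : ℂ → ZMod 2, χ = fun z => if ∃ j : ℕ, (i + 1 ≤ j ∧ j ≤ al i) ∧ z = bd N j then 1 else 0 := ⟨_, rfl⟩
  have hχj : ∀ j : ℕ, j ≤ N → χ (bd N j) = if i + 1 ≤ j ∧ j ≤ al i then 1 else 0 := by
    intro j hj
    rw [hχ]
    refine if_congr ⟨?_, fun h => ⟨j, h, rfl⟩⟩ rfl rfl
    rintro ⟨j', hj', he⟩
    have ha := a1 i hi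
    have hj'N : (j' : ℝ) ∈ Ico (0:ℝ) N := ⟨by positivity, by exact_mod_cast (by omega : j' < N)⟩
    rcases eq_or_lt_of_le hj with rfl | hj
    · rw [bd_self hN0.ne', ← bd_zero] at he
      have := bd_inj' hN0 ⟨le_rfl, hN0⟩ hj'N he
      have : j' = 0 := by exact_mod_cast this.symm
      omega
    · have := bd_inj' hN0 ⟨by positivity, by exact_mod_cast hj⟩ hj'N he
      have : j = j' := by exact_mod_cast this
      rw [this]; exact hj'
  obtain ⟨w, hw⟩ : ∃ w : St D 5 → ZMod 2, w = fun fl => χ (p (base fl) (pt fl 0)) := ⟨_, rfl⟩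
  have I0 : (0:ℝ) ∈ Icc (0:ℝ) 1 := by simp
  have I1 : (1:ℝ) ∈ Icc (0:ℝ) 1 := by simp
  have w0 : ∀ m < N, w (d m) = if i + 1 ≤ m ∧ m ≤ al i then 1 else 0 := by
    intro m hm
    rw [← hχj m hm.le, hw]
    simp only
    rw [(G.side m hm).2 0 I0, add_zero]
  have w1 : ∀ m < N, w (flp (d m)) = if i + 1 ≤ m + 1 ∧ m + 1 ≤ al i then 1 else 0 := by
    intro m hm
    rw [← hχj (m + 1) hm, hw]
    simp only
    rw [pt_flp, base_flp, sub_zero, (G.side m hm).2 1 I1]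
    push_cast; rfl
  have wns : ∀ fl, base fl ∈ P → ¬ isSide N d fl → w fl = w (Gf fl) := by
    intro fl h1 h2
    rw [hw]; simp only
    rw [(G.glued fl h1 h2).2.2 0 I0]
  have e0 : ∀ m < N, w (d m) + w (flp (d m)) = if m = i ∨ m = al i then 1 else 0 := by
    intro m hm
    rw [w0 m hm, w1 m hm]
    by_cases h1 : m = i
    · subst h1
      rw [if_neg (by omega), if_pos (by omega), if_pos (by omega)]; rfl
    · by_cases h2 : m = al i
      · rw [if_pos (by omega), if_neg (by omega), if_pos (by omega)]; rfl
      · by_cases h3 : i < m ∧ m < al i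
        · rw [if_pos (by omega), if_pos (by omega), if_neg (by omega)]; rfl
        · rw [if_neg (by omega), if_neg (by omega), if_neg (by omega)]; rfl
  have eal : ∀ m < N, (w (d m) + w (flp (d m)) = w (Gf (d m)) + w (flp (Gf (d m)))) := by
    intro m hm
    have hh : w (Gf (d m)) + w (flp (Gf (d m))) = w (d (al m)) + w (flp (d (al m))) := by
      rcases a4 m hm with h | h
      · rw [h]
      · rw [h, flp_flp, add_comm]
    rw [hh, e0 m hm, e0 _ (a1 m hm)]
    refine if_congr ?_ rfl rfl
    constructor
    · rintro (rfl | rfl)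
      · right; rfl
      · left; exact a2 i hi
    · rintro (h | h)
      · right; rw [← h, a2 m hm]
      · left; rw [← a2 m hm, h, a2 i hi]
  have eE : ∀ fl, base fl ∈ P → w fl + w (Gf fl) = w (flp fl) + w (Gf (flp fl)) := by
    intro fl hfl
    have z2 : ∀ a b c d : ZMod 2, a + b = c + d → a + c = b + d := by decide
    apply z2
    by_cases hsd : isSide N d fl
    · obtain ⟨m, hm, rfl | rfl⟩ := hsd
      · rw [Gf_flp]; exact eal m hm
      · rw [flp_flp, Gf_flp, add_comm, eal m hm, add_comm]
    · have h2 : ¬ isSide N d (flp fl) := by rwa [isSide_flp]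
      rw [wns fl hfl hsd, wns (flp fl) (by rwa [base_flp]) h2]
  obtain ⟨c, hc⟩ : ∃ c : St D 2 → Fin 5 → ZMod 2, ∀ fl, base fl ∈ P → c (base fl) (fl.2 4) = w fl + w (Gf fl) := by
    refine ⟨fun s k => if h : ∃ fl, base fl = s ∧ fl.2 4 = k then w h.choose + w (Gf h.choose) else 0, fun fl hfl => ?_⟩
    have h : ∃ fl', base fl' = base fl ∧ fl'.2 4 = fl.2 4 := ⟨fl, rfl, rfl⟩
    simp only [dif_pos h]
    rcases flag_cases h.choose_spec.1 h.choose_spec.2 with e | e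
    · rw [e]
    · rw [e, ← eE fl hfl]
  obtain ⟨g, hg⟩ : ∃ g : St D 3 → ZMod 2, g = fun τ => χ (p (τ.1, (Fin.castLEEmb (by decide : 2 ≤ 3)).trans τ.2) (Pi.single (τ.2 2) 1)) := ⟨_, rfl⟩
  have hgadd : ∀ s κ (hκ : κ ∉ range s.2), g (s.addv κ hκ) = χ (p s (Pi.single κ 1)) := by
    intro s κ hκ
    rw [hg]
    simp only
    have : ((s.addv κ hκ).1, (Fin.castLEEmb (by decide : 2 ≤ 3)).trans (s.addv κ hκ).2) = s := by
      refine St.ext' rfl fun a => ?_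
      fin_cases a <;> rfl
    rw [this]; rfl
  obtain ⟨h, hh⟩ := h1_vanish hloc s0 c g (by
    intro s k κ hκ hs hk hne
    obtain ⟨fl, rfl, rfl, rfl⟩ := exists_flag s hk hκ hne
    rw [hc fl (hfull _ hs), St.addv_mv, hgadd, hgadd, hw]
    simp only
    rw [pt_zero, pt_zero]
    rfl)
  have hconst := G.conn h (by
    intro fl hfl hns
    have h1 := hh (base fl) (fl.2 4) (G.reach _ hfl) (cK_notMem fl)
    rw [hc fl hfl, wns fl hfl hns] at h1
    have z2 : ∀ a b c : ZMod 2, a + a = b + c → b = c := by decide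
    exact z2 _ _ _ h1)
  have fin : w (d m) = w (Gf (d m)) := by
    have hb := (G.side m hm).1
    have h1 := hh (base (d m)) ((d m).2 4) (G.reach _ hb) (cK_notMem _)
    rw [hc _ hb, hconst _ hb, hconst ((base (d m)).mv _)
      (hfull _ ((G.reach _ hb).tail ⟨_, cK_notMem _, rfl⟩))] at h1
    have z2 : ∀ a b c : ZMod 2, b + c = a + a → b = c := by decide
    exact z2 _ _ _ h1
  constructor
  · intro h
    rw [h, w0 m hm, w0 _ (a1 m hm)] at fin
    exact ite_iff_zmod fin
  · intro h
    rw [h, w0 m hm, w1 _ (a1 m hm)] at fin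
    exact ite_iff_zmod fin

theorem surfC_of_loc (hloc : LocEuclidean 4 (GlueSpaceStar D)) (s0 : St D 2) : SurfC s0 := by
  obtain ⟨N, P, p, d, G, hs, hfull⟩ := Grown.full s0
  obtain ⟨al, a1, a2, a3, a4⟩ := G.pair hs
  have unt1 : ∀ i < N, i < al i → Gf (d i) = flp (d (al i)) := by
    intro i hi hlt
    rcases a4 i hi with h | h
    · have := (G.coh hloc hfull a1 a2 a4 hi hlt i hi).1 h
      omega
    · exact h
  have unt : ∀ m < N, Gf (d m) = flp (d (al m)) := by
    intro m hm
    rcases lt_or_gt_of_ne (a3 m hm) with h | h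
    · have := unt1 (al m) (a1 m hm) (by rw [a2 m hm]; exact h)
      rw [a2 m hm] at this
      rw [← Gf_Gf (flp (d (al m))), Gf_flp, this, flp_flp]
    · exact unt1 m hm h
  have a5 : ∀ i m, i < N → m < N → i < m → m < al i → i < al m ∧ al m < al i := by
    intro i m hi hm h1 h2
    have := (G.coh hloc hfull a1 a2 a4 hi (by omega) m hm).2 (unt m hm)
    have hne : al m ≠ i := by
      intro h
      have := a2 m hm
      rw [h] at this
      omega
    omega
  obtain ⟨Ps, q1, q2, q3, q4⟩ := phase2 N al (by have := G.hN; omega) a1 a2 a3 a5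
  have flpIcc : ∀ {t : ℝ}, t ∈ Icc (0:ℝ) 1 → 1 - t ∈ Icc (0:ℝ) 1 := fun ht => ⟨by linarith [ht.2], by linarith [ht.1]⟩
  have k1 : ∀ z z', Relation.EqvGen (PR N al) z z' → ∀ s ∈ P, ∀ s' ∈ P, ∀ y ∈ tri s, ∀ y' ∈ tri s', p s y = z → p s' y' = z' →
      TR (s, y) (s', y') := by
    intro z z' h
    induction h with
    | rel z z' h =>
      obtain ⟨m, hm, t, ht, rfl, rfl⟩ := h
      intro s hs s' hs' y hy y' hy' e1 e2
      have S := G.side m hm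
      have S' := G.side (al m) (a1 m hm)
      have h1 := G.ker s hs _ S.1 y hy _ (pt_mem _ ht) (e1.trans (S.2 t ht).symm)
      have h2 := TR_Gf (d m) t
      rw [unt m hm, base_flp, pt_flp] at h2
      have h3 := G.ker _ S'.1 s' hs' _ (pt_mem _ (flpIcc ht)) y' hy'
        (by rw [S'.2 _ (flpIcc ht), e2]; congr 1; ring)
      exact (h1.trans h2).trans h3
    | refl z =>
      intro s hs s' hs' y hy y' hy' e1 e2
      exact G.ker s hs s' hs' y hy y' hy' (e1.trans e2.symm)
    | symm z z' _ ih =>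
      intro s hs s' hs' y hy y' hy' e1 e2
      exact (ih s' hs' s hs y' hy' y hy e2 e1).symm
    | trans z z' z'' h1 h2 ih1 ih2 =>
      intro s hs s' hs' y hy y' hy' e1 e2
      have hz' : z' ∈ DD := (EqvPR_mem h1).1 (e1 ▸ G.maps s hs y hy)
      obtain ⟨s'', hs'', y'', hy'', e3⟩ := G.surj z' hz'
      exact (ih1 s hs s'' hs'' y hy y'' hy'' e1 e3).trans (ih2 s'' hs'' s' hs' y'' hy'' y' hy' e3 e2)
  have k2 : ∀ q q' : St D 2 × (Fin 5 → ℝ), TR q q' → q.1 ∈ P → q.2 ∈ tri q.1 → Relation.EqvGen (PR N al) (p q.1 q.2) (p q'.1 q'.2) := by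
    intro q q' h h1 h2
    induction h with
    | refl => exact .refl _
    | @tail q2 q3 hpre h ih =>
      refine ih.trans _ _ _ ?_
      have r1 : q2.1 ∈ P := hfull _ ((G.reach _ h1).trans (TR.toSR hpre))
      have r2 := TR.tri hpre h2
      obtain ⟨s, y⟩ := q2
      simp only at r1 r2
      obtain ⟨k, hk, h0, rfl⟩ := h
      simp only at hk h0 ⊢
      obtain ⟨fl, rfl, rfl⟩ := exists_flag' _ hk
      obtain ⟨ht, he⟩ := eq_pt fl r2 h0
      generalize y (fl.2 3) = t at ht he
      subst he
      have hgoal : p ((base fl).mv (fl.2 4)) (pt fl t ∘ (D.glue ((base fl).1, fl.2 4)).symm) = p (base (Gf fl)) (pt (Gf fl) t) := by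
        rw [pt_Gf]; rfl
      rw [hgoal]
      by_cases hsd : isSide N d fl
      · obtain ⟨m, hm, rfl | rfl⟩ := hsd
        · refine .rel _ _ ⟨m, hm, t, ht, (G.side m hm).2 t ht, ?_⟩
          rw [unt m hm, base_flp, pt_flp, (G.side _ (a1 m hm)).2 _ (flpIcc ht)]
          congr 1; ring
        · refine .rel _ _ ⟨m, hm, 1 - t, flpIcc ht, ?_, ?_⟩
          · rw [base_flp, pt_flp, (G.side m hm).2 _ (flpIcc ht)]
          · rw [Gf_flp, unt m hm, flp_flp, (G.side _ (a1 m hm)).2 _ ht]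
            congr 1; ring
      · rw [(G.glued fl r1 hsd).2.2 t ht]; exact .refl _
  refine ⟨fun s y => Ps (p s y), fun s hs => ?_, fun s hs y hy => ?_, fun w hw => ?_, fun s s' hs hs' y hy y' hy' => ?_⟩
  · exact q1.comp (G.cont s (hfull s hs)) (G.maps s (hfull s hs))
  · exact q2 _ (G.maps s (hfull s hs) y hy)
  · obtain ⟨z, hz, rfl⟩ := q3 w hw
    obtain ⟨s, hs, y, hy, rfl⟩ := G.surj z hz
    exact ⟨s, G.reach s hs, y, hy, rfl⟩
  · rw [q4 _ (G.maps s (hfull s hs) y hy) _ (G.maps s' (hfull s' hs') y' hy')]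
    exact ⟨fun h => k1 _ _ h s (hfull s hs) s' (hfull s' hs') y hy y' hy' rfl rfl, fun h => k2 (s, y) (s', y') h (hfull s hs) hy⟩

end surfc
end FileS3

section FileS4
section surfs
variable {D : GlueingDatum 4}
open Set

/-- the triangle index of an oriented edge -/
def idx (s : St D 2) : D.I × {s : Finset (Fin 5) // s.card = 2} := (s.1, ⟨Finset.univ.map s.2, by simp⟩)

theorem mem_idx {s : St D 2} {v : Fin 5} : v ∈ (idx s).2.1 ↔ v ∈ range s.2 := by simp [idx]

/-- a triangle point as a point of the total space -/
def toS (s : St D 2) (y : tri s) : SurfTotal D :=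
  ⟨idx s, ⟨y.1, y.2.1, y.2.2.1, fun v hv => by obtain ⟨a, rfl⟩ := mem_idx.1 hv; exact y.2.2.2 a⟩⟩

/-- a triangle point as a point of the surface -/
def mkS (s : St D 2) (y : tri s) : SurfSpace D := Quot.mk _ (toS s y)

theorem surf_ext {x x' : SurfTotal D} (h1 : x.1 = x'.1) (h2 : x.2.1 = x'.2.1) : x = x' := by
  obtain ⟨p, y⟩ := x
  obtain ⟨p', y'⟩ := x'
  simp only at h1
  subst h1
  have : y = y' := Subtype.ext h2
  rw [this]

theorem idx_pre (s : St D 2) (π) : idx (s.pre π) = idx s := by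
  refine Prod.ext rfl (Subtype.ext (Finset.ext fun v => ?_))
  rw [mem_idx, mem_idx, St.range_pre]

theorem idx_eq {s s' : St D 2} (h : idx s = idx s') : s' = s ∨ s' = s.pre (Equiv.swap 0 1) := by
  have h1 : s.1 = s'.1 := congrArg (fun q => q.1) h
  have h2 : ∀ a, s'.2 a = s.2 0 ∨ s'.2 a = s.2 1 := by
    intro a
    have : s'.2 a ∈ range s.2 := by rw [← mem_idx, h, mem_idx]; exact ⟨a, rfl⟩
    obtain ⟨b, hb⟩ := this
    fin_cases b
    · left; exact hb.symm
    · right; exact hb.symm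
  have hne : s'.2 0 ≠ s'.2 1 := fun h => absurd (s'.2.injective h) (by decide)
  rcases h2 0 with h0 | h0
  · have h3 : s'.2 1 = s.2 1 := by rcases h2 1 with h | h; exacts [absurd (h0.trans h.symm) hne, h]
    left
    refine St.ext' h1.symm fun a => ?_
    fin_cases a
    exacts [h0, h3]
  · have h3 : s'.2 1 = s.2 0 := by rcases h2 1 with h | h; exacts [h, absurd (h0.trans h.symm) hne]
    right
    refine St.ext' h1.symm fun a => ?_
    fin_cases a
    exacts [h0, h3]

theorem idx_mv (s : St D 2) (k : Fin 5) : (idx (s.mv k)).2.1 = (idx s).2.1.image (D.glue (s.1, k)) := by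
  ext v
  rw [mem_idx, Finset.mem_image]
  constructor
  · rintro ⟨a, rfl⟩; exact ⟨s.2 a, mem_idx.2 ⟨a, rfl⟩, rfl⟩
  · rintro ⟨w, hw, rfl⟩
    obtain ⟨a, rfl⟩ := mem_idx.1 hw
    exact ⟨a, rfl⟩

theorem exists_idx (p : D.I × {s : Finset (Fin 5) // s.card = 2}) : ∃ s : St D 2, idx s = p := by
  obtain ⟨i, S, hS⟩ := p
  obtain ⟨a, b, hab, rfl⟩ := Finset.card_eq_two.1 hS
  refine ⟨St.mk2 i a b hab, Prod.ext rfl (Subtype.ext (Finset.ext fun v => ?_))⟩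
  rw [mem_idx, St.mk2_range]; simp

theorem exists_toS (x : SurfTotal D) : ∃ s y, toS s y = x := by
  obtain ⟨s, hs⟩ := exists_idx x.1
  refine ⟨s, ⟨x.2.1, x.2.2.1, x.2.2.2.1, fun a => x.2.2.2.2 _ ?_⟩, surf_ext hs rfl⟩
  rw [← hs, mem_idx]; exact ⟨a, rfl⟩

theorem surfRel_toS {s : St D 2} {y : tri s} {x : SurfTotal D} : surfRel D (toS s y) x ↔
    ∃ k, k ∉ range s.2 ∧ y.1 k = 0 ∧ x = toS (s.mv k) ⟨_, tri_step y.2 k⟩ := by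
  constructor
  · rintro ⟨k, h1, h2, h3, h4, h5⟩
    refine ⟨k, fun h => h1 (mem_idx.2 h), h2, surf_ext (Prod.ext h3.symm (Subtype.ext ?_)) h5⟩
    exact h4.trans (idx_mv s k).symm
  · rintro ⟨k, h1, h2, rfl⟩
    exact ⟨k, fun h => h1 (mem_idx.1 h), h2, rfl, idx_mv s k, rfl⟩

theorem surfRel_symm {x x' : SurfTotal D} (h : surfRel D x x') : surfRel D x' x := by
  obtain ⟨s, y, rfl⟩ := exists_toS x
  obtain ⟨k, h1, h2, rfl⟩ := surfRel_toS.1 h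
  rw [surfRel_toS]
  refine ⟨opf D s.1 k, St.op_notMem h1, ?_, surf_ext ?_ ?_⟩
  · show y.1 ((D.glue (s.1, k)).symm _) = 0
    rw [← glue_opf, Equiv.symm_apply_apply]; exact h2
  · show idx s = idx ((s.mv k).mv _)
    rw [St.mv_mv]
  · show y.1 = (y.1 ∘ (D.glue (s.1, k)).symm) ∘ (D.glue (nbr D s.1 k, opf D s.1 k)).symm
    rw [glue_back]; ext v; simp

theorem TR_mkS {p q : St D 2 × (Fin 5 → ℝ)} (h : TR p q) : ∀ (hp : p.2 ∈ tri p.1) (hq : q.2 ∈ tri q.1),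
    mkS p.1 ⟨p.2, hp⟩ = mkS q.1 ⟨q.2, hq⟩ := by
  induction h with
  | refl => intro _ _; rfl
  | tail h1 h ih =>
    intro hp hq
    rw [ih hp (TR.tri h1 hp)]
    obtain ⟨k, hk, h0, rfl⟩ := h
    exact Quot.sound (surfRel_toS.2 ⟨k, hk, h0, rfl⟩)

theorem mkS_eq {s s' : St D 2} {y : tri s} {y' : tri s'} (h : mkS s y = mkS s' y') :
    TR (s, y.1) (s', y'.1) ∨ TR (s, y.1) (s'.pre (Equiv.swap 0 1), y'.1) := by
  have := quot_transport (fun _ _ => surfRel_symm) (Q := fun x => ∀ s' y', toS s' y' = x →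
    TR (s, y.1) (s', y'.1) ∨ TR (s, y.1) (s'.pre (Equiv.swap 0 1), y'.1)) ?_ h ?_
  · exact this s' y' rfl
  · intro a b hab ha s' y' e
    obtain ⟨s1, y1, rfl⟩ := exists_toS a
    obtain ⟨k, h1, h2, rfl⟩ := surfRel_toS.1 hab
    have ha := ha s1 y1 rfl
    have e1 : s' = s1.mv k ∨ s' = (s1.mv k).pre (Equiv.swap 0 1) := idx_eq (congrArg (fun x => x.1) e).symm
    have e2 : y'.1 = y1.1 ∘ (D.glue (s1.1, k)).symm := congrArg (fun x => x.2.1) e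
    rw [e2]
    have t1 : TR (s1, y1.1) (s1.mv k, y1.1 ∘ (D.glue (s1.1, k)).symm) := .single ⟨k, h1, h2, rfl⟩
    have t2 : TR (s1.pre (Equiv.swap 0 1), y1.1) ((s1.mv k).pre (Equiv.swap 0 1), y1.1 ∘ (D.glue (s1.1, k)).symm) :=
      .single ⟨k, by rwa [St.range_pre], h2, rfl⟩
    rcases e1 with rfl | rfl
    · rcases ha with ha | ha
      · exact .inl (ha.trans t1)
      · exact .inr (ha.trans t2)
    · rw [St.pre_pre, Equiv.swap_mul_self, St.pre_one]
      rcases ha with ha | ha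
      · exact .inr (ha.trans t1)
      · exact .inl (ha.trans t2)
  · intro s' y' e
    have e1 : s' = s ∨ s' = s.pre (Equiv.swap 0 1) := idx_eq (congrArg (fun x => x.1) e).symm
    have e2 : y'.1 = y.1 := congrArg (fun x => x.2.1) e
    rw [e2]
    rcases e1 with rfl | rfl
    · exact .inl .refl
    · rw [St.pre_pre, Equiv.swap_mul_self, St.pre_one]
      exact .inr .refl

theorem mkS_eq_iff (hnf : ∀ s : St D 2, ¬ SR s (s.pre (Equiv.swap 0 1))) {s s' : St D 2} {y : tri s} {y' : tri s'}
    (hs : SR s s') : mkS s y = mkS s' y' ↔ TR (s, y.1) (s', y'.1) := by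
  constructor
  · intro h
    rcases mkS_eq h with h | h
    · exact h
    · exact absurd (hs.symm.trans (TR.toSR h)) (hnf s')
  · intro h; exact TR_mkS h y.2 y'.2

theorem mkS_cont (s : St D 2) : Continuous (mkS s) := by
  refine continuous_quot_mk.comp ((continuous_sigmaMk (σ := fun p : D.I × {s : Finset (Fin 5) // s.card = 2} => LabTri p.2.1)
    (i := idx s)).comp (?_ : Continuous fun y : tri s => (⟨y.1, _⟩ : LabTri (idx s).2.1)))
  exact Continuous.subtype_mk continuous_subtype_val _

theorem tri_convex (s : St D 2) : Convex ℝ (tri s) := by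
  intro x hx y hy a b ha hb hab
  refine ⟨fun v => ?_, ?_, fun c => ?_⟩
  · have := hx.1 v; have := hy.1 v
    simp only [Pi.add_apply, Pi.smul_apply, smul_eq_mul]; positivity
  · simp only [Pi.add_apply, Pi.smul_apply, smul_eq_mul, Finset.sum_add_distrib, ← Finset.mul_sum]
    rw [hx.2.1, hy.2.1]; linarith
  · simp only [Pi.add_apply, Pi.smul_apply, smul_eq_mul, hx.2.2 c, hy.2.2 c]; ring

theorem tri_compact (s : St D 2) : IsCompact (tri s) := by
  refine (isCompact_Icc (a := (0 : Fin 5 → ℝ)) (b := 1)).of_isClosed_subset ?_ ?_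
  · have : tri s = (⋂ v, {y | 0 ≤ y v}) ∩ ({y | ∑ v, y v = 1} ∩ ⋂ a, {y | y (s.2 a) = 0}) := by
      ext y; simp [tri]
    rw [this]
    refine (isClosed_iInter fun v => isClosed_le continuous_const (continuous_apply v)).inter
      ((isClosed_eq (by fun_prop) continuous_const).inter
        (isClosed_iInter fun a => isClosed_eq (continuous_apply _) continuous_const))
  · intro y hy
    refine ⟨hy.1, fun v => ?_⟩
    show y v ≤ 1
    rw [← hy.2.1]
    exact Finset.single_le_sum (fun i _ => hy.1 i) (Finset.mem_univ v)

theorem tri_nonempty (s : St D 2) : (tri s).Nonempty := by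
  obtain ⟨fl, rfl⟩ := exists_flag'' s
  exact ⟨_, pt_mem fl (t := 0) (by simp)⟩

/-- the candidate component -/
def Cset (s0 : St D 2) : Set (SurfSpace D) := {z | ∃ s, SR s0 s ∧ ∃ y, z = mkS s y}

theorem toS_mem_Cset {s0 s : St D 2} {y : tri s} : mkS s y ∈ Cset s0 ↔ ∃ s', SR s0 s' ∧ idx s' = idx s := by
  constructor
  · rintro ⟨s', h1, y', h2⟩
    rcases mkS_eq h2 with h | h
    · exact ⟨s, h1.trans (TR.toSR h).symm, rfl⟩
    · refine ⟨s.pre (Equiv.swap 0 1), h1.trans ?_, idx_pre _ _⟩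
      have := (TR.toSR h).symm.pre (Equiv.swap 0 1)
      rwa [St.pre_pre, Equiv.swap_mul_self, St.pre_one] at this
  · rintro ⟨s', h1, h2⟩
    rcases idx_eq h2 with rfl | rfl
    · exact ⟨_, h1, y, rfl⟩
    · have hy : y.1 ∈ tri s' := by
        refine ⟨y.2.1, y.2.2.1, fun a => ?_⟩
        have : s'.2 a ∈ range (s'.pre (Equiv.swap 0 1)).2 := by rw [St.range_pre]; exact ⟨a, rfl⟩
        obtain ⟨b, hb⟩ := this
        rw [← hb]; exact y.2.2.2 b
      exact ⟨s', h1, ⟨y.1, hy⟩, congrArg (Quot.mk _) (surf_ext (idx_pre _ _) rfl)⟩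

theorem Cset_clopen (s0 : St D 2) : IsClopen (Cset s0) := by
  have hpre : ∀ x : SurfTotal D, Quot.mk (surfRel D) x ∈ Cset s0 ↔ ∃ s', SR s0 s' ∧ idx s' = x.1 := by
    intro x
    obtain ⟨s, y, rfl⟩ := exists_toS x
    exact toS_mem_Cset
  have hop : ∀ A : Set (D.I × {s : Finset (Fin 5) // s.card = 2}), IsOpen {x : SurfTotal D | x.1 ∈ A} := by
    intro A
    rw [isOpen_sigma_iff]
    intro p
    by_cases hp : p ∈ A
    · convert isOpen_univ; exact eq_univ_of_forall fun _ => hp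
    · convert isOpen_empty; exact eq_empty_of_forall_notMem fun _ => hp
  have e1 : Quot.mk (surfRel D) ⁻¹' (Cset s0) = {x : SurfTotal D | x.1 ∈ {p | ∃ s', SR s0 s' ∧ idx s' = p}} := by
    ext x; exact hpre x
  constructor
  · rw [← isOpen_compl_iff]
    apply isQuotientMap_quot_mk.isOpen_preimage.1
    rw [preimage_compl, e1]
    exact hop {p | ∃ s', SR s0 s' ∧ idx s' = p}ᶜ
  · apply isQuotientMap_quot_mk.isOpen_preimage.1
    rw [e1]
    exact hop _

theorem comp_eq (s0 : St D 2) (y0 : tri s0) : connectedComponent (mkS s0 y0) = Cset s0 := by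
  apply Subset.antisymm
  · exact (Cset_clopen s0).connectedComponent_subset ⟨s0, .refl, y0, rfl⟩
  · have tc : ∀ (s : St D 2) (y y' : tri s), connectedComponent (mkS s y) = connectedComponent (mkS s y') := by
      intro s y y'
      have : PreconnectedSpace (tri s) := isPreconnected_iff_preconnectedSpace.1 (tri_convex s).isPreconnected
      have h := isPreconnected_range (mkS_cont s)
      exact connectedComponent_eq (h.subset_connectedComponent ⟨y, rfl⟩ ⟨y', rfl⟩)
    have key : ∀ s, SR s0 s → ∀ y : tri s, connectedComponent (mkS s0 y0) = connectedComponent (mkS s y) := by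
      intro s hs
      induction hs with
      | refl => intro y; exact tc _ _ _
      | @tail s1 s2 _ h ih =>
        intro y
        obtain ⟨k, hk, rfl⟩ := h
        obtain ⟨fl, rfl, rfl⟩ := exists_flag' _ hk
        have h0 : (0:ℝ) ∈ Icc (0:ℝ) 1 := by simp
        rw [ih ⟨_, pt_mem fl h0⟩, tc _ y ⟨_, pt_mem (Gf fl) h0⟩]
        exact congrArg _ (TR_mkS (TR_Gf fl 0) _ _)
    rintro z ⟨s, hs, y, rfl⟩
    rw [key s hs y]
    exact mem_connectedComponent

theorem Cset_compact (s0 : St D 2) : IsCompact (Cset s0) := by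
  have hfin : Finite (St D 2) := by
    have := D.fintypeI
    unfold St; infer_instance
  have : Cset s0 = ⋃ s ∈ {s | SR s0 s}, range (mkS s) := by
    ext z; simp [Cset, eq_comm]
  rw [this]
  refine (toFinite _).isCompact_biUnion fun s _ => ?_
  have : CompactSpace (tri s) := isCompact_iff_compactSpace.1 (tri_compact s)
  exact isCompact_range (mkS_cont s)

theorem surf_of_surfC (hnf : ∀ s : St D 2, ¬ SR s (s.pre (Equiv.swap 0 1))) (hC : ∀ s0 : St D 2, SurfC s0) : Surf D := by
  intro z
  obtain ⟨x, rfl⟩ := Quot.exists_rep z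
  obtain ⟨s0, y0, rfl⟩ := exists_toS x
  obtain ⟨Φ, f1, f2, f3, f4⟩ := hC s0
  show Nonempty (connectedComponent (mkS s0 y0) ≃ₜ _)
  rw [comp_eq]
  have uniq : ∀ s s' : St D 2, SR s0 s → SR s0 s' → idx s = idx s' → s' = s := by
    intro s s' h h' he
    rcases idx_eq he with rfl | rfl
    · rfl
    · exact absurd (h.symm.trans h') (hnf s)
  obtain ⟨g, hg⟩ : ∃ g : SurfTotal D → E3, g = fun x => if h : ∃ s, SR s0 s ∧ idx s = x.1 then Φ h.choose x.2.1 else 0 := ⟨_, rfl⟩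
  have g1 : ∀ s (x : SurfTotal D), SR s0 s → idx s = x.1 → g x = Φ s x.2.1 := by
    intro s x h1 h2
    have h : ∃ s, SR s0 s ∧ idx s = x.1 := ⟨s, h1, h2⟩
    simp only [hg]
    rw [dif_pos h, uniq s h.choose h1 h.choose_spec.1 (h2.trans h.choose_spec.2.symm)]
  have g2 : ∀ (x : SurfTotal D), (¬ ∃ s, SR s0 s ∧ idx s = x.1) → g x = 0 := by
    intro x h; simp only [hg]; rw [dif_neg h]
  have gr : ∀ x x', surfRel D x x' → g x = g x' := by
    intro x x' hr
    by_cases h : ∃ s, SR s0 s ∧ idx s = x.1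
    · obtain ⟨s, h1, h2⟩ := h
      have hy : x.2.1 ∈ tri s := ⟨x.2.2.1, x.2.2.2.1, fun a => x.2.2.2.2 _ (by rw [← h2, mem_idx]; exact ⟨a, rfl⟩)⟩
      have hx : x = toS s ⟨x.2.1, hy⟩ := surf_ext h2.symm rfl
      rw [hx] at hr
      obtain ⟨k, hk, h0, rfl⟩ := surfRel_toS.1 hr
      have hs' : SR s0 (s.mv k) := h1.tail ⟨k, hk, rfl⟩
      rw [g1 s x h1 h2, g1 (s.mv k) _ hs' rfl]
      exact (f4 s _ h1 hs' _ hy _ (tri_step hy k)).2 (.single ⟨k, hk, h0, rfl⟩)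
    · have h' : ¬ ∃ s, SR s0 s ∧ idx s = x'.1 := by
        rintro ⟨s, h1, h2⟩
        have hr := surfRel_symm hr
        have hy : x'.2.1 ∈ tri s := ⟨x'.2.2.1, x'.2.2.2.1, fun a => x'.2.2.2.2 _ (by rw [← h2, mem_idx]; exact ⟨a, rfl⟩)⟩
        have hx : x' = toS s ⟨x'.2.1, hy⟩ := surf_ext h2.symm rfl
        rw [hx] at hr
        obtain ⟨k, hk, h0, rfl⟩ := surfRel_toS.1 hr
        exact h ⟨s.mv k, h1.tail ⟨k, hk, rfl⟩, rfl⟩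
      rw [g2 x h, g2 x' h']
  have gc : Continuous g := by
    rw [continuous_sigma_iff]
    intro p
    by_cases h : ∃ s, SR s0 s ∧ idx s = p
    · obtain ⟨s, h1, rfl⟩ := h
      have hy : ∀ x : LabTri (idx s).2.1, x.1 ∈ tri s := fun x => ⟨x.2.1, x.2.2.1, fun a => x.2.2.2 _ (by rw [mem_idx]; exact ⟨a, rfl⟩)⟩
      have e : (fun x : LabTri (idx s).2.1 => g ⟨idx s, x⟩) = fun x => Φ s x.1 := by
        ext1 x; exact g1 s _ h1 rfl
      rw [e]
      exact (f1 s h1).comp_continuous continuous_subtype_val hy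
    · have e : (fun x : LabTri p.2.1 => g ⟨p, x⟩) = fun x => 0 := by
        ext1 x; exact g2 _ h
      rw [e]; exact continuous_const
  obtain ⟨G, hG⟩ : ∃ G : SurfSpace D → E3, G = Quot.lift g gr := ⟨_, rfl⟩
  have Gc : Continuous G := by rw [hG]; exact continuous_quot_lift gr gc
  have GΦ : ∀ s (y : tri s), SR s0 s → G (mkS s y) = Φ s y.1 := by
    intro s y hs
    rw [hG]; exact g1 s (toS s y) hs rfl
  have : CompactSpace (Cset s0) := isCompact_iff_compactSpace.1 (Cset_compact s0)
  have Gm : ∀ z : Cset s0, G z.1 ∈ Metric.sphere (0 : EuclideanSpace ℝ (Fin 3)) 1 := by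
    rintro ⟨z, s, hs, y, rfl⟩
    rw [mem_sphere_zero_iff_norm, GΦ s y hs]
    exact f2 s hs y.1 y.2
  have hb : Function.Bijective (fun z : Cset s0 => (⟨G z.1, Gm z⟩ : Metric.sphere (0 : EuclideanSpace ℝ (Fin 3)) 1)) := by
    constructor
    · rintro ⟨z, s, hs, y, rfl⟩ ⟨z', s', hs', y', rfl⟩ h
      have h1 := congrArg Subtype.val h
      simp only at h1
      rw [GΦ s y hs, GΦ s' y' hs'] at h1
      exact Subtype.ext (TR_mkS ((f4 s s' hs hs' _ y.2 _ y'.2).1 h1) y.2 y'.2)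
    · rintro ⟨w, hw⟩
      obtain ⟨s, hs, y, hy, rfl⟩ := f3 w (mem_sphere_zero_iff_norm.1 hw)
      exact ⟨⟨mkS s ⟨y, hy⟩, s, hs, _, rfl⟩, Subtype.ext (GΦ s ⟨y, hy⟩ hs)⟩
  refine ⟨Continuous.homeoOfEquivCompactToT2 (f := Equiv.ofBijective _ hb) ?_⟩
  exact Continuous.subtype_mk (Gc.comp continuous_subtype_val) _

theorem surfC_of_surf (hnf : ∀ s : St D 2, ¬ SR s (s.pre (Equiv.swap 0 1))) (hS : Surf D) (s0 : St D 2) : SurfC s0 := by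
  obtain ⟨y0, hy0⟩ := tri_nonempty s0
  have e := hS (mkS s0 ⟨y0, hy0⟩)
  rw [comp_eq] at e
  obtain ⟨e⟩ := e
  have hmem : ∀ s, SR s0 s → ∀ y : tri s, mkS s y ∈ Cset s0 := fun s hs y => ⟨s, hs, y, rfl⟩
  obtain ⟨Φ, hΦ⟩ : ∃ Φ : St D 2 → (Fin 5 → ℝ) → E3, ∀ s (hs : SR s0 s) (y : tri s), Φ s y.1 = (e ⟨mkS s y, hmem s hs y⟩).1 := by
    refine ⟨fun s y => if h : SR s0 s ∧ y ∈ tri s then (e ⟨mkS s ⟨y, h.2⟩, hmem s h.1 _⟩).1 else 0, fun s hs y => ?_⟩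
    simp only
    rw [dif_pos ⟨hs, y.2⟩]
  refine ⟨Φ, fun s hs => ?_, fun s hs y hy => ?_, fun w hw => ?_, fun s s' hs hs' y hy y' hy' => ?_⟩
  · rw [continuousOn_iff_continuous_domRestrict]
    have : (tri s).domRestrict (Φ s) = fun y : tri s => (e ⟨mkS s y, hmem s hs y⟩).1 := by
      ext1 y; exact hΦ s hs y
    rw [this]
    exact continuous_subtype_val.comp (e.continuous.comp ((mkS_cont s).subtype_mk _))
  · rw [hΦ s hs ⟨y, hy⟩]; exact mem_sphere_zero_iff_norm.1 (e _).2
  · obtain ⟨⟨z, s, hs, y, rfl⟩, hz⟩ := e.surjective ⟨w, mem_sphere_zero_iff_norm.2 hw⟩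
    exact ⟨s, hs, y.1, y.2, by rw [hΦ s hs y]; exact congrArg Subtype.val hz⟩
  · rw [hΦ s hs ⟨y, hy⟩, hΦ s' hs' ⟨y', hy'⟩, ← mkS_eq_iff hnf (hs.symm.trans hs') (y := ⟨y, hy⟩) (y' := ⟨y', hy'⟩)]
    constructor
    · intro h
      exact congrArg Subtype.val (e.injective (Subtype.ext h))
    · intro h
      congr 3

theorem noflip_of_dir (h : Dir D) (s : St D 2) : ¬ SR s (s.pre (Equiv.swap 0 1)) := by
  obtain ⟨o, h1, h2⟩ := h
  intro hs
  have key : ∀ s', SR s s' → (o s.1 (s.2 0) (s.2 1) ↔ o s'.1 (s'.2 0) (s'.2 1)) := by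
    intro s' hs'
    induction hs' with
    | refl => rfl
    | @tail s1 s2 _ h ih =>
      obtain ⟨k, hk, rfl⟩ := h
      rw [ih]
      have n : ∀ a, s1.2 a ≠ k := fun a h => hk ⟨a, h⟩
      have h01 : s1.2 0 ≠ s1.2 1 := fun h => absurd (s1.2.injective h) (by decide)
      exact h2 _ _ _ _ (n 0) (n 1) h01
  have h3 := key _ hs
  have h01 : s.2 0 ≠ s.2 1 := fun h => absurd (s.2.injective h) (by decide)
  have h4 := h1 s.1 _ _ h01
  have e0 : (s.pre (Equiv.swap 0 1)).2 0 = s.2 1 := rfl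
  have e1 : (s.pre (Equiv.swap 0 1)).2 1 = s.2 0 := rfl
  rw [e0, e1] at h3
  unfold Xor' Xor at h4
  have : (s.pre (Equiv.swap 0 1)).1 = s.1 := rfl
  rw [this] at h3
  tauto

end surfs
end FileS4

section FileL1
section hol
variable {D : GlueingDatum 4}
open Set

/-- trivial holonomy in dimension `d` -/
def Hol (D : GlueingDatum 4) (d : ℕ) : Prop := ∀ (s : St D d) π, SR s (s.pre π) → π = 1

theorem SR_chain {d : ℕ} {s s' : St D d} (h : SR s s') : ∃ (n : ℕ) (S : ℕ → St D d) (k : ℕ → Fin 5), S 0 = s ∧ S n = s' ∧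
    ∀ r < n, k r ∉ range (S r).2 ∧ S (r + 1) = (S r).mv (k r) := by
  induction h with
  | refl => exact ⟨0, fun _ => s, fun _ => 0, rfl, rfl, fun r hr => absurd hr (by omega)⟩
  | tail _ h ih =>
    obtain ⟨n, S, k, h0, hn, hr⟩ := ih
    obtain ⟨κ, hκ, rfl⟩ := h
    refine ⟨n + 1, fun r => if r ≤ n then S r else (S n).mv κ, fun r => if r < n then k r else κ, by simpa using h0, ?_, ?_⟩
    · simp [hn]
    · intro r hr'
      rcases Nat.lt_succ_iff_lt_or_eq.1 hr' with h | rfl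
      · have h1 : r ≤ n := by omega
        have h2 : r + 1 ≤ n := by omega
        simp only [h, h1, h2, if_true]
        exact hr r h
      · simp [hn, hκ]

theorem hol3 (hC : Cycl D) : Hol D 3 := by
  have key : ∀ n : ℕ, ∀ (S : ℕ → St D 3) (k : ℕ → Fin 5) (π : Equiv.Perm (Fin 3)),
      (∀ r < n, k r ∉ range (S r).2 ∧ S (r + 1) = (S r).mv (k r)) → S n = (S 0).pre π → π = 1 := by
    intro n
    induction n using Nat.strong_induction_on with
    | _ n ih =>
    intro S k π hr hn
    rcases Nat.eq_zero_or_pos n with rfl | hpos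
    · exact St.pre_inj (s := S 0) (by rw [← hn]; rfl)
    by_cases hbt : ∃ r, r + 1 < n ∧ k (r + 1) = opf D (S r).1 (k r)
    · obtain ⟨r, hrn, he⟩ := hbt
      have hback : S (r + 2) = S r := by
        rw [(hr (r + 1) hrn).2, he, (hr r (by omega)).2, St.mv_mv]
      refine ih (n - 2) (by omega) (fun q => if q ≤ r then S q else S (q + 2)) (fun q => if q < r then k q else k (q + 2)) π ?_ ?_
      · intro q hq
        rcases lt_trichotomy q r with h | h | h
        · have h1 : q ≤ r := by omega
          have h2 : q + 1 ≤ r := by omega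
          simp only [h, h1, h2, if_true]
          exact hr q (by omega)
        · subst h
          have h2 : ¬ (q + 1 ≤ q) := by omega
          simp only [le_refl, if_true, lt_irrefl, if_false, h2]
          rw [← hback]
          exact hr (q + 2) (by omega)
        · have h1 : ¬ q ≤ r := by omega
          have h2 : ¬ q + 1 ≤ r := by omega
          have h3 : ¬ q < r := by omega
          simp only [h1, h2, h3, if_false]
          exact hr (q + 2) (by omega)
      · simp only [Nat.zero_le, if_true]
        by_cases h : n - 2 ≤ r
        · have : r = n - 2 := by omega
          rw [if_pos h, ← this, ← hback, ← hn]; congr 1; omega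
        · rw [if_neg h, ← hn]; congr 1; omega
    push Not at hbt
    have hlast := hr (n - 1) (by omega)
    have hn1 : n - 1 + 1 = n := by omega
    rw [hn1] at hlast
    by_cases hl : opf D (S (n - 1)).1 (k (n - 1)) = k 0
    · by_cases h1 : n = 1
      · exfalso
        subst h1
        have h2 := congrArg (fun q : St D 3 => q.1) (hn.symm.trans hlast.2)
        exact D.P_fixedPointFree ((S 0).1, k 0) (by rw [P_eq]; exact Prod.ext h2.symm hl)
      · have hend : S (n - 1) = (S 1).pre π := by
          have h2 := (hr 0 hpos).2
          rw [zero_add] at h2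
          have h3 : (S n).mv (k 0) = S (n - 1) := by rw [hlast.2, ← hl, St.mv_mv]
          rw [← h3, hn, h2]; rfl
        refine ih (n - 2) (by omega) (fun q => S (q + 1)) (fun q => k (q + 1)) π (fun q hq => hr (q + 1) (by omega)) ?_
        simp only [zero_add]
        rw [← hend]; congr 1; omega
    · have := hC n hpos (fun r => (S r).1) (fun r => (S r).2) k (fun r => opf D (S (r - 1)).1 (k (r - 1)))
        (fun r _ => (S r).2.injective) (fun r h => (hr r h).1) ?_ ?_ ?_ ?_ ?_ hl
      · have h1 : ∀ a, (S 0).2 (π a) = (S 0).2 a := by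
          intro a
          have := congrFun this a
          simp only [hn] at this
          exact this
        ext a
        exact congrArg _ ((S 0).2.injective (h1 a))
      · intro r h
        simp only [Nat.add_sub_cancel, (hr r h).2]
        rfl
      · intro r h
        simp only [(hr r h).2]
        rfl
      · intro r h0 h
        obtain ⟨q, rfl⟩ : ∃ q, r = q + 1 := ⟨r - 1, by omega⟩
        exact hbt q h
      · simp only [hn]; rfl
      · simp only [hn]; exact St.range_pre _ _
  intro s π h
  obtain ⟨n, S, k, rfl, hn, hr⟩ := SR_chain h
  exact key n S k π hr hn

theorem hol2 (hD : Dir D) : Hol D 2 := by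
  intro s π h
  have : ∀ π : Equiv.Perm (Fin 2), π = 1 ∨ π = Equiv.swap 0 1 := by decide
  rcases this π with h1 | rfl
  · exact h1
  · exact absurd h (noflip_of_dir hD s)

theorem hol5 : Hol D 5 := by
  intro s π h
  have : ∀ s', SR s s' → s' = s := by
    intro s' h
    induction h with
    | refl => rfl
    | tail _ h ih =>
      obtain ⟨k, hk, rfl⟩ := h
      exact absurd (flag_surj _ k) hk
  exact St.pre_inj (s := s) (by rw [this _ h]; rfl)

theorem hol4 : Hol D 4 := by
  intro s π h
  have miss : ∀ (s : St D 4) k k', k ∉ range s.2 → k' ∉ range s.2 → k = k' := by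
    intro s k k' h h'
    by_contra hne
    have h1 : (Finset.univ.map s.2).card = 4 := by simp
    have h2 : k ∉ Finset.univ.map s.2 := by simpa using h
    have h3 : k' ∉ insert k (Finset.univ.map s.2) := by
      simp only [Finset.mem_insert, not_or]
      exact ⟨fun h => hne h.symm, by simpa using h'⟩
    have h4 := Finset.card_le_univ (insert k' (insert k (Finset.univ.map s.2)))
    rw [Finset.card_insert_of_notMem h3, Finset.card_insert_of_notMem h2, h1] at h4
    simp at h4
  have : ∀ s', SR s s' → s' = s ∨ ∃ k, k ∉ range s.2 ∧ s' = s.mv k := by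
    intro s' h
    induction h with
    | refl => left; rfl
    | tail _ h ih =>
      obtain ⟨k, hk, rfl⟩ := h
      rcases ih with rfl | ⟨κ, hκ, rfl⟩
      · exact .inr ⟨k, hk, rfl⟩
      · left
        rw [miss _ k _ hk (St.op_notMem hκ), St.mv_mv]
  rcases this _ h with h | ⟨k, hk, h⟩
  · exact St.pre_inj (s := s) (by rw [h]; rfl)
  · exfalso
    have h1 : s.1 = nbr D s.1 k := congrArg (fun q : St D 4 => q.1) h
    have h2 : opf D s.1 k ∉ range s.2 := by
      rw [← St.range_pre s π, h]; exact St.op_notMem hk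
    exact D.P_fixedPointFree (s.1, k) (by rw [P_eq]; exact Prod.ext h1.symm (miss _ _ _ h2 hk))

theorem TR_hol (hC : Cycl D) (hD : Dir D) {s s' : St D 2} {y : Fin 5 → ℝ} (hy : ∀ a, y (s.2 a) ≠ 0)
    (h : TR (s, y) (s', y)) (hs : s.1 = s'.1) : s' = s := by
  have hol : ∀ d, 2 ≤ d → d ≤ 5 → Hol D d := by
    intro d h1 h2
    interval_cases d
    exacts [hol2 hD, hol3 hC, hol4, hol5]
  let F := Finset.univ.filter fun v => y v ≠ 0
  obtain ⟨t, ht⟩ : ∃ t : Fin F.card ↪ Fin 5, range t = F := ⟨(F.orderEmbOfFin rfl).toEmbedding, by simp⟩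
  have hd : Hol D F.card := by
    apply hol
    · have : (Finset.univ.map s.2) ⊆ F := by
        intro v hv
        simp only [Finset.mem_map, Finset.mem_univ, true_and] at hv
        obtain ⟨a, rfl⟩ := hv
        simpa [F] using hy a
      have := Finset.card_le_card this
      simpa using this
    · have := Finset.card_le_univ F
      simpa using this
  have key : ∀ q : St D 2 × (Fin 5 → ℝ), TR (s, y) q → ∃ g : Equiv.Perm (Fin 5), q.2 = y ∘ g.symm ∧
      (∀ a, q.1.2 a = g (s.2 a)) ∧ SR ((s.1, t) : St D F.card) (q.1.1, t.trans g.toEmbedding) := by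
    intro q hq
    induction hq with
    | refl => exact ⟨1, rfl, fun a => rfl, .refl⟩
    | tail _ h ih =>
      obtain ⟨k, hk, h0, rfl⟩ := h
      obtain ⟨g, e1, e2, e3⟩ := ih
      rename_i q _
      refine ⟨g.trans (D.glue (q.1.1, k)), ?_, ?_, ?_⟩
      · simp only [e1]; rfl
      · intro a; simp only [St.mv_snd, e2]; rfl
      · refine e3.tail ⟨k, ?_, rfl⟩
        rintro ⟨a, ha⟩
        have h1 : t a ∈ (F : Set (Fin 5)) := by rw [← ht]; exact ⟨a, rfl⟩
        rw [e1, ← ha] at h0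
        have h2 : y (t a) ≠ 0 := by simpa [F] using h1
        apply h2
        simpa using h0
  obtain ⟨g, e1, e2, e3⟩ := key _ h
  simp only at e1 e2 e3
  have hg : ∀ v, y (g v) = y v := by
    intro v
    have := congrFun e1 (g v)
    simpa using this
  have hex : ∀ a, ∃ b, t b = g (t a) := by
    intro a
    have h1 : t a ∈ (F : Set (Fin 5)) := by rw [← ht]; exact ⟨a, rfl⟩
    have h2 : y (t a) ≠ 0 := by simpa [F] using h1
    have h3 : g (t a) ∈ (F : Set (Fin 5)) := by simpa [F, hg] using h2
    rw [← ht] at h3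
    exact h3
  choose b hb using hex
  have binj : Function.Injective b := by
    intro a a' h
    have := hb a
    rw [h, hb a'] at this
    exact (t.injective (g.injective this)).symm
  let π : Equiv.Perm (Fin F.card) := Equiv.ofBijective b (Finite.injective_iff_bijective.1 binj)
  have hpi : ((s'.1, t.trans g.toEmbedding) : St D F.card) = St.pre (D := D) (s.1, t) π := by
    refine St.ext' hs.symm fun a => ?_
    exact (hb a).symm
  rw [hpi] at e3
  have h1 := hd _ _ e3
  refine St.ext' hs.symm fun a => ?_
  rw [e2]
  have h2 : s.2 a ∈ range t := by rw [ht]; simpa [F] using hy a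
  obtain ⟨c, hc⟩ := h2
  rw [← hc, ← hb c]
  congr 1
  exact congrArg (fun π : Equiv.Perm (Fin F.card) => π c) h1

end hol
end FileL1

section FileL2
section theta
variable {D : GlueingDatum 4}
open Set

/-- points of the open star of an edge -/
def dm (s : St D 2) : Set (Fin 5 → ℝ) := {y | (∀ v, 0 ≤ y v) ∧ ∑ v, y v = 1 ∧ ∀ a, 0 < y (s.2 a)}
/-- the part of a point away from the edge -/
def rt (s : St D 2) (y : Fin 5 → ℝ) : Fin 5 → ℝ := y - extz s.2 (y ∘ s.2)
/-- the weight of the part away from the edge -/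
def rr (s : St D 2) (y : Fin 5 → ℝ) : ℝ := 1 - y (s.2 0) - y (s.2 1)
/-- the local chart on the star of an edge -/
def th (Φ : St D 2 → (Fin 5 → ℝ) → E3) (s : St D 2) (y : Fin 5 → ℝ) : ℝ × E3 :=
  (Real.log (y (s.2 0)) - Real.log (y (s.2 1)), (rr s y / (1 - rr s y)) • Φ s ((rr s y)⁻¹ • rt s y))

theorem mv_comp (s : St D 2) (k : Fin 5) (y : Fin 5 → ℝ) :
    (y ∘ (D.glue (s.1, k)).symm) ∘ (s.mv k).2 = y ∘ s.2 := by
  ext a; simp [St.mv_snd]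

theorem rt_mv (s : St D 2) (k : Fin 5) (y : Fin 5 → ℝ) :
    rt (s.mv k) (y ∘ (D.glue (s.1, k)).symm) = rt s y ∘ (D.glue (s.1, k)).symm := by
  unfold rt
  rw [mv_comp]
  have := extz_trans s.2 (y ∘ s.2) (D.glue (s.1, k))
  change extz (s.mv k).2 _ = _ at this
  rw [this]; rfl

theorem rr_mv (s : St D 2) (k : Fin 5) (y : Fin 5 → ℝ) :
    rr (s.mv k) (y ∘ (D.glue (s.1, k)).symm) = rr s y := by
  have h0 := congrFun (mv_comp s k y) 0
  have h1 := congrFun (mv_comp s k y) 1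
  unfold rr
  rw [show (y ∘ (D.glue (s.1, k)).symm) ((s.mv k).2 0) = _ from h0,
    show (y ∘ (D.glue (s.1, k)).symm) ((s.mv k).2 1) = _ from h1]; rfl

theorem dm_step {s : St D 2} {y : Fin 5 → ℝ} (hy : y ∈ dm s) (k : Fin 5) :
    y ∘ (D.glue (s.1, k)).symm ∈ dm (s.mv k) := by
  refine ⟨fun v => hy.1 _, ?_, fun a => ?_⟩
  · rw [← hy.2.1]; exact Equiv.sum_comp (D.glue (s.1, k)).symm y
  · rw [St.mv_snd]; simpa using hy.2.2 a

theorem rt_sum {s : St D 2} {y : Fin 5 → ℝ} (hy : y ∈ dm s) : ∑ v, rt s y v = rr s y := by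
  simp only [rt, Pi.sub_apply, Finset.sum_sub_distrib, extz_sum, hy.2.1, Fin.sum_univ_two, rr, Function.comp]
  ring

theorem rt_mem (s : St D 2) (y : Fin 5 → ℝ) (a) : rt s y (s.2 a) = 0 := by
  simp [rt, extz_apply]

theorem rt_notMem (s : St D 2) (y : Fin 5 → ℝ) {v} (hv : v ∉ range s.2) : rt s y v = y v := by
  simp [rt, extz_notMem _ _ hv]

theorem rt_nonneg {s : St D 2} {y : Fin 5 → ℝ} (hy : y ∈ dm s) (v) : 0 ≤ rt s y v := by
  by_cases hv : v ∈ range s.2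
  · obtain ⟨a, rfl⟩ := hv; rw [rt_mem]
  · rw [rt_notMem _ _ hv]; exact hy.1 v

theorem rr_nonneg {s : St D 2} {y : Fin 5 → ℝ} (hy : y ∈ dm s) : 0 ≤ rr s y := by
  rw [← rt_sum hy]; exact Finset.sum_nonneg fun v _ => rt_nonneg hy v

theorem rr_lt {s : St D 2} {y : Fin 5 → ℝ} (hy : y ∈ dm s) : rr s y < 1 := by
  have := hy.2.2 0; have := hy.2.2 1; unfold rr; linarith

theorem rt_tri {s : St D 2} {y : Fin 5 → ℝ} (hy : y ∈ dm s) (hr : rr s y ≠ 0) : (rr s y)⁻¹ • rt s y ∈ tri s := by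
  have h0 := rr_nonneg hy
  refine ⟨fun v => mul_nonneg (inv_nonneg.2 h0) (rt_nonneg hy v), ?_, fun a => ?_⟩
  · simp only [Pi.smul_apply, smul_eq_mul, ← Finset.mul_sum, rt_sum hy]; exact inv_mul_cancel₀ hr
  · simp [rt_mem]

theorem rt_zero {s : St D 2} {y : Fin 5 → ℝ} (hy : y ∈ dm s) (hr : rr s y = 0) : rt s y = 0 := by
  have := (Finset.sum_eq_zero_iff_of_nonneg fun v _ => rt_nonneg hy v).1 ((rt_sum hy).trans hr)
  ext v; exact this v (Finset.mem_univ _)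

/-- chains of triangle moves induce chains of moves of points of the star -/
theorem TR_comb {p q : St D 2 × (Fin 5 → ℝ)} (h : TR p q) (r : ℝ) (x : Fin 2 → ℝ) :
    TR (p.1, r • p.2 + extz p.1.2 x) (q.1, r • q.2 + extz q.1.2 x) := by
  induction h with
  | refl => exact .refl
  | tail _ h ih =>
    obtain ⟨k, hk, h0, rfl⟩ := h
    refine ih.tail ⟨k, hk, ?_, Prod.ext rfl ?_⟩
    · simp [h0, extz_notMem _ _ hk]
    · exact congrArg₂ (· + ·) rfl (extz_trans _ _ _)

theorem SR_comb {s s' : St D 2} (h : SR s s') (x : Fin 2 → ℝ) : TR (s, extz s.2 x) (s', extz s'.2 x) := by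
  induction h with
  | refl => exact .refl
  | tail _ h ih =>
    obtain ⟨k, hk, rfl⟩ := h
    exact ih.tail ⟨k, hk, extz_notMem _ _ hk, Prod.ext rfl (extz_trans _ _ _)⟩

theorem TR_dm {p q : St D 2 × (Fin 5 → ℝ)} (h : TR p q) (hp : p.2 ∈ dm p.1) : q.2 ∈ dm q.1 := by
  induction h with
  | refl => exact hp
  | tail _ h ih => obtain ⟨k, hk, _, rfl⟩ := h; exact dm_step ih k

theorem rr_cont (s : St D 2) : Continuous (rr s) :=
  (continuous_const.sub (continuous_apply _)).sub (continuous_apply _)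

theorem rt_cont (s : St D 2) : Continuous (rt s) :=
  continuous_id.sub ((extz_cont s.2).comp (continuous_pi fun a => continuous_apply (s.2 a)))

theorem th_cont {Φ : St D 2 → (Fin 5 → ℝ) → E3} {s : St D 2} (hc : ContinuousOn (Φ s) (tri s))
    (hn : ∀ y ∈ tri s, ‖Φ s y‖ = 1) : ContinuousOn (th Φ s) (dm s) := by
  refine ContinuousOn.prodMk ?_ ?_
  · refine ContinuousOn.sub ?_ ?_
    · exact ContinuousOn.log (continuous_apply _).continuousOn fun y hy => (hy.2.2 0).ne'
    · exact ContinuousOn.log (continuous_apply _).continuousOn fun y hy => (hy.2.2 1).ne'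
  · have hρ : ContinuousOn (fun y => rr s y / (1 - rr s y)) (dm s) :=
      (rr_cont s).continuousOn.div (continuous_const.sub (rr_cont s)).continuousOn fun y hy => by
        have := rr_lt hy; linarith
    intro y hy
    by_cases hr : rr s y = 0
    · have h0 : (rr s y / (1 - rr s y)) • Φ s ((rr s y)⁻¹ • rt s y) = 0 := by rw [hr]; simp
      unfold ContinuousWithinAt
      simp only [h0]
      refine squeeze_zero_norm' (a := fun y => rr s y / (1 - rr s y)) ?_ ?_
      · filter_upwards [self_mem_nhdsWithin] with z hz
        have h1 := rr_nonneg hz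
        have h2 := rr_lt hz
        have h3 : 0 ≤ rr s z / (1 - rr s z) := div_nonneg h1 (by linarith)
        by_cases h : rr s z = 0
        · simp [h]
        · rw [norm_smul, hn _ (rt_tri hz h), Real.norm_of_nonneg h3, mul_one]
      · have := hρ y hy
        unfold ContinuousWithinAt at this
        simpa [hr] using this
    · refine (hρ y hy).smul ?_
      have hm : ContinuousWithinAt (fun y => (rr s y)⁻¹ • rt s y) (dm s ∩ {z | rr s z ≠ 0}) y :=
        ((rr_cont s).continuousAt.inv₀ hr).continuousWithinAt.smul (rt_cont s).continuousWithinAt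
      have h2 : ContinuousWithinAt (fun y => Φ s ((rr s y)⁻¹ • rt s y)) (dm s ∩ {z | rr s z ≠ 0}) y :=
        ContinuousWithinAt.comp (f := fun y => (rr s y)⁻¹ • rt s y) (hc _ (rt_tri hy hr)) hm
          fun z hz => rt_tri hz.1 hz.2
      exact (continuousWithinAt_inter ((isOpen_ne_fun (rr_cont s) continuous_const).mem_nhds hr)).1 h2

theorem y_eq (s : St D 2) (y : Fin 5 → ℝ) : rt s y + extz s.2 (y ∘ s.2) = y := by unfold rt; simp

theorem th_norm {Φ : St D 2 → (Fin 5 → ℝ) → E3} {s : St D 2}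
    (hn : ∀ y ∈ tri s, ‖Φ s y‖ = 1) {y} (hy : y ∈ dm s) : ‖(th Φ s y).2‖ = rr s y / (1 - rr s y) := by
  have h1 := rr_nonneg hy
  have h2 := rr_lt hy
  have h3 : 0 ≤ rr s y / (1 - rr s y) := div_nonneg h1 (by linarith)
  unfold th
  by_cases h : rr s y = 0
  · simp [h]
  · rw [norm_smul, hn _ (rt_tri hy h), Real.norm_of_nonneg h3, mul_one]

theorem th_iff {s0 : St D 2} {Φ : St D 2 → (Fin 5 → ℝ) → E3} (hn : ∀ s, SR s0 s → ∀ y ∈ tri s, ‖Φ s y‖ = 1)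
    (hΦ : ∀ s s', SR s0 s → SR s0 s' → ∀ y ∈ tri s, ∀ y' ∈ tri s', Φ s y = Φ s' y' ↔ TR (s, y) (s', y'))
    {s s' : St D 2} (hs : SR s0 s) (hs' : SR s0 s') {y y' : Fin 5 → ℝ} (hy : y ∈ dm s) (hy' : y' ∈ dm s') :
    th Φ s y = th Φ s' y' ↔ TR (s, y) (s', y') := by
  constructor
  · intro h
    have h1 : Real.log (y (s.2 0)) - Real.log (y (s.2 1)) = Real.log (y' (s'.2 0)) - Real.log (y' (s'.2 1)) :=
      congrArg Prod.fst h
    have h2 := congrArg Prod.snd h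
    have h3 := congrArg norm h2
    rw [th_norm (hn s hs) hy, th_norm (hn s' hs') hy'] at h3
    have a1 := rr_lt hy; have a2 := rr_lt hy'; have b1 := rr_nonneg hy; have b2 := rr_nonneg hy'
    have hr : rr s y = rr s' y' := by
      rw [div_eq_div_iff (by linarith) (by linarith)] at h3
      linarith
    have p0 := hy.2.2 0; have p1 := hy.2.2 1; have q0 := hy'.2.2 0; have q1 := hy'.2.2 1
    have hq : y (s.2 0) / y (s.2 1) = y' (s'.2 0) / y' (s'.2 1) := by
      apply Real.log_injOn_pos (div_pos p0 p1) (div_pos q0 q1)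
      rw [Real.log_div p0.ne' p1.ne', Real.log_div q0.ne' q1.ne']; exact h1
    have hsum : y (s.2 0) + y (s.2 1) = y' (s'.2 0) + y' (s'.2 1) := by unfold rr at hr; linarith
    have e1 : y (s.2 1) = y' (s'.2 1) := by
      rw [div_eq_div_iff p1.ne' q1.ne'] at hq
      have : (y (s.2 0) + y (s.2 1)) * y (s.2 1) = (y (s.2 0) + y (s.2 1)) * y' (s'.2 1) := by
        nlinarith
      exact mul_left_cancel₀ (by positivity) this
    have e0 : y (s.2 0) = y' (s'.2 0) := by linarith
    have hx : y ∘ s.2 = y' ∘ s'.2 := by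
      ext a; fin_cases a
      · exact e0
      · exact e1
    have hss : SR s s' := hs.symm.trans hs'
    by_cases h0 : rr s y = 0
    · have h0' := hr ▸ h0
      have := SR_comb hss (y ∘ s.2)
      have u1 := y_eq s y
      have u2 := y_eq s' y'
      rw [rt_zero hy h0, zero_add] at u1
      rw [rt_zero hy' h0', zero_add, ← hx] at u2
      rwa [u1, u2] at this
    · have h0' : rr s' y' ≠ 0 := hr ▸ h0
      have hΦe : Φ s ((rr s y)⁻¹ • rt s y) = Φ s' ((rr s' y')⁻¹ • rt s' y') := by
        unfold th at h2
        simp only [← hr] at h2 ⊢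
        exact smul_right_injective _ (div_ne_zero h0 (by linarith : (1 - rr s y) ≠ 0)) h2
      have := TR_comb ((hΦ s s' hs hs' _ (rt_tri hy h0) _ (rt_tri hy' h0')).1 hΦe) (rr s y) (y ∘ s.2)
      simp only at this
      rw [smul_inv_smul₀ h0, y_eq, hr, smul_inv_smul₀ h0', hx, y_eq] at this
      exact this
  · intro h
    have key : ∀ q : St D 2 × (Fin 5 → ℝ), TR (s, y) q → th Φ s y = th Φ q.1 q.2 := by
      intro q hq
      induction hq with
      | refl => rfl
      | @tail b c hb h ih =>
        obtain ⟨k, hk, hk0, rfl⟩ := h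
        rw [ih]
        have hbd : b.2 ∈ dm b.1 := TR_dm hb hy
        have hbs : SR s0 b.1 := hs.trans (TR.toSR hb)
        have m0 := congrFun (mv_comp b.1 k b.2) 0
        have m1 := congrFun (mv_comp b.1 k b.2) 1
        simp only [Function.comp] at m0 m1
        refine Prod.ext ?_ ?_
        · simp only [th, Function.comp]
          rw [m0, m1]
        · simp only [th]
          rw [rr_mv, rt_mv]
          by_cases h0 : rr b.1 b.2 = 0
          · simp [h0]
          · congr 1
            refine (hΦ _ _ hbs (hbs.tail ⟨k, hk, rfl⟩) _ (rt_tri hbd h0) _ ?_).2 ?_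
            · exact tri_step (rt_tri hbd h0) k
            · refine .single ⟨k, hk, ?_, rfl⟩
              simp [rt_notMem _ _ hk, hk0]
    exact key _ h

theorem th_surj {s0 : St D 2} {Φ : St D 2 → (Fin 5 → ℝ) → E3}
    (hw : ∀ w, ‖w‖ = 1 → ∃ s, SR s0 s ∧ ∃ y ∈ tri s, Φ s y = w) (p : ℝ × E3) :
    ∃ s, SR s0 s ∧ ∃ y ∈ dm s, th Φ s y = p := by
  obtain ⟨t, w⟩ := p
  obtain ⟨u, hu, hwu⟩ : ∃ u : E3, ‖u‖ = 1 ∧ w = ‖w‖ • u := by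
    by_cases h : w = 0
    · exact ⟨EuclideanSpace.single 0 1, by simp, by simp [h]⟩
    · have hn := norm_ne_zero_iff.2 h
      exact ⟨‖w‖⁻¹ • w, by rw [norm_smul, norm_inv, norm_norm, inv_mul_cancel₀ hn], by rw [smul_inv_smul₀ hn]⟩
  obtain ⟨s, hs, z, hz, hΦz⟩ := hw u hu
  have hE := Real.exp_pos t
  have hN := norm_nonneg w
  set N := ‖w‖ with hNdef
  set E := Real.exp t with hEdef
  let r := N / (1 + N)
  let x : Fin 2 → ℝ := ![E / ((1 + N) * (1 + E)), 1 / ((1 + N) * (1 + E))]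
  let y := r • z + extz s.2 x
  have hx : ∀ a, 0 < x a := by
    intro a; fin_cases a
    · show 0 < E / ((1 + N) * (1 + E)); positivity
    · show 0 < 1 / ((1 + N) * (1 + E)); positivity
  have hya : ∀ a, y (s.2 a) = x a := by
    intro a; simp only [y, Pi.add_apply, Pi.smul_apply, hz.2.2 a, extz_apply]; simp
  have hxs : x 0 + x 1 = 1 - r := by
    show E / ((1 + N) * (1 + E)) + 1 / ((1 + N) * (1 + E)) = 1 - N / (1 + N)
    field_simp; ring
  have hyd : y ∈ dm s := by
    refine ⟨fun v => ?_, ?_, fun a => by rw [hya]; exact hx a⟩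
    · exact add_nonneg (mul_nonneg (by positivity) (hz.1 v)) (extz_nonneg _ _ (fun a => (hx a).le) v)
    · simp only [y, Pi.add_apply, Pi.smul_apply, smul_eq_mul, Finset.sum_add_distrib, ← Finset.mul_sum, hz.2.1,
        extz_sum, Fin.sum_univ_two, hxs]
      ring
  have hrr : rr s y = r := by unfold rr; rw [hya, hya]; linarith
  have hrt : rt s y = r • z := by
    have : y ∘ s.2 = x := funext hya
    unfold rt; rw [this]; simp [y]
  refine ⟨s, hs, y, hyd, Prod.ext ?_ ?_⟩
  · simp only [th, hya]
    show Real.log (E / ((1 + N) * (1 + E))) - Real.log (1 / ((1 + N) * (1 + E))) = t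
    rw [← Real.log_div (by positivity) (by positivity)]
    have : E / ((1 + N) * (1 + E)) / (1 / ((1 + N) * (1 + E))) = E := by field_simp
    rw [this, hEdef, Real.log_exp]
  · simp only [th, hrr, hrt]
    have h1 : r / (1 - r) = N := by
      have : 1 - r = 1 / (1 + N) := by simp only [r]; field_simp; ring
      rw [this]; simp only [r]; field_simp
    rw [h1]
    by_cases h0 : N = 0
    · rw [h0, zero_smul]; exact (norm_eq_zero.1 (hNdef.symm.trans h0)).symm
    · have : r ≠ 0 := div_ne_zero h0 (by positivity)
      rw [inv_smul_smul₀ this, hΦz]; exact hwu.symm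

theorem th_bound {s0 : St D 2} {Φ : St D 2 → (Fin 5 → ℝ) → E3} (hn : ∀ s, SR s0 s → ∀ y ∈ tri s, ‖Φ s y‖ = 1)
    (M : ℝ) : ∃ ε > 0, ∀ s, SR s0 s → ∀ y ∈ dm s, ‖th Φ s y‖ ≤ M → ∀ a, ε ≤ y (s.2 a) := by
  refine ⟨1 / ((1 + |M|) * (1 + Real.exp |M|)), by positivity, fun s hs y hy hM a => ?_⟩
  have h1 : |Real.log (y (s.2 0)) - Real.log (y (s.2 1))| ≤ |M| := ((norm_fst_le (th Φ s y)).trans hM).trans (le_abs_self _)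
  have h2 : ‖(th Φ s y).2‖ ≤ |M| := ((norm_snd_le (th Φ s y)).trans hM).trans (le_abs_self _)
  rw [th_norm (hn s hs) hy] at h2
  have p0 := hy.2.2 0; have p1 := hy.2.2 1
  have hM0 := abs_nonneg M
  have hs1 : 1 ≤ (1 + |M|) * (y (s.2 0) + y (s.2 1)) := by
    have hl := rr_lt hy
    rw [div_le_iff₀ (by linarith)] at h2
    unfold rr at h2
    nlinarith
  have hE := Real.exp_pos |M|
  obtain ⟨h3, h4⟩ := abs_le.1 h1
  have k0 : y (s.2 0) ≤ Real.exp |M| * y (s.2 1) := by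
    have : Real.log (y (s.2 0)) ≤ Real.log (Real.exp |M| * y (s.2 1)) := by
      rw [Real.log_mul hE.ne' p1.ne', Real.log_exp]; linarith
    exact (Real.log_le_log_iff p0 (by positivity)).1 this
  have k1 : y (s.2 1) ≤ Real.exp |M| * y (s.2 0) := by
    have : Real.log (y (s.2 1)) ≤ Real.log (Real.exp |M| * y (s.2 0)) := by
      rw [Real.log_mul hE.ne' p0.ne', Real.log_exp]; linarith
    exact (Real.log_le_log_iff p1 (by positivity)).1 this
  rw [div_le_iff₀ (by positivity)]
  have g0 : y (s.2 0) + y (s.2 1) ≤ y (s.2 0) * (1 + Real.exp |M|) := by linarith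
  have g1 : y (s.2 0) + y (s.2 1) ≤ y (s.2 1) * (1 + Real.exp |M|) := by linarith
  fin_cases a
  · have := mul_le_mul_of_nonneg_left g0 (by positivity : 0 ≤ 1 + |M|)
    show 1 ≤ y (s.2 0) * _
    linarith
  · have := mul_le_mul_of_nonneg_left g1 (by positivity : 0 ≤ 1 + |M|)
    show 1 ≤ y (s.2 1) * _
    linarith
end theta
end FileL2

section FileL3
section local_charts
variable {D : GlueingDatum 4}
open Set

theorem TR_mkX {p q : St D 2 × (Fin 5 → ℝ)} (h : TR p q) (a b : Delta 4) (ha : p.2 = a.1) (hb : q.2 = b.1) :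
    mkX (D := D) ⟨p.1.1, a⟩ = mkX ⟨q.1.1, b⟩ := by
  have key : ∃ b : Delta 4, q.2 = b.1 ∧ mkX (D := D) ⟨p.1.1, a⟩ = mkX ⟨q.1.1, b⟩ := by
    clear hb b
    induction h with
    | refl => exact ⟨a, ha, rfl⟩
    | @tail b c _ h ih =>
      obtain ⟨k, hk, h0, rfl⟩ := h
      obtain ⟨b', hb', he⟩ := ih
      refine ⟨crossD b.1.1 k b', ?_, ?_⟩
      · simp only [crossD, hb']
      · rw [he]; exact (mkX_cross b.1.1 b' k (hb' ▸ h0)).symm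
  obtain ⟨b', hb', he⟩ := key
  have : b' = b := Subtype.ext (hb'.symm.trans hb)
  rw [he, this]

theorem mem_dm (s : St D 2) (y : Delta 4) : y.1 ∈ dm s ↔ ∀ a, 0 < y.1 (s.2 a) :=
  ⟨fun h => h.2.2, fun h => ⟨y.2.1, y.2.2, h⟩⟩

theorem dm_notVertex {s : St D 2} {y : Delta 4} (hy : y.1 ∈ dm s) (i : D.I) : mkX (D := D) ⟨i, y⟩ ∉ vertexImage D := by
  rw [mem_vertexImage]
  rintro ⟨v, hv⟩
  change y.1 v = 1 at hv
  obtain ⟨a, ha⟩ : ∃ a, s.2 a ≠ v := by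
    by_contra hc
    push Not at hc
    exact absurd (s.2.injective ((hc 0).trans (hc 1).symm)) (by decide)
  have h1 := hy.2.2 a
  have h2 := Finset.add_le_sum (fun w _ => hy.1 w) (Finset.mem_univ (s.2 a)) (Finset.mem_univ v) ha
  rw [hy.2.1] at h2
  linarith

theorem star_chart (hC : Cycl D) (hD : Dir D) (s0 : St D 2) (hS : SurfC s0) (y0 : Delta 4) (hy0 : y0.1 ∈ dm s0) :
    ∃ U : Set (GlueSpace D), IsOpen U ∧ mkX ⟨s0.1, y0⟩ ∈ U ∧ U ⊆ (vertexImage D)ᶜ ∧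
      Nonempty (U ≃ₜ EuclideanSpace ℝ (Fin 4)) := by
  obtain ⟨Φ, hc, hn, hw, hΦ⟩ := hS
  have hcpt : CompactSpace (Delta 4) := isCompact_iff_compactSpace.1 (isCompact_stdSimplex ℝ (Fin 5))
  let R := {s : St D 2 // SR s0 s}
  have hfin : Finite R := inferInstance
  let Θ : R → Delta 4 → ℝ × E3 := fun s y => th Φ s.1 y.1
  let O : R → Set (Delta 4) := fun s => {y | ∀ a, 0 < y.1 (s.1.2 a)}
  have coc : ∀ v : Fin 5, Continuous fun y : Delta 4 => y.1 v := fun v => (continuous_apply v).comp continuous_subtype_val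
  have hO : ∀ s, IsOpen (O s) := fun s => by
    have : O s = ⋂ a, {y : Delta 4 | 0 < y.1 (s.1.2 a)} := by ext y; simp [O]
    rw [this]
    exact isOpen_iInter_of_finite fun a => isOpen_lt continuous_const (coc _)
  have hOd : ∀ s y, y ∈ O s → y.1 ∈ dm s.1 := fun s y h => (mem_dm _ _).2 h
  have hΘc : ∀ s, ContinuousOn (Θ s) (O s) := fun s =>
    (th_cont (hc s.1 s.2) (hn s.1 s.2)).comp continuous_subtype_val.continuousOn fun y hy => hOd s y hy
  have hΘi : ∀ s s' y y', y ∈ O s → y' ∈ O s' → (Θ s y = Θ s' y' ↔ TR (s.1, y.1) (s'.1, y'.1)) :=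
    fun s s' y y' h h' => th_iff hn hΦ s.2 s'.2 (hOd s y h) (hOd s' y' h')
  have hΘs : ∀ p, ∃ s : R, ∃ y ∈ O s, Θ s y = p := fun p => by
    obtain ⟨s, hs, y, hy, h⟩ := th_surj hw p
    exact ⟨⟨s, hs⟩, ⟨y, hy.1, hy.2.1⟩, hy.2.2, h⟩
  choose sg yg hyg hg using hΘs
  let ψ : ℝ × E3 → GlueSpace D := fun p => mkX ⟨(sg p).1.1, yg p⟩
  have hψ : ∀ s y, y ∈ O s → ψ (Θ s y) = mkX ⟨s.1.1, y⟩ := fun s y hy =>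
    TR_mkX ((hΘi _ _ _ _ (hyg _) hy).1 (hg (Θ s y))) _ _ rfl rfl
  -- transport
  have htr : ∀ (V : Set (ℝ × E3)) (i : D.I) (y : Delta 4), mkX ⟨i, y⟩ ∈ ψ '' V →
      ∃ s : R, s.1.1 = i ∧ y ∈ O s ∧ Θ s y ∈ V := by
    rintro V i y ⟨p, hp, hpe⟩
    refine mkX_transport (D := D) (Q := fun q => ∃ s : R, s.1.1 = q.1 ∧ q.2 ∈ O s ∧ Θ s q.2 ∈ V) ?_ hpe
      ⟨sg p, rfl, hyg p, by rw [hg]; exact hp⟩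
    rintro ⟨j, z⟩ k hk ⟨s, rfl, hz, hV⟩
    change z.1 k = 0 at hk
    have hks : k ∉ range s.1.2 := by
      rintro ⟨a, rfl⟩
      exact absurd hk (hz a).ne'
    have hd := dm_step (hOd s z hz) k
    let s' : R := ⟨s.1.mv k, s.2.tail ⟨k, hks, rfl⟩⟩
    have hz' : crossD s.1.1 k z ∈ O s' := hd.2.2
    refine ⟨s', rfl, hz', ?_⟩
    have : Θ s z = Θ s' (crossD s.1.1 k z) :=
      (hΘi s s' _ _ hz hz').2 (.single ⟨k, hks, hk, rfl⟩)
    show Θ s' (crossD s.1.1 k z) ∈ V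
    rw [← this]; exact hV
  -- openness
  have hop : IsOpenMap ψ := by
    intro V hV
    refine isQuotientMap_quot_mk.isOpen_preimage.1 (isOpen_sigma_iff.2 fun i => ?_)
    have : (Sigma.mk i ⁻¹' (Quot.mk (glueRel D) ⁻¹' (ψ '' V))) =
        ⋃ s : {s : R // s.1.1 = i}, (O s.1 ∩ Θ s.1 ⁻¹' V) := by
      ext y
      simp only [mem_preimage, mem_iUnion]
      constructor
      · intro h
        obtain ⟨s, h1, h2, h3⟩ := htr V i y h
        exact ⟨⟨s, h1⟩, h2, h3⟩
      · rintro ⟨⟨s, rfl⟩, h2, h3⟩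
        exact ⟨_, h3, hψ s y h2⟩
    rw [this]
    exact isOpen_iUnion fun s => (hΘc s.1).isOpen_inter_preimage (hO s.1) hV
  -- compactness
  have hK : ∀ M : ℝ, ∃ K : R → Set (Delta 4), (∀ s, IsClosed (K s)) ∧ (∀ s, K s ⊆ O s) ∧
      ∀ s, ∀ y ∈ O s, ‖Θ s y‖ ≤ M → y ∈ K s := by
    intro M
    obtain ⟨ε, hε, h⟩ := th_bound hn M
    refine ⟨fun s => {y | ∀ a, ε ≤ y.1 (s.1.2 a)}, fun s => ?_, fun s y hy a => hε.trans_le (hy a),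
      fun s y hy hM => h s.1 s.2 y.1 (hOd s y hy) hM⟩
    have : {y : Delta 4 | ∀ a, ε ≤ y.1 (s.1.2 a)} = ⋂ a, {y : Delta 4 | ε ≤ y.1 (s.1.2 a)} := by ext y; simp
    beta_reduce
    rw [this]
    exact isClosed_iInter fun a => isClosed_le continuous_const (coc _)
  -- continuity
  have hcont : Continuous ψ := by
    rw [continuous_iff_continuousAt]
    intro p
    have hball : ContinuousOn ψ (Metric.ball 0 (‖p‖ + 1)) := by
      obtain ⟨K, hK1, hK2, hK3⟩ := hK (‖p‖ + 1)
      rw [continuousOn_iff_isClosed]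
      intro C hCl
      refine ⟨⋃ s : R, Θ s '' (K s ∩ {y | mkX ⟨s.1.1, y⟩ ∈ C}), isClosed_iUnion_of_finite fun s => ?_, ?_⟩
      · have h1 : IsClosed {y : Delta 4 | mkX (D := D) ⟨s.1.1, y⟩ ∈ C} :=
          hCl.preimage (continuous_quot_mk.comp (continuous_sigmaMk (σ := fun _ : D.I => Delta 4) (i := s.1.1)))
        exact (((hK1 s).inter h1).isCompact.image_of_continuousOn
          ((hΘc s).mono fun y hy => hK2 s hy.1)).isClosed
      · ext q
        simp only [mem_inter_iff, mem_iUnion, mem_preimage]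
        refine and_congr_left fun hq => ⟨fun h => ?_, ?_⟩
        · refine ⟨sg q, yg q, ⟨hK3 _ _ (hyg q) ?_, h⟩, hg q⟩
          rw [hg]; rw [mem_ball_zero_iff] at hq; exact hq.le
        · rintro ⟨s, y, ⟨hy, hyC⟩, rfl⟩
          rw [hψ s y (hK2 s hy)]; exact hyC
    exact hball.continuousAt (Metric.isOpen_ball.mem_nhds (by simp))
  -- local injectivity
  let t0 : R := ⟨s0, .refl⟩
  have hy0' : y0 ∈ O t0 := hy0.2.2
  let p0 := Θ t0 y0
  have hinj : ∃ W : Set (ℝ × E3), IsOpen W ∧ p0 ∈ W ∧ InjOn ψ W := by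
    obtain ⟨K, hK1, hK2, hK3⟩ := hK (‖p0‖ + 1)
    let A : R × R → Set ((ℝ × E3) × (ℝ × E3)) := fun t =>
      if t.1.1.1 = t.2.1.1 ∧ t.1 ≠ t.2 then (fun y => (Θ t.1 y, Θ t.2 y)) '' (K t.1 ∩ K t.2) else ∅
    have hA : IsClosed (⋃ t, A t) := by
      refine isClosed_iUnion_of_finite fun t => ?_
      simp only [A]
      split_ifs
      · exact (((hK1 t.1).inter (hK1 t.2)).isCompact.image_of_continuousOn
          (((hΘc t.1).mono fun y hy => hK2 _ hy.1).prodMk ((hΘc t.2).mono fun y hy => hK2 _ hy.2))).isClosed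
      · exact isClosed_empty
    have hp : (p0, p0) ∉ ⋃ t, A t := by
      rw [mem_iUnion]
      rintro ⟨⟨s, s'⟩, h⟩
      simp only [A] at h
      split_ifs at h with hss
      · obtain ⟨y, ⟨hy, hy'⟩, he⟩ := h
        have e1 : Θ s y = p0 := congrArg Prod.fst he
        have e2 : Θ s' y = p0 := congrArg Prod.snd he
        have hT := (hΘi s s' y y (hK2 _ hy) (hK2 _ hy')).1 (e1.trans e2.symm)
        have := TR_hol hC hD (fun a => (hK2 _ hy a).ne') hT hss.1
        exact hss.2 (Subtype.ext this.symm)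
      · exact h
    have hnh : (⋃ t, A t)ᶜ ∈ nhds (p0, p0) := hA.isOpen_compl.mem_nhds hp
    rw [nhds_prod_eq] at hnh
    obtain ⟨W1, hW1, W2, hW2, hWW⟩ := Filter.mem_prod_iff.1 hnh
    have hb : Metric.ball 0 (‖p0‖ + 1) ∈ nhds p0 := Metric.isOpen_ball.mem_nhds (by simp)
    obtain ⟨W, hWs, hWo, hpW⟩ := mem_nhds_iff.1 (Filter.inter_mem (Filter.inter_mem hW1 hW2) hb)
    refine ⟨W, hWo, hpW, fun p hp p' hp' he => ?_⟩
    obtain ⟨s', h1, h2, h3⟩ := htr {p'} (sg p).1.1 (yg p) ⟨p', rfl, he.symm⟩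
    rw [mem_singleton_iff] at h3
    by_cases hss : sg p = s'
    · rw [← h3, ← hss, hg]
    · exfalso
      have hm : (p, p') ∈ (⋃ t, A t)ᶜ := hWW ⟨(hWs hp).1.1, (hWs hp').1.2⟩
      refine hm (mem_iUnion.2 ⟨(sg p, s'), ?_⟩)
      simp only [A]
      rw [if_pos ⟨h1.symm, hss⟩]
      have hb1 := (hWs hp).2
      have hb2 := (hWs hp').2
      rw [mem_ball_zero_iff] at hb1 hb2
      exact ⟨yg p, ⟨hK3 _ _ (hyg p) (by rw [hg]; exact hb1.le), hK3 _ _ h2 (by rw [h3]; exact hb2.le)⟩,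
        Prod.ext (hg p) h3⟩
  obtain ⟨W, hWo, hpW, hWi⟩ := hinj
  -- the chart
  have hfr : Module.finrank ℝ (EuclideanSpace ℝ (Fin 4)) = Module.finrank ℝ (ℝ × E3) := by
    rw [Module.finrank_prod]; simp [E3]
  let L : EuclideanSpace ℝ (Fin 4) ≃L[ℝ] ℝ × E3 := ContinuousLinearEquiv.ofFinrankEq hfr
  obtain ⟨r, hr, hrW⟩ := Metric.isOpen_iff.1 (hWo.preimage L.continuous) (L.symm p0) (by simpa using hpW)
  let B := OpenPartialHomeomorph.univBall (E := EuclideanSpace ℝ (Fin 4)) (L.symm p0) r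
  have hBs : B.source = univ := OpenPartialHomeomorph.univBall_source _ _
  have hBt : B.target = Metric.ball (L.symm p0) r := OpenPartialHomeomorph.univBall_target _ hr
  let g : EuclideanSpace ℝ (Fin 4) → GlueSpace D := fun x => ψ (L (B x))
  have hgc : Continuous g :=
    hcont.comp (L.continuous.comp (OpenPartialHomeomorph.continuous_univBall _ _))
  have hBW : ∀ x, L (B x) ∈ W := fun x => hrW (hBt ▸ B.map_source (by rw [hBs]; trivial))
  have hgi : Function.Injective g := by
    intro x x' h
    have h1 := L.injective (hWi (hBW x) (hBW x') h)
    exact B.injOn (by rw [hBs]; trivial) (by rw [hBs]; trivial) h1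
  have hgo : IsOpenMap g := by
    intro V hV
    have : g '' V = ψ '' (L '' (B '' V)) := by rw [image_image, image_image]
    rw [this]
    exact hop _ (L.toHomeomorph.isOpenMap _ (B.isOpen_image_of_subset_source hV (by rw [hBs]; exact subset_univ _)))
  have hemb := Topology.IsOpenEmbedding.of_continuous_injective_isOpenMap hgc hgi hgo
  refine ⟨range g, hemb.isOpen_range, ⟨0, ?_⟩, ?_, ⟨hemb.isEmbedding.toHomeomorph.symm⟩⟩
  · have : B 0 = L.symm p0 := OpenPartialHomeomorph.univBall_apply_zero _ _
    simp only [g, this, ContinuousLinearEquiv.apply_symm_apply]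
    exact hψ t0 y0 hy0'
  · rintro _ ⟨x, rfl⟩
    exact dm_notVertex (hOd _ _ (hyg _)) _

theorem loc_of_surfC (hC : Cycl D) (hD : Dir D) (hS : ∀ s0 : St D 2, SurfC s0) : LocEuclidean 4 (GlueSpaceStar D) := by
  rintro ⟨z, hz⟩
  obtain ⟨⟨i, y⟩, rfl⟩ := Quot.exists_rep z
  have hv : ¬ ∃ v, y.1 v = 1 := fun h => hz ((mem_vertexImage (⟨i, y⟩ : GlueTotal D)).2 h)
  obtain ⟨a, ha⟩ : ∃ a, 0 < y.1 a := by
    by_contra hc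
    push Not at hc
    have := Finset.sum_nonpos fun v (_ : v ∈ Finset.univ) => hc v
    rw [y.2.2] at this; linarith
  obtain ⟨b, hb, hba⟩ : ∃ b, 0 < y.1 b ∧ a ≠ b := by
    by_contra hc
    push Not at hc
    refine hv ⟨a, ?_⟩
    refine Eq.trans (Finset.sum_eq_single a (fun c _ hca => ?_) (by simp)).symm y.2.2
    by_contra h0
    exact hca (hc c (lt_of_le_of_ne (y.2.1 c) (Ne.symm h0))).symm
  obtain ⟨U, hU, hzU, hUv, ⟨e⟩⟩ := star_chart hC hD (St.mk2 i a b hba) (hS _) y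
    ((mem_dm _ _).2 fun c => by
      fin_cases c
      · exact ha
      · exact hb)
  refine ⟨Subtype.val ⁻¹' U, hU.preimage continuous_subtype_val, hzU, ⟨?_⟩⟩
  refine Homeomorph.trans ?_ e
  refine (Topology.IsEmbedding.subtypeVal.homeomorphImage (Subtype.val ⁻¹' U)).trans (Homeomorph.setCongr ?_)
  ext q
  exact ⟨fun ⟨w, hw, h⟩ => h ▸ hw, fun h => ⟨⟨q, hUv h⟩, h, rfl⟩⟩

end local_charts

theorem star_main (D : GlueingDatum 4) :
    LocEuclidean 4 (GlueSpaceStar D) ↔ (Cycl D ∧ Dir D ∧ Surf D) :=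
  ⟨fun h => ⟨cycl_of_tri (tri_trivial h), dir_of_edge (edge_noflip h), surf_of_surfC (edge_noflip h) (surfC_of_loc h)⟩,
    fun ⟨hC, hD, hS⟩ => loc_of_surfC hC hD (surfC_of_surf (noflip_of_dir hD) hS)⟩
end FileL3

/-- Main Theorem: the space `X*` obtained from finitely many 4-simplices by pairwise
simplicial glueings of their tetrahedral faces, with the vertices removed, is a
4-manifold if and only if conditions Cycl, Dir and Surf all hold. -/
theorem star_four_manifold_iff_cycl_dir_surf (D : GlueingDatum 4) :
    LocEuclidean 4 (GlueSpaceStar D) ↔ (Cycl D ∧ Dir D ∧ Surf D) := by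
  exact star_main D
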